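/- Let Ω ⊂ ℝ² be a compact convex region of unit area with nonempty interior whose frontier ∂Ω has length ℓ, k ≥ 1 an integer, c > 0 a constant, and r_n = √((log n + (2k−1)·log log n + ξ)/(π·n)), where ξ = −2·log(√(e^{−c} + π·ℓ²/64) − ℓ·√π/8) if k = 1, and ξ = 2·log(ℓ·√π/(2^{k+1}·k!)) + 2c if k > 1. Then the probability that the random geometric graph G(χ_n, r_n) is (k+1)-connected converges to exp(−e^{−c}) as n → ∞. -/

import Mathlib

open MeasureTheory Metric Real Filter Topology

/-- Probability that a Poisson variable of mean `x` is at most `k`. -/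
noncomputable def poissonLow (k : ℕ) (x : ℝ) : ℝ :=
  exp (-x) * ∑ s ∈ Finset.range (k + 1), x ^ s / (s.factorial : ℝ)

lemma poissonLow_sum_pos (k : ℕ) {x : ℝ} (hx : 0 ≤ x) :
    1 ≤ ∑ s ∈ Finset.range (k + 1), x ^ s / (s.factorial : ℝ) := by
  rw [Finset.sum_range_succ']
  simp only [pow_zero, Nat.factorial_zero, Nat.cast_one, div_one]
  have : 0 ≤ ∑ s ∈ Finset.range k, x ^ (s + 1) / ((s + 1).factorial : ℝ) :=
    Finset.sum_nonneg fun i _ => by positivity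
  linarith

lemma exp_neg_le_poissonLow (k : ℕ) {x : ℝ} (hx : 0 ≤ x) : exp (-x) ≤ poissonLow k x :=
  le_mul_of_one_le_right (exp_pos _).le (poissonLow_sum_pos k hx)

lemma poissonLow_pos (k : ℕ) {x : ℝ} (hx : 0 ≤ x) : 0 < poissonLow k x :=
  (exp_pos _).trans_le (exp_neg_le_poissonLow k hx)

lemma hasDerivAt_poissonLow (k : ℕ) (x : ℝ) :
    HasDerivAt (poissonLow k) (-(exp (-x) * (x ^ k / (k.factorial : ℝ)))) x := by
  induction k with
  | zero =>
    have : poissonLow 0 = fun x => exp (-x) := by ext; simp [poissonLow]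
    rw [this]
    simpa using (hasDerivAt_neg x).exp
  | succ k ih =>
    have : poissonLow (k + 1) = fun x => poissonLow k x +
        exp (-x) * (x ^ (k + 1) / ((k + 1).factorial : ℝ)) := by
      ext y; simp only [poissonLow]; rw [Finset.sum_range_succ _ (k + 1), mul_add]
    rw [this]
    have h2 := ((hasDerivAt_neg x).exp).mul
      (((hasDerivAt_pow (k + 1) x)).div_const ((k + 1).factorial : ℝ))
    refine (ih.add h2).congr_deriv ?_
    rw [Nat.factorial_succ]
    have : (k.factorial : ℝ) ≠ 0 := by positivity
    push_cast
    field_simp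
    ring

lemma continuous_poissonLow (k : ℕ) : Continuous (poissonLow k) :=
  continuous_iff_continuousAt.2 fun x => (hasDerivAt_poissonLow k x).continuousAt

lemma poissonLow_antitone (k : ℕ) : AntitoneOn (poissonLow k) (Set.Ici 0) := by
  refine antitoneOn_of_deriv_nonpos (convex_Ici 0) (continuous_poissonLow k).continuousOn
    (fun x _ => (hasDerivAt_poissonLow k x).differentiableAt.differentiableWithinAt) ?_
  intro x hx
  rw [interior_Ici] at hx
  have : 0 < x := hx
  rw [(hasDerivAt_poissonLow k x).deriv]
  have : 0 ≤ exp (-x) * (x ^ k / (k.factorial : ℝ)) := by positivity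
  linarith

lemma poissonLow_le {k : ℕ} {x y : ℝ} (hx : 0 ≤ x) (hxy : x ≤ y) :
    poissonLow k y ≤ poissonLow k x :=
  poissonLow_antitone k hx (Set.mem_Ici.2 (hx.trans hxy)) hxy

lemma poissonLow_zero (k : ℕ) : poissonLow k 0 = 1 := by
  simp [poissonLow, Finset.sum_range_succ']

lemma poissonLow_le_one (k : ℕ) {x : ℝ} (hx : 0 ≤ x) : poissonLow k x ≤ 1 := by
  simpa [poissonLow_zero] using poissonLow_le (k := k) le_rfl hx

lemma poissonLow_le_exp_mul (k : ℕ) {a b : ℝ} (ha : 0 ≤ a) (hb : 0 ≤ b) :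
    poissonLow k a ≤ exp b * poissonLow k (a + b) := by
  unfold poissonLow
  rw [← mul_assoc, ← exp_add, show b + -(a + b) = -a by ring]
  gcongr
  linarith

/-- Polynomial decay: `q(x) ≤ C (1 + x)⁻ᴺ`. -/
lemma poissonLow_le_pow (k N : ℕ) : ∃ C : ℝ, 0 < C ∧ ∀ x : ℝ, 0 ≤ x →
    poissonLow k x ≤ C / (1 + x) ^ N := by
  have hsum : ∀ x : ℝ, 0 ≤ x → ∑ s ∈ Finset.range (k + 1), x ^ s / (s.factorial : ℝ)
      ≤ (k + 1) * (1 + x) ^ k := by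
    intro x hx
    calc _ ≤ ∑ s ∈ Finset.range (k + 1), (1 + x) ^ k := by
          refine Finset.sum_le_sum fun s hs => ?_
          have h1 : x ^ s / (s.factorial : ℝ) ≤ x ^ s :=
            div_le_self (by positivity) (by exact_mod_cast Nat.one_le_iff_ne_zero.2 (Nat.factorial_ne_zero s))
          calc _ ≤ x ^ s := h1
            _ ≤ (1 + x) ^ s := by gcongr; linarith
            _ ≤ _ := pow_le_pow_right₀ (by linarith) (by simp at hs; omega)
      _ = _ := by simp
  refine ⟨(k + 1) * ((k + N).factorial * exp 1), by positivity, fun x hx => ?_⟩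
  have h2 : (1 + x) ^ (k + N) / ((k + N).factorial : ℝ) ≤ exp (1 + x) :=
    Real.pow_div_factorial_le_exp _ (by linarith) _
  rw [le_div_iff₀ (by positivity), poissonLow]
  have h3 : (1 + x) ^ (k + N) ≤ exp (1 + x) * (k + N).factorial := by
    rwa [div_le_iff₀ (by positivity)] at h2
  calc _ ≤ exp (-x) * ((k + 1) * (1 + x) ^ k) * (1 + x) ^ N := by
        gcongr; exact hsum x hx
    _ = (k + 1) * (exp (-x) * (1 + x) ^ (k + N)) := by rw [pow_add]; ring
    _ ≤ (k + 1) * (exp (-x) * (exp (1 + x) * (k + N).factorial)) := by gcongr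
    _ = _ := by
      rw [exp_add, exp_neg]; field_simp

/-- The recursive form of a multi-region occupancy probability. -/
def occupancy (k : ℕ) (a : ℝ) : List ℝ → ℕ → ℝ
  | [], m => a ^ m
  | p :: ps, m => ∑ s ∈ Finset.range (k + 1), (m.choose s : ℝ) * p ^ s * occupancy k a ps (m - s)

lemma occupancy_nonneg (k : ℕ) {a : ℝ} (ha : 0 ≤ a) (ps : List ℝ) (hps : ∀ p ∈ ps, 0 ≤ p) (m : ℕ) :
    0 ≤ occupancy k a ps m := by
  induction ps generalizing m with
  | nil => exact pow_nonneg ha _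
  | cons p ps ih =>
    simp only [List.mem_cons, forall_eq_or_imp] at hps
    exact Finset.sum_nonneg fun s _ =>
      mul_nonneg (mul_nonneg (by positivity) (pow_nonneg hps.1 _)) (ih hps.2 _)

lemma occupancy_le (k : ℕ) {a : ℝ} (ha : 0 ≤ a) (ha1 : a ≤ 1) (ps : List ℝ) (hps : ∀ p ∈ ps, 0 ≤ p)
    (m M : ℕ) (hmM : m ≤ M) : occupancy k a ps m ≤ a ^ (m - ps.length * k) *
      (ps.map fun p => ∑ s ∈ Finset.range (k + 1), (M : ℝ) ^ s * p ^ s / (s.factorial : ℝ)).prod := by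
  induction ps generalizing m with
  | nil => simp [occupancy]
  | cons p ps ih =>
    simp only [List.mem_cons, forall_eq_or_imp] at hps
    simp only [occupancy, List.map_cons, List.prod_cons, List.length_cons]
    set Q := (ps.map fun p => ∑ s ∈ Finset.range (k + 1), (M : ℝ) ^ s * p ^ s / (s.factorial : ℝ)).prod
    have hQ : 0 ≤ Q := List.prod_nonneg (by
      intro x hx; simp only [List.mem_map] at hx; obtain ⟨y, hy, rfl⟩ := hx
      have := hps.2 y hy
      exact Finset.sum_nonneg fun s _ => by positivity)
    rw [Finset.sum_mul, Finset.mul_sum]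
    refine Finset.sum_le_sum fun s hs => ?_
    have hs' : s ≤ k := by simp at hs; omega
    have h1 : (m.choose s : ℝ) ≤ (M : ℝ) ^ s / (s.factorial : ℝ) :=
      (Nat.choose_le_pow_div s m).trans (by gcongr)
    have h2 := ih hps.2 (m - s) (by omega)
    have h3 : a ^ (m - s - ps.length * k) ≤ a ^ (m - (ps.length + 1) * k) :=
      pow_le_pow_of_le_one ha ha1 (by rw [add_mul]; omega)
    have h0 := occupancy_nonneg k ha ps hps.2 (m - s)
    have hp := hps.1
    calc _ ≤ (M : ℝ) ^ s / (s.factorial : ℝ) * p ^ s * (a ^ (m - (ps.length + 1) * k) * Q) := by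
          gcongr
          exact h2.trans (by gcongr)
      _ = _ := by ring

lemma le_occupancy (k : ℕ) {a : ℝ} (ha : 0 ≤ a) (ha1 : a ≤ 1) (ps : List ℝ) (hps : ∀ p ∈ ps, 0 ≤ p)
    (m d : ℕ) (hm : d + (ps.length + 1) * k ≤ m) : a ^ m *
      (ps.map fun p => ∑ s ∈ Finset.range (k + 1), (d : ℝ) ^ s * p ^ s / (s.factorial : ℝ)).prod
      ≤ occupancy k a ps m := by
  induction ps generalizing m with
  | nil => simp [occupancy]
  | cons p ps ih =>
    simp only [List.mem_cons, forall_eq_or_imp] at hps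
    simp only [occupancy, List.map_cons, List.prod_cons, List.length_cons] at hm ⊢
    set Q := (ps.map fun p => ∑ s ∈ Finset.range (k + 1), (d : ℝ) ^ s * p ^ s / (s.factorial : ℝ)).prod
    have hQ : 0 ≤ Q := List.prod_nonneg (by
      intro x hx; simp only [List.mem_map] at hx; obtain ⟨y, hy, rfl⟩ := hx
      have := hps.2 y hy
      exact Finset.sum_nonneg fun s _ => by positivity)
    rw [Finset.sum_mul, Finset.mul_sum]
    refine Finset.sum_le_sum fun s hs => ?_
    have hs' : s ≤ k := by simp at hs; omega
    have hm' : d + (ps.length + 1) * k + k ≤ m := by linarith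
    have h1 : (d : ℝ) ^ s / (s.factorial : ℝ) ≤ (m.choose s : ℝ) := by
      refine le_trans ?_ (Nat.pow_le_choose s m)
      have : d ≤ m + 1 - s := by
        have := Nat.zero_le ((ps.length + 1) * k); omega
      gcongr
    have h2 := ih hps.2 (m - s) (by omega)
    have h3 : a ^ m ≤ a ^ (m - s) := pow_le_pow_of_le_one ha ha1 (by omega)
    have hp := hps.1
    calc _ = (d : ℝ) ^ s / (s.factorial : ℝ) * p ^ s * (a ^ m * Q) := by ring
      _ ≤ _ := by
          gcongr
          exact le_trans (by gcongr) h2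

lemma measurableSet_card_le {α ι : Type*} [MeasurableSpace α] [Fintype ι] (P : ι → α → Prop)
    [∀ i, DecidablePred (P i)] (hP : ∀ i, MeasurableSet {x | P i x}) (k : ℕ) :
    MeasurableSet {x | (Finset.univ.filter fun i => P i x).card ≤ k} := by
  have : Measurable fun x => (Finset.univ.filter fun i => P i x).card := by
    simp only [Finset.card_filter]
    exact Finset.measurable_sum _ fun i _ => Measurable.ite (hP i) measurable_const measurable_const
  exact measurableSet_le this measurable_const

/-- All regions of the list contain at most `k` of the points. -/
def FewIn {ι E : Type*} [Fintype ι] (k : ℕ) (L : List (Set E)) (ω : ι → E) : Prop :=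
  ∀ R ∈ L, Nat.card {i // ω i ∈ R} ≤ k

open Classical in
lemma fewIn_iff {ι E : Type*} [Fintype ι] (k : ℕ) (L : List (Set E)) (ω : ι → E) :
    FewIn k L ω ↔ ∀ R ∈ L, (Finset.univ.filter fun i => ω i ∈ R).card ≤ k := by
  simp only [FewIn, Nat.card_eq_fintype_card, Fintype.card_subtype]

lemma measurableSet_fewIn {ι E : Type*} [Fintype ι] [MeasurableSpace E] (k : ℕ)
    (L : List (Set E)) (hL : ∀ R ∈ L, MeasurableSet R) :
    MeasurableSet {ω : ι → E | FewIn k L ω} := by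
  classical
  simp only [fewIn_iff]
  have : {ω : ι → E | ∀ R ∈ L, (Finset.univ.filter fun i => ω i ∈ R).card ≤ k} =
      ⋂ R ∈ L.toFinset, {ω : ι → E | (Finset.univ.filter fun i => ω i ∈ R).card ≤ k} := by
    ext; simp
  rw [this]
  refine Finset.measurableSet_biInter _ fun R hR => ?_
  exact measurableSet_card_le _ (fun i => measurable_pi_apply i (hL R (by simpa using hR))) k

lemma pi_real_fewIn {E : Type*} [MeasurableSpace E] (k : ℕ)
    (L : List (Set E)) (hL : ∀ R ∈ L, MeasurableSet R) (hd : L.Pairwise Disjoint)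
    (ν : Measure E) [IsFiniteMeasure ν] (ι : Type) [Fintype ι]  :
    (Measure.pi fun _ : ι => ν).real {ω | FewIn k L ω} =
      occupancy k (ν.real (⋃ R ∈ L, R)ᶜ) (L.map ν.real) (Fintype.card ι) := by
  classical
  induction L generalizing ν ι with
  | nil =>
    simp [FewIn, occupancy, Measure.real, Measure.pi_univ]
  | cons R L ih =>
    simp only [List.mem_cons, forall_eq_or_imp] at hL
    rw [List.pairwise_cons] at hd
    have hLd := hd.1
    simp only [List.map_cons, occupancy]
    set ν' := ν.restrict Rᶜ with hν'
    -- the piece where the points in `R` are exactly those of `T`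
    let piece (T : Finset ι) : Set (ι → E) :=
      {ω | (∀ i, ω i ∈ R ↔ i ∈ T) ∧ FewIn k L ω}
    have hset : {ω : ι → E | FewIn k (R :: L) ω} =
        ⋃ T ∈ (Finset.univ : Finset (Finset ι)).filter (fun T => T.card ≤ k), piece T := by
      ext ω
      simp only [Set.mem_ofPred_eq, Set.mem_iUnion, Finset.mem_filter, Finset.mem_univ, true_and,
        piece, fewIn_iff, List.mem_cons, forall_eq_or_imp, exists_prop]
      constructor
      · rintro ⟨h1, h2⟩
        exact ⟨_, h1, fun i => by simp, h2⟩
      · rintro ⟨T, h1, h2, h3⟩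
        refine ⟨?_, h3⟩
        convert h1
        ext i; simp [h2]
    have hmeas : ∀ T, MeasurableSet (piece T) := fun T => by
      have h0 : piece T = {ω : ι → E | ∀ i, ω i ∈ R ↔ i ∈ T} ∩ {ω | FewIn k L ω} := rfl
      rw [h0]
      refine MeasurableSet.inter ?_ (measurableSet_fewIn k L hL.2)
      have : {ω : ι → E | ∀ i, ω i ∈ R ↔ i ∈ T} = ⋂ i, {ω : ι → E | ω i ∈ R ↔ i ∈ T} := by
        ext; simp
      rw [this]
      refine MeasurableSet.iInter fun i => ?_
      exact (measurable_pi_apply i hL.1).iff (MeasurableSet.const _)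
    have hdisj : Pairwise fun T T' => Disjoint (piece T) (piece T') := by
      intro T T' hne
      rw [Set.disjoint_left]
      rintro ω ⟨h1, _⟩ ⟨h2, _⟩
      apply hne
      ext i; rw [← h1, h2]
    have hpiece : ∀ T : Finset ι, (Measure.pi fun _ : ι => ν).real (piece T) =
        ν.real R ^ T.card * occupancy k (ν.real (⋃ R' ∈ R :: L, R')ᶜ) (L.map ν.real)
          (Fintype.card ι - T.card) := by
      intro T
      obtain ⟨P, hP⟩ : ∃ P : ι → Prop, ∀ i, i ∈ T ↔ P i := ⟨fun i => i ∈ T, fun _ => Iff.rfl⟩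
      have hcard : Fintype.card {i // P i} = T.card := Fintype.card_of_subtype T hP
      have mp := measurePreserving_piEquivPiSubtypeProd (fun _ : ι => ν) P
      have himg : piece T = (MeasurableEquiv.piEquivPiSubtypeProd (fun _ : ι => E) P) ⁻¹'
          ((Set.univ.pi fun _ => R) ×ˢ
            ({ω | FewIn k L ω} ∩ Set.univ.pi fun _ => Rᶜ)) := by
        ext ω
        simp only [piece, Set.mem_ofPred_eq, Set.mem_preimage, Set.mem_prod, Set.mem_pi,
          Set.mem_univ, true_imp_iff, Set.mem_inter_iff, fewIn_iff,
          MeasurableEquiv.piEquivPiSubtypeProd_apply, Set.mem_compl_iff, Subtype.forall]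
        have key : (∀ i, ω i ∈ R ↔ i ∈ T) → ∀ R' ∈ L,
            (Finset.univ.filter fun i : {i // ¬ P i} => ω i ∈ R').card =
            (Finset.univ.filter fun i => ω i ∈ R').card := by
          intro h R' hR'
          rw [← Finset.card_map (Function.Embedding.subtype _)]
          congr 1
          ext i
          simp only [Finset.mem_map, Finset.mem_filter, Finset.mem_univ, true_and,
            Function.Embedding.subtype_apply, Subtype.exists, exists_and_left, exists_prop,
            exists_eq_right_right, and_iff_left_iff_imp]
          intro hi
          rw [← hP, ← h]
          exact Set.disjoint_right.1 (hLd R' hR') hi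
        constructor
        · rintro ⟨h1, h2⟩
          refine ⟨fun i hi => (h1 i).2 ((hP i).2 hi), fun R' hR' => ?_, fun i hi h => hi ((hP i).1 ((h1 i).1 h))⟩
          rw [key h1 R' hR']; exact h2 R' hR'
        · rintro ⟨h1, h2, h3⟩
          have h4 : ∀ i, ω i ∈ R ↔ i ∈ T := fun i =>
            ⟨fun h => by by_contra hi; exact h3 i (fun h' => hi ((hP i).2 h')) h, fun h => h1 i ((hP i).1 h)⟩
          refine ⟨h4, fun R' hR' => ?_⟩
          rw [← key h4 R' hR']; exact h2 R' hR'
      have hm2 : MeasurableSet ({ω : {i // ¬ P i} → E | FewIn k L ω} ∩ Set.univ.pi fun _ => Rᶜ) :=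
        (measurableSet_fewIn k L hL.2).inter (MeasurableSet.univ_pi fun _ => hL.1.compl)
      have hm1 : MeasurableSet (Set.univ.pi fun _ : {i // P i} => R) :=
        MeasurableSet.univ_pi fun _ => hL.1
      rw [himg, measureReal_def, mp.measure_preimage_equiv, Measure.prod_prod, ENNReal.toReal_mul,
        Measure.pi_pi]
      congr 1
      · simp [Measure.real, hcard]
      · rw [← Measure.restrict_apply' (MeasurableSet.univ_pi fun _ => hL.1.compl),
          Measure.restrict_pi_pi, ← measureReal_def]
        have := ih hL.2 hd.2 ν' {i // ¬ P i}
        rw [this]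
        congr 1
        · rw [measureReal_def, measureReal_def, hν', Measure.restrict_apply' hL.1.compl]
          congr 2
          ext x; simp [and_comm]
        · refine List.map_congr_left fun R' hR' => ?_
          rw [measureReal_def, measureReal_def, hν', Measure.restrict_apply' hL.1.compl]
          congr 2
          exact Set.inter_eq_left.2 fun x hx h => Set.disjoint_left.1 (hLd R' hR') h hx
        · rw [Fintype.card_subtype_compl, hcard]
    rw [hset, measureReal_biUnion_finset (fun T _ T' _ h => hdisj h) (fun T _ => hmeas T)]
    simp only [hpiece]
    have hfib : ∀ T ∈ (Finset.univ : Finset (Finset ι)).filter (fun T => T.card ≤ k),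
        T.card ∈ Finset.range (k + 1) := by
      intro T hT; simp at hT ⊢; omega
    rw [← Finset.sum_fiberwise_of_maps_to hfib]
    refine Finset.sum_congr rfl fun s hs => ?_
    have hs' : s ≤ k := by simp at hs; omega
    have : ((Finset.univ : Finset (Finset ι)).filter (fun T => T.card ≤ k)).filter
        (fun T => T.card = s) = Finset.univ.powersetCard s := by
      ext T; simp [Finset.mem_powersetCard]; omega
    rw [this, Finset.sum_congr rfl (g := fun _ => ν.real R ^ s *
        occupancy k (ν.real (⋃ R' ∈ R :: L, R')ᶜ) (L.map ν.real) (Fintype.card ι - s))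
      (fun T hT => by rw [(Finset.mem_powersetCard.1 hT).2])]
    simp [Finset.card_powersetCard, mul_assoc]

section
variable {E κ : Type*} [MeasurableSpace E] [Fintype κ] {ι : Type} [Fintype ι]
  (μ : Measure E) [IsProbabilityMeasure μ]

lemma pi_real_fewIn_family (k : ℕ) (R : κ → Set E) (hR : ∀ l, MeasurableSet (R l))
    (hd : Pairwise fun l l' => Disjoint (R l) (R l')) :
    (Measure.pi fun _ : ι => μ).real {ω | ∀ l, Nat.card {i // ω i ∈ R l} ≤ k} =
      occupancy k (1 - ∑ l, μ.real (R l)) (Finset.univ.toList.map fun l => μ.real (R l))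
        (Fintype.card ι) := by
  classical
  have h := pi_real_fewIn k (Finset.univ.toList.map R)
    (by simp only [List.mem_map]; rintro _ ⟨l, _, rfl⟩; exact hR l)
    (by
      rw [List.pairwise_map]
      exact (Finset.nodup_toList _).imp fun h => hd h) μ ι
  have e1 : {ω : ι → E | FewIn k (Finset.univ.toList.map R) ω} =
      {ω | ∀ l, Nat.card {i // ω i ∈ R l} ≤ k} := by
    ext ω; simp [FewIn]
  have e2 : (⋃ R' ∈ Finset.univ.toList.map R, R') = ⋃ l ∈ (Finset.univ : Finset κ), R l := by
    ext; simp
  rw [e1, e2, probReal_compl_eq_one_sub (Finset.measurableSet_biUnion _ fun l _ => hR l),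
    measureReal_biUnion_finset (fun l _ l' _ h => hd h) (fun l _ => hR l), List.map_map] at h
  exact h

lemma sum_real_le_one (R : κ → Set E) (hR : ∀ l, MeasurableSet (R l))
    (hd : Pairwise fun l l' => Disjoint (R l) (R l')) : ∑ l, μ.real (R l) ≤ 1 := by
  rw [← measureReal_biUnion_finset (fun l _ l' _ h => hd h) (fun l _ => hR l)]
  exact measureReal_le_one

lemma pi_real_few_le (k : ℕ) (R : κ → Set E) (hR : ∀ l, MeasurableSet (R l))
    (hd : Pairwise fun l l' => Disjoint (R l) (R l')) (n : ℕ) (hn : Fintype.card ι ≤ n) :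
    (Measure.pi fun _ : ι => μ).real {ω | ∀ l, Nat.card {i // ω i ∈ R l} ≤ k} ≤
      exp ((∑ l, μ.real (R l)) * (n - Fintype.card ι + Fintype.card κ * k)) *
        ∏ l, poissonLow k (n * μ.real (R l)) := by
  rw [pi_real_fewIn_family μ k R hR hd]
  set P := ∑ l, μ.real (R l) with hP
  have hP1 : P ≤ 1 := sum_real_le_one μ R hR hd
  have hP0 : 0 ≤ P := Finset.sum_nonneg fun l _ => measureReal_nonneg
  refine (occupancy_le k (by linarith) (by linarith) _ (by simp) _ n hn).trans ?_
  rw [List.map_map, Finset.prod_map_toList, List.length_map, Finset.length_toList,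
    Finset.card_univ]
  simp only [poissonLow, Finset.prod_mul_distrib, ← exp_sum, Function.comp_apply]
  rw [← mul_assoc, ← exp_add]
  have hs : ∑ x, -(n * μ.real (R x)) = -(n * P) := by
    rw [hP, Finset.mul_sum, Finset.sum_neg_distrib]
  rw [hs]
  simp only [mul_pow]
  have hexp : (1 - P) ^ (Fintype.card ι - Fintype.card κ * k) ≤
      exp (P * (n - Fintype.card ι + Fintype.card κ * k) + -(n * P)) := by
    calc _ ≤ (exp (-P)) ^ (Fintype.card ι - Fintype.card κ * k) := by
          exact pow_le_pow_left₀ (by linarith) (one_sub_le_exp_neg P) _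
      _ = exp (-P * ((Fintype.card ι - Fintype.card κ * k : ℕ) : ℝ)) := by
          rw [← exp_nat_mul]; ring_nf
      _ ≤ _ := by
          rw [exp_le_exp]
          have : (Fintype.card ι : ℝ) - Fintype.card κ * k ≤
              ((Fintype.card ι - Fintype.card κ * k : ℕ) : ℝ) := by
            have h2 : Fintype.card ι ≤ Fintype.card ι - Fintype.card κ * k + Fintype.card κ * k := by
              omega
            have h3 : (Fintype.card ι : ℝ) ≤
              ((Fintype.card ι - Fintype.card κ * k : ℕ) : ℝ) + Fintype.card κ * k := by
              exact_mod_cast h2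
            linarith
          nlinarith
  refine mul_le_mul_of_nonneg_right hexp (Finset.prod_nonneg fun l _ =>
    Finset.sum_nonneg fun s _ => ?_)
  have := measureReal_nonneg (μ := μ) (s := R l)
  positivity

lemma exp_neg_add_sq_le {x : ℝ} (h0 : 0 ≤ x) (h1 : x ≤ 1 / 2) : exp (-(x + x ^ 2)) ≤ 1 - x := by
  rw [exp_neg, inv_le_comm₀ (exp_pos _) (by linarith)]
  refine le_trans ?_ (Real.quadratic_le_exp_of_nonneg (by positivity))
  rw [inv_le_iff_one_le_mul₀ (by linarith)]
  nlinarith [mul_nonneg h0 h0, mul_nonneg (mul_nonneg h0 h0) h0,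
    mul_nonneg (mul_nonneg h0 h0) (sub_nonneg.2 h1), pow_nonneg h0 4, pow_nonneg h0 5,
    mul_nonneg (pow_nonneg h0 3) (sub_nonneg.2 h1), mul_nonneg (pow_nonneg h0 4) (sub_nonneg.2 h1)]

lemma le_pi_real_few (k : ℕ) (R : κ → Set E) (hR : ∀ l, MeasurableSet (R l))
    (hd : Pairwise fun l l' => Disjoint (R l) (R l')) (n d : ℕ) (hn : Fintype.card ι ≤ n)
    (hdn : d + (Fintype.card κ + 1) * k ≤ Fintype.card ι) (hP2 : ∑ l, μ.real (R l) ≤ 1 / 2) :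
    exp (-(n * (∑ l, μ.real (R l)) ^ 2)) * (d / n : ℝ) ^ (k * Fintype.card κ) *
        ∏ l, poissonLow k (n * μ.real (R l)) ≤
    (Measure.pi fun _ : ι => μ).real {ω | ∀ l, Nat.card {i // ω i ∈ R l} ≤ k} := by
  rw [pi_real_fewIn_family μ k R hR hd]
  set P := ∑ l, μ.real (R l) with hP
  have hP0 : 0 ≤ P := Finset.sum_nonneg fun l _ => measureReal_nonneg
  refine le_trans ?_ (le_occupancy k (by linarith) (by linarith) _ (by simp) _ d
    (by simpa using hdn))
  rw [List.map_map, Finset.prod_map_toList]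
  simp only [poissonLow, Finset.prod_mul_distrib, ← exp_sum, Function.comp_apply]
  have hs : ∑ x, -(n * μ.real (R x)) = -(n * P) := by
    rw [hP, Finset.mul_sum, Finset.sum_neg_distrib]
  rw [hs]
  simp only [mul_pow]
  have hexp : exp (-(n * P ^ 2)) * exp (-(n * P)) ≤ (1 - P) ^ Fintype.card ι := by
    calc _ = exp (-(P + P ^ 2)) ^ n := by rw [← exp_add, ← exp_nat_mul]; ring_nf
      _ ≤ (1 - P) ^ n := by gcongr; exact exp_neg_add_sq_le hP0 hP2
      _ ≤ _ := pow_le_pow_of_le_one (by linarith) (by linarith) hn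
  have hdn' : d ≤ n := by
    have := Nat.zero_le ((Fintype.card κ + 1) * k); omega
  have hprod : (d / n : ℝ) ^ (k * Fintype.card κ) * ∏ l, ∑ s ∈ Finset.range (k + 1),
      (n : ℝ) ^ s * μ.real (R l) ^ s / (s.factorial : ℝ) ≤ ∏ l, ∑ s ∈ Finset.range (k + 1),
      (d : ℝ) ^ s * μ.real (R l) ^ s / (s.factorial : ℝ) := by
    rw [pow_mul, ← Finset.card_univ (α := κ), ← Finset.prod_const, ← Finset.prod_mul_distrib]
    refine Finset.prod_le_prod (fun l _ => ?_) fun l _ => ?_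
    · refine mul_nonneg (by positivity) (Finset.sum_nonneg fun s _ => ?_)
      have := measureReal_nonneg (μ := μ) (s := R l)
      positivity
    · rw [Finset.mul_sum]
      refine Finset.sum_le_sum fun s hs => ?_
      have hs' : s ≤ k := by simp at hs; omega
      have := measureReal_nonneg (μ := μ) (s := R l)
      rw [← mul_div_assoc, ← mul_assoc]
      gcongr
      rcases Nat.eq_zero_or_pos n with rfl | hn0
      · have : d = 0 := by omega
        subst this
        rcases Nat.eq_zero_or_pos k with rfl | hk
        · have : s = 0 := by omega
          subst this; simp
        · simp [hk.ne']
      have hn0' : (0 : ℝ) < n := by exact_mod_cast hn0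
      calc (d / n : ℝ) ^ k * (n : ℝ) ^ s ≤ (d / n : ℝ) ^ s * (n : ℝ) ^ s := by
            gcongr ?_ * _
            refine pow_le_pow_of_le_one (by positivity) ?_ hs'
            rw [div_le_one hn0']; exact_mod_cast hdn'
        _ = _ := by rw [← mul_pow, div_mul_cancel₀ _ hn0'.ne']
  have hnn : 0 ≤ ∏ l, ∑ s ∈ Finset.range (k + 1),
      (n : ℝ) ^ s * μ.real (R l) ^ s / (s.factorial : ℝ) :=
    Finset.prod_nonneg fun l _ => Finset.sum_nonneg fun s _ => by
      have := measureReal_nonneg (μ := μ) (s := R l)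
      positivity
  calc _ = (exp (-(n * P ^ 2)) * exp (-(n * P))) * ((d / n : ℝ) ^ (k * Fintype.card κ) *
        ∏ l, ∑ s ∈ Finset.range (k + 1), (n : ℝ) ^ s * μ.real (R l) ^ s / (s.factorial : ℝ)) := by
        ring
    _ ≤ _ := mul_le_mul hexp hprod (by positivity) (by apply pow_nonneg; linarith)
end

/-- Bonferroni's inequality for a single natural number. -/
lemma abs_indicator_sub_alternating_le (w J : ℕ) :
    |(if w = 0 then (1 : ℝ) else 0) - ∑ j ∈ Finset.range J, (-1) ^ j * (w.choose j : ℝ)| ≤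
      (w.choose J : ℝ) := by
  rcases J with _ | J
  · simp; split_ifs <;> simp
  rcases w with _ | w
  · rw [Finset.sum_range_succ']
    simp
  have h := Int.alternating_sum_range_choose_eq_choose (n := w) (m := J)
  have h' : ∑ j ∈ Finset.range (J + 1), (-1 : ℝ) ^ j * ((w + 1).choose j : ℝ) =
      (-1) ^ J * (w.choose J : ℝ) := by exact_mod_cast h
  rw [h']
  simp only [Nat.add_eq_zero_iff, one_ne_zero, and_false, if_false, zero_sub, abs_neg, abs_mul,
    abs_pow, abs_one, one_pow, one_mul, Nat.abs_cast]
  rw [Nat.choose_succ_succ]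
  push_cast
  linarith [(w.choose (J + 1)).cast_nonneg (α := ℝ)]

/-- Convergence of binomial moments to those of a Poisson variable gives convergence of the
probability of vanishing. -/
lemma tendsto_exp_neg_of_binomial_moments (P : ℕ → ℝ) (M : ℕ → ℕ → ℝ) (lam : ℝ)
    (hbon : ∀ n J, |P n - ∑ j ∈ Finset.range J, (-1) ^ j * M n j| ≤ M n J)
    (hM : ∀ j, Tendsto (fun n => M n j) atTop (𝓝 (lam ^ j / (j.factorial : ℝ)))) :
    Tendsto P atTop (𝓝 (exp (-lam))) := by
  have hsum : HasSum (fun j : ℕ => (-1) ^ j * (lam ^ j / (j.factorial : ℝ))) (exp (-lam)) := by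
    have := NormedSpace.expSeries_div_hasSum_exp (𝔸 := ℝ) (-lam)
    rw [← Real.exp_eq_exp_ℝ] at this
    refine this.congr_fun ?_
    intro j
    rw [neg_pow lam j]; ring
  have h1 := hsum.tendsto_sum_nat
  have h2 : Tendsto (fun j : ℕ => lam ^ j / (j.factorial : ℝ)) atTop (𝓝 0) :=
    FloorSemiring.tendsto_pow_div_factorial_atTop lam
  rw [Metric.tendsto_atTop]
  intro ε hε
  obtain ⟨J, hJ1, hJ2⟩ := ((h1.eventually (Metric.ball_mem_nhds _ (by positivity : 0 < ε / 4))).and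
    (h2.eventually (Iio_mem_nhds (by positivity : 0 < ε / 4)))).exists
  have hS : Tendsto (fun n => ∑ j ∈ Finset.range J, (-1) ^ j * M n j) atTop
      (𝓝 (∑ j ∈ Finset.range J, (-1) ^ j * (lam ^ j / (j.factorial : ℝ)))) :=
    tendsto_finsetSum _ fun j _ => (hM j).const_mul _
  obtain ⟨N, hN⟩ := eventually_atTop.1 ((hS.eventually
    (Metric.ball_mem_nhds _ (by positivity : 0 < ε / 4))).and
    ((hM J).eventually (Iio_mem_nhds (show lam ^ J / (J.factorial : ℝ) < ε / 4 from hJ2))))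
  refine ⟨N, fun n hn => ?_⟩
  obtain ⟨ha, hb⟩ := hN n hn
  have hc := hbon n J
  rw [Real.dist_eq] at ha hJ1
  rw [Real.dist_eq]
  replace hb : M n J < ε / 4 := hb
  rw [abs_lt] at *
  rw [abs_le] at hc
  constructor <;> linarith [hc.1, hc.2, ha.1, ha.2, hJ1.1, hJ1.2]

section
open ENNReal
variable {E : Type*} [MeasurableSpace E] {ι : Type} [Fintype ι]
  (μ : Measure E) [IsProbabilityMeasure μ]

lemma lintegral_pi_resample [DecidableEq ι] (b : ι) (f : (ι → E) → ℝ≥0∞) (hf : Measurable f) :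
    ∫⁻ x, f x ∂(Measure.pi fun _ : ι => μ) =
      ∫⁻ x, ∫⁻ y, f (Function.update x b y) ∂μ ∂(Measure.pi fun _ : ι => μ) := by
  have hg : Measurable fun x : ι → E => ∫⁻ y, f (Function.update x b y) ∂μ := by
    have := hf.lmarginal (μ := fun _ : ι => μ) (s := {b})
    have h2 : (fun x : ι → E => ∫⁻ y, f (Function.update x b y) ∂μ) =
        lmarginal (fun _ : ι => μ) {b} f := by
      ext x; rw [lmarginal_singleton]
    rwa [h2]
  refine lintegral_eq_of_lmarginal_eq (μ := fun _ : ι => μ) {b} hf hg ?_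
  ext x
  rw [lmarginal_singleton, lmarginal_singleton]
  simp

lemma lintegral_pi_prod (f : ι → E → ℝ≥0∞) (hf : ∀ i, Measurable (f i)) :
    ∫⁻ x, ∏ i, f i (x i) ∂(Measure.pi fun _ : ι => μ) = ∏ i, ∫⁻ y, f i y ∂μ := by
  have h := ProbabilityTheory.lintegral_prod_eq_prod_lintegral_of_indepFun
    (μ := Measure.pi fun _ : ι => μ) Finset.univ (fun i (x : ι → E) => f i (x i))
    (ProbabilityTheory.iIndepFun_pi (μ := fun _ : ι => μ) (X := f) fun i => (hf i).aemeasurable)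
    (fun i => (hf i).comp (measurable_pi_apply i))
  rw [h]
  refine Finset.prod_congr rfl fun i _ => ?_
  exact (measurePreserving_eval (fun _ : ι => μ) i).lintegral_comp (hf i)

lemma lintegral_pi_kernel [DecidableEq ι] {a b : ι} (hab : a ≠ b) (K : E → E → ℝ≥0∞)
    (hK : Measurable (Function.uncurry K)) (f : E → ℝ≥0∞) (hf : Measurable f) :
    ∫⁻ x, K (x a) (x b) * ∏ l ∈ (Finset.univ.erase a).erase b, f (x l) ∂(Measure.pi fun _ : ι => μ)
      = (∫⁻ u, ∫⁻ v, K u v ∂μ ∂μ) * (∫⁻ u, f u ∂μ) ^ (Fintype.card ι - 2) := by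
  have hKm : Measurable fun u => ∫⁻ v, K u v ∂μ := hK.lintegral_prod_right
  rw [lintegral_pi_resample μ b]
  swap
  · refine Measurable.mul ?_ (Finset.measurable_prod _ fun l _ => hf.comp (measurable_pi_apply l))
    exact hK.comp (Measurable.prodMk (measurable_pi_apply a) (measurable_pi_apply b) :
      Measurable fun x : ι → E => (x a, x b))
  let g : ι → E → ℝ≥0∞ := fun l => if l = a then fun u => ∫⁻ v, K u v ∂μ else
    if l = b then fun _ => 1 else f
  have hg : ∀ l, Measurable (g l) := fun l => by
    simp only [g]; split_ifs; exacts [hKm, measurable_const, hf]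
  have e : ∀ h : ι → ℝ≥0∞, ∏ l, h l = h a * (h b * ∏ l ∈ (Finset.univ.erase a).erase b, h l) := by
    intro h
    rw [Finset.mul_prod_erase _ _ (by simp [hab.symm]), Finset.mul_prod_erase _ _ (by simp)]
  have h1 : ∀ x : ι → E, ∫⁻ y, K (Function.update x b y a) (Function.update x b y b) *
      ∏ l ∈ (Finset.univ.erase a).erase b, f (Function.update x b y l) ∂μ = ∏ l, g l (x l) := by
    intro x
    rw [e]
    have : ∀ y, ∏ l ∈ (Finset.univ.erase a).erase b, f (Function.update x b y l) =
        ∏ l ∈ (Finset.univ.erase a).erase b, f (x l) := fun y =>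
      Finset.prod_congr rfl fun l hl => by
        rw [Function.update_of_ne (Finset.ne_of_mem_erase hl)]
    simp only [this, Function.update_self, Function.update_of_ne hab]
    have hKx : Measurable fun y => K (x a) y := hK.comp measurable_prodMk_left
    rw [lintegral_mul_const _ hKx]
    simp only [g, hab.symm, if_true, if_false, one_mul]
    congr 1
    refine Finset.prod_congr rfl fun l hl => ?_
    simp only [Finset.mem_erase] at hl
    rw [if_neg hl.2.1, if_neg hl.1]
  simp only [h1]
  rw [lintegral_pi_prod μ g hg, e]
  simp only [g, hab.symm, if_true, if_false, lintegral_one, measure_univ, one_mul]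
  congr 1
  rw [Finset.prod_congr rfl (g := fun _ => ∫⁻ u, f u ∂μ)]
  · rw [Finset.prod_const, Finset.card_erase_of_mem (by simp [hab.symm]),
      Finset.card_erase_of_mem (by simp), Finset.card_univ, Nat.sub_sub]
  · intro l hl
    simp only [Finset.mem_erase] at hl
    rw [if_neg hl.2.1, if_neg hl.1]

/-- Upper bound for the probability that, given the points indexed by `T`, certain regions
contain at most `k` of the other points. -/
lemma pi_few_upper (k n : ℕ) (hn : Fintype.card ι = n) (T : Finset ι) (A : Set (ι → E))
    (hA : MeasurableSet A) (A' : Set (T → E)) (R : (T → E) → T → Set E) (P0 : ℝ)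
    (hRm : ∀ x ∈ A', ∀ l, MeasurableSet (R x l))
    (hRd : ∀ x ∈ A', Pairwise fun l l' => Disjoint (R x l) (R x l'))
    (hRP : ∀ x ∈ A', ∑ l, μ.real (R x l) ≤ P0)
    (hAA : ∀ X ∈ A, (fun i : T => X i) ∈ A' ∧ ∀ l,
      Nat.card {j : ι // j ∉ T ∧ X j ∈ R (fun i : T => X i) l} ≤ k)
    (B : (T → E) → ℝ≥0∞)
    (hB : ∀ x ∈ A', ∏ l, ENNReal.ofReal (poissonLow k (n * μ.real (R x l))) ≤ B x) :
    (Measure.pi fun _ : ι => μ) A ≤ ENNReal.ofReal (exp (P0 * (T.card + T.card * k))) *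
      ∫⁻ x, B x ∂(Measure.pi fun _ : T => μ) := by
  classical
  obtain ⟨P, hP⟩ : ∃ P : ι → Prop, P = fun i => i ∈ T := ⟨_, rfl⟩
  have mp := measurePreserving_piEquivPiSubtypeProd (fun _ : ι => μ) P
  set e := MeasurableEquiv.piEquivPiSubtypeProd (fun _ : ι => E) P
  have h1 : (Measure.pi fun _ : ι => μ) A = ((Measure.pi fun _ : {i // P i} => μ).prod
      (Measure.pi fun _ : {i // ¬ P i} => μ)) (e.symm ⁻¹' A) :=
    (mp.symm.measure_preimage_equiv A).symm
  rw [h1, Measure.prod_apply (e.symm.measurable hA)]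
  have hcardT : Fintype.card {i // P i} = T.card := Fintype.card_of_subtype T (by simp [hP])
  have hcard : Fintype.card {i // ¬ P i} = n - T.card := by
    rw [Fintype.card_subtype_compl, hcardT, hn]
  have hTn : T.card ≤ n := hn ▸ Finset.card_le_univ T
  subst hP
  replace hcard : Fintype.card {i // i ∉ T} = n - T.card := by convert hcard
  have hmain : ∀ x : {i // i ∈ T} → E, (Measure.pi fun _ : {i // i ∉ T} => μ)
      (Prod.mk x ⁻¹' (e.symm ⁻¹' A)) ≤
      ENNReal.ofReal (exp (P0 * (T.card + T.card * k))) * B x := by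
    intro x
    by_cases hx : x ∈ A'
    · have hsub : Prod.mk x ⁻¹' (e.symm ⁻¹' A) ⊆
          {ω : {i // i ∉ T} → E | ∀ l, Nat.card {i // ω i ∈ R x l} ≤ k} := by
        intro y hy l
        obtain ⟨h2, h3⟩ := hAA _ hy
        have hx' : (fun i : T => e.symm (x, y) i) = x := by
          ext i
          have : e (e.symm (x, y)) = (x, y) := e.apply_symm_apply _
          exact congrFun (congrArg Prod.fst this) i
        have hy' : ∀ i : {i // i ∉ T}, e.symm (x, y) i = y i := by
          intro i
          have : e (e.symm (x, y)) = (x, y) := e.apply_symm_apply _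
          exact congrFun (congrArg Prod.snd this) i
        rw [hx'] at h3
        refine le_trans (le_of_eq ?_) (h3 l)
        refine Nat.card_congr ⟨fun i => ⟨i.1.1, i.1.2, by rw [hy']; exact i.2⟩,
          fun j => ⟨⟨j.1, j.2.1⟩, by rw [← hy']; exact j.2.2⟩, fun _ => rfl, fun _ => rfl⟩
      refine (measure_mono hsub).trans ?_
      have hb := pi_real_few_le (ι := {i // i ∉ T}) μ k (R x) (hRm x hx) (hRd x hx) n
        (by rw [hcard]; omega)
      rw [measureReal_def] at hb
      rw [← ENNReal.ofReal_toReal (measure_ne_top _ _)]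
      refine (ENNReal.ofReal_le_ofReal hb).trans ?_
      rw [ENNReal.ofReal_mul (exp_pos _).le, ENNReal.ofReal_prod_of_nonneg]
      · refine mul_le_mul' (ENNReal.ofReal_le_ofReal (exp_le_exp.2 ?_)) (hB x hx)
        rw [hcard, Fintype.card_coe]
        push_cast [Nat.cast_sub hTn]
        have := hRP x hx
        rw [show (n : ℝ) - (n - T.card) + T.card * k = T.card + T.card * k by ring]
        gcongr
      · intro l _
        exact (poissonLow_pos k (by positivity)).le
    · have : Prod.mk x ⁻¹' (e.symm ⁻¹' A) = ∅ := by
        ext y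
        simp only [Set.mem_preimage, Set.mem_empty_iff_false, iff_false]
        intro hy
        obtain ⟨h2, h3⟩ := hAA _ hy
        have hx' : (fun i : T => e.symm (x, y) i) = x := by
          ext i
          have : e (e.symm (x, y)) = (x, y) := e.apply_symm_apply _
          exact congrFun (congrArg Prod.fst this) i
        rw [hx'] at h2
        exact hx h2
      rw [this]; simp
  calc _ ≤ ∫⁻ x, ENNReal.ofReal (exp (P0 * (T.card + T.card * k))) * B x
        ∂(Measure.pi fun _ : {i // i ∈ T} => μ) := by
        refine le_trans (le_of_eq ?_) (lintegral_mono hmain)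
        congr!
    _ = _ := by
      rw [lintegral_const_mul' _ _ ENNReal.ofReal_ne_top]

/-- Lower bound for the probability that, given the points indexed by `T`, certain regions
contain at most `k` of the other points. -/
lemma pi_few_lower (k n d : ℕ) (hn : Fintype.card ι = n) (T : Finset ι) (A : Set (ι → E))
    (hA : MeasurableSet A) (A' : Set (T → E)) (hA' : MeasurableSet A')
    (R : (T → E) → T → Set E) (P0 : ℝ) (hP0 : P0 ≤ 1 / 2)
    (hd : d + (T.card + 1) * k + T.card ≤ n)
    (hRm : ∀ x ∈ A', ∀ l, MeasurableSet (R x l))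
    (hRd : ∀ x ∈ A', Pairwise fun l l' => Disjoint (R x l) (R x l'))
    (hRP : ∀ x ∈ A', ∑ l, μ.real (R x l) ≤ P0)
    (hAA : ∀ X : ι → E, (fun i : T => X i) ∈ A' → (∀ l,
      Nat.card {j : ι // j ∉ T ∧ X j ∈ R (fun i : T => X i) l} ≤ k) → X ∈ A) :
    ENNReal.ofReal (exp (-(n * P0 ^ 2)) * (d / n : ℝ) ^ (k * T.card)) *
      ∫⁻ x in A', ∏ l, ENNReal.ofReal (poissonLow k (n * μ.real (R x l)))
        ∂(Measure.pi fun _ : T => μ) ≤ (Measure.pi fun _ : ι => μ) A := by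
  classical
  obtain ⟨P, hP⟩ : ∃ P : ι → Prop, P = fun i => i ∈ T := ⟨_, rfl⟩
  have mp := measurePreserving_piEquivPiSubtypeProd (fun _ : ι => μ) P
  set e := MeasurableEquiv.piEquivPiSubtypeProd (fun _ : ι => E) P
  have h1 : (Measure.pi fun _ : ι => μ) A = ((Measure.pi fun _ : {i // P i} => μ).prod
      (Measure.pi fun _ : {i // ¬ P i} => μ)) (e.symm ⁻¹' A) :=
    (mp.symm.measure_preimage_equiv A).symm
  rw [h1, Measure.prod_apply (e.symm.measurable hA)]
  have hcardT : Fintype.card {i // P i} = T.card := Fintype.card_of_subtype T (by simp [hP])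
  have hcard : Fintype.card {i // ¬ P i} = n - T.card := by
    rw [Fintype.card_subtype_compl, hcardT, hn]
  have hTn : T.card ≤ n := hn ▸ Finset.card_le_univ T
  subst hP
  replace hcard : Fintype.card {i // i ∉ T} = n - T.card := by convert hcard
  have hmain : ∀ x ∈ A',
      ENNReal.ofReal (exp (-(n * P0 ^ 2)) * (d / n : ℝ) ^ (k * T.card)) *
        ∏ l, ENNReal.ofReal (poissonLow k (n * μ.real (R x l))) ≤
      (Measure.pi fun _ : {i // i ∉ T} => μ) (Prod.mk x ⁻¹' (e.symm ⁻¹' A)) := by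
    intro x hx
    have hsub : {ω : {i // i ∉ T} → E | ∀ l, Nat.card {i // ω i ∈ R x l} ≤ k} ⊆
        Prod.mk x ⁻¹' (e.symm ⁻¹' A) := by
      intro y hy
      have hx' : (fun i : T => e.symm (x, y) i) = x := by
        ext i
        have : e (e.symm (x, y)) = (x, y) := e.apply_symm_apply _
        exact congrFun (congrArg Prod.fst this) i
      have hy' : ∀ i : {i // i ∉ T}, e.symm (x, y) i = y i := by
        intro i
        have : e (e.symm (x, y)) = (x, y) := e.apply_symm_apply _
        exact congrFun (congrArg Prod.snd this) i
      refine hAA _ (by rw [hx']; exact hx) fun l => ?_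
      rw [hx']
      refine le_trans (le_of_eq ?_) (hy l)
      refine Nat.card_congr ⟨fun j => ⟨⟨j.1, j.2.1⟩, by rw [← hy']; exact j.2.2⟩,
        fun i => ⟨i.1.1, i.1.2, by rw [hy']; exact i.2⟩, fun _ => rfl, fun _ => rfl⟩
    refine le_trans ?_ (measure_mono hsub)
    have hb := le_pi_real_few (ι := {i // i ∉ T}) μ k (R x) (hRm x hx) (hRd x hx) n d
      (by rw [hcard]; omega) (by rw [hcard, Fintype.card_coe]; omega) ((hRP x hx).trans hP0)
    rw [measureReal_def] at hb
    rw [← ENNReal.ofReal_toReal (measure_ne_top _ _)]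
    refine le_trans ?_ (ENNReal.ofReal_le_ofReal hb)
    rw [ENNReal.ofReal_mul (p := _ * _) (by positivity), ENNReal.ofReal_prod_of_nonneg]
    · rw [Fintype.card_coe]
      gcongr
      exact hRP x hx
    · intro l _
      exact (poissonLow_pos k (by positivity)).le
  calc _ = ∫⁻ x in A', ENNReal.ofReal (exp (-(n * P0 ^ 2)) * (d / n : ℝ) ^ (k * T.card)) *
        ∏ l, ENNReal.ofReal (poissonLow k (n * μ.real (R x l)))
        ∂(Measure.pi fun _ : {i // i ∈ T} => μ) := by
        rw [lintegral_const_mul' _ _ ENNReal.ofReal_ne_top]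
    _ ≤ ∫⁻ x in A', (Measure.pi fun _ : {i // i ∉ T} => μ) (Prod.mk x ⁻¹' (e.symm ⁻¹' A))
        ∂(Measure.pi fun _ : {i // i ∈ T} => μ) := by
        refine setLIntegral_mono' hA' hmain
    _ ≤ _ := by
      refine (setLIntegral_le_lintegral _ _).trans (le_of_eq ?_)
      congr!
end

lemma nat_card_le_of_imp {ι : Type*} [Finite ι] {P Q : ι → Prop} (h : ∀ i, P i → Q i) :
    Nat.card {i // P i} ≤ Nat.card {i // Q i} :=
  Nat.card_le_card_of_injective (Subtype.map id h) (Subtype.map_injective h Function.injective_id)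

section
open ENNReal
variable {E : Type*} [PseudoMetricSpace E] {ι : Type}

/-- The point `X i` has at most `k` other points within distance `r`. -/
def LowDeg (k : ℕ) (r : ℝ) (X : ι → E) (i : ι) : Prop :=
  Nat.card {j // j ≠ i ∧ X j ∈ closedBall (X i) r} ≤ k

/-- Low-degree indices without a smaller low-degree index nearby. -/
def LeadLow [LT ι] (k : ℕ) (r : ℝ) (X : ι → E) (i : ι) : Prop :=
  LowDeg k r X i ∧ ∀ j, j < i → dist (X j) (X i) ≤ 2 * r → ¬ LowDeg k r X j

variable [SecondCountableTopology E] [MeasurableSpace E] [BorelSpace E] [Fintype ι]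

lemma measurable_eval_dist (i j : ι) : Measurable fun X : ι → E => dist (X i) (X j) :=
  (measurable_pi_apply i).dist (measurable_pi_apply j)

lemma measurableSet_lowDeg (k : ℕ) (r : ℝ) (i : ι) :
    MeasurableSet {X : ι → E | LowDeg k r X i} := by
  classical
  have : {X : ι → E | LowDeg k r X i} =
      {X | (Finset.univ.filter fun j => j ≠ i ∧ X j ∈ closedBall (X i) r).card ≤ k} := by
    ext X; simp only [LowDeg, Nat.card_eq_fintype_card, Fintype.card_subtype]
  rw [this]
  refine measurableSet_card_le (fun j (X : ι → E) => j ≠ i ∧ X j ∈ closedBall (X i) r)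
    (fun j => ?_) k
  exact (MeasurableSet.const _).inter (measurableSet_le (measurable_eval_dist j i) measurable_const)

lemma measurableSet_leadLow [LT ι] (k : ℕ) (r : ℝ) (i : ι) :
    MeasurableSet {X : ι → E | LeadLow k r X i} := by
  have : {X : ι → E | LeadLow k r X i} = {X : ι → E | LowDeg k r X i} ∩
      ⋂ j, {X : ι → E | j < i → dist (X j) (X i) ≤ 2 * r → ¬ LowDeg k r X j} := by
    ext X; simp [LeadLow]
  rw [this]
  refine (measurableSet_lowDeg k r i).inter (MeasurableSet.iInter fun j => ?_)
  exact (MeasurableSet.const _).imp ((measurableSet_le (measurable_eval_dist j i)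
    measurable_const).imp (measurableSet_lowDeg k r j).compl)

/-- The points indexed by `T` are pairwise at distance more than `ρ`. -/
def FarApart (ρ : ℝ) (T : Finset ι) (X : ι → E) : Prop :=
  ∀ i ∈ T, ∀ j ∈ T, i ≠ j → ρ < dist (X i) (X j)

lemma measurableSet_farApart (ρ : ℝ) (T : Finset ι) :
    MeasurableSet {X : ι → E | FarApart ρ T X} := by
  have : {X : ι → E | FarApart ρ T X} =
      ⋂ i, ⋂ j, {X | i ∈ T → j ∈ T → i ≠ j → ρ < dist (X i) (X j)} := by
    ext X; simp only [FarApart, Set.mem_iInter, Set.mem_ofPred_eq]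
    exact ⟨fun h i j hi hj => h i hi j hj, fun h i hi j hj => h i j hi hj⟩
  rw [this]
  refine MeasurableSet.iInter fun i => MeasurableSet.iInter fun j => ?_
  exact (MeasurableSet.const _).imp ((MeasurableSet.const _).imp ((MeasurableSet.const _).imp
    (measurableSet_lt measurable_const (measurable_eval_dist i j))))

lemma measurableSet_allLow (k : ℕ) (r : ℝ) (T : Finset ι) :
    MeasurableSet {X : ι → E | ∀ i ∈ T, LowDeg k r X i} := by
  have : {X : ι → E | ∀ i ∈ T, LowDeg k r X i} = ⋂ i ∈ T, {X : ι → E | LowDeg k r X i} := by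
    ext; simp
  rw [this]
  exact Finset.measurableSet_biInter _ fun i _ => measurableSet_lowDeg k r i

lemma disjoint_closedBall_of_lt {x y : E} {r : ℝ} (h : 2 * r < dist x y) :
    Disjoint (closedBall x r) (closedBall y r) :=
  closedBall_disjoint_closedBall (by linarith)

variable (μ : Measure E) [IsProbabilityMeasure μ] (k n : ℕ) (r : ℝ)

/-- Approximate probability that a point at `x` is of low degree. -/
noncomputable def lowDensity (x : E) : ℝ≥0∞ :=
  ENNReal.ofReal (poissonLow k (n * μ.real (closedBall x r)))

lemma measurable_measure_closedBall : Measurable fun x : E => μ (closedBall x r) := by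
  have h : MeasurableSet {p : E × E | dist p.2 p.1 ≤ r} :=
    measurableSet_le (measurable_snd.dist measurable_fst) measurable_const
  exact measurable_measure_prodMk_left h

lemma measurable_lowDensity : Measurable (lowDensity μ k n r) := by
  refine ENNReal.measurable_ofReal.comp ((continuous_poissonLow k).measurable.comp ?_)
  exact ((measurable_measure_closedBall μ r).ennreal_toReal).const_mul _

lemma lowDensity_le_one (x : E) : lowDensity μ k n r x ≤ 1 := by
  rw [← ENNReal.ofReal_one]
  exact ENNReal.ofReal_le_ofReal (poissonLow_le_one k (by positivity))

lemma lintegral_lowDensity_le_one : ∫⁻ x, lowDensity μ k n r x ∂μ ≤ 1 := by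
  refine (lintegral_mono (lowDensity_le_one μ k n r)).trans ?_
  simp

lemma lintegral_pi_lowDensity {κ : Type} [Fintype κ] :
    ∫⁻ x, ∏ l, lowDensity μ k n r (x l) ∂(Measure.pi fun _ : κ => μ) =
      (∫⁻ x, lowDensity μ k n r x ∂μ) ^ Fintype.card κ := by
  rw [lintegral_pi_prod μ (fun _ => lowDensity μ k n r) fun _ => measurable_lowDensity μ k n r]
  simp

lemma pi_allLow_far_le (hn : Fintype.card ι = n) (T : Finset ι) {pm : ℝ}
    (hpm : ∀ x, μ.real (closedBall x r) ≤ pm) :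
    (Measure.pi fun _ : ι => μ) {X | (∀ i ∈ T, LowDeg k r X i) ∧ FarApart (2 * r) T X} ≤
      ENNReal.ofReal (exp (T.card * pm * (T.card + T.card * k))) *
        (∫⁻ x, lowDensity μ k n r x ∂μ) ^ T.card := by
  have h := pi_few_upper μ k n hn T
    {X | (∀ i ∈ T, LowDeg k r X i) ∧ FarApart (2 * r) T X}
    ((measurableSet_allLow k r T).inter (measurableSet_farApart _ T))
    {x | ∀ i j, i ≠ j → 2 * r < dist (x i) (x j)} (fun x l => closedBall (x l) r) (T.card * pm)
    (fun x _ l => measurableSet_closedBall) (fun x hx i j hij => disjoint_closedBall_of_lt (hx i j hij))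
    (fun x _ => (Finset.sum_le_sum fun l _ => hpm (x l)).trans (by simp))
    (fun X hX => ⟨fun i j hij => hX.2 i i.2 j j.2 (fun h => hij (Subtype.ext h)), fun l =>
      (nat_card_le_of_imp fun j hj => ⟨fun h => hj.1 (h ▸ l.2), hj.2⟩).trans (hX.1 l l.2)⟩)
    (fun x => ∏ l, lowDensity μ k n r (x l)) (fun x _ => le_rfl)
  rwa [lintegral_pi_lowDensity, Fintype.card_coe] at h

/-- Integral of the density over close pairs. -/
noncomputable def closePairs : ℝ≥0∞ :=
  ∫⁻ x, ∫⁻ y, (if dist x y ≤ 4 * r then lowDensity μ k n r x * lowDensity μ k n r y else 0) ∂μ ∂μ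

lemma measurable_closeKernel : Measurable (Function.uncurry fun x y : E =>
    if dist x y ≤ 4 * r then lowDensity μ k n r x * lowDensity μ k n r y else 0) := by
  refine Measurable.ite (measurableSet_le (measurable_fst.dist measurable_snd) measurable_const)
    ?_ measurable_const
  exact ((measurable_lowDensity μ k n r).comp measurable_fst).mul
    ((measurable_lowDensity μ k n r).comp measurable_snd)

lemma pow_lintegral_le_far {κ : Type} [Fintype κ] [DecidableEq κ] :
    (∫⁻ x, lowDensity μ k n r x ∂μ) ^ Fintype.card κ ≤
      (∫⁻ x in {x : κ → E | ∀ i j, i ≠ j → 4 * r < dist (x i) (x j)},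
        ∏ l, lowDensity μ k n r (x l) ∂(Measure.pi fun _ : κ => μ)) +
      (Fintype.card κ * Fintype.card κ - Fintype.card κ : ℕ) * (closePairs μ k n r *
        (∫⁻ x, lowDensity μ k n r x ∂μ) ^ (Fintype.card κ - 2)) := by
  set A' := {x : κ → E | ∀ i j, i ≠ j → 4 * r < dist (x i) (x j)} with hA'
  have hm : MeasurableSet A' := by
    have : A' = ⋂ i, ⋂ j, {x | i ≠ j → 4 * r < dist (x i) (x j)} := by
      ext; simp [hA']
    rw [this]
    exact MeasurableSet.iInter fun i => MeasurableSet.iInter fun j =>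
      (MeasurableSet.const _).imp (measurableSet_lt measurable_const (measurable_eval_dist i j))
  rw [← lintegral_pi_lowDensity, ← lintegral_add_compl _ hm]
  gcongr
  have e : ∀ (h : κ → ℝ≥0∞) (a b : κ), a ≠ b →
      ∏ l, h l = h a * (h b * ∏ l ∈ (Finset.univ.erase a).erase b, h l) := by
    intro h a b hab
    rw [Finset.mul_prod_erase _ _ (by simp [hab.symm]), Finset.mul_prod_erase _ _ (by simp)]
  have hK := measurable_closeKernel μ k n r
  set K := fun x y : E =>
    if dist x y ≤ 4 * r then lowDensity μ k n r x * lowDensity μ k n r y else 0 with hKdef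
  calc _ ≤ ∫⁻ x, ∑ p ∈ (Finset.univ : Finset κ).offDiag,
        K (x p.1) (x p.2) * ∏ l ∈ (Finset.univ.erase p.1).erase p.2, lowDensity μ k n r (x l)
        ∂(Measure.pi fun _ : κ => μ) := by
        rw [← lintegral_indicator hm.compl]
        refine lintegral_mono fun x => ?_
        by_cases hx : x ∈ A'
        · simp [hx]
        · rw [Set.indicator_of_mem (by exact hx)]
          simp only [hA', Set.mem_ofPred_eq] at hx
          push Not at hx
          obtain ⟨i, j, hij, hd⟩ := hx
          refine le_trans ?_ (Finset.single_le_sum (f := fun p : κ × κ => K (x p.1) (x p.2) *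
            ∏ l ∈ (Finset.univ.erase p.1).erase p.2, lowDensity μ k n r (x l)) (fun _ _ => zero_le)
            (show (i, j) ∈ (Finset.univ : Finset κ).offDiag by simp [hij]))
          simp only [K, if_pos hd]
          rw [e _ i j hij, mul_assoc]
    _ = ∑ p ∈ (Finset.univ : Finset κ).offDiag, closePairs μ k n r *
        (∫⁻ x, lowDensity μ k n r x ∂μ) ^ (Fintype.card κ - 2) := by
        rw [lintegral_finsetSum]
        · refine Finset.sum_congr rfl fun p hp => ?_
          have hp' : p.1 ≠ p.2 := by simpa using hp
          exact lintegral_pi_kernel μ hp' K hK _ (measurable_lowDensity μ k n r)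
        · intro p _
          refine Measurable.mul ?_ (Finset.measurable_prod _ fun l _ =>
            (measurable_lowDensity μ k n r).comp (measurable_pi_apply l))
          exact hK.comp (Measurable.prodMk (measurable_pi_apply p.1) (measurable_pi_apply p.2) :
            Measurable fun x : κ → E => (x p.1, x p.2))
    _ = _ := by
        rw [Finset.sum_const, Finset.offDiag_card, Finset.card_univ, nsmul_eq_mul]

lemma le_pi_allLow_far (hr : 0 ≤ r) (hn : Fintype.card ι = n) (T : Finset ι) {pm : ℝ}
    (hpm : ∀ x, μ.real (closedBall x r) ≤ pm) (d : ℕ) (hd : d + (T.card + 1) * k + T.card ≤ n)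
    (hP0 : T.card * pm ≤ 1 / 2) :
    ENNReal.ofReal (exp (-(n * (T.card * pm) ^ 2)) * (d / n : ℝ) ^ (k * T.card)) *
        (∫⁻ x, lowDensity μ k n r x ∂μ) ^ T.card ≤
      (Measure.pi fun _ : ι => μ) {X | (∀ i ∈ T, LowDeg k r X i) ∧ FarApart (4 * r) T X} +
      (T.card * T.card - T.card : ℕ) * (closePairs μ k n r *
        (∫⁻ x, lowDensity μ k n r x ∂μ) ^ (T.card - 2)) := by
  classical
  have h := pi_few_lower μ k n d hn T
    {X | (∀ i ∈ T, LowDeg k r X i) ∧ FarApart (4 * r) T X}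
    ((measurableSet_allLow k r T).inter (measurableSet_farApart _ T))
    {x | ∀ i j, i ≠ j → 4 * r < dist (x i) (x j)}
    (by
      have : {x : T → E | ∀ i j, i ≠ j → 4 * r < dist (x i) (x j)} =
          ⋂ i, ⋂ j, {x | i ≠ j → 4 * r < dist (x i) (x j)} := by ext; simp
      rw [this]
      exact MeasurableSet.iInter fun i => MeasurableSet.iInter fun j =>
        (MeasurableSet.const _).imp (measurableSet_lt measurable_const (measurable_eval_dist i j)))
    (fun x l => closedBall (x l) r) (T.card * pm) hP0 hd
    (fun x _ l => measurableSet_closedBall)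
    (fun x hx i j hij => disjoint_closedBall_of_lt (by linarith [hx i j hij]))
    (fun x _ => (Finset.sum_le_sum fun l _ => hpm (x l)).trans (by simp))
    (fun X hX hl => by
      have hfar : FarApart (4 * r) T X := fun i hi j hj hij =>
        hX ⟨i, hi⟩ ⟨j, hj⟩ (fun h => hij (congrArg Subtype.val h))
      refine ⟨fun i hi => (nat_card_le_of_imp fun j hj => ⟨fun hjT => ?_, hj.2⟩).trans
        (hl ⟨i, hi⟩), hfar⟩
      have h1 := hfar j hjT i hi hj.1
      have h2 := mem_closedBall.1 hj.2
      linarith)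
  have h2 := pow_lintegral_le_far μ k n r (κ := T)
  rw [Fintype.card_coe] at h2
  refine (mul_le_mul_right h2 _).trans ?_
  rw [mul_add]
  refine add_le_add h ?_
  refine mul_le_of_le_one_left zero_le ?_
  rw [← ENNReal.ofReal_one]
  refine ENNReal.ofReal_le_ofReal ?_
  refine mul_le_one₀ (exp_le_one_iff.2 (by
    have : (0 : ℝ) ≤ n * (T.card * pm) ^ 2 := by positivity
    linarith)) (by positivity) ?_
  refine pow_le_one₀ (by positivity) (div_le_one_of_le₀ ?_ (by positivity))
  have : d ≤ n := by
    have := Nat.zero_le ((T.card + 1) * k); omega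
  exact_mod_cast this
end

section
open ENNReal
variable {E : Type*} [PseudoMetricSpace E] {ι : Type}
variable [SecondCountableTopology E] [MeasurableSpace E] [BorelSpace E] [Fintype ι]
variable (μ : Measure E) [IsProbabilityMeasure μ] (k n : ℕ) (r : ℝ)

/-- `h` bounds the probability that two nearby points are both of low degree. -/
def PairBound (h : E → E → ℝ≥0∞) : Prop :=
  ∀ x y, dist x y ≤ 2 * r → ∃ D₁ D₂ : Set E, MeasurableSet D₁ ∧ MeasurableSet D₂ ∧ Disjoint D₁ D₂ ∧
    (D₁ ⊆ closedBall x r ∨ D₁ ⊆ closedBall y r) ∧ (D₂ ⊆ closedBall x r ∨ D₂ ⊆ closedBall y r) ∧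
    ENNReal.ofReal (poissonLow k (n * μ.real D₁)) * ENNReal.ofReal (poissonLow k (n * μ.real D₂))
      ≤ h x y

lemma pi_allLow_near_le [DecidableEq ι] (hn : Fintype.card ι = n) (T : Finset ι)
    {pm : ℝ} (hpm : ∀ x, μ.real (closedBall x r) ≤ pm) {h : E → E → ℝ≥0∞}
    (hm : Measurable (Function.uncurry h)) (hh : PairBound μ k n r h) {i b : ι} (hi : i ∈ T)
    (hb : b ∉ T) :
    (Measure.pi fun _ : ι => μ) {X | ((∀ i ∈ T, LowDeg k r X i) ∧ FarApart (4 * r) T X) ∧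
        LowDeg k r X b ∧ dist (X b) (X i) ≤ 2 * r} ≤
      ENNReal.ofReal (exp ((T.card + 1) * pm * ((T.card + 1) + (T.card + 1) * k))) *
        ((∫⁻ x, ∫⁻ y, h x y ∂μ ∂μ) * (∫⁻ x, lowDensity μ k n r x ∂μ) ^ (T.card - 1)) := by
  classical
  set T' := insert b T with hT'
  have hcard : T'.card = T.card + 1 := Finset.card_insert_of_notMem hb
  let ii : T' := ⟨i, Finset.mem_insert_of_mem hi⟩
  let bb : T' := ⟨b, Finset.mem_insert_self _ _⟩
  have hib : ii ≠ bb := fun h => hb (by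
    have : i = b := congrArg Subtype.val h
    rwa [← this])
  choose! D₁ D₂ hD1 hD2 hDd hDs1 hDs2 hDh using hh
  let R : (T' → E) → T' → Set E := fun x l => if l = ii then D₁ (x ii) (x bb) else
    if l = bb then D₂ (x ii) (x bb) else closedBall (x l) r
  have hRi : ∀ x, R x ii = D₁ (x ii) (x bb) := fun x => if_pos rfl
  have hRb : ∀ x, R x bb = D₂ (x ii) (x bb) := fun x => by simp only [R, if_neg hib.symm, if_true]
  have hRo : ∀ x l, l ≠ ii → l ≠ bb → R x l = closedBall (x l) r := fun x l h1 h2 => by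
    simp only [R, if_neg h1, if_neg h2]
  let A' : Set (T' → E) := {x | dist (x ii) (x bb) ≤ 2 * r ∧ ∀ l, l ≠ ii → l ≠ bb →
    4 * r < dist (x l) (x ii) ∧ ∀ l', l' ≠ ii → l' ≠ bb → l ≠ l' → 4 * r < dist (x l) (x l')}
  have hsub : ∀ x ∈ A', ∀ l, ∃ l', R x l ⊆ closedBall (x l') r ∧ (l ≠ ii → l ≠ bb → l' = l) ∧
      (l = ii ∨ l = bb → l' = ii ∨ l' = bb) := by
    intro x hx l
    by_cases h1 : l = ii
    · subst h1
      rw [hRi]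
      rcases hDs1 _ _ hx.1 with h | h
      exacts [⟨ii, h, by simp, by simp⟩, ⟨bb, h, by simp, by simp⟩]
    by_cases h2 : l = bb
    · subst h2
      rw [hRb]
      rcases hDs2 _ _ hx.1 with h | h
      exacts [⟨ii, h, by simp, by simp⟩, ⟨bb, h, by simp, by simp⟩]
    · exact ⟨l, (hRo x l h1 h2).le, by simp, by tauto⟩
  have hr : ∀ x ∈ A', 0 ≤ r := fun x hx => by
    have := dist_nonneg.trans hx.1; linarith
  have key := pi_few_upper μ k n hn T'
    {X | ((∀ i ∈ T, LowDeg k r X i) ∧ FarApart (4 * r) T X) ∧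
        LowDeg k r X b ∧ dist (X b) (X i) ≤ 2 * r}
    (((measurableSet_allLow k r T).inter (measurableSet_farApart _ T)).inter
      ((measurableSet_lowDeg k r b).inter (measurableSet_le (measurable_eval_dist b i)
        measurable_const))) A' R (T'.card * pm)
    (fun x hx l => by
      by_cases h1 : l = ii
      · subst h1; rw [hRi]; exact hD1 _ _ hx.1
      by_cases h2 : l = bb
      · subst h2; rw [hRb]; exact hD2 _ _ hx.1
      · rw [hRo x l h1 h2]; exact measurableSet_closedBall)
    (fun x hx l l' hll => by
      have hr0 := hr x hx
      have hfar : ∀ l m, l ≠ ii → l ≠ bb → (m = ii ∨ m = bb) → 2 * r < dist (x l) (x m) := by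
        intro l m h1 h2 hm
        have h3 := (hx.2 l h1 h2).1
        rcases hm with rfl | rfl
        · linarith
        · have := dist_triangle (x l) (x bb) (x ii)
          have h4 := hx.1
          rw [dist_comm] at h4
          linarith
      obtain ⟨m, hm1, hm2, hm3⟩ := hsub x hx l
      obtain ⟨m', hm1', hm2', hm3'⟩ := hsub x hx l'
      by_cases h1 : l = ii ∨ l = bb
      · by_cases h2 : l' = ii ∨ l' = bb
        · rcases h1 with rfl | rfl <;> rcases h2 with rfl | rfl
          · exact absurd rfl hll
          · simp only [hRi, hRb]; exact hDd _ _ hx.1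
          · simp only [hRi, hRb]; exact (hDd _ _ hx.1).symm
          · exact absurd rfl hll
        · push Not at h2
          obtain rfl := hm2' h2.1 h2.2
          exact (disjoint_closedBall_of_lt (hfar _ _ h2.1 h2.2 (hm3 h1))).symm.mono hm1 hm1'
      · push Not at h1
        obtain rfl := hm2 h1.1 h1.2
        by_cases h2 : l' = ii ∨ l' = bb
        · exact (disjoint_closedBall_of_lt (hfar _ _ h1.1 h1.2 (hm3' h2))).mono hm1 hm1'
        · push Not at h2
          obtain rfl := hm2' h2.1 h2.2
          have := (hx.2 _ h1.1 h1.2).2 _ h2.1 h2.2 hll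
          exact (disjoint_closedBall_of_lt (by linarith)).mono hm1 hm1')
    (fun x hx => (Finset.sum_le_sum fun l _ => by
      obtain ⟨m, hm1, -⟩ := hsub x hx l
      exact (measureReal_mono hm1).trans (hpm _)).trans (by simp))
    (fun X hX => by
      obtain ⟨⟨hlow, hfar⟩, hlb, hd⟩ := hX
      have hne : ∀ l : T', l ≠ bb → (l : ι) ∈ T := fun l hl =>
        (Finset.mem_insert.1 l.2).resolve_left fun h => hl (Subtype.ext h)
      have hA : (fun i : T' => X i) ∈ A' := by
        refine ⟨by rw [dist_comm]; exact hd, fun l h1 h2 => ⟨hfar l (hne l h2) i hi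
          fun h => h1 (Subtype.ext h), fun l' h1' h2' hll => hfar l (hne l h2) l' (hne l' h2')
          fun h => hll (Subtype.ext h)⟩⟩
      refine ⟨hA, fun l => ?_⟩
      obtain ⟨m, hm1, -⟩ := hsub _ hA l
      have hmlow : LowDeg k r X m := by
        by_cases h : m = bb
        · rw [h]; exact hlb
        · exact hlow m (hne m h)
      exact (nat_card_le_of_imp fun j hj => ⟨fun h => hj.1 (h ▸ m.2), hm1 hj.2⟩).trans hmlow)
    (fun x => h (x ii) (x bb) * ∏ l ∈ (Finset.univ.erase ii).erase bb, lowDensity μ k n r (x l))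
    (fun x hx => by
      rw [← Finset.mul_prod_erase _ _ (Finset.mem_univ ii),
        ← Finset.mul_prod_erase _ _ (show bb ∈ Finset.univ.erase ii by simp [hib.symm]),
        ← mul_assoc]
      refine mul_le_mul' ?_ (le_of_eq (Finset.prod_congr rfl fun l hl => ?_))
      · rw [hRi, hRb]; exact hDh _ _ hx.1
      · simp only [Finset.mem_erase] at hl
        rw [hRo x l hl.2.1 hl.1]; rfl)
  rw [lintegral_pi_kernel μ hib h hm _ (measurable_lowDensity μ k n r), Fintype.card_coe, hcard]
    at key
  simpa using key

/-- Lower bound for the probability that all indices of `T` are leading low-degree indices. -/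
lemma le_pi_leadLow [LinearOrder ι] (hr : 0 ≤ r) (hn : Fintype.card ι = n) (T : Finset ι) {pm : ℝ}
    (hpm : ∀ x, μ.real (closedBall x r) ≤ pm) (d : ℕ) (hd : d + (T.card + 1) * k + T.card ≤ n)
    (hP0 : T.card * pm ≤ 1 / 2) {h : E → E → ℝ≥0∞}
    (hm : Measurable (Function.uncurry h)) (hh : PairBound μ k n r h) :
    ENNReal.ofReal (exp (-(n * (T.card * pm) ^ 2)) * (d / n : ℝ) ^ (k * T.card)) *
        (∫⁻ x, lowDensity μ k n r x ∂μ) ^ T.card ≤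
      (Measure.pi fun _ : ι => μ) {X | ∀ i ∈ T, LeadLow k r X i} +
      T.card * n * (ENNReal.ofReal (exp ((T.card + 1) * pm * ((T.card + 1) + (T.card + 1) * k))) *
        ((∫⁻ x, ∫⁻ y, h x y ∂μ ∂μ) * (∫⁻ x, lowDensity μ k n r x ∂μ) ^ (T.card - 1))) +
      (T.card * T.card - T.card : ℕ) * (closePairs μ k n r *
        (∫⁻ x, lowDensity μ k n r x ∂μ) ^ (T.card - 2)) := by
  refine (le_pi_allLow_far μ k n r hr hn T hpm d hd hP0).trans ?_
  gcongr
  set C := ENNReal.ofReal (exp ((T.card + 1) * pm * ((T.card + 1) + (T.card + 1) * k))) *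
        ((∫⁻ x, ∫⁻ y, h x y ∂μ ∂μ) * (∫⁻ x, lowDensity μ k n r x ∂μ) ^ (T.card - 1))
  have hsub : {X : ι → E | (∀ i ∈ T, LowDeg k r X i) ∧ FarApart (4 * r) T X} ⊆
      {X | ∀ i ∈ T, LeadLow k r X i} ∪ ⋃ i ∈ T, ⋃ b ∈ Tᶜ,
        {X | ((∀ i ∈ T, LowDeg k r X i) ∧ FarApart (4 * r) T X) ∧
        LowDeg k r X b ∧ dist (X b) (X i) ≤ 2 * r} := by
    intro X hX
    by_cases hL : ∀ i ∈ T, LeadLow k r X i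
    · exact Or.inl hL
    · right
      push Not at hL
      obtain ⟨i, hi, hnot⟩ := hL
      simp only [LeadLow, not_and, not_forall, not_not] at hnot
      obtain ⟨j, hji, hjd, hjl⟩ := hnot (hX.1 i hi)
      have hjT : j ∉ T := fun hjT => by
        have := hX.2 j hjT i hi hji.ne
        linarith
      simp only [Set.mem_iUnion]
      exact ⟨i, hi, j, by simpa using hjT, hX, hjl, hjd⟩
  refine (measure_mono hsub).trans ((measure_union_le _ _).trans ?_)
  gcongr
  refine (measure_biUnion_finset_le _ _).trans ?_
  calc _ ≤ ∑ i ∈ T, (n : ℝ≥0∞) * C := by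
        refine Finset.sum_le_sum fun i hi => (measure_biUnion_finset_le _ _).trans ?_
        calc _ ≤ ∑ b ∈ Tᶜ, C := Finset.sum_le_sum fun b hb =>
              pi_allLow_near_le μ k n r hn T hpm hm hh hi (by simpa using hb)
          _ ≤ _ := by
            rw [Finset.sum_const, nsmul_eq_mul]
            gcongr
            exact hn ▸ Finset.card_le_univ _
    _ = _ := by rw [Finset.sum_const, nsmul_eq_mul, mul_assoc]
end

section
open ENNReal
variable {E : Type*} [PseudoMetricSpace E]
variable [SecondCountableTopology E] [MeasurableSpace E] [BorelSpace E]
variable (μ : Measure E) [IsProbabilityMeasure μ] (k : ℕ)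

/-- The expected number of `j`-element sets of leading low-degree indices. -/
noncomputable def leadMoment (n : ℕ) (r : ℝ) (j : ℕ) : ℝ :=
  ∑ T ∈ Finset.powersetCard j (Finset.univ : Finset (Fin n)),
    (Measure.pi fun _ : Fin n => μ).real {X | ∀ i ∈ T, LeadLow k r X i}

lemma measurableSet_allLead {n : ℕ} (r : ℝ) (T : Finset (Fin n)) :
    MeasurableSet {X : Fin n → E | ∀ i ∈ T, LeadLow k r X i} := by
  have : {X : Fin n → E | ∀ i ∈ T, LeadLow k r X i} = ⋂ i ∈ T, {X : Fin n → E | LeadLow k r X i} := by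
    ext; simp
  rw [this]
  exact Finset.measurableSet_biInter _ fun i _ => measurableSet_leadLow k r i

lemma exists_leadLow {n : ℕ} {r : ℝ} {X : Fin n → E} (h : ∃ i, LowDeg k r X i) :
    ∃ i, LeadLow k r X i := by
  classical
  obtain ⟨i, hi⟩ := h
  have hne : (Finset.univ.filter fun i => LowDeg k r X i).Nonempty := ⟨i, by simp [hi]⟩
  refine ⟨_, (Finset.mem_filter.1 (Finset.min'_mem _ hne)).2, fun j hj _ hl => ?_⟩
  exact absurd (Finset.min'_le _ j (by simp [hl])) (not_le.2 hj)

lemma leadLow_bonferroni (n : ℕ) (r : ℝ) (J : ℕ) :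
    |(Measure.pi fun _ : Fin n => μ).real {X | ∀ i, ¬ LowDeg k r X i} -
      ∑ j ∈ Finset.range J, (-1) ^ j * leadMoment μ k n r j| ≤ leadMoment μ k n r J := by
  classical
  set P := Measure.pi fun _ : Fin n => μ
  let w : (Fin n → E) → ℕ := fun X => (Finset.univ.filter fun i => LeadLow k r X i).card
  have hch : ∀ X j, ((w X).choose j : ℝ) =
      ∑ T ∈ Finset.powersetCard j (Finset.univ : Finset (Fin n)),
        {X | ∀ i ∈ T, LeadLow k r X i}.indicator (fun _ => (1 : ℝ)) X := by
    intro X j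
    rw [← Finset.card_powersetCard]
    simp only [Set.indicator_apply, Set.mem_ofPred_eq]
    rw [← Finset.sum_filter, Finset.sum_const, nsmul_eq_mul, mul_one]
    congr 2
    ext T
    simp only [Finset.mem_powersetCard, Finset.mem_filter, true_and,
      Finset.subset_iff, Finset.mem_univ]
    tauto
  have hInt : ∀ j, Integrable (fun X => ((w X).choose j : ℝ)) P := by
    intro j
    simp only [hch]
    exact integrable_finsetSum _ fun T _ =>
      (integrable_const _).indicator (measurableSet_allLead k r T)
  have hM : ∀ j, leadMoment μ k n r j = ∫ X, ((w X).choose j : ℝ) ∂P := by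
    intro j
    simp only [hch]
    rw [integral_finsetSum _ fun T _ => (integrable_const _).indicator (measurableSet_allLead k r T)]
    refine Finset.sum_congr rfl fun T _ => ?_
    rw [integral_indicator_const _ (measurableSet_allLead k r T)]
    simp [P]
  have hzero : ∀ X, (w X = 0 ↔ ∀ i, ¬ LowDeg k r X i) := by
    intro X
    simp only [w, Finset.card_eq_zero, Finset.filter_eq_empty_iff, Finset.mem_univ, true_imp_iff]
    constructor
    · intro h i hi
      obtain ⟨i', hi'⟩ := exists_leadLow k ⟨i, hi⟩
      exact h hi'
    · exact fun h i hi => h i hi.1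
  have hms : MeasurableSet {X : Fin n → E | ∀ i, ¬ LowDeg k r X i} := by
    have : {X : Fin n → E | ∀ i, ¬ LowDeg k r X i} = ⋂ i, {X : Fin n → E | LowDeg k r X i}ᶜ := by
      ext; simp
    rw [this]
    exact MeasurableSet.iInter fun i => (measurableSet_lowDeg k r i).compl
  have hP : P.real {X | ∀ i, ¬ LowDeg k r X i} = ∫ X, (if w X = 0 then (1 : ℝ) else 0) ∂P := by
    have : (fun X => if w X = 0 then (1 : ℝ) else 0) =
        {X | ∀ i, ¬ LowDeg k r X i}.indicator (fun _ => (1 : ℝ)) := by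
      ext X; simp only [hzero, Set.indicator_apply, Set.mem_ofPred_eq]
    rw [this, integral_indicator_const _ hms]; simp
  have hPi : Integrable (fun X => if w X = 0 then (1 : ℝ) else 0) P := by
    have : (fun X => if w X = 0 then (1 : ℝ) else 0) =
        {X | ∀ i, ¬ LowDeg k r X i}.indicator (fun _ => (1 : ℝ)) := by
      ext X; simp only [hzero, Set.indicator_apply, Set.mem_ofPred_eq]
    rw [this]; exact (integrable_const _).indicator hms
  simp only [hM]
  rw [hP]
  simp only [← integral_const_mul]
  rw [← integral_finsetSum _ fun j _ => (hInt j).const_mul _,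
    ← integral_sub hPi (integrable_finsetSum _ fun j _ => (hInt j).const_mul _)]
  refine (abs_integral_le_integral_abs).trans ?_
  refine integral_mono ((hPi.sub (integrable_finsetSum _ fun j _ => (hInt j).const_mul _)).abs)
    (hInt J) fun X => ?_
  exact abs_indicator_sub_alternating_le (w X) J

lemma leadMoment_le {n : ℕ} {r pm : ℝ} (hpm : ∀ x, μ.real (closedBall x r) ≤ pm) (j : ℕ) :
    leadMoment μ k n r j ≤ exp (j * pm * (j + j * k)) *
      (n.choose j * (∫⁻ x, lowDensity μ k n r x ∂μ).toReal ^ j) := by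
  have hI : ∫⁻ x, lowDensity μ k n r x ∂μ ≠ ∞ :=
    ne_top_of_le_ne_top one_ne_top (lintegral_lowDensity_le_one μ k n r)
  have : ∀ T ∈ Finset.powersetCard j (Finset.univ : Finset (Fin n)),
      (Measure.pi fun _ : Fin n => μ).real {X | ∀ i ∈ T, LeadLow k r X i} ≤
        exp (j * pm * (j + j * k)) * (∫⁻ x, lowDensity μ k n r x ∂μ).toReal ^ j := by
    intro T hT
    have hc := (Finset.mem_powersetCard.1 hT).2
    have h := pi_allLow_far_le μ k n r (Fintype.card_fin n) T hpm
    rw [hc] at h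
    have h2 : (Measure.pi fun _ : Fin n => μ) {X | ∀ i ∈ T, LeadLow k r X i} ≤
        (Measure.pi fun _ : Fin n => μ) {X | (∀ i ∈ T, LowDeg k r X i) ∧ FarApart (2 * r) T X} := by
      refine measure_mono fun X hX => ⟨fun i hi => (hX i hi).1, fun i hi j hj hij => ?_⟩
      by_contra hd
      rw [not_lt] at hd
      rcases lt_or_gt_of_ne hij with h | h
      · exact (hX j hj).2 i h hd (hX i hi).1
      · exact (hX i hi).2 j h (by rwa [dist_comm]) (hX j hj).1
    have h3 := ENNReal.toReal_mono (mul_ne_top ofReal_ne_top (pow_ne_top hI)) (h2.trans h)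
    rwa [toReal_mul, toReal_ofReal (exp_pos _).le, toReal_pow] at h3
  refine (Finset.sum_le_card_nsmul _ _ _ this).trans (le_of_eq ?_)
  rw [Finset.card_powersetCard, Finset.card_univ, Fintype.card_fin, nsmul_eq_mul]; ring

lemma le_leadMoment {n : ℕ} {r pm : ℝ} (hr : 0 ≤ r) (hpm : ∀ x, μ.real (closedBall x r) ≤ pm)
    (j d : ℕ) (hd : d + (j + 1) * k + j ≤ n) (hP0 : j * pm ≤ 1 / 2) {h : E → E → ℝ≥0∞}
    (hm : Measurable (Function.uncurry h)) (hh : PairBound μ k n r h) {H K : ℝ} (hH0 : 0 ≤ H)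
    (hK0 : 0 ≤ K) (hH : ∫⁻ x, ∫⁻ y, h x y ∂μ ∂μ ≤ ENNReal.ofReal H)
    (hK : closePairs μ k n r ≤ ENNReal.ofReal K) :
    exp (-(n * (j * pm) ^ 2)) * (d / n : ℝ) ^ (k * j) *
        (n.choose j * (∫⁻ x, lowDensity μ k n r x ∂μ).toReal ^ j) ≤
      leadMoment μ k n r j +
      j * exp ((j + 1) * pm * ((j + 1) + (j + 1) * k)) * ((n ^ 2 * H) *
        (n * (∫⁻ x, lowDensity μ k n r x ∂μ).toReal) ^ (j - 1)) +
      (j * j - j : ℕ) * ((n ^ 2 * K) * (n * (∫⁻ x, lowDensity μ k n r x ∂μ).toReal) ^ (j - 2)) := by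
  have hI : ∫⁻ x, lowDensity μ k n r x ∂μ ≠ ∞ :=
    ne_top_of_le_ne_top one_ne_top (lintegral_lowDensity_le_one μ k n r)
  set I := ∫⁻ x, lowDensity μ k n r x ∂μ with hIdef
  have hI0 : 0 ≤ I.toReal := toReal_nonneg
  have key : ∀ T ∈ Finset.powersetCard j (Finset.univ : Finset (Fin n)),
      exp (-(n * (j * pm) ^ 2)) * (d / n : ℝ) ^ (k * j) * I.toReal ^ j ≤
      (Measure.pi fun _ : Fin n => μ).real {X | ∀ i ∈ T, LeadLow k r X i} +
      (j * n * (exp ((j + 1) * pm * ((j + 1) + (j + 1) * k)) * (H * I.toReal ^ (j - 1))) +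
      (j * j - j : ℕ) * (K * I.toReal ^ (j - 2))) := by
    intro T hT
    have hc := (Finset.mem_powersetCard.1 hT).2
    have h1 := le_pi_leadLow μ k n r hr (Fintype.card_fin n) T hpm d (by rw [hc]; exact hd)
      (by rw [hc]; exact hP0) hm hh
    rw [hc] at h1
    have h2 := h1.trans (add_le_add (add_le_add_right (mul_le_mul_right (mul_le_mul_right
      (mul_le_mul_left hH (I ^ (j - 1))) _) _) _) (mul_le_mul_right
        (mul_le_mul_left hK (I ^ (j - 2))) _))
    have t1 : (Measure.pi fun _ : Fin n => μ) {X | ∀ i ∈ T, LeadLow k r X i} ≠ ∞ := measure_ne_top _ _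
    have t2 : (j : ℝ≥0∞) * n * (ENNReal.ofReal (exp ((j + 1) * pm * ((j + 1) + (j + 1) * k))) *
        (ENNReal.ofReal H * I ^ (j - 1))) ≠ ∞ := by finiteness
    have t3 : ((j * j - j : ℕ) : ℝ≥0∞) * (ENNReal.ofReal K * I ^ (j - 2)) ≠ ∞ := by finiteness
    have h3 := ENNReal.toReal_mono (by finiteness) h2
    rw [toReal_add (by finiteness) t3, toReal_add t1 t2] at h3
    simp only [toReal_mul, toReal_pow, toReal_natCast, toReal_ofReal hH0, toReal_ofReal hK0,
      toReal_ofReal (exp_pos _).le] at h3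
    rw [toReal_ofReal (by positivity)] at h3
    rw [← add_assoc]
    exact h3
  have hs := Finset.sum_le_sum key
  rw [Finset.sum_const, Finset.sum_add_distrib, Finset.sum_const, Finset.card_powersetCard,
    Finset.card_univ, Fintype.card_fin, nsmul_eq_mul, nsmul_eq_mul] at hs
  have hcp : (n.choose j : ℝ) ≤ n ^ j := by exact_mod_cast Nat.choose_le_pow n j
  have e1 : (n.choose j : ℝ) * (j * n * (exp ((j + 1) * pm * ((j + 1) + (j + 1) * k)) *
      (H * I.toReal ^ (j - 1)))) ≤ j * exp ((j + 1) * pm * ((j + 1) + (j + 1) * k)) *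
      ((n ^ 2 * H) * (n * I.toReal) ^ (j - 1)) := by
    rcases j with _ | j
    · simp
    · refine (mul_le_mul_of_nonneg_right hcp (by positivity)).trans (le_of_eq ?_)
      simp only [Nat.add_sub_cancel]
      ring
  have e2 : (n.choose j : ℝ) * ((j * j - j : ℕ) * (K * I.toReal ^ (j - 2))) ≤
      (j * j - j : ℕ) * ((n ^ 2 * K) * (n * I.toReal) ^ (j - 2)) := by
    rcases j with _ | _ | j
    · simp
    · simp
    · refine (mul_le_mul_of_nonneg_right hcp (by positivity)).trans (le_of_eq ?_)
      have : j + 1 + 1 - 2 = j := by omega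
      rw [this]
      ring
  have e3 : leadMoment μ k n r j = ∑ T ∈ Finset.powersetCard j (Finset.univ : Finset (Fin n)),
    (Measure.pi fun _ : Fin n => μ).real {X | ∀ i ∈ T, LeadLow k r X i} := rfl
  rw [e3]
  nlinarith [hs, e1, e2]

/-- Poisson limit theorem: the probability that no point has low degree. -/
theorem tendsto_pi_no_lowDeg {r pm H K : ℕ → ℝ} {lam : ℝ} {h : ℕ → E → E → ℝ≥0∞}
    (hr : ∀ n, 0 ≤ r n) (hpm : ∀ n x, μ.real (closedBall x (r n)) ≤ pm n)
    (hpm0 : Tendsto pm atTop (𝓝 0)) (hpm2 : Tendsto (fun n => n * pm n ^ 2) atTop (𝓝 0))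
    (hlam : Tendsto (fun n : ℕ => n * (∫⁻ x, lowDensity μ k n (r n) x ∂μ).toReal) atTop (𝓝 lam))
    (hH0 : ∀ n, 0 ≤ H n) (hK0 : ∀ n, 0 ≤ K n)
    (hm : ∀ n, Measurable (Function.uncurry (h n)))
    (hh : ∀ᶠ n in atTop, PairBound μ k n (r n) (h n))
    (hH : ∀ᶠ n in atTop, ∫⁻ x, ∫⁻ y, h n x y ∂μ ∂μ ≤ ENNReal.ofReal (H n))
    (hK : ∀ᶠ n in atTop, closePairs μ k n (r n) ≤ ENNReal.ofReal (K n))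
    (hHt : Tendsto (fun n : ℕ => n ^ 2 * H n) atTop (𝓝 0))
    (hKt : Tendsto (fun n : ℕ => n ^ 2 * K n) atTop (𝓝 0)) :
    Tendsto (fun n => (Measure.pi fun _ : Fin n => μ).real {X | ∀ i, ¬ LowDeg k (r n) X i}) atTop
      (𝓝 (exp (-lam))) := by
  refine tendsto_exp_neg_of_binomial_moments _ (fun n j => leadMoment μ k n (r n) j) lam
    (fun n J => leadLow_bonferroni μ k n (r n) J) fun j => ?_
  have hch := ProbabilityTheory.tendsto_choose_mul_pow_atTop j hlam
  have hup : Tendsto (fun n => exp (j * pm n * (j + j * k)) *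
      (n.choose j * (∫⁻ x, lowDensity μ k n (r n) x ∂μ).toReal ^ j)) atTop
      (𝓝 (lam ^ j / (j.factorial : ℝ))) := by
    have : Tendsto (fun n => exp (j * pm n * (j + j * k))) atTop (𝓝 1) := by
      have := ((hpm0.const_mul (j : ℝ)).mul_const ((j : ℝ) + j * k)).rexp
      simpa using this
    simpa using this.mul hch
  have hfrac : Tendsto (fun n : ℕ => ((n - ((j + 1) * k + j) : ℕ) / n : ℝ)) atTop (𝓝 1) := by
    have h1 : Tendsto (fun n : ℕ => 1 - (((j + 1) * k + j : ℕ) : ℝ) / n) atTop (𝓝 1) := by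
      simpa using (tendsto_const_nhds (x := (1 : ℝ))).sub
        (tendsto_const_div_atTop_nhds_zero_nat (((j + 1) * k + j : ℕ) : ℝ))
    refine h1.congr' ?_
    filter_upwards [eventually_ge_atTop ((j + 1) * k + j), eventually_gt_atTop 0] with n hn hn0
    have : (n : ℝ) ≠ 0 := by positivity
    rw [Nat.cast_sub hn]; field_simp
  have hlow1 : Tendsto (fun n : ℕ => exp (-(n * (j * pm n) ^ 2)) *
      ((n - ((j + 1) * k + j) : ℕ) / n : ℝ) ^ (k * j) *
      (n.choose j * (∫⁻ x, lowDensity μ k n (r n) x ∂μ).toReal ^ j)) atTop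
      (𝓝 (lam ^ j / (j.factorial : ℝ))) := by
    have h1 : Tendsto (fun n : ℕ => exp (-(n * (j * pm n) ^ 2))) atTop (𝓝 1) := by
      have := ((hpm2.const_mul ((j : ℝ) ^ 2)).neg).rexp
      simp only [mul_zero, neg_zero, exp_zero] at this
      refine this.congr fun n => ?_
      congr 1; ring
    simpa using (h1.mul (hfrac.pow (k * j))).mul hch
  have hE1 : Tendsto (fun n : ℕ => j * exp ((j + 1) * pm n * ((j + 1) + (j + 1) * k)) *
      ((n ^ 2 * H n) * (n * (∫⁻ x, lowDensity μ k n (r n) x ∂μ).toReal) ^ (j - 1))) atTop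
      (𝓝 0) := by
    have h1 : Tendsto (fun n => exp ((j + 1) * pm n * ((j + 1) + (j + 1) * k))) atTop (𝓝 1) := by
      have := ((hpm0.const_mul (j + 1 : ℝ)).mul_const ((j + 1 : ℝ) + (j + 1) * k)).rexp
      simpa using this
    simpa using (h1.const_mul (j : ℝ)).mul (hHt.mul (hlam.pow (j - 1)))
  have hE2 : Tendsto (fun n : ℕ => ((j * j - j : ℕ) : ℝ) *
      ((n ^ 2 * K n) * (n * (∫⁻ x, lowDensity μ k n (r n) x ∂μ).toReal) ^ (j - 2))) atTop
      (𝓝 0) := by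
    simpa using (hKt.mul (hlam.pow (j - 2))).const_mul ((j * j - j : ℕ) : ℝ)
  have hlow := (hlow1.sub hE1).sub hE2
  simp only [sub_zero] at hlow
  refine tendsto_of_tendsto_of_tendsto_of_le_of_le' hlow hup ?_
    (Eventually.of_forall fun n => leadMoment_le μ k (hpm n) j)
  have hP0 : ∀ᶠ n in atTop, j * pm n ≤ 1 / 2 := by
    have := hpm0.const_mul (j : ℝ)
    rw [mul_zero] at this
    exact this.eventually_le_const (by norm_num)
  filter_upwards [hP0, hh, hH, hK, eventually_ge_atTop ((j + 1) * k + j)] with n h1 h2 h3 h4 h5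
  have := le_leadMoment μ k (hr n) (hpm n) j (n - ((j + 1) * k + j)) (by omega) h1 (hm n) h2
    (hH0 n) (hK0 n) h3 h4
  linarith

end

open scoped Pointwise in
lemma volume_similarity (a ν : ℂ) (hν : ‖ν‖ = 1) (r : ℝ) (s : Set ℂ) :
    volume ((fun z : ℂ => a + r * (ν * z)) '' s) = ENNReal.ofReal (r ^ 2) * volume s := by
  have e : (fun z : ℂ => a + r * (ν * z)) '' s =
      (fun z => a + z) '' (r • ((fun z => ν * z) '' s)) := by
    rw [← Set.image_smul, Set.image_image, Set.image_image]
    simp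
  rw [e, Set.image_add_left, measure_preimage_add, Measure.addHaar_smul]
  · rw [Complex.finrank_real_complex, abs_of_nonneg (by positivity)]
    congr 1
    let c : Circle := ⟨ν, by simp [Submonoid.unitSphere, hν]⟩
    have h2 : (fun z => ν * z) '' s = rotation c '' s := by
      exact Set.image_congr fun z _ => (rotation_apply c z).symm
    rw [h2, LinearIsometryEquiv.image_eq_preimage_symm]
    exact (rotation c).symm.measurePreserving.measure_preimage_emb
      (rotation c).symm.toMeasurableEquiv.measurableEmbedding _

lemma volume_image_add_smul (a : ℂ) (r : ℝ) (s : Set ℂ) :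
    volume ((fun z : ℂ => a + r * z) '' s) = ENNReal.ofReal (r ^ 2) * volume s := by
  simpa using volume_similarity a 1 (by simp) r s

lemma volume_reProdIm (s t : Set ℝ) :
    volume (s ×ℂ t) = volume s * volume t := by
  have h : s ×ℂ t = Complex.measurableEquivRealProd ⁻¹' (s ×ˢ t) := by
    ext z; simp [Complex.mem_reProdIm]
  rw [h, Complex.volume_preserving_equiv_real_prod.measure_preimage_equiv, Measure.volume_eq_prod,
    Measure.prod_prod]

/-- A planar convex body of unit area around the origin. -/
structure UnitBody (Ω : Set ℂ) (ρ R : ℝ) : Prop where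
  convex : Convex ℝ Ω
  isCompact : IsCompact Ω
  volume_eq : volume Ω = 1
  pos : 0 < ρ
  ball_subset : closedBall 0 ρ ⊆ Ω
  subset_ball : Ω ⊆ closedBall 0 R

namespace UnitBody
variable {Ω : Set ℂ} {ρ R : ℝ}

lemma le (h : UnitBody Ω ρ R) : ρ ≤ R := by
  have : (ρ : ℂ) ∈ closedBall (0 : ℂ) R := h.subset_ball (h.ball_subset (by simp [abs_of_pos h.pos]))
  simpa [abs_of_pos h.pos] using this

lemma R_pos (h : UnitBody Ω ρ R) : 0 < R := h.pos.trans_le h.le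

lemma zero_mem (h : UnitBody Ω ρ R) : (0 : ℂ) ∈ Ω := h.ball_subset (by simp [h.pos.le])

lemma mem_nhds (h : UnitBody Ω ρ R) : Ω ∈ 𝓝 (0 : ℂ) :=
  mem_of_superset (closedBall_mem_nhds _ h.pos) h.ball_subset

lemma absorbent (h : UnitBody Ω ρ R) : Absorbent ℝ Ω := absorbent_nhds_zero h.mem_nhds

lemma gauge_add_le (h : UnitBody Ω ρ R) (x y : ℂ) : gauge Ω (x + y) ≤ gauge Ω x + gauge Ω y :=
  _root_.gauge_add_le h.convex h.absorbent x y

lemma gauge_smul (_h : UnitBody Ω ρ R) {s : ℝ} (hs : 0 ≤ s) (x : ℂ) :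
    gauge Ω (s * x) = s * gauge Ω x := by
  have := gauge_smul_of_nonneg (s := Ω) hs x
  simpa using this

lemma gauge_le_one_iff (h : UnitBody Ω ρ R) {x : ℂ} : gauge Ω x ≤ 1 ↔ x ∈ Ω := by
  rw [gauge_le_one_iff_mem_closure h.convex h.mem_nhds, h.isCompact.isClosed.closure_eq]

lemma gauge_le (h : UnitBody Ω ρ R) (x : ℂ) : gauge Ω x ≤ ‖x‖ / ρ := by
  rw [le_div_iff₀ h.pos, mul_comm]
  exact mul_gauge_le_norm (ball_subset_closedBall.trans h.ball_subset)

lemma le_gauge (h : UnitBody Ω ρ R) (x : ℂ) : ‖x‖ / R ≤ gauge Ω x :=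
  le_gauge_of_subset_closedBall h.absorbent h.R_pos.le h.subset_ball

lemma gauge_sub_le (h : UnitBody Ω ρ R) (x y : ℂ) : gauge Ω x - gauge Ω y ≤ ‖x - y‖ / ρ := by
  have := h.gauge_add_le y (x - y)
  rw [add_sub_cancel] at this
  linarith [h.gauge_le (x - y)]

lemma abs_gauge_sub_le (h : UnitBody Ω ρ R) (x y : ℂ) : |gauge Ω x - gauge Ω y| ≤ ‖x - y‖ / ρ := by
  rw [abs_le]
  have := h.gauge_sub_le y x
  rw [norm_sub_rev] at this
  exact ⟨by linarith, h.gauge_sub_le x y⟩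

lemma lipschitz (h : UnitBody Ω ρ R) : LipschitzWith (⟨ρ, h.pos.le⟩ : NNReal)⁻¹ (gauge Ω) :=
  h.convex.lipschitzWith_gauge h.pos (ball_subset_closedBall.trans h.ball_subset)

lemma continuous_gauge (h : UnitBody Ω ρ R) : Continuous (gauge Ω) := h.lipschitz.continuous

lemma measurable_gauge (h : UnitBody Ω ρ R) : Measurable (gauge Ω) := h.continuous_gauge.measurable

lemma gauge_le_eq_image (h : UnitBody Ω ρ R) {s : ℝ} (hs : 0 < s) :
    {x | gauge Ω x ≤ s} = (fun z : ℂ => 0 + s * z) '' Ω := by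
  ext x
  constructor
  · intro hx
    refine ⟨((s⁻¹ : ℝ) : ℂ) * x, ?_, ?_⟩
    · rw [← h.gauge_le_one_iff, h.gauge_smul (by positivity), inv_mul_le_iff₀ hs, mul_one]; exact hx
    · have : (s : ℂ) ≠ 0 := by exact_mod_cast hs.ne'
      push_cast; field_simp; simp
  · rintro ⟨z, hz, rfl⟩
    show gauge Ω (0 + s * z) ≤ s
    rw [zero_add, h.gauge_smul hs.le]
    exact mul_le_of_le_one_right hs.le (h.gauge_le_one_iff.2 hz)

lemma volume_gauge_le (h : UnitBody Ω ρ R) {s : ℝ} (hs : 0 < s) :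
    volume {x | gauge Ω x ≤ s} = ENNReal.ofReal (s ^ 2) := by
  rw [h.gauge_le_eq_image hs, volume_image_add_smul 0 s, h.volume_eq, mul_one]

lemma measurableSet (h : UnitBody Ω ρ R) : MeasurableSet Ω := h.isCompact.measurableSet

lemma isProbabilityMeasure (h : UnitBody Ω ρ R) : IsProbabilityMeasure (volume.restrict Ω) :=
  ⟨by simp [h.volume_eq]⟩

lemma volume_ne_top (h : UnitBody Ω ρ R) (s : Set ℂ) : volume (Ω ∩ s) ≠ ⊤ :=
  ne_top_of_le_ne_top (by rw [h.volume_eq]; simp) (measure_mono Set.inter_subset_left)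

lemma norm_le (h : UnitBody Ω ρ R) {x : ℂ} (hx : x ∈ Ω) : ‖x‖ ≤ R := by simpa using h.subset_ball hx

/-- Contracting a piece of the body towards one of its points. -/
lemma contract_mem (h : UnitBody Ω ρ R) {x p : ℂ} (hx : x ∈ Ω) (hp : p ∈ Ω) {s : ℝ} (hs : 0 ≤ s)
    (hs1 : s ≤ 1) : x + s * (p - x) ∈ Ω := by
  have := h.convex hx hp (sub_nonneg.2 hs1) hs (by ring)
  simp only [Complex.real_smul] at this
  convert this using 1
  push_cast; ring

lemma dist_contract_le (h : UnitBody Ω ρ R) {x p : ℂ} (hx : x ∈ Ω) (hp : p ∈ Ω) {s : ℝ}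
    (hs : 0 ≤ s) : dist (x + s * (p - x)) x ≤ s * (2 * R) := by
  rw [dist_eq_norm, add_sub_cancel_left, norm_mul, Complex.norm_real, Real.norm_of_nonneg hs]
  gcongr
  exact (norm_sub_le _ _).trans (by linarith [h.norm_le hx, h.norm_le hp])

lemma contract_volume (_h : UnitBody Ω ρ R) (x : ℂ) (s : ℝ) (A : Set ℂ) :
    volume ((fun p => x + s * (p - x)) '' A) = ENNReal.ofReal (s ^ 2) * volume A := by
  have : (fun p : ℂ => x + s * (p - x)) = fun p : ℂ => (x - s * x) + s * p := by
    ext p; ring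
  rw [this, volume_image_add_smul]

/-- Area of the part of the body within `r` of `x`. -/
noncomputable def _root_.ballArea (Ω : Set ℂ) (r : ℝ) (x : ℂ) : ℝ :=
  (volume.restrict Ω).real (closedBall x r)

lemma real_eq (_h : UnitBody Ω ρ R) {s : Set ℂ} (hs : MeasurableSet s) :
    (volume.restrict Ω).real s = (volume (Ω ∩ s)).toReal := by
  rw [measureReal_restrict_apply hs, Measure.real, Set.inter_comm]

lemma le_real (h : UnitBody Ω ρ R) {s t : Set ℂ} (hs : MeasurableSet s) (ht : t ⊆ Ω ∩ s) :
    (volume t).toReal ≤ (volume.restrict Ω).real s := by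
  rw [h.real_eq hs]
  exact ENNReal.toReal_mono (h.volume_ne_top s) (measure_mono ht)

lemma real_le (h : UnitBody Ω ρ R) {s t : Set ℂ} (hs : MeasurableSet s) (ht : Ω ∩ s ⊆ t)
    (htop : volume t ≠ ⊤) : (volume.restrict Ω).real s ≤ (volume t).toReal := by
  rw [h.real_eq hs]
  exact ENNReal.toReal_mono htop (measure_mono ht)

lemma le_ballArea (h : UnitBody Ω ρ R) {x : ℂ} (hx : x ∈ Ω) {r : ℝ} (hr : 0 ≤ r) (hr1 : r ≤ 2 * R) :
    r ^ 2 / (4 * R ^ 2) ≤ ballArea Ω r x := by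
  have hR := h.R_pos
  have hs : 0 ≤ r / (2 * R) := by positivity
  have hs1 : r / (2 * R) ≤ 1 := by rw [div_le_one (by positivity)]; exact hr1
  have := h.le_real (s := closedBall x r)
    (t := (fun p => x + (r / (2 * R) : ℝ) * (p - x)) '' Ω) measurableSet_closedBall (by
      rintro _ ⟨p, hp, rfl⟩
      refine ⟨h.contract_mem hx hp hs hs1, ?_⟩
      rw [mem_closedBall]
      refine (h.dist_contract_le hx hp hs).trans (le_of_eq ?_)
      field_simp)
  rw [h.contract_volume x, h.volume_eq, mul_one, ENNReal.toReal_ofReal (by positivity)] at this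
  refine le_trans (le_of_eq ?_) this
  field_simp; norm_num

lemma ballArea_le (h : UnitBody Ω ρ R) (x : ℂ) {r : ℝ} (hr : 0 ≤ r) : ballArea Ω r x ≤ π * r ^ 2 := by
  have := h.real_le (s := closedBall x r) measurableSet_closedBall Set.inter_subset_right
    (by rw [Complex.volume_closedBall]; finiteness)
  rw [Complex.volume_closedBall] at this
  refine this.trans (le_of_eq ?_)
  rw [ENNReal.toReal_mul, ENNReal.toReal_pow, ENNReal.toReal_ofReal hr, ENNReal.coe_toReal,
    NNReal.coe_real_pi]
  ring

lemma ballArea_nonneg (Ω : Set ℂ) (r : ℝ) (x : ℂ) : 0 ≤ ballArea Ω r x := measureReal_nonneg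

end UnitBody

/-- The unit disc cut by a vertical line at signed distance `u` from the centre. -/
def discCap (u : ℝ) : Set ℂ := {z | z ∈ closedBall (0 : ℂ) 1 ∧ -u ≤ z.re}

/-- The area of `discCap u`. -/
noncomputable def capArea (u : ℝ) : ℝ := (volume (discCap u)).toReal

lemma measurableSet_discCap (u : ℝ) : MeasurableSet (discCap u) :=
  measurableSet_closedBall.inter (measurableSet_le measurable_const Complex.measurable_re)

lemma volume_discCap_le (u : ℝ) : volume (discCap u) ≤ ENNReal.ofReal π := by
  refine (measure_mono fun z hz => hz.1).trans (le_of_eq (b := ENNReal.ofReal π) ?_)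
  rw [Complex.volume_closedBall]
  simp [ENNReal.ofReal, NNReal.pi, Real.toNNReal_of_nonneg pi_pos.le]
  rfl

lemma volume_discCap_ne_top (u : ℝ) : volume (discCap u) ≠ ⊤ :=
  ne_top_of_le_ne_top ENNReal.ofReal_ne_top (volume_discCap_le u)

lemma capArea_mono : Monotone capArea := fun _ _ h =>
  ENNReal.toReal_mono (volume_discCap_ne_top _) (measure_mono fun _ hz => ⟨hz.1, by linarith [hz.2]⟩)

lemma capArea_sub_le {u v : ℝ} (h : u ≤ v) : capArea v ≤ capArea u + 2 * (v - u) := by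
  have hsub : discCap v ⊆ discCap u ∪ (Set.Icc (-v) (-u) ×ℂ Set.Icc (-1) 1) := by
    intro z hz
    by_cases hzu : -u ≤ z.re
    · exact Or.inl ⟨hz.1, hzu⟩
    · refine Or.inr ⟨⟨hz.2, (not_le.1 hzu).le⟩, ?_⟩
      have : |z.im| ≤ 1 := (Complex.abs_im_le_norm z).trans (by simpa using hz.1)
      exact abs_le.1 this
  have h2 : volume (discCap v) ≤ volume (discCap u) + ENNReal.ofReal (2 * (v - u)) := by
    refine (measure_mono hsub).trans ((measure_union_le _ _).trans ?_)
    gcongr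
    rw [volume_reProdIm, Real.volume_Icc, Real.volume_Icc, ← ENNReal.ofReal_mul (by linarith)]
    apply ENNReal.ofReal_le_ofReal; linarith
  have h3 := ENNReal.toReal_mono (by
    exact ENNReal.add_ne_top.2 ⟨volume_discCap_ne_top u, ENNReal.ofReal_ne_top⟩) h2
  rwa [ENNReal.toReal_add (volume_discCap_ne_top u) ENNReal.ofReal_ne_top,
    ENNReal.toReal_ofReal (by linarith)] at h3

lemma continuous_capArea : Continuous capArea := by
  have : LipschitzWith 2 capArea := by
    refine LipschitzWith.of_le_add_mul 2 fun x y => ?_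
    rcases le_total x y with h | h
    · have := capArea_mono h
      have h2 : 0 ≤ dist x y := dist_nonneg
      simp only [NNReal.coe_ofNat]; linarith
    · have := capArea_sub_le h
      rw [Real.dist_eq, abs_of_nonneg (by linarith)]; simpa using this
  exact this.continuous

lemma capArea_zero : capArea 0 = π / 2 := by
  have h1 : volume (discCap 0) = volume ((fun z : ℂ => -z) ⁻¹' discCap 0) :=
    ((Measure.measurePreserving_neg (volume : Measure ℂ)).measure_preimage
      (measurableSet_discCap 0).nullMeasurableSet).symm
  have h0 : volume {z : ℂ | z.re = 0} = 0 := by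
    have : {z : ℂ | z.re = 0} = ({0} : Set ℝ) ×ℂ Set.univ := by
      ext z; simp [Complex.mem_reProdIm]
    rw [this, volume_reProdIm]; simp
  have h2 : volume (discCap 0 ∪ (fun z : ℂ => -z) ⁻¹' discCap 0) =
      volume (discCap 0) + volume ((fun z : ℂ => -z) ⁻¹' discCap 0) := by
    refine measure_union₀ ((measurableSet_discCap 0).preimage measurable_neg).nullMeasurableSet ?_
    refine measure_mono_null (fun z hz => ?_) h0
    have a := hz.1.2
    have b := hz.2.2
    simp only [Complex.neg_re] at a b
    show z.re = 0
    linarith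
  have h3 : discCap 0 ∪ (fun z : ℂ => -z) ⁻¹' discCap 0 = closedBall 0 1 := by
    ext z
    simp only [discCap, Set.mem_union, Set.mem_preimage, Set.mem_ofPred_eq, mem_closedBall,
      dist_zero_right, norm_neg, Complex.neg_re, neg_zero]
    constructor
    · rintro (h | h) <;> exact h.1
    · intro h
      rcases le_total 0 z.re with h' | h'
      · exact Or.inl ⟨h, h'⟩
      · exact Or.inr ⟨h, by linarith⟩
  rw [h3, ← h1, Complex.volume_closedBall] at h2
  have h4 := congrArg ENNReal.toReal h2
  rw [ENNReal.toReal_add (volume_discCap_ne_top 0) (volume_discCap_ne_top 0)] at h4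
  simp only [ENNReal.ofReal_one, one_pow, one_mul, ENNReal.coe_toReal, NNReal.coe_real_pi] at h4
  unfold capArea
  linarith

lemma capArea_upper {u : ℝ} (hu : 0 ≤ u) : capArea u ≤ π / 2 + 2 * u := by
  have := capArea_sub_le hu
  rw [capArea_zero] at this; linarith

lemma le_capArea {u : ℝ} (hu : 0 ≤ u) (hu1 : u ≤ 1) :
    π / 2 + 2 * u * √(1 - u ^ 2) ≤ capArea u := by
  set b := √(1 - u ^ 2)
  have hb : 0 ≤ b := Real.sqrt_nonneg _
  have hb2 : b ^ 2 = 1 - u ^ 2 := Real.sq_sqrt (by nlinarith)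
  have hsub : discCap 0 ∪ (Set.Ico (-u) 0 ×ℂ Set.Icc (-b) b) ⊆ discCap u := by
    rintro z (hz | hz)
    · exact ⟨hz.1, by have := hz.2; linarith⟩
    · obtain ⟨⟨h1, h2⟩, h3, h4⟩ := hz
      change -u ≤ z.re at h1
      change z.re < 0 at h2
      change -b ≤ z.im at h3
      change z.im ≤ b at h4
      refine ⟨?_, h1⟩
      rw [mem_closedBall, dist_zero_right, ← sq_le_one_iff₀ (norm_nonneg _), Complex.sq_norm,
        Complex.normSq_apply]
      nlinarith
  have hd : Disjoint (discCap 0) (Set.Ico (-u) 0 ×ℂ Set.Icc (-b) b) := by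
    rw [Set.disjoint_left]
    intro z h1 h2
    have a := h1.2
    have c : z.re < 0 := h2.1.2
    linarith
  have h := measure_mono (μ := volume) hsub
  rw [measure_union' hd (measurableSet_discCap 0), volume_reProdIm, Real.volume_Ico, Real.volume_Icc,
    ← ENNReal.ofReal_mul (by linarith)] at h
  have h3 := ENNReal.toReal_mono (volume_discCap_ne_top u) h
  rw [ENNReal.toReal_add (volume_discCap_ne_top 0) ENNReal.ofReal_ne_top,
    ENNReal.toReal_ofReal (by nlinarith)] at h3
  have := capArea_zero
  unfold capArea at this ⊢
  linarith

lemma capArea_linear_le {u : ℝ} (hu : 0 ≤ u) : π / 2 + min u (1 / 2) ≤ capArea u := by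
  set v := min u (1 / 2)
  have hv0 : 0 ≤ v := le_min hu (by norm_num)
  have hv : v ≤ 1 / 2 := min_le_right _ _
  have h1 := le_capArea hv0 (by linarith)
  have h2 : (1 : ℝ) / 2 ≤ √(1 - v ^ 2) := Real.le_sqrt_of_sq_le (by nlinarith)
  have := capArea_mono (min_le_left u (1 / 2))
  nlinarith

lemma volume_cap (a ν : ℂ) (hν : ‖ν‖ = 1) {r : ℝ} (hr : 0 < r) (τ : ℝ) :
    volume {p | p ∈ closedBall a r ∧ -τ ≤ inner ℝ ν (p - a)} =
      ENNReal.ofReal (r ^ 2) * volume (discCap (τ / r)) := by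
  rw [← volume_similarity a ν hν r]
  congr 1
  have hνc : (starRingEnd ℂ) ν * ν = 1 := by
    rw [mul_comm, Complex.mul_conj, Complex.normSq_eq_norm_sq, hν]; simp
  have hr' : (r : ℂ) ≠ 0 := by exact_mod_cast hr.ne'
  ext p
  constructor
  · rintro ⟨h1, h2⟩
    refine ⟨(starRingEnd ℂ) ν * (p - a) / r, ⟨?_, ?_⟩, ?_⟩
    · rw [mem_closedBall, dist_zero_right, norm_div, norm_mul, RCLike.norm_conj, hν, one_mul,
        Complex.norm_real, Real.norm_of_nonneg hr.le, div_le_one hr, ← dist_eq_norm]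
      exact h1
    · rw [Complex.inner, mul_comm] at h2
      rw [Complex.div_ofReal_re, ← neg_div]
      exact div_le_div_of_nonneg_right h2 hr.le
    · show a + r * (ν * ((starRingEnd ℂ) ν * (p - a) / r)) = p
      have : (r : ℂ) * (ν * ((starRingEnd ℂ) ν * (p - a) / r)) =
        ((starRingEnd ℂ) ν * ν) * (p - a) * (r / r) := by ring
      rw [this, hνc, div_self hr']; ring
  · rintro ⟨z, ⟨h1, h2⟩, rfl⟩
    refine ⟨?_, ?_⟩
    · rw [mem_closedBall, dist_eq_norm]
      simp only [add_sub_cancel_left, norm_mul, hν, one_mul, Complex.norm_real, Real.norm_eq_abs,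
        abs_of_pos hr]
      have : ‖z‖ ≤ 1 := by simpa using h1
      nlinarith
    · rw [Complex.inner]
      have : (a + r * (ν * z) - a) * (starRingEnd ℂ) ν = (r : ℂ) * z * ((starRingEnd ℂ) ν * ν) := by
        ring
      rw [this, hνc, mul_one, Complex.re_ofReal_mul]
      rw [← neg_div, div_le_iff₀ hr] at h2
      linarith

/-- Within distance `σ` of `a`, the set is a half-plane with inner normal `ν`, up to an error `η`. -/
structure FlatAt (Ω : Set ℂ) (σ η : ℝ) (a ν : ℂ) (τ : ℝ) : Prop where
  unit : ‖ν‖ = 1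
  outer : ∀ p ∈ Ω, p ∈ closedBall a σ → -τ ≤ inner ℝ ν (p - a)
  mem : ∀ p ∈ closedBall a σ, -τ + η ≤ inner ℝ ν (p - a) → p ∈ Ω

lemma inner_cone {e ν w : ℂ} (he : ‖e‖ = 1) (hν : ‖ν‖ = 1) (h1 : 7 / 10 ≤ inner ℝ e ν)
    (h2 : 99 / 100 * ‖w‖ ≤ inner ℝ e w) : ‖w‖ / 2 ≤ inner ℝ ν w := by
  have h3 : ‖w - ‖w‖ • e‖ ≤ 1 / 5 * ‖w‖ := by
    refine abs_le_of_sq_le_sq' ?_ (by positivity) |>.2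
    rw [norm_sub_sq_real, norm_smul, he, inner_smul_right, real_inner_comm, norm_norm]
    nlinarith [norm_nonneg w]
  have h4 : inner ℝ ν w = ‖w‖ * inner ℝ e ν + inner ℝ ν (w - ‖w‖ • e) := by
    rw [inner_sub_right, inner_smul_right, real_inner_comm e ν]; ring
  have h5 := (abs_le.1 (abs_real_inner_le_norm ν (w - ‖w‖ • e))).1
  rw [hν, one_mul] at h5
  nlinarith [norm_nonneg w]

/-- A narrow cone around the positive real axis. -/
def narrowCone (s : ℝ) : Set ℂ := {z | z ∈ closedBall (0 : ℂ) s ∧ 99 / 100 * ‖z‖ ≤ z.re}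

lemma measurableSet_narrowCone (s : ℝ) : MeasurableSet (narrowCone s) :=
  measurableSet_closedBall.inter
    (measurableSet_le (measurable_norm.const_mul _) Complex.measurable_re)

lemma volume_narrowCone_ne_top (s : ℝ) : volume (narrowCone s) ≠ ⊤ :=
  ne_top_of_le_ne_top (by rw [Complex.volume_closedBall]; finiteness)
    (measure_mono (t := closedBall (0 : ℂ) s) fun _ hz => hz.1)

/-- The area of the unit narrow cone. -/
noncomputable def coneConst : ℝ := (volume (narrowCone 1)).toReal

lemma coneConst_pos : 0 < coneConst := by
  refine ENNReal.toReal_pos (ne_of_gt ?_) (volume_narrowCone_ne_top 1)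
  refine MeasureTheory.Measure.measure_pos_of_mem_nhds volume (x := (1 / 2 : ℂ)) ?_
  have h1 : ∀ᶠ z : ℂ in 𝓝 (1 / 2), ‖z‖ < 1 :=
    continuous_norm.continuousAt.eventually_lt_const (by norm_num)
  have h2 : ∀ᶠ z : ℂ in 𝓝 (1 / 2), 99 / 100 * ‖z‖ < z.re :=
    (continuous_const.mul continuous_norm).continuousAt.eventually_lt
      Complex.continuous_re.continuousAt (by norm_num)
  filter_upwards [h1, h2] with z hz1 hz2
  exact ⟨by simpa using hz1.le, hz2.le⟩

lemma volume_narrowCone {s : ℝ} (hs : 0 < s) :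
    (volume (narrowCone s)).toReal = s ^ 2 * coneConst := by
  have : narrowCone s = (fun z : ℂ => 0 + s * z) '' narrowCone 1 := by
    have hs' : (s : ℂ) ≠ 0 := by exact_mod_cast hs.ne'
    ext z
    constructor
    · rintro ⟨h1, h2⟩
      have hn : ‖z‖ ≤ s := by simpa using h1
      refine ⟨z / s, ⟨?_, ?_⟩, ?_⟩
      · simp only [mem_closedBall, dist_zero_right, norm_div, Complex.norm_real, Real.norm_eq_abs,
          abs_of_pos hs]
        rwa [div_le_one hs]
      · rw [norm_div, Complex.norm_real, Real.norm_eq_abs, abs_of_pos hs, Complex.div_ofReal_re,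
          ← mul_div_assoc]
        exact div_le_div_of_nonneg_right h2 hs.le
      · simp only [zero_add]; field_simp
    · rintro ⟨z, ⟨h1, h2⟩, rfl⟩
      have hn : ‖z‖ ≤ 1 := by simpa using h1
      refine ⟨?_, ?_⟩
      · simp only [mem_closedBall, dist_zero_right, zero_add, norm_mul, Complex.norm_real,
          Real.norm_eq_abs, abs_of_pos hs]
        nlinarith
      · simp only [zero_add, norm_mul, Complex.norm_real, Real.norm_eq_abs, abs_of_pos hs,
          Complex.re_ofReal_mul]
        nlinarith
  rw [this, volume_image_add_smul, ENNReal.toReal_mul, ENNReal.toReal_ofReal (by positivity)]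
  rfl

lemma inner_mul_left_unit {e : ℂ} (he : ‖e‖ = 1) (z : ℂ) : inner ℝ e (e * z) = z.re := by
  rw [Complex.inner]
  have : e * z * (starRingEnd ℂ) e = (e * (starRingEnd ℂ) e) * z := by ring
  rw [this, Complex.mul_conj, Complex.normSq_eq_norm_sq, he]; simp

namespace UnitBody
variable {Ω : Set ℂ} {ρ R : ℝ}

/-- The higher of two points sees an additional crescent of the body. -/
lemma crescent_area (h : UnitBody Ω ρ R) {a ν : ℂ} {r σ η τ : ℝ} (hf : FlatAt Ω σ η a ν τ)
    (hr : 0 < r) (hσ : 4 * r ≤ σ) (hη : η ≤ r / 4) {p q : ℂ} (hq : q ∈ Ω)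
    (hqa : dist q a ≤ 2 * r) (hpq : dist q p ≤ 2 * r) (hne : p ≠ q)
    (ho : 0 ≤ inner ℝ ν (q - p)) :
    coneConst * r * dist q p / 4 ≤
      (volume.restrict Ω).real (closedBall q r \ closedBall p r) := by
  set d := dist q p with hd
  have hd0 : 0 < d := dist_pos.2 hne.symm
  have hdn : ‖q - p‖ = d := (dist_eq_norm q p).symm
  set u : ℂ := (1 / d : ℝ) • (q - p) with hu
  have hu1 : ‖u‖ = 1 := by
    rw [hu, norm_smul, hdn, Real.norm_of_nonneg (by positivity)]; field_simp
  have huν : 0 ≤ inner ℝ u ν := by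
    rw [hu, real_inner_smul_left, real_inner_comm]; positivity
  have hN2 : ‖u + ν‖ ^ 2 = 2 + 2 * inner ℝ u ν := by
    rw [norm_add_sq_real, hu1, hf.unit]; ring
  have hNpos : 14 / 10 ≤ ‖u + ν‖ := by
    refine abs_le_of_sq_le_sq' (by nlinarith) (norm_nonneg _) |>.2
  have hN0 : 0 < ‖u + ν‖ := by linarith
  set e : ℂ := (1 / ‖u + ν‖ : ℝ) • (u + ν) with he
  have he1 : ‖e‖ = 1 := by
    rw [he, norm_smul, Real.norm_of_nonneg (by positivity)]; field_simp
  have heν : 7 / 10 ≤ inner ℝ e ν := by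
    rw [he, real_inner_smul_left, inner_add_left, real_inner_self_eq_norm_sq, hf.unit, one_div,
      inv_mul_eq_div, le_div_iff₀ hN0]
    nlinarith
  have heu : 7 / 10 ≤ inner ℝ e u := by
    rw [he, real_inner_smul_left, inner_add_left, real_inner_self_eq_norm_sq, hu1, one_div,
      inv_mul_eq_div, le_div_iff₀ hN0, real_inner_comm u ν]
    nlinarith
  set κ := min d r / 2 with hκ
  have hκ0 : 0 < κ := by positivity
  have hκr : κ ≤ r / 2 := by rw [hκ]; linarith [min_le_right d r]
  have hκd : κ ≤ d / 2 := by rw [hκ]; linarith [min_le_left d r]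
  have hκd4 : d / 4 ≤ κ := by
    rw [hκ]
    have : d / 2 ≤ min d r := le_min (by linarith) (by linarith)
    linarith
  have hκcase : κ = d / 2 ∨ κ = r / 2 ∧ r ≤ d := by
    rcases le_total d r with hh | hh
    · left; rw [hκ, min_eq_left hh]
    · right; rw [hκ, min_eq_right hh]; exact ⟨rfl, hh⟩
  have key := h.le_real (s := closedBall q r \ closedBall p r)
    (t := (fun z : ℂ => q + (1 : ℝ) * (e * z)) '' (narrowCone r \ narrowCone (r - κ)))
    (measurableSet_closedBall.diff measurableSet_closedBall) (by
      rintro _ ⟨z, ⟨⟨hz1, hz2⟩, hz3⟩, rfl⟩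
      have hzr : ‖z‖ ≤ r := by simpa using hz1
      have hzκ : r - κ < ‖z‖ := by
        by_contra hcon
        exact hz3 ⟨by simpa using hcon, hz2⟩
      simp only [Complex.ofReal_one, one_mul]
      have hw : ‖e * z‖ = ‖z‖ := by rw [norm_mul, he1, one_mul]
      have hew : 99 / 100 * ‖e * z‖ ≤ inner ℝ e (e * z) := by
        rw [inner_mul_left_unit he1, hw]; exact hz2
      have hwν := inner_cone he1 hf.unit heν hew
      have hwu := inner_cone he1 hu1 heu hew
      rw [hw] at hwν hwu
      have hqσ : q ∈ closedBall a σ := by rw [mem_closedBall]; linarith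
      refine ⟨hf.mem _ ?_ ?_, ?_, ?_⟩
      · rw [mem_closedBall]
        have : dist (q + e * z) q ≤ r := by rw [dist_eq_norm, add_sub_cancel_left, hw]; exact hzr
        linarith [dist_triangle (q + e * z) q a]
      · have := hf.outer q hq hqσ
        rw [add_sub_right_comm, inner_add_right]
        linarith
      · rw [mem_closedBall, dist_eq_norm, add_sub_cancel_left, hw]; exact hzr
      · rw [mem_closedBall, not_le, dist_eq_norm]
        have e1 : q + e * z - p = d • u + e * z := by
          rw [hu, smul_smul, mul_one_div_cancel hd0.ne', one_smul]; ring
        refine lt_of_pow_lt_pow_left₀ 2 (norm_nonneg _) ?_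
        rw [e1, norm_add_sq_real, norm_smul, hu1, hw, real_inner_smul_left, mul_one,
          Real.norm_of_nonneg hd0.le]
        rcases hκcase with hc | ⟨hc, hc'⟩ <;> nlinarith)
  have hsub : narrowCone (r - κ) ⊆ narrowCone r := fun z hz =>
    ⟨closedBall_subset_closedBall (by linarith) hz.1, hz.2⟩
  rw [volume_similarity q e he1, measure_sdiff hsub
    (measurableSet_narrowCone _).nullMeasurableSet (volume_narrowCone_ne_top _),
    ENNReal.toReal_mul, ENNReal.toReal_sub_of_le (measure_mono hsub) (volume_narrowCone_ne_top _),
    volume_narrowCone hr, volume_narrowCone (by linarith), one_pow, ENNReal.ofReal_one,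
    ENNReal.toReal_one, one_mul] at key
  refine le_trans ?_ key
  have := coneConst_pos
  have : r * d / 4 ≤ r ^ 2 - (r - κ) ^ 2 := by nlinarith
  nlinarith

lemma ballArea_le_of_flat (h : UnitBody Ω ρ R) {a ν : ℂ} {r σ η τ : ℝ} (hf : FlatAt Ω σ η a ν τ)
    (hr : 0 < r) {l : ℂ} (hl : dist l a + r ≤ σ) :
    ballArea Ω r l ≤ r ^ 2 * capArea ((τ + inner ℝ ν (l - a)) / r) := by
  have hv := volume_cap l ν hf.unit hr (τ + inner ℝ ν (l - a))
  have := h.real_le (s := closedBall l r)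
    (t := {p | p ∈ closedBall l r ∧ -(τ + inner ℝ ν (l - a)) ≤ inner ℝ ν (p - l)})
    measurableSet_closedBall (by
      rintro p ⟨hp, hpl⟩
      refine ⟨hpl, ?_⟩
      have h1 := hf.outer p hp (by
        rw [mem_closedBall] at hpl ⊢; linarith [dist_triangle p l a])
      have : p - l = (p - a) - (l - a) := by ring
      rw [this, inner_sub_right ν (p - a) (l - a)]; linarith) (by
        rw [hv]; exact ENNReal.mul_ne_top ENNReal.ofReal_ne_top (volume_discCap_ne_top _))
  rw [hv, ENNReal.toReal_mul, ENNReal.toReal_ofReal (by positivity)] at this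
  exact this

lemma _root_.volume_line_eq_zero {u : ℂ} (hu : u ≠ 0) (l : ℂ) :
    volume {p : ℂ | inner ℝ u (p - l) = 0} = 0 := by
  have h1 : volume ((LinearMap.ker (innerSL ℝ u).toLinearMap : Submodule ℝ ℂ) : Set ℂ) = 0 := by
    refine Measure.addHaar_submodule _ _ fun htop => hu ?_
    have : u ∈ LinearMap.ker (innerSL ℝ u).toLinearMap := by rw [htop]; trivial
    simpa using this
  have h2 : {p : ℂ | inner ℝ u (p - l) = 0} = (fun p => p + (-l)) ⁻¹'
      ((LinearMap.ker (innerSL ℝ u).toLinearMap : Submodule ℝ ℂ) : Set ℂ) := by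
    ext p; simp [sub_eq_add_neg]
  rw [h2, measure_preimage_add_right, h1]

/-- Area of the two outer half-discs around a pair of points in flat position. -/
lemma outer_halves_area (h : UnitBody Ω ρ R) {a ν : ℂ} {r σ η τ : ℝ} (hf : FlatAt Ω σ η a ν τ)
    (hr : 0 < r) (hη0 : 0 ≤ η) {l q : ℂ} (hl : dist l a + r ≤ σ) (hq : dist q a + r ≤ σ) {u : ℂ}
    (hu : u ≠ 0) (hul : 0 ≤ inner ℝ u (q - l)) (ho : 0 ≤ inner ℝ ν (q - l)) :
    ballArea Ω r l - 2 * r * η ≤ (volume.restrict Ω).real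
      ({p | p ∈ closedBall l r ∧ inner ℝ u (p - l) < 0} ∪
        {p | p ∈ closedBall q r ∧ 0 < inner ℝ u (p - q)}) := by
  set E : Set ℂ := {p | p ∈ closedBall l r ∧ -(τ - η + inner ℝ ν (l - a)) ≤ inner ℝ ν (p - l)}
    with hE
  have hEm : ∀ p ∈ E, -τ + η ≤ inner ℝ ν (p - a) := by
    rintro p ⟨-, hp⟩
    have : p - a = (p - l) + (l - a) := by ring
    rw [this, inner_add_right]; linarith
  have hvE := volume_cap l ν hf.unit hr (τ - η + inner ℝ ν (l - a))
  have mlt : MeasurableSet {p : ℂ | inner ℝ u (p - l) < 0} :=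
    measurableSet_lt (by fun_prop) measurable_const
  have mgt : MeasurableSet {p : ℂ | 0 < inner ℝ u (p - q)} :=
    measurableSet_lt measurable_const (by fun_prop)
  have mgl : MeasurableSet {p : ℂ | 0 < inner ℝ u (p - l)} :=
    measurableSet_lt measurable_const (by fun_prop)
  have mE : MeasurableSet E :=
    measurableSet_closedBall.inter (measurableSet_le measurable_const
      (by fun_prop : Measurable fun p : ℂ => inner ℝ ν (p - l)))
  set E₂ : Set ℂ := (fun p => p + (l - q)) ⁻¹' (E ∩ {p : ℂ | 0 < inner ℝ u (p - l)}) with hE₂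
  have mE₂ : MeasurableSet E₂ := (mE.inter mgl).preimage (measurable_id.add_const (l - q))
  have hE₂p : ∀ p ∈ E₂, p ∈ closedBall q r ∧ 0 < inner ℝ u (p - q) ∧ p ∈ Ω := by
    rintro p ⟨hp1, hp2⟩
    have e1 : p + (l - q) - l = p - q := by ring
    have hb : p ∈ closedBall q r := by
      have := hp1.1
      rw [mem_closedBall, dist_eq_norm, e1, ← dist_eq_norm] at this
      exact this
    have hp2' : 0 < inner ℝ u (p + (l - q) - l) := hp2
    rw [e1] at hp2'
    refine ⟨hb, hp2', hf.mem p ?_ ?_⟩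
    · rw [mem_closedBall] at hb ⊢; linarith [dist_triangle p q a]
    · have := hEm _ hp1
      have e2 : p - a = (p + (l - q) - a) + (q - l) := by ring
      rw [e2, inner_add_right]; linarith
  have key := h.le_real (s := {p | p ∈ closedBall l r ∧ inner ℝ u (p - l) < 0} ∪
      {p | p ∈ closedBall q r ∧ 0 < inner ℝ u (p - q)})
    (t := (E ∩ {p : ℂ | inner ℝ u (p - l) < 0}) ∪ E₂)
    ((measurableSet_closedBall.inter mlt).union (measurableSet_closedBall.inter mgt)) (by
      rintro p (⟨hp1, hp2⟩ | hp)
      · refine ⟨hf.mem p ?_ (hEm p hp1), Or.inl ⟨hp1.1, hp2⟩⟩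
        have := hp1.1
        rw [mem_closedBall] at this ⊢; linarith [dist_triangle p l a]
      · obtain ⟨h1, h2, h3⟩ := hE₂p p hp
        exact ⟨h3, Or.inr ⟨h1, h2⟩⟩)
  have hdisj : Disjoint (E ∩ {p : ℂ | inner ℝ u (p - l) < 0}) E₂ := by
    rw [Set.disjoint_left]
    rintro p ⟨-, hp⟩ hp2
    have h2 := (hE₂p p hp2).2.1
    have hp' : inner ℝ u (p - l) < 0 := hp
    have : p - l = (p - q) + (q - l) := by ring
    rw [this, inner_add_right] at hp'
    linarith
  have hvle : volume E ≤ volume ((E ∩ {p : ℂ | inner ℝ u (p - l) < 0}) ∪ E₂) := by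
    rw [measure_union hdisj mE₂, hE₂, measure_preimage_add_right]
    have hsub : E ⊆ ((E ∩ {p : ℂ | inner ℝ u (p - l) < 0}) ∪
        (E ∩ {p : ℂ | 0 < inner ℝ u (p - l)})) ∪ {p : ℂ | inner ℝ u (p - l) = 0} := by
      intro p hp
      rcases lt_trichotomy (inner ℝ u (p - l)) 0 with h1 | h1 | h1
      · exact Or.inl (Or.inl ⟨hp, h1⟩)
      · exact Or.inr h1
      · exact Or.inl (Or.inr ⟨hp, h1⟩)
    refine (measure_mono hsub).trans ((measure_union_le _ _).trans ?_)
    rw [volume_line_eq_zero hu, add_zero]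
    exact measure_union_le _ _
  have hA := h.ballArea_le_of_flat hf hr hl
  have hcap := capArea_sub_le (u := (τ - η + inner ℝ ν (l - a)) / r)
    (v := (τ + inner ℝ ν (l - a)) / r) (by gcongr; linarith)
  have htop : volume ((E ∩ {p : ℂ | inner ℝ u (p - l) < 0}) ∪ E₂) ≠ ⊤ := by
    refine ne_top_of_le_ne_top (b := volume (closedBall l r) + volume (closedBall q r))
      (by simp only [Complex.volume_closedBall]; finiteness) ?_
    refine (measure_union_le _ _).trans (add_le_add (measure_mono fun p hp => hp.1.1)
      (measure_mono fun p hp => (hE₂p p hp).1))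
  have h5 := ENNReal.toReal_mono htop hvle
  rw [hvE, ENNReal.toReal_mul, ENNReal.toReal_ofReal (by positivity)] at h5
  have e3 : (τ + inner ℝ ν (l - a)) / r - (τ - η + inner ℝ ν (l - a)) / r = η / r := by ring
  rw [e3] at hcap
  have h6 : r ^ 2 * capArea ((τ + inner ℝ ν (l - a)) / r) ≤
      r ^ 2 * (capArea ((τ - η + inner ℝ ν (l - a)) / r) + 2 * (η / r)) := by gcongr
  have e4 : r ^ 2 * (2 * (η / r)) = 2 * r * η := by field_simp
  have h7 : r ^ 2 * capArea ((τ - η + inner ℝ ν (l - a)) / r) ≤ _ := h5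
  linarith [h6, h7, key, mul_add (r ^ 2) (capArea ((τ - η + inner ℝ ν (l - a)) / r)) (2 * (η / r))]

end UnitBody

/-- Points within `r` of `a` or `b`, outside the lens spanned by `a` and `b`. -/
def pairRegion (r : ℝ) (a b : ℂ) : Set ℂ :=
  (closedBall a r ∪ closedBall b r) \ (closedBall a (dist a b) ∩ closedBall b (dist a b))

lemma pairRegion_comm (r : ℝ) (a b : ℂ) : pairRegion r a b = pairRegion r b a := by
  rw [pairRegion, pairRegion, Set.union_comm, dist_comm a b, Set.inter_comm]

lemma measurableSet_pairRegion (r : ℝ) (a b : ℂ) : MeasurableSet (pairRegion r a b) :=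
  (measurableSet_closedBall.union measurableSet_closedBall).diff
    (measurableSet_closedBall.inter measurableSet_closedBall)

lemma mem_pairRegion_of_inner_neg {r : ℝ} {a b p : ℂ} (hp : p ∈ closedBall a r)
    (h : inner ℝ (b - a) (p - a) < 0) : p ∈ pairRegion r a b := by
  refine ⟨Or.inl hp, fun hcon => ?_⟩
  have h1 := hcon.2
  rw [mem_closedBall, dist_eq_norm, dist_eq_norm, norm_sub_rev a b] at h1
  have h2 : p - b = (p - a) - (b - a) := by ring
  have h3 : ‖p - b‖ ^ 2 = ‖p - a‖ ^ 2 - 2 * inner ℝ (p - a) (b - a) + ‖b - a‖ ^ 2 := by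
    rw [h2, norm_sub_sq_real]
  rw [real_inner_comm] at h
  nlinarith [norm_nonneg (p - b), norm_nonneg (b - a), norm_nonneg (p - a)]

namespace UnitBody
variable {Ω : Set ℂ} {ρ R : ℝ}

lemma half_contract (h : UnitBody Ω ρ R) {a b : ℂ} (ha : a ∈ Ω) {r : ℝ} (hr : 0 < r)
    (hr1 : r ≤ 2 * R)
    (hv : 1 / 4 ≤ (volume (Ω ∩ {p | inner ℝ (b - a) (p - a) < 0})).toReal) :
    r ^ 2 / (16 * R ^ 2) ≤ (volume.restrict Ω).real (pairRegion r a b) := by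
  have hR := h.R_pos
  have hs : 0 < r / (2 * R) := by positivity
  have hs1 : r / (2 * R) ≤ 1 := by rw [div_le_one (by positivity)]; exact hr1
  have key := h.le_real (s := pairRegion r a b)
    (t := (fun p => a + (r / (2 * R) : ℝ) * (p - a)) '' (Ω ∩ {p | inner ℝ (b - a) (p - a) < 0}))
    (measurableSet_pairRegion _ _ _) (by
      rintro _ ⟨p, ⟨hp, hp2⟩, rfl⟩
      refine ⟨h.contract_mem ha hp hs.le hs1, mem_pairRegion_of_inner_neg ?_ ?_⟩
      · rw [mem_closedBall]
        refine (h.dist_contract_le ha hp hs.le).trans (le_of_eq ?_)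
        field_simp
      · rw [add_sub_cancel_left, ← Complex.real_smul, inner_smul_right]
        exact mul_neg_of_pos_of_neg hs hp2)
  rw [h.contract_volume a, ENNReal.toReal_mul, ENNReal.toReal_ofReal (by positivity)] at key
  refine le_trans ?_ key
  calc r ^ 2 / (16 * R ^ 2) = (r / (2 * R)) ^ 2 * (1 / 4) := by field_simp; norm_num
    _ ≤ _ := by gcongr

lemma volume_strip_le (h : UnitBody Ω ρ R) {a b : ℂ} (hab : a ≠ b) :
    (volume (Ω ∩ {p | 0 ≤ inner ℝ (b - a) (p - a) ∧ inner ℝ (a - b) (p - b) ≥ 0})).toReal ≤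
      2 * R * dist a b := by
  have hR := h.R_pos
  set d := dist a b with hd
  have hd0 : 0 < d := dist_pos.2 hab
  have hdn : ‖b - a‖ = d := by rw [hd, dist_comm, dist_eq_norm]
  set u : ℂ := (1 / d : ℝ) • (b - a) with hu
  have hu1 : ‖u‖ = 1 := by
    rw [hu, norm_smul, hdn, Real.norm_of_nonneg (by positivity)]; field_simp
  have hba : b - a = (d : ℂ) * u := by
    rw [← Complex.real_smul, hu, smul_smul, mul_one_div_cancel hd0.ne', one_smul]
  set c : ℝ := (a * (starRingEnd ℂ) u).im
  have hsub : Ω ∩ {p | 0 ≤ inner ℝ (b - a) (p - a) ∧ inner ℝ (a - b) (p - b) ≥ 0} ⊆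
      (fun z : ℂ => a + (1 : ℝ) * (u * z)) '' (Set.Icc 0 d ×ℂ Set.Icc (-R - c) (R - c)) := by
    rintro p ⟨hp, h1, h2⟩
    have huu : u * (starRingEnd ℂ) u = 1 := by
      rw [Complex.mul_conj, Complex.normSq_eq_norm_sq, hu1]; simp
    refine ⟨(p - a) * (starRingEnd ℂ) u, ?_, ?_⟩
    · have hre : inner ℝ (b - a) (p - a) = d * ((p - a) * (starRingEnd ℂ) u).re := by
        rw [hba, ← Complex.real_smul, real_inner_smul_left, Complex.inner]
      have h3 : p - b = (p - a) - (b - a) := by ring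
      have hsq : inner ℝ (b - a) (b - a) = d ^ 2 := by rw [real_inner_self_eq_norm_sq, hdn]
      have h2' : inner ℝ (b - a) (p - a) ≤ d ^ 2 := by
        have h5 : a - b = -(b - a) := by ring
        rw [ge_iff_le, h5, h3, inner_neg_left, inner_sub_right (b - a) (p - a) (b - a), hsq] at h2
        linarith
      rw [hre] at h1 h2'
      have him : |(p * (starRingEnd ℂ) u).im| ≤ R := by
        refine (Complex.abs_im_le_norm _).trans ?_
        rw [norm_mul, Complex.norm_conj, hu1, mul_one]
        exact h.norm_le hp
      rw [abs_le] at him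
      have him2 : ((p - a) * (starRingEnd ℂ) u).im = (p * (starRingEnd ℂ) u).im - c := by
        rw [sub_mul, Complex.sub_im]
      rw [Complex.mem_reProdIm]
      refine ⟨⟨nonneg_of_mul_nonneg_right h1 hd0, ?_⟩, ?_, ?_⟩
      · rw [sq] at h2'
        exact le_of_mul_le_mul_left h2' hd0
      · rw [him2]; linarith
      · rw [him2]; linarith
    · simp only [Complex.ofReal_one, one_mul]
      calc a + u * ((p - a) * (starRingEnd ℂ) u) = a + (p - a) * (u * (starRingEnd ℂ) u) := by ring
        _ = p := by rw [huu]; ring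
  have hle := measure_mono (μ := volume) hsub
  rw [volume_similarity a u hu1, volume_reProdIm, Real.volume_Icc, Real.volume_Icc] at hle
  refine (ENNReal.toReal_mono (by finiteness) hle).trans (le_of_eq ?_)
  rw [← ENNReal.ofReal_mul (by linarith), ← ENNReal.ofReal_mul (by norm_num),
    ENNReal.toReal_ofReal (by ring_nf; positivity)]
  ring

/-- Crude lower bound on the area of the pair region. -/
lemma crude_pair_area (h : UnitBody Ω ρ R) {a b : ℂ} (ha : a ∈ Ω) (hb : b ∈ Ω) (hab : a ≠ b)
    {r : ℝ} (hr : 0 < r) (hr1 : r ≤ 2 * R) (hd : 4 * R * dist a b ≤ 1) :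
    r ^ 2 / (16 * R ^ 2) ≤ (volume.restrict Ω).real (pairRegion r a b) := by
  by_cases h1 : 1 / 4 ≤ (volume (Ω ∩ {p | inner ℝ (b - a) (p - a) < 0})).toReal
  · exact h.half_contract ha hr hr1 h1
  by_cases h2 : 1 / 4 ≤ (volume (Ω ∩ {p | inner ℝ (a - b) (p - b) < 0})).toReal
  · rw [pairRegion_comm]
    exact h.half_contract hb hr hr1 h2
  exfalso
  have h3 := h.volume_strip_le hab
  have hcov : Ω ⊆ ((Ω ∩ {p | inner ℝ (b - a) (p - a) < 0}) ∪
      (Ω ∩ {p | inner ℝ (a - b) (p - b) < 0})) ∪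
      (Ω ∩ {p | 0 ≤ inner ℝ (b - a) (p - a) ∧ inner ℝ (a - b) (p - b) ≥ 0}) := by
    intro p hp
    rcases lt_or_ge (inner ℝ (b - a) (p - a)) 0 with g1 | g1
    · exact Or.inl (Or.inl ⟨hp, g1⟩)
    rcases lt_or_ge (inner ℝ (a - b) (p - b)) 0 with g2 | g2
    · exact Or.inl (Or.inr ⟨hp, g2⟩)
    · exact Or.inr ⟨hp, g1, g2⟩
  have h4 := (measure_mono (μ := volume) hcov).trans ((measure_union_le _ _).trans
    (add_le_add_left (measure_union_le _ _) _))
  rw [h.volume_eq] at h4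
  have f := h.volume_ne_top
  have f12 := ENNReal.add_ne_top.2 ⟨f {p | inner ℝ (b - a) (p - a) < 0},
    f {p | inner ℝ (a - b) (p - b) < 0}⟩
  have h5 := ENNReal.toReal_mono (ENNReal.add_ne_top.2 ⟨f12, f _⟩) h4
  rw [ENNReal.toReal_add f12 (f _), ENNReal.toReal_add (f _) (f _)] at h5
  simp only [ENNReal.toReal_one] at h5
  linarith

set_option maxHeartbeats 800000 in
/-- Lower bound on the area of the pair region in flat position. -/
lemma flat_pair_area_aux (h : UnitBody Ω ρ R) {a ν : ℂ} {r σ η τ D : ℝ}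
    (hf : FlatAt Ω σ η a ν τ) (hr : 0 < r) (hη0 : 0 ≤ η) (hη : η ≤ r / 2) (hD : 1 ≤ D)
    {l q : ℂ} (hlΩ : l ∈ Ω) (hl : dist l a + r ≤ σ) (hq : dist q a + r ≤ σ) (hne : l ≠ q)
    (hd : dist l q ≤ D * r) (ho : 0 ≤ inner ℝ ν (q - l)) :
    ballArea Ω r l - 2 * r * η + 3 / 10 * r * (dist l q / (8 * D ^ 2) - η) ≤
      (volume.restrict Ω).real (pairRegion r l q) := by
  have hA := h.outer_halves_area hf hr hη0 hl hq (u := q - l) (sub_ne_zero.2 hne.symm)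
    real_inner_self_nonneg ho
  set R₁ : Set ℂ := {p | p ∈ closedBall l r ∧ inner ℝ (q - l) (p - l) < 0} ∪
        {p | p ∈ closedBall q r ∧ 0 < inner ℝ (q - l) (p - q)} with hR₁
  have mlt : MeasurableSet {p : ℂ | inner ℝ (q - l) (p - l) < 0} :=
    measurableSet_lt (by fun_prop) measurable_const
  have mgt : MeasurableSet {p : ℂ | 0 < inner ℝ (q - l) (p - q)} :=
    measurableSet_lt measurable_const (by fun_prop)
  have mR₁ : MeasurableSet R₁ :=
    (measurableSet_closedBall.inter mlt).union (measurableSet_closedBall.inter mgt)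
  have hsub : R₁ ⊆ pairRegion r l q := by
    rintro p (⟨hp1, hp2⟩ | ⟨hp1, hp2⟩)
    · exact mem_pairRegion_of_inner_neg hp1 hp2
    · rw [pairRegion_comm]
      refine mem_pairRegion_of_inner_neg hp1 ?_
      have : l - q = -(q - l) := by ring
      rw [this, inner_neg_left]; linarith
  set d := dist l q with hdd
  have hd0 : 0 < d := dist_pos.2 hne
  have hdn : ‖q - l‖ = d := by rw [hdd, dist_comm, dist_eq_norm]
  set u : ℂ := (1 / d : ℝ) • (q - l) with hu
  have hu1 : ‖u‖ = 1 := by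
    rw [hu, norm_smul, hdn, Real.norm_of_nonneg (by positivity)]; field_simp
  have hql : q - l = (d : ℂ) * u := by
    rw [← Complex.real_smul, hu, smul_smul, mul_one_div_cancel hd0.ne', one_smul]
  set α := (ν * (starRingEnd ℂ) u).re with hα
  set β := (ν * (starRingEnd ℂ) u).im with hβ
  have hαβ : α ^ 2 + β ^ 2 = 1 := by
    have : ‖ν * (starRingEnd ℂ) u‖ ^ 2 = 1 := by
      rw [norm_mul, Complex.norm_conj, hu1, hf.unit]; norm_num
    rw [← this, ← Complex.normSq_eq_norm_sq, Complex.normSq_apply]; ring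
  have hinn : ∀ z : ℂ, inner ℝ ν (u * z) = α * z.re + β * z.im := by
    intro z
    rw [Complex.inner, hα, hβ]
    simp only [Complex.mul_re, Complex.mul_im, Complex.conj_re, Complex.conj_im]
    ring
  have hα0 : 0 ≤ α := by
    rw [hql, ← mul_one ((d : ℂ) * u), mul_assoc, ← Complex.real_smul, inner_smul_right, hinn] at ho
    simp only [Complex.one_re, mul_one, Complex.one_im, mul_zero, add_zero] at ho
    exact nonneg_of_mul_nonneg_right ho hd0
  obtain ⟨T, hTv, hT⟩ : ∃ T : Set ℝ, volume T = ENNReal.ofReal (3 / 10 * r) ∧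
      ∀ y ∈ T, (r / 2) ^ 2 < y ^ 2 ∧ y ^ 2 ≤ (4 / 5 * r) ^ 2 ∧ |β| * (r / 2) ≤ β * y := by
    rcases le_total 0 β with hb | hb
    · refine ⟨Set.Ioo (r / 2) (4 / 5 * r), ?_, ?_⟩
      · rw [Real.volume_Ioo]; congr 1; ring
      · rintro y ⟨h1, h2⟩
        rw [abs_of_nonneg hb]
        refine ⟨by nlinarith, by nlinarith, by gcongr⟩
    · refine ⟨Set.Ioo (-(4 / 5 * r)) (-(r / 2)), ?_, ?_⟩
      · rw [Real.volume_Ioo]; congr 1; ring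
      · rintro y ⟨h1, h2⟩
        rw [abs_of_nonpos hb]
        refine ⟨by nlinarith, by nlinarith, by nlinarith⟩
  have hαβ1 : 1 ≤ α + |β| := by
    have := sq_abs β
    nlinarith [abs_nonneg β]
  have hD2 : d / (8 * D ^ 2) ≤ r / 8 := by
    rw [div_le_div_iff₀ (by positivity) (by norm_num)]
    nlinarith
  have key := h.le_real (s := pairRegion r l q \ R₁)
    (t := (fun z : ℂ => l + (1 : ℝ) * (u * z)) '' (Set.Ioo η (d / (8 * D ^ 2)) ×ℂ T))
    ((measurableSet_pairRegion _ _ _).diff mR₁) (by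
      rintro _ ⟨z, hz, rfl⟩
      rw [Complex.mem_reProdIm] at hz
      obtain ⟨⟨hz1, hz2⟩, hz3⟩ := hz
      obtain ⟨hT1, hT2, hT3⟩ := hT _ hz3
      simp only [Complex.ofReal_one, one_mul]
      have hn : ‖u * z‖ ^ 2 = z.re ^ 2 + z.im ^ 2 := by
        rw [norm_mul, hu1, one_mul, ← Complex.normSq_eq_norm_sq, Complex.normSq_apply]; ring
      have hz0 : 0 < z.re := lt_of_le_of_lt hη0 hz1
      have hball : dist (l + u * z) l ≤ r := by
        rw [dist_eq_norm, add_sub_cancel_left]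
        refine abs_le_of_sq_le_sq' ?_ hr.le |>.2
        rw [hn]; nlinarith
      have hinner : inner ℝ (q - l) (u * z) = d * z.re := by
        rw [hql, ← Complex.real_smul, real_inner_smul_left, inner_mul_left_unit hu1]
      have hq2 : l + u * z - q = u * z - (q - l) := by ring
      have hnq : ‖l + u * z - q‖ ^ 2 = z.re ^ 2 + z.im ^ 2 - 2 * (d * z.re) + d ^ 2 := by
        rw [hq2, norm_sub_sq_real, hn, hdn, real_inner_comm, hinner]
      refine ⟨hf.mem _ ?_ ?_, ⟨Or.inl hball, ?_⟩, ?_⟩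
      · rw [mem_closedBall]; linarith [dist_triangle (l + u * z) l a]
      · have h1 := hf.outer l hlΩ (by rw [mem_closedBall]; linarith)
        have e : l + u * z - a = (l - a) + u * z := by ring
        rw [e, inner_add_right, hinn]
        have : η * 1 ≤ η * (α + |β|) := by gcongr
        have h2 : α * η ≤ α * z.re := by gcongr
        have h3 : |β| * η ≤ |β| * (r / 2) := by gcongr
        linarith
      · rintro ⟨-, h2⟩
        rw [mem_closedBall, dist_eq_norm] at h2
        have h3 : 2 * (d * z.re) ≤ (r / 2) ^ 2 := by
          have h4 : d * z.re ≤ d * (d / (8 * D ^ 2)) := by gcongr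
          have h5 : d * (d / (8 * D ^ 2)) ≤ r ^ 2 / 8 := by
            rw [← mul_div_assoc, div_le_div_iff₀ (by positivity) (by norm_num)]
            have : d * d ≤ (D * r) * (D * r) := by gcongr
            linarith
          linarith
        have h6 : ‖l + u * z - q‖ ^ 2 ≤ d ^ 2 := by gcongr
        rw [hnq] at h6
        linarith [sq_nonneg z.re]
      · rintro (⟨-, h2⟩ | ⟨-, h2⟩)
        · rw [add_sub_cancel_left, hinner] at h2
          nlinarith
        · rw [hq2, inner_sub_right (q - l) (u * z) (q - l), hinner, real_inner_self_eq_norm_sq,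
            hdn] at h2
          have : d / (8 * D ^ 2) ≤ d := div_le_self hd0.le (by nlinarith)
          nlinarith)
  rw [volume_similarity l u hu1, volume_reProdIm, hTv, Real.volume_Ioo, ENNReal.toReal_mul,
    ENNReal.toReal_mul, ENNReal.toReal_ofReal (by positivity),
    ENNReal.toReal_ofReal (r := 3 / 10 * r) (by positivity)] at key
  have h8 : d / (8 * D ^ 2) - η ≤ (ENNReal.ofReal (d / (8 * D ^ 2) - η)).toReal := by
    rw [ENNReal.toReal_ofReal']; exact le_max_left _ _
  have := h.isProbabilityMeasure
  have h9 := measureReal_inter_add_sdiff (μ := volume.restrict Ω) (s := pairRegion r l q) mR₁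
  rw [Set.inter_eq_self_of_subset_right hsub] at h9
  rw [← h9]
  have h10 : 3 / 10 * r * (d / (8 * D ^ 2) - η) ≤
      3 / 10 * r * (ENNReal.ofReal (d / (8 * D ^ 2) - η)).toReal := by gcongr
  linarith

lemma flat_pair_area (h : UnitBody Ω ρ R) {a b ν : ℂ} {r σ η τ D : ℝ}
    (hf : FlatAt Ω σ η a ν τ) (hr : 0 < r) (hη0 : 0 ≤ η) (hη : η ≤ r / 2) (hD : 1 ≤ D)
    (hσ : (D + 1) * r ≤ σ) (ha : a ∈ Ω) (hb : b ∈ Ω) (hab : a ≠ b) (hd : dist a b ≤ D * r) :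
    min (ballArea Ω r a) (ballArea Ω r b) - 3 * r * η + r * dist a b / (40 * D ^ 2) ≤
      (volume.restrict Ω).real (pairRegion r a b) := by
  have e : 3 / 10 * r * (dist a b / (8 * D ^ 2)) = 3 / 80 * (r * dist a b / D ^ 2) := by ring
  have e2 : r * dist a b / (40 * D ^ 2) = 1 / 40 * (r * dist a b / D ^ 2) := by ring
  have e3 : 0 ≤ r * dist a b / D ^ 2 := by positivity
  have e4 : 0 ≤ r * η := by positivity
  rcases le_total 0 (inner ℝ ν (b - a)) with ho | ho
  · have := h.flat_pair_area_aux hf hr hη0 hη hD ha (by rw [dist_self]; nlinarith)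
      (by rw [dist_comm]; nlinarith) hab hd ho
    have := min_le_left (ballArea Ω r a) (ballArea Ω r b)
    nlinarith
  · have := h.flat_pair_area_aux hf hr hη0 hη hD hb (by rw [dist_comm]; nlinarith)
      (by rw [dist_self]; nlinarith) hab.symm (by rw [dist_comm]; exact hd) (by
        have : a - b = -(b - a) := by ring
        rw [this, inner_neg_right]; linarith)
    rw [pairRegion_comm, dist_comm b a] at this
    have := min_le_right (ballArea Ω r a) (ballArea Ω r b)
    nlinarith

end UnitBody

/-- Symmetric second difference along the two coordinate directions. -/
noncomputable def secondDiff (g : ℂ → ℝ) (w : ℝ) (x : ℂ) : ℝ :=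
  (g (x + w) + g (x - w) - 2 * g x) + (g (x + w * Complex.I) + g (x - w * Complex.I) - 2 * g x)

lemma FlatAt.mono {Ω : Set ℂ} {σ η η' : ℝ} {a ν : ℂ} {τ : ℝ} (h : FlatAt Ω σ η a ν τ)
    (hη : η ≤ η') : FlatAt Ω σ η' a ν τ :=
  ⟨h.unit, h.outer, fun p hp hp2 => h.mem p hp (by linarith)⟩

lemma FlatAt.of_closedBall_subset {Ω : Set ℂ} {σ η : ℝ} {a : ℂ} (h : closedBall a σ ⊆ Ω) :
    FlatAt Ω σ η a 1 σ := by
  refine ⟨by simp, fun p _ hp => ?_, fun p hp _ => h hp⟩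
  have h1 := (abs_le.1 (abs_real_inner_le_norm (1 : ℂ) (p - a))).1
  rw [mem_closedBall, dist_eq_norm] at hp
  simp only [norm_one, one_mul] at h1
  linarith

namespace UnitBody
variable {Ω : Set ℂ} {ρ R : ℝ}

lemma closedBall_subset (h : UnitBody Ω ρ R) {x : ℂ} {σ : ℝ} (hx : gauge Ω x ≤ 1 - σ / ρ) :
    closedBall x σ ⊆ Ω := by
  intro p hp
  rw [mem_closedBall, dist_eq_norm] at hp
  rw [← h.gauge_le_one_iff]
  have h1 := h.gauge_sub_le p x
  have h2 : ‖p - x‖ / ρ ≤ σ / ρ := by have := h.pos; gcongr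
  linarith

lemma gauge_inv_two (h : UnitBody Ω ρ R) {x y : ℂ} {s : ℝ} (hs : 0 ≤ s) (hs1 : s ≤ 1) :
    gauge Ω (x + s * (y - x)) ≤ (1 - s) * gauge Ω x + s * gauge Ω y := by
  have e : x + s * (y - x) = ((1 - s : ℝ) : ℂ) * x + (s : ℝ) * y := by push_cast; ring
  rw [e, ← h.gauge_smul hs, ← h.gauge_smul (sub_nonneg.2 hs1)]
  exact h.gauge_add_le _ _

lemma fderiv_le (h : UnitBody Ω ρ R) {x : ℂ} (hd : DifferentiableAt ℝ (gauge Ω) x) (p : ℂ) :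
    fderiv ℝ (gauge Ω) x p ≤ gauge Ω p := by
  have h1 := (hd.hasFDerivAt.hasLineDerivAt p).tendsto_slope_zero_right
  refine le_of_tendsto h1 ?_
  filter_upwards [self_mem_nhdsWithin] with t ht
  have ht : 0 < t := ht
  have h2 := h.gauge_add_le x (t * p)
  rw [h.gauge_smul ht.le] at h2
  rw [smul_eq_mul, inv_mul_le_iff₀ ht, Complex.real_smul]
  linarith

lemma fderiv_self (h : UnitBody Ω ρ R) {x : ℂ} (hd : DifferentiableAt ℝ (gauge Ω) x) :
    fderiv ℝ (gauge Ω) x x = gauge Ω x := by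
  have h1 := (hd.hasFDerivAt.hasLineDerivAt x).tendsto_slope_zero_right
  refine tendsto_nhds_unique h1 (tendsto_const_nhds.congr' ?_)
  filter_upwards [self_mem_nhdsWithin] with t ht
  have ht : 0 < t := ht
  have e : x + t • x = ((1 + t : ℝ) : ℂ) * x := by rw [Complex.real_smul]; push_cast; ring
  rw [e, h.gauge_smul (by positivity), smul_eq_mul]
  field_simp; ring

lemma norm_fderiv_le (h : UnitBody Ω ρ R) (x : ℂ) : ‖fderiv ℝ (gauge Ω) x‖ ≤ 1 / ρ := by
  have := norm_fderiv_le_of_lipschitz ℝ (x₀ := x) h.lipschitz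
  rw [one_div]; exact this

lemma le_norm_fderiv (h : UnitBody Ω ρ R) {x : ℂ} (hd : DifferentiableAt ℝ (gauge Ω) x)
    (hx : x ≠ 0) : 1 / R ≤ ‖fderiv ℝ (gauge Ω) x‖ := by
  have h1 := (le_abs_self _).trans ((fderiv ℝ (gauge Ω) x).le_opNorm x)
  rw [h.fderiv_self hd] at h1
  have h2 := h.le_gauge x
  have h3 : 0 < ‖x‖ := norm_pos_iff.2 hx
  have h4 : 1 / R * ‖x‖ ≤ ‖fderiv ℝ (gauge Ω) x‖ * ‖x‖ := by
    rw [one_div_mul_eq_div]; linarith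
  exact le_of_mul_le_mul_right h4 h3

lemma secondDiff_nonneg (h : UnitBody Ω ρ R) (w : ℝ) (x : ℂ) : 0 ≤ secondDiff (gauge Ω) w x := by
  have key : ∀ v : ℂ, 0 ≤ gauge Ω (x + v) + gauge Ω (x - v) - 2 * gauge Ω x := by
    intro v
    have h1 := h.gauge_add_le (x + v) (x - v)
    have e : x + v + (x - v) = ((2 : ℝ) : ℂ) * x := by push_cast; ring
    rw [e, h.gauge_smul (by norm_num)] at h1
    linarith
  exact add_nonneg (key _) (key _)

/-- Near a point of differentiability the gauge is controlled by its second difference. -/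
lemma gauge_le_linear (h : UnitBody Ω ρ R) {x : ℂ} (hd : DifferentiableAt ℝ (gauge Ω) x) {w : ℝ}
    (hw : 0 < w) {v : ℂ} (hv : |v.re| + |v.im| ≤ w) :
    gauge Ω (x + v) ≤ gauge Ω x + fderiv ℝ (gauge Ω) x v + secondDiff (gauge Ω) w x := by
  set L := fderiv ℝ (gauge Ω) x with hL
  have hlow : ∀ z, gauge Ω x + L z ≤ gauge Ω (x + z) := fun z => by
    have := h.fderiv_le hd (x + z)
    rw [map_add, h.fderiv_self hd] at this
    exact this
  obtain ⟨e₁, he₁, hv₁⟩ : ∃ e₁ : ℝ, (e₁ = w ∨ e₁ = -w) ∧ v.re = |v.re| / w * e₁ := by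
    rcases le_total 0 v.re with h0 | h0
    · exact ⟨w, Or.inl rfl, by rw [abs_of_nonneg h0]; field_simp⟩
    · exact ⟨-w, Or.inr rfl, by rw [abs_of_nonpos h0]; field_simp⟩
  obtain ⟨e₂, he₂, hv₂⟩ : ∃ e₂ : ℝ, (e₂ = w ∨ e₂ = -w) ∧ v.im = |v.im| / w * e₂ := by
    rcases le_total 0 v.im with h0 | h0
    · exact ⟨w, Or.inl rfl, by rw [abs_of_nonneg h0]; field_simp⟩
    · exact ⟨-w, Or.inr rfl, by rw [abs_of_nonpos h0]; field_simp⟩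
  set s₁ := |v.re| / w with hs₁
  set s₂ := |v.im| / w with hs₂
  have hs₁0 : 0 ≤ s₁ := by positivity
  have hs₂0 : 0 ≤ s₂ := by positivity
  have hs : s₁ + s₂ ≤ 1 := by rw [hs₁, hs₂, ← add_div, div_le_one hw]; exact hv
  have hv' : v = s₁ * (e₁ : ℂ) + s₂ * (e₂ * Complex.I) := by
    refine Complex.ext ?_ ?_
    · simp [← hv₁]
    · simp [← hv₂]
  have hx : x + v = ((1 - s₁ - s₂ : ℝ) : ℂ) * x +
      (((s₁ : ℝ) : ℂ) * (x + e₁) + ((s₂ : ℝ) : ℂ) * (x + e₂ * Complex.I)) := by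
    rw [hv']; push_cast; ring
  have hconv : gauge Ω (x + v) ≤ (1 - s₁ - s₂) * gauge Ω x + (s₁ * gauge Ω (x + e₁) +
      s₂ * gauge Ω (x + e₂ * Complex.I)) := by
    rw [hx, ← h.gauge_smul hs₁0, ← h.gauge_smul hs₂0, ← h.gauge_smul (by linarith)]
    exact (h.gauge_add_le _ _).trans (add_le_add_right (h.gauge_add_le _ _) _)
  have hLv : L v = s₁ * L e₁ + s₂ * L (e₂ * Complex.I) := by
    rw [hv', map_add, ← Complex.real_smul, ← Complex.real_smul, map_smul, map_smul, smul_eq_mul,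
      smul_eq_mul]
  have hD₁ : gauge Ω (x + e₁) - gauge Ω x - L e₁ ≤
      gauge Ω (x + w) + gauge Ω (x - w) - 2 * gauge Ω x := by
    have h1 := hlow w
    have h2 := hlow (-w)
    rw [map_neg, ← sub_eq_add_neg x] at h2
    rcases he₁ with rfl | rfl
    · linarith
    · push_cast; rw [map_neg, ← sub_eq_add_neg x]; linarith
  have hD₂ : gauge Ω (x + e₂ * Complex.I) - gauge Ω x - L (e₂ * Complex.I) ≤
      gauge Ω (x + w * Complex.I) + gauge Ω (x - w * Complex.I) - 2 * gauge Ω x := by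
    have h1 := hlow (w * Complex.I)
    have h2 := hlow (-(w * Complex.I))
    rw [map_neg, ← sub_eq_add_neg x] at h2
    rcases he₂ with rfl | rfl
    · linarith
    · push_cast; rw [neg_mul, map_neg, ← sub_eq_add_neg x]; linarith
  have hp₁ := hlow e₁
  have hp₂ := hlow (e₂ * Complex.I)
  have g1 : s₁ * (gauge Ω (x + e₁) - gauge Ω x - L e₁) ≤
      gauge Ω (x + e₁) - gauge Ω x - L e₁ := mul_le_of_le_one_left (by linarith) (by linarith)
  have g2 : s₂ * (gauge Ω (x + e₂ * Complex.I) - gauge Ω x - L (e₂ * Complex.I)) ≤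
      gauge Ω (x + e₂ * Complex.I) - gauge Ω x - L (e₂ * Complex.I) :=
    mul_le_of_le_one_left (by linarith) (by linarith)
  rw [hLv, secondDiff]
  linarith

/-- Distance to the supporting line determined by the gauge. -/
noncomputable def _root_.gaugeDepth (Ω : Set ℂ) (x : ℂ) : ℝ :=
  (1 - gauge Ω x) / ‖fderiv ℝ (gauge Ω) x‖

lemma flatAt (h : UnitBody Ω ρ R) {x : ℂ} (hd : DifferentiableAt ℝ (gauge Ω) x) (hx : x ≠ 0)
    {σ : ℝ} (hσ : 0 < σ) : ∃ ν, FlatAt Ω σ (R * secondDiff (gauge Ω) (2 * σ) x) x ν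
      (gaugeDepth Ω x) := by
  set L := fderiv ℝ (gauge Ω) x with hL
  have hN := h.le_norm_fderiv hd hx
  rw [← hL] at hN
  have hR := h.R_pos
  have hN0 : 0 < ‖L‖ := lt_of_lt_of_le (by positivity) hN
  set w := (InnerProductSpace.toDual ℝ ℂ).symm L with hw
  have hwL : ∀ z, inner ℝ w z = L z := fun z => InnerProductSpace.toDual_symm_apply
  have hwn : ‖w‖ = ‖L‖ := LinearIsometryEquiv.norm_map _ _
  have hνL : ∀ z, inner ℝ (-((1 / ‖L‖ : ℝ) • w)) z = -(L z / ‖L‖) := fun z => by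
    rw [inner_neg_left, real_inner_smul_left, hwL, one_div_mul_eq_div]
  have hτ : gaugeDepth Ω x = (1 - gauge Ω x) / ‖L‖ := rfl
  refine ⟨-((1 / ‖L‖ : ℝ) • w), ?_, ?_, ?_⟩
  · rw [norm_neg, norm_smul, hwn, Real.norm_of_nonneg (by positivity)]; field_simp
  · intro p hp _
    rw [hνL, hτ, neg_le_neg_iff]
    have h1 := h.fderiv_le hd p
    have h2 := h.gauge_le_one_iff.2 hp
    rw [map_sub, h.fderiv_self hd]
    gcongr
    linarith
  · intro p hp hp2
    rw [hνL, hτ] at hp2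
    have h1 : R * secondDiff (gauge Ω) (2 * σ) x ≥ secondDiff (gauge Ω) (2 * σ) x / ‖L‖ := by
      rw [ge_iff_le, div_le_iff₀ hN0]
      have h2 : 1 ≤ R * ‖L‖ := by
        rw [div_le_iff₀ hR] at hN; linarith
      have := h.secondDiff_nonneg (2 * σ) x
      nlinarith
    have h3 : L (p - x) / ‖L‖ ≤ (1 - gauge Ω x - secondDiff (gauge Ω) (2 * σ) x) / ‖L‖ := by
      rw [sub_div]; linarith
    rw [div_le_div_iff_of_pos_right hN0] at h3
    rw [← h.gauge_le_one_iff]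
    rw [mem_closedBall, dist_eq_norm] at hp
    have h4 := h.gauge_le_linear hd (w := 2 * σ) (by positivity) (v := p - x) (by
      linarith [Complex.abs_re_le_norm (p - x), Complex.abs_im_le_norm (p - x)])
    rw [add_sub_cancel, ← hL] at h4
    linarith

lemma le_ballArea_of_flat (h : UnitBody Ω ρ R) {a ν : ℂ} {r σ η τ : ℝ} (hf : FlatAt Ω σ η a ν τ)
    (hr : 0 < r) (hη : 0 ≤ η) (hσ : r ≤ σ) :
    r ^ 2 * capArea (τ / r) - 2 * r * η ≤ ballArea Ω r a := by
  have hv := volume_cap a ν hf.unit hr (τ - η)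
  have := h.le_real (s := closedBall a r)
    (t := {p | p ∈ closedBall a r ∧ -(τ - η) ≤ inner ℝ ν (p - a)})
    measurableSet_closedBall (fun p hp => ⟨hf.mem p (closedBall_subset_closedBall hσ hp.1)
      (by have := hp.2; linarith), hp.1⟩)
  rw [hv, ENNReal.toReal_mul, ENNReal.toReal_ofReal (by positivity)] at this
  have hcap := capArea_sub_le (u := (τ - η) / r) (v := τ / r) (by gcongr; linarith)
  have e3 : τ / r - (τ - η) / r = η / r := by ring
  rw [e3] at hcap
  have h6 : r ^ 2 * capArea (τ / r) ≤ r ^ 2 * (capArea ((τ - η) / r) + 2 * (η / r)) := by gcongr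
  have e4 : r ^ 2 * (2 * (η / r)) = 2 * r * η := by field_simp
  have h7 : r ^ 2 * capArea ((τ - η) / r) ≤ ballArea Ω r a := this
  linarith [mul_add (r ^ 2) (capArea ((τ - η) / r)) (2 * (η / r))]

lemma ballArea_le_capArea (h : UnitBody Ω ρ R) {x : ℂ} (hd : DifferentiableAt ℝ (gauge Ω) x)
    (hx : x ≠ 0) {r : ℝ} (hr : 0 < r) :
    ballArea Ω r x ≤ r ^ 2 * capArea (gaugeDepth Ω x / r) := by
  obtain ⟨ν, hf⟩ := h.flatAt hd hx hr
  have := h.ballArea_le_of_flat hf hr (l := x) (by simp)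
  simpa using this

lemma secondDiff_smul (h : UnitBody Ω ρ R) {s w : ℝ} (hs : 0 < s) (hs1 : s ≤ 1) (x : ℂ) :
    s * secondDiff (gauge Ω) w x ≤ secondDiff (gauge Ω) w (s * x) := by
  have key : ∀ v : ℂ, s * (gauge Ω (x + v) + gauge Ω (x - v) - 2 * gauge Ω x) ≤
      gauge Ω (s * x + v) + gauge Ω (s * x - v) - 2 * gauge Ω (s * x) := by
    intro v
    have h1 := h.gauge_inv_two (x := s * x) (y := s * x + v) hs.le hs1
    have h2 := h.gauge_inv_two (x := s * x) (y := s * x - v) hs.le hs1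
    have e1 : (s * x : ℂ) + s * (s * x + v - s * x) = s * (x + v) := by ring
    have e2 : (s * x : ℂ) + s * (s * x - v - s * x) = s * (x - v) := by ring
    rw [e1, h.gauge_smul hs.le, h.gauge_smul hs.le] at h1
    rw [e2, h.gauge_smul hs.le, h.gauge_smul hs.le] at h2
    rw [h.gauge_smul hs.le]
    have h3 := h.gauge_add_le (s * x + v) (s * x - v)
    have e : (s * x : ℂ) + v + (s * x - v) = ((2 : ℝ) : ℂ) * (s * x) := by push_cast; ring
    rw [e, h.gauge_smul (by norm_num), h.gauge_smul hs.le] at h3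
    nlinarith
  rw [secondDiff, secondDiff, mul_add]
  exact add_le_add (key _) (key _)

lemma continuous_secondDiff (h : UnitBody Ω ρ R) (w : ℝ) : Continuous (secondDiff (gauge Ω) w) := by
  have := h.continuous_gauge
  unfold secondDiff
  fun_prop

end UnitBody

namespace UnitBody
variable {Ω : Set ℂ} {ρ R : ℝ}

lemma volume_annulus (h : UnitBody Ω ρ R) {s t : ℝ} (hs : 0 < s) (hst : s ≤ t) :
    (volume {x | s < gauge Ω x ∧ gauge Ω x ≤ t}).toReal = t ^ 2 - s ^ 2 := by
  have e : {x | s < gauge Ω x ∧ gauge Ω x ≤ t} = {x | gauge Ω x ≤ t} \ {x | gauge Ω x ≤ s} := by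
    ext x
    constructor
    · rintro ⟨h1, h2⟩; exact ⟨h2, not_le.2 h1⟩
    · rintro ⟨h1, h2⟩; exact ⟨not_le.1 h2, h1⟩
  have hsub : {x | gauge Ω x ≤ s} ⊆ {x | gauge Ω x ≤ t} := fun x hx => le_trans hx hst
  have hm : MeasurableSet {x | gauge Ω x ≤ s} := measurableSet_le h.measurable_gauge measurable_const
  rw [e, measure_sdiff hsub hm.nullMeasurableSet (by rw [h.volume_gauge_le hs]; finiteness),
    h.volume_gauge_le hs, h.volume_gauge_le (hs.trans_le hst), ← ENNReal.ofReal_sub _ (by positivity),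
    ENNReal.toReal_ofReal (by nlinarith)]

lemma integrableOn_of_continuous (h : UnitBody Ω ρ R) {f : ℂ → ℝ} (hf : Continuous f) :
    Integrable (fun x => Ω.indicator (fun _ => (1 : ℝ)) x * f x) := by
  have h1 := (hf.continuousOn (s := Ω)).integrableOn_compact (μ := volume) h.isCompact
  rw [← integrable_indicator_iff h.measurableSet] at h1
  refine h1.congr (Eventually.of_forall fun x => ?_)
  by_cases hx : x ∈ Ω <;> simp [hx]

lemma integral_difference_le (h : UnitBody Ω ρ R) {v : ℂ} {w : ℝ} (hv : ‖v‖ = w) (hw : 0 < w)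
    (hwρ : 2 * w ≤ ρ) :
    ∫ x, Ω.indicator (fun _ => (1 : ℝ)) x * (gauge Ω (x + v) + gauge Ω (x - v) - 2 * gauge Ω x) ≤
      4 * w ^ 2 / ρ ^ 2 := by
  have hρ := h.pos
  have hc := h.continuous_gauge
  set χ := Ω.indicator (fun _ => (1 : ℝ)) with hχ
  have hδ : w / ρ ≤ 1 / 2 := by rw [div_le_div_iff₀ hρ (by norm_num)]; linarith
  have hδ0 : 0 < w / ρ := by positivity
  have i1 : Integrable fun x => χ x * (gauge Ω (x + v) - gauge Ω x) :=
    h.integrableOn_of_continuous (by fun_prop)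
  have i2 : Integrable fun x => χ x * (gauge Ω x - gauge Ω (x - v)) :=
    h.integrableOn_of_continuous (by fun_prop)
  have i2' : Integrable fun x => χ (x + v) * (gauge Ω (x + v) - gauge Ω x) := by
    have := i2.comp_add_right v
    simpa using this
  have e2 : ∫ x, χ x * (gauge Ω x - gauge Ω (x - v)) =
      ∫ x, χ (x + v) * (gauge Ω (x + v) - gauge Ω x) := by
    rw [← integral_add_right_eq_self _ v]
    simp
  have e : ∫ x, χ x * (gauge Ω (x + v) + gauge Ω (x - v) - 2 * gauge Ω x) =
      ∫ x, (χ x * (gauge Ω (x + v) - gauge Ω x) - χ (x + v) * (gauge Ω (x + v) - gauge Ω x)) := by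
    rw [integral_sub i1 i2', ← e2, ← integral_sub i1 i2]
    congr 1; ext x; ring
  set V := {x | 1 - w / ρ ≤ gauge Ω x ∧ gauge Ω x ≤ 1 + w / ρ} with hV
  have hmV : MeasurableSet V := (measurableSet_le measurable_const h.measurable_gauge).inter
    (measurableSet_le h.measurable_gauge measurable_const)
  have hvV : ∀ ε : ℝ, 0 < ε → ε < 1 / 2 → volume V ≤ ENNReal.ofReal (4 * (w / ρ) + 4 * ε) := by
    intro ε hε hε2
    have h1 := h.volume_annulus (s := 1 - w / ρ - ε) (t := 1 + w / ρ) (by linarith) (by linarith)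
    have hsub : V ⊆ {x | 1 - w / ρ - ε < gauge Ω x ∧ gauge Ω x ≤ 1 + w / ρ} :=
      fun x hx => ⟨by linarith [hx.1], hx.2⟩
    refine (measure_mono hsub).trans ?_
    refine ENNReal.le_ofReal_iff_toReal_le ?_ (by positivity) |>.2 ?_
    · exact ne_top_of_le_ne_top (by rw [h.volume_gauge_le (s := 1 + w / ρ) (by positivity)]; finiteness)
        (measure_mono (t := {x | gauge Ω x ≤ 1 + w / ρ}) fun x hx => hx.2)
    · rw [h1]; nlinarith
  have hvV' : volume V ≤ ENNReal.ofReal (4 * (w / ρ)) := by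
    have ht : Tendsto (fun ε : ℝ => ENNReal.ofReal (4 * (w / ρ) + 4 * ε)) (𝓝[>] 0)
        (𝓝 (ENNReal.ofReal (4 * (w / ρ) + 4 * 0))) :=
      (ENNReal.continuous_ofReal.comp (by fun_prop)).continuousAt.tendsto.mono_left
        nhdsWithin_le_nhds
    rw [mul_zero, add_zero] at ht
    refine ge_of_tendsto ht ?_
    filter_upwards [Ioo_mem_nhdsGT (show (0 : ℝ) < 1 / 2 by norm_num)] with ε hε
    exact hvV ε hε.1 hε.2
  have hb : ∀ x, χ x * (gauge Ω (x + v) - gauge Ω x) - χ (x + v) * (gauge Ω (x + v) - gauge Ω x) ≤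
      V.indicator (fun _ => w / ρ) x := by
    intro x
    have hl := h.abs_gauge_sub_le (x + v) x
    rw [add_sub_cancel_left, hv, abs_le] at hl
    by_cases h1 : x ∈ Ω <;> by_cases h2 : x + v ∈ Ω
    · simp only [hχ, Set.indicator_of_mem h1, Set.indicator_of_mem h2, sub_self]
      exact Set.indicator_nonneg (fun _ _ => hδ0.le) _
    · have hxV : x ∈ V := by
        have a1 := h.gauge_le_one_iff.2 h1
        have a2 := not_le.1 (mt h.gauge_le_one_iff.1 h2)
        exact ⟨by linarith, by linarith⟩
      simp only [hχ, Set.indicator_of_mem h1, Set.indicator_of_notMem h2, Set.indicator_of_mem hxV]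
      linarith
    · have hxV : x ∈ V := by
        have a1 := h.gauge_le_one_iff.2 h2
        have a2 := not_le.1 (mt h.gauge_le_one_iff.1 h1)
        exact ⟨by linarith, by linarith⟩
      simp only [hχ, Set.indicator_of_mem h2, Set.indicator_of_notMem h1, Set.indicator_of_mem hxV]
      linarith
    · simp only [hχ, Set.indicator_of_notMem h1, Set.indicator_of_notMem h2]
      simp only [zero_mul, sub_zero]
      exact Set.indicator_nonneg (fun _ _ => hδ0.le) _
  rw [e]
  refine (integral_mono (i1.sub i2') ((integrable_indicator_iff hmV).2
    (integrableOn_const (hs := ne_top_of_le_ne_top ENNReal.ofReal_ne_top hvV'))) hb).trans ?_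
  rw [integral_indicator hmV, setIntegral_const, smul_eq_mul]
  have h9 : volume.real V ≤ 4 * (w / ρ) := ENNReal.toReal_le_of_le_ofReal (by positivity) hvV'
  calc volume.real V * (w / ρ) ≤ 4 * (w / ρ) * (w / ρ) := by gcongr
    _ = _ := by field_simp

lemma integral_secondDiff_le (h : UnitBody Ω ρ R) {w : ℝ} (hw : 0 < w) (hwρ : 2 * w ≤ ρ) :
    ∫ x, Ω.indicator (fun _ => (1 : ℝ)) x * secondDiff (gauge Ω) w x ≤ 8 * w ^ 2 / ρ ^ 2 := by
  have hc := h.continuous_gauge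
  have h1 := h.integral_difference_le (v := (w : ℂ)) (w := w) (by simp [abs_of_pos hw]) hw hwρ
  have h2 := h.integral_difference_le (v := (w * Complex.I : ℂ)) (w := w)
    (by simp [abs_of_pos hw]) hw hwρ
  have h3 := integral_add (h.integrableOn_of_continuous (f := fun x =>
    gauge Ω (x + w) + gauge Ω (x - w) - 2 * gauge Ω x) (by fun_prop))
    (h.integrableOn_of_continuous (f := fun x =>
    gauge Ω (x + w * Complex.I) + gauge Ω (x - w * Complex.I) - 2 * gauge Ω x) (by fun_prop))
  have e : ∫ x, Ω.indicator (fun _ => (1 : ℝ)) x * secondDiff (gauge Ω) w x = _ := Eq.trans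
    (by congr 1; ext x; rw [secondDiff]; ring) h3
  rw [e]
  refine (add_le_add h1 h2).trans (le_of_eq (by ring))

lemma volume_secondDiff_gt (h : UnitBody Ω ρ R) {w η : ℝ} (hw : 0 < w) (hwρ : 2 * w ≤ ρ)
    (hη : 0 < η) : (volume (Ω ∩ {x | η ≤ secondDiff (gauge Ω) w x})).toReal ≤
      8 * w ^ 2 / (ρ ^ 2 * η) := by
  have h1 := mul_meas_ge_le_integral_of_nonneg (μ := volume)
    (f := fun x => Ω.indicator (fun _ => (1 : ℝ)) x * secondDiff (gauge Ω) w x)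
    (Eventually.of_forall fun x => mul_nonneg (Set.indicator_nonneg (fun _ _ => zero_le_one) _)
      (h.secondDiff_nonneg w x)) (h.integrableOn_of_continuous (h.continuous_secondDiff w)) η
  have e : {x | η ≤ Ω.indicator (fun _ => (1 : ℝ)) x * secondDiff (gauge Ω) w x} =
      Ω ∩ {x | η ≤ secondDiff (gauge Ω) w x} := by
    ext x
    by_cases hx : x ∈ Ω
    · simp [hx]
    · simp [hx, hη]
  rw [e] at h1
  have h2 := h1.trans (h.integral_secondDiff_le hw hwρ)
  have hρ := h.pos
  rw [le_div_iff₀ (by positivity)]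
  rw [le_div_iff₀ (by positivity)] at h2
  have h3 : volume.real (Ω ∩ {x | η ≤ secondDiff (gauge Ω) w x}) =
    (volume (Ω ∩ {x | η ≤ secondDiff (gauge Ω) w x})).toReal := rfl
  rw [h3] at h2
  linarith

/-- Points near the boundary at which the body is not flat at scale `σ` up to error `η`. -/
def _root_.roughSet (Ω : Set ℂ) (R δ σ η : ℝ) : Set ℂ :=
  Ω ∩ {x | 1 - δ < gauge Ω x ∧
    (¬ DifferentiableAt ℝ (gauge Ω) x ∨ η ≤ R * secondDiff (gauge Ω) (2 * σ) x)}

lemma measurableSet_roughSet (h : UnitBody Ω ρ R) (δ σ η : ℝ) :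
    MeasurableSet (roughSet Ω R δ σ η) := by
  refine h.measurableSet.inter ((measurableSet_lt measurable_const h.measurable_gauge).inter ?_)
  exact (measurableSet_of_differentiableAt ℝ _).compl.union (measurableSet_le measurable_const
    ((h.continuous_secondDiff _).measurable.const_mul R))

lemma ae_differentiableAt (h : UnitBody Ω ρ R) :
    ∀ᵐ x : ℂ, DifferentiableAt ℝ (gauge Ω) x := h.lipschitz.ae_differentiableAt

lemma volume_roughSet_le (h : UnitBody Ω ρ R) {δ σ η : ℝ} (hδ : 0 < δ) (hδ1 : δ ≤ 1 / 4)
    (hσ : 0 < σ) (hσρ : 4 * σ ≤ ρ) (hη : 0 < η) :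
    (volume (roughSet Ω R δ σ η)).toReal ≤ 1024 * R * δ * σ ^ 2 / (ρ ^ 2 * η) := by
  have hR := h.R_pos
  have hρ := h.pos
  set Z := Ω ∩ {x | 1 - δ < gauge Ω x ∧ η / R ≤ secondDiff (gauge Ω) (2 * σ) x} with hZ
  have hZm : MeasurableSet Z :=
    h.measurableSet.inter ((measurableSet_lt measurable_const h.measurable_gauge).inter
      (measurableSet_le measurable_const (h.continuous_secondDiff _).measurable))
  have hZle : volume (roughSet Ω R δ σ η) ≤ volume Z := by
    refine measure_mono_ae ?_
    filter_upwards [h.ae_differentiableAt] with x hx hxr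
    obtain ⟨h1, h2, h3⟩ := hxr
    refine ⟨h1, h2, ?_⟩
    rw [div_le_iff₀ hR, mul_comm]
    exact h3.resolve_left (not_not.2 hx)
  refine (ENNReal.toReal_mono (h.volume_ne_top _) hZle).trans ?_
  set J := ⌊1 / (2 * δ)⌋₊ with hJ
  have hJ1 : (J : ℝ) * δ ≤ 1 / 2 := by
    have : (J : ℝ) ≤ 1 / (2 * δ) := Nat.floor_le (by positivity)
    rw [le_div_iff₀ (by positivity)] at this; linarith
  have hJ2 : 1 / 4 ≤ (J : ℝ) * δ := by
    have : 1 / (2 * δ) < J + 1 := Nat.lt_floor_add_one _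
    rw [div_lt_iff₀ (by positivity)] at this; nlinarith
  have hlam : ∀ j ∈ Finset.range J, 1 / 2 ≤ (1 - δ) ^ j := by
    intro j hj
    have hjJ : (j : ℝ) ≤ J := by exact_mod_cast (Finset.mem_range.1 hj).le
    have := one_add_mul_le_pow (show (-2 : ℝ) ≤ -δ by linarith) j
    rw [← sub_eq_add_neg] at this
    nlinarith
  have hlam1 : ∀ j : ℕ, (1 - δ) ^ j ≤ 1 := fun j => pow_le_one₀ (by linarith) (by linarith)
  have hlam0 : ∀ j : ℕ, 0 < (1 - δ) ^ j := fun j => pow_pos (by linarith) j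
  set S : ℕ → Set ℂ := fun j => (fun z : ℂ => (0 : ℂ) + (((1 - δ) ^ j : ℝ) : ℂ) * z) '' Z with hS
  have hSm : ∀ j, MeasurableSet (S j) := by
    intro j
    have hne : (((1 - δ) ^ j : ℝ) : ℂ) ≠ 0 := by exact_mod_cast (hlam0 j).ne'
    have e : S j = (fun z : ℂ => (((1 - δ) ^ j : ℝ) : ℂ)⁻¹ * z) ⁻¹' Z := by
      ext z
      constructor
      · rintro ⟨y, hy, rfl⟩
        simp only [zero_add, Set.mem_preimage, ← mul_assoc, inv_mul_cancel₀ hne, one_mul]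
        exact hy
      · intro hz
        exact ⟨_, hz, by simp only [zero_add, ← mul_assoc, mul_inv_cancel₀ hne, one_mul]⟩
    rw [e]
    exact hZm.preimage (measurable_id.const_mul _)
  have hSg : ∀ j, ∀ z ∈ S j, (1 - δ) ^ (j + 1) < gauge Ω z ∧ gauge Ω z ≤ (1 - δ) ^ j := by
    rintro j _ ⟨y, ⟨hy1, hy2, -⟩, rfl⟩
    have hy3 := h.gauge_le_one_iff.2 hy1
    simp only [zero_add]
    rw [h.gauge_smul (hlam0 j).le, pow_succ]
    exact ⟨mul_lt_mul_of_pos_left hy2 (hlam0 j), mul_le_of_le_one_right (hlam0 j).le hy3⟩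
  have hdisj : Set.PairwiseDisjoint (↑(Finset.range J)) S := by
    have aux : ∀ i j : ℕ, i < j → Disjoint (S i) (S j) := by
      intro i j hij
      rw [Set.disjoint_left]
      intro z h1 h2
      have a1 := (hSg i z h1).1
      have a2 := (hSg j z h2).2
      have a3 : (1 - δ) ^ j ≤ (1 - δ) ^ (i + 1) :=
        pow_le_pow_of_le_one (by linarith) (by linarith) hij
      linarith
    intro i _ j _ hij
    rcases lt_or_gt_of_ne hij with h1 | h1
    · exact aux i j h1
    · exact (aux j i h1).symm
  have hunion : (⋃ j ∈ Finset.range J, S j) ⊆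
      Ω ∩ {x | η / (2 * R) ≤ secondDiff (gauge Ω) (2 * σ) x} := by
    intro z hz
    simp only [Set.mem_iUnion] at hz
    obtain ⟨j, hj, hz⟩ := hz
    refine ⟨h.gauge_le_one_iff.1 ((hSg j z hz).2.trans (hlam1 j)), ?_⟩
    obtain ⟨y, ⟨hy1, hy2, hy3⟩, rfl⟩ := hz
    simp only [zero_add]
    have a1 := h.secondDiff_smul (w := 2 * σ) (hlam0 j) (hlam1 j) y
    have a2 := hlam j hj
    have a3 : 1 / 2 * (η / R) ≤ (1 - δ) ^ j * secondDiff (gauge Ω) (2 * σ) y := by gcongr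
    have e : η / (2 * R) = 1 / 2 * (η / R) := by field_simp
    show η / (2 * R) ≤ _
    rw [e]; linarith
  have hmeas := ENNReal.toReal_mono (h.volume_ne_top _) (measure_mono (μ := volume) hunion)
  rw [measure_biUnion_finset hdisj (fun j _ => hSm j), ENNReal.toReal_sum (fun j _ => by
    rw [hS]; simp only; rw [volume_image_add_smul]
    exact ENNReal.mul_ne_top ENNReal.ofReal_ne_top (h.volume_ne_top _))] at hmeas
  have hterm : ∀ j ∈ Finset.range J, 1 / 4 * (volume Z).toReal ≤ (volume (S j)).toReal := by
    intro j hj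
    rw [hS]; simp only
    rw [volume_image_add_smul, ENNReal.toReal_mul, ENNReal.toReal_ofReal (by positivity)]
    have := hlam j hj
    gcongr
    nlinarith
  have hsum := Finset.sum_le_sum hterm
  rw [Finset.sum_const, Finset.card_range, nsmul_eq_mul] at hsum
  have hb := h.volume_secondDiff_gt (w := 2 * σ) (η := η / (2 * R)) (by positivity) (by linarith)
    (by positivity)
  have htot := (hsum.trans hmeas).trans hb
  have hZ0 : 0 ≤ (volume Z).toReal := ENNReal.toReal_nonneg
  have e : 8 * (2 * σ) ^ 2 / (ρ ^ 2 * (η / (2 * R))) = 64 * R * σ ^ 2 / (ρ ^ 2 * η) := by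
    field_simp; ring
  rw [e] at htot
  have h10 : 1 / 16 * (volume Z).toReal ≤ δ * (J * (1 / 4 * (volume Z).toReal)) := by nlinarith
  have h11 : δ * (J * (1 / 4 * (volume Z).toReal)) ≤ δ * (64 * R * σ ^ 2 / (ρ ^ 2 * η)) := by gcongr
  have e2 : 1024 * R * δ * σ ^ 2 / (ρ ^ 2 * η) = 16 * (δ * (64 * R * σ ^ 2 / (ρ ^ 2 * η))) := by
    ring
  rw [e2]; linarith

/-- Outside the rough set every point of the body is in flat position. -/
lemma exists_flatAt (h : UnitBody Ω ρ R) {δ σ η : ℝ} (hδ1 : δ < 1) (hσ : 0 < σ)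
    (hσδ : σ / ρ ≤ δ) {x : ℂ} (hx : x ∈ Ω) (hxr : x ∉ roughSet Ω R δ σ η) :
    ∃ ν τ, FlatAt Ω σ η x ν τ := by
  by_cases h1 : 1 - δ < gauge Ω x
  · have h2 : ¬ (¬ DifferentiableAt ℝ (gauge Ω) x ∨ η ≤ R * secondDiff (gauge Ω) (2 * σ) x) :=
      fun hc => hxr ⟨hx, h1, hc⟩
    push Not at h2
    have hx0 : x ≠ 0 := by
      rintro rfl
      rw [gauge_zero] at h1; linarith
    obtain ⟨ν, hν⟩ := h.flatAt h2.1 hx0 hσ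
    exact ⟨ν, _, hν.mono h2.2.le⟩
  · exact ⟨1, σ, FlatAt.of_closedBall_subset (h.closedBall_subset (by linarith))⟩

end UnitBody

lemma poissonLow_add_le (k : ℕ) {a b : ℝ} (ha : 0 ≤ a) (hb : 0 ≤ b) :
    poissonLow k (a + b) ≤ poissonLow k a * poissonLow k b := by
  have h1 : ∑ s ∈ Finset.range (k + 1), (a + b) ^ s / (s.factorial : ℝ) ≤
      (∑ s ∈ Finset.range (k + 1), a ^ s / (s.factorial : ℝ)) *
        ∑ s ∈ Finset.range (k + 1), b ^ s / (s.factorial : ℝ) := by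
    have h2 : ∀ s ∈ Finset.range (k + 1), (a + b) ^ s / (s.factorial : ℝ) =
        ∑ i ∈ Finset.range (s + 1),
          a ^ i / (i.factorial : ℝ) * (b ^ (s - i) / (s - i).factorial) := by
      intro s _
      rw [add_pow, Finset.sum_div]
      refine Finset.sum_congr rfl fun i hi => ?_
      have hi' : i ≤ s := Nat.lt_succ_iff.1 (Finset.mem_range.1 hi)
      rw [Nat.cast_choose ℝ hi']
      have := Nat.factorial_ne_zero s
      field_simp
    rw [Finset.sum_congr rfl h2, Finset.sum_range_diag_flip (k + 1)
      fun i j => a ^ i / (i.factorial : ℝ) * (b ^ j / j.factorial), Finset.sum_mul_sum]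
    refine Finset.sum_le_sum fun i _ => Finset.sum_le_sum_of_subset_of_nonneg
      (Finset.range_mono (Nat.sub_le _ _)) fun j _ _ => by positivity
  rw [poissonLow, poissonLow, poissonLow, neg_add, Real.exp_add]
  have := mul_le_mul_of_nonneg_left h1 (mul_nonneg (exp_pos (-a)).le (exp_pos (-b)).le)
  linarith

/-- The integral of the Poisson lower tail over the plane. -/
noncomputable def poissonPlane (k : ℕ) : ℝ := ∫ v : ℂ, poissonLow k ‖v‖

lemma integrable_poissonLow_norm (k : ℕ) : Integrable fun v : ℂ => poissonLow k ‖v‖ := by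
  obtain ⟨C, hC, h⟩ := poissonLow_le_pow k 3
  have h1 : Integrable fun v : ℂ => (1 + ‖v‖) ^ (-(3 : ℝ)) :=
    integrable_one_add_norm (by rw [Complex.finrank_real_complex]; norm_num)
  refine (h1.const_mul C).mono' ((continuous_poissonLow k).comp
    continuous_norm).aestronglyMeasurable (Eventually.of_forall fun v => ?_)
  rw [Real.norm_of_nonneg (poissonLow_pos k (norm_nonneg v)).le, Real.rpow_neg (by positivity)]
  refine (h _ (norm_nonneg v)).trans (le_of_eq ?_)
  rw [div_eq_mul_inv]
  norm_cast

lemma poissonPlane_nonneg (k : ℕ) : 0 ≤ poissonPlane k :=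
  integral_nonneg fun v => (poissonLow_pos k (norm_nonneg v)).le

lemma lintegral_poissonLow_norm (k : ℕ) {c : ℝ} (hc : 0 < c) :
    ∫⁻ v : ℂ, ENNReal.ofReal (poissonLow k (c * ‖v‖)) = ENNReal.ofReal (poissonPlane k / c ^ 2) := by
  have e : ∀ v : ℂ, c * ‖v‖ = ‖c • v‖ := fun v => by
    rw [norm_smul, Real.norm_of_nonneg hc.le]
  simp only [e]
  rw [← ofReal_integral_eq_lintegral_ofReal
    ((integrable_poissonLow_norm k).comp_smul hc.ne')
    (Eventually.of_forall fun v => (poissonLow_pos k (norm_nonneg _)).le),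
    Measure.integral_comp_smul volume (fun v : ℂ => poissonLow k ‖v‖) c,
    Complex.finrank_real_complex, smul_eq_mul, abs_of_nonneg (by positivity), poissonPlane,
    inv_mul_eq_div]

/-- Decay constant in the area bounds for pairs of nearby points. -/
noncomputable def pairConst (D : ℝ) : ℝ := min (coneConst / 4) (1 / (40 * D ^ 2))

lemma pairConst_pos {D : ℝ} (hD : 0 < D) : 0 < pairConst D :=
  lt_min (by have := coneConst_pos; positivity) (by positivity)

/-- Majorant for the probability that two nearby points have few neighbours; `Z` is the
exceptional set where the boundary is not flat. -/
noncomputable def pairKernel (Ω Z : Set ℂ) (R D : ℝ) (k n : ℕ) (r : ℝ) (x y : ℂ) : ENNReal :=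
  Z.indicator 1 x * (closedBall (0 : ℂ) (D * r)).indicator
      (fun _ => ENNReal.ofReal (poissonLow k (n * (r ^ 2 / (16 * R ^ 2))))) (x - y) +
    (ENNReal.ofReal 3 * (lowDensity (volume.restrict Ω) k n r x +
      lowDensity (volume.restrict Ω) k n r y) *
        ENNReal.ofReal (poissonLow k (pairConst D * n * r * ‖x - y‖)) +
    (Ωᶜ.indicator 1 x + Ωᶜ.indicator 1 y))

section
variable {Ω Z : Set ℂ} {ρ R D r η : ℝ} {k n : ℕ}

lemma UnitBody.measurable_pairKernel (h : UnitBody Ω ρ R) (hZ : MeasurableSet Z) :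
    Measurable (Function.uncurry (pairKernel Ω Z R D k n r)) := by
  have := h.isProbabilityMeasure
  have h1 := measurable_lowDensity (volume.restrict Ω) k n r
  have h2 : Measurable (Z.indicator (1 : ℂ → ENNReal)) := measurable_one.indicator hZ
  have h3 : Measurable (Ωᶜ.indicator (1 : ℂ → ENNReal)) :=
    measurable_one.indicator h.measurableSet.compl
  have h4 : Measurable ((closedBall (0 : ℂ) (D * r)).indicator
      (fun _ => ENNReal.ofReal (poissonLow k (n * (r ^ 2 / (16 * R ^ 2)))))) :=
    measurable_const.indicator measurableSet_closedBall
  have h5 : Measurable (fun p : ℂ × ℂ => p.1 - p.2) := by fun_prop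
  have h6 : Measurable fun p : ℂ × ℂ =>
      ENNReal.ofReal (poissonLow k (pairConst D * n * r * ‖p.1 - p.2‖)) :=
    ENNReal.measurable_ofReal.comp ((continuous_poissonLow k).comp (by fun_prop)).measurable
  unfold pairKernel Function.uncurry
  exact ((h2.comp measurable_fst).mul (h4.comp h5)).add
    (((measurable_const.mul ((h1.comp measurable_fst).add (h1.comp measurable_snd))).mul h6).add
      ((h3.comp measurable_fst).add (h3.comp measurable_snd)))

lemma UnitBody.lintegral_pairKernel_le (h : UnitBody Ω ρ R) (hZ : MeasurableSet Z) (hD : 0 < D)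
    (hr : 0 < r) (hn : 0 < n) :
    ∫⁻ x, ∫⁻ y, pairKernel Ω Z R D k n r x y ∂volume.restrict Ω ∂volume.restrict Ω ≤
      volume Z * ENNReal.ofReal (poissonLow k (n * (r ^ 2 / (16 * R ^ 2))) * (π * (D * r) ^ 2)) +
      ENNReal.ofReal (6 * (poissonPlane k / (pairConst D * n * r) ^ 2)) *
        ∫⁻ x, lowDensity (volume.restrict Ω) k n r x ∂volume.restrict Ω := by
  have := h.isProbabilityMeasure
  have hcn : 0 < pairConst D * n * r := by have := pairConst_pos hD; positivity
  set μ := volume.restrict Ω with hμ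
  have h1 := measurable_lowDensity μ k n r
  have h2 : Measurable (Z.indicator (1 : ℂ → ENNReal)) := measurable_one.indicator hZ
  have h3 : Measurable (Ωᶜ.indicator (1 : ℂ → ENNReal)) :=
    measurable_one.indicator h.measurableSet.compl
  have h4 : Measurable ((closedBall (0 : ℂ) (D * r)).indicator
      (fun _ => ENNReal.ofReal (poissonLow k (n * (r ^ 2 / (16 * R ^ 2)))))) :=
    measurable_const.indicator measurableSet_closedBall
  have h6 : Measurable fun v : ℂ =>
      ENNReal.ofReal (poissonLow k (pairConst D * n * r * ‖v‖)) :=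
    ENNReal.measurable_ofReal.comp ((continuous_poissonLow k).comp (by fun_prop)).measurable
  have hs : ∀ (f : ℂ → ENNReal) (x : ℂ), ∫⁻ y, f (x - y) ∂μ ≤ ∫⁻ y, f y := fun f x => by
    refine (lintegral_mono' Measure.restrict_le_self le_rfl).trans ?_
    rw [lintegral_sub_left_eq_self f x]
  have hs' : ∀ (f : ℂ → ENNReal) (x : ℂ), ∫⁻ y, f (y - x) ∂μ ≤ ∫⁻ y, f y := fun f x => by
    refine (lintegral_mono' Measure.restrict_le_self le_rfl).trans ?_
    rw [lintegral_sub_right_eq_self f x]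
  set f4 := (closedBall (0 : ℂ) (D * r)).indicator
      (fun _ => ENNReal.ofReal (poissonLow k (n * (r ^ 2 / (16 * R ^ 2))))) with hf4
  set f6 := fun v : ℂ => ENNReal.ofReal (poissonLow k (pairConst D * n * r * ‖v‖)) with hf6
  have hI4 : ∫⁻ y, f4 y = ENNReal.ofReal
      (poissonLow k (n * (r ^ 2 / (16 * R ^ 2))) * (π * (D * r) ^ 2)) := by
    rw [hf4, lintegral_indicator measurableSet_closedBall, setLIntegral_const,
      Complex.volume_closedBall, ENNReal.ofReal_mul (poissonLow_pos k (by positivity)).le,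
      ENNReal.ofReal_mul pi_pos.le, ENNReal.ofReal_pow (by positivity), mul_comm (ENNReal.ofReal π)]
    congr 2
    rw [← NNReal.coe_real_pi, ENNReal.ofReal_coe_nnreal]
  have hI6 : ∫⁻ y, f6 y = ENNReal.ofReal (poissonPlane k / (pairConst D * n * r) ^ 2) :=
    lintegral_poissonLow_norm k hcn
  have hI3 : ∫⁻ x, Ωᶜ.indicator (1 : ℂ → ENNReal) x ∂μ = 0 := by
    rw [lintegral_indicator_one h.measurableSet.compl, hμ, Measure.restrict_apply
      h.measurableSet.compl]
    simp
  have hIZ : ∫⁻ x, Z.indicator (1 : ℂ → ENNReal) x ∂μ ≤ volume Z := by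
    rw [lintegral_indicator_one hZ]
    exact Measure.restrict_le_self _
  have s4 : ∀ x, Measurable fun y => f4 (x - y) := fun x =>
    h4.comp (by fun_prop : Measurable fun y => x - y)
  have s6 : ∀ x, Measurable fun y => f6 (x - y) := fun x =>
    h6.comp (by fun_prop : Measurable fun y => x - y)
  have s6' : ∀ x, Measurable fun y => f6 (y - x) := fun x =>
    h6.comp (by fun_prop : Measurable fun y => y - x)
  have m6 : Measurable fun p : ℂ × ℂ => f6 (p.1 - p.2) := h6.comp (by fun_prop)
  have m4 : Measurable fun p : ℂ × ℂ => f4 (p.1 - p.2) := h4.comp (by fun_prop)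
  have A1 : ∫⁻ x, ∫⁻ y, Z.indicator 1 x * f4 (x - y) ∂μ ∂μ ≤ volume Z * ∫⁻ y, f4 y := by
    calc _ ≤ ∫⁻ x, Z.indicator 1 x * (∫⁻ y, f4 y) ∂μ := by
          refine lintegral_mono fun x => ?_
          rw [lintegral_const_mul _ (s4 x)]
          exact mul_le_mul' le_rfl (hs f4 x)
      _ ≤ _ := by
          rw [lintegral_mul_const _ h2]
          exact mul_le_mul' hIZ le_rfl
  have A2 : ∫⁻ x, ∫⁻ y, lowDensity μ k n r x * f6 (x - y) ∂μ ∂μ ≤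
      (∫⁻ x, lowDensity μ k n r x ∂μ) * ∫⁻ y, f6 y := by
    calc _ ≤ ∫⁻ x, lowDensity μ k n r x * (∫⁻ y, f6 y) ∂μ := by
          refine lintegral_mono fun x => ?_
          rw [lintegral_const_mul _ (s6 x)]
          exact mul_le_mul' le_rfl (hs f6 x)
      _ ≤ _ := by rw [lintegral_mul_const _ h1]
  have A3 : ∫⁻ x, ∫⁻ y, lowDensity μ k n r y * f6 (x - y) ∂μ ∂μ ≤
      (∫⁻ x, lowDensity μ k n r x ∂μ) * ∫⁻ y, f6 y := by
    rw [lintegral_lintegral_swap]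
    · calc _ ≤ ∫⁻ x, lowDensity μ k n r x * (∫⁻ y, f6 y) ∂μ := by
            refine lintegral_mono fun x => ?_
            rw [lintegral_const_mul _ (s6' x)]
            exact mul_le_mul' le_rfl (hs' f6 x)
        _ ≤ _ := by rw [lintegral_mul_const _ h1]
    · exact ((h1.comp measurable_snd).mul m6).aemeasurable
  have key : ∀ x, ∫⁻ y, pairKernel Ω Z R D k n r x y ∂μ =
      ∫⁻ y, Z.indicator 1 x * f4 (x - y) ∂μ +
      (ENNReal.ofReal 3 * (∫⁻ y, lowDensity μ k n r x * f6 (x - y) ∂μ +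
        ∫⁻ y, lowDensity μ k n r y * f6 (x - y) ∂μ) + Ωᶜ.indicator 1 x) := by
    intro x
    have e : ∀ y, pairKernel Ω Z R D k n r x y = Z.indicator 1 x * f4 (x - y) +
        (ENNReal.ofReal 3 * (lowDensity μ k n r x * f6 (x - y) + lowDensity μ k n r y * f6 (x - y))
          + (Ωᶜ.indicator 1 x + Ωᶜ.indicator 1 y)) := fun y => by
      rw [← add_mul, ← mul_assoc]; rfl
    have n1 : Measurable fun y => Z.indicator 1 x * f4 (x - y) := measurable_const.mul (s4 x)
    have n2 : Measurable fun y => lowDensity μ k n r y * f6 (x - y) := h1.mul (s6 x)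
    have n3 : Measurable fun y => lowDensity μ k n r x * f6 (x - y) := measurable_const.mul (s6 x)
    have n4 : Measurable fun y => (Ωᶜ.indicator (1 : ℂ → ENNReal) x + Ωᶜ.indicator 1 y) :=
      measurable_const.add h3
    have n5 : Measurable fun y => lowDensity μ k n r x * f6 (x - y) + lowDensity μ k n r y *
      f6 (x - y) := n3.add n2
    simp only [e]
    rw [lintegral_add_left n1, lintegral_add_right _ n4, lintegral_add_right _ h3, hI3, add_zero,
      lintegral_const, measure_univ, mul_one, lintegral_const_mul _ n5,
      lintegral_add_right _ n2]
  have m7 : Measurable fun x => ∫⁻ y, lowDensity μ k n r x * f6 (x - y) ∂μ :=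
    Measurable.lintegral_prod_right' (f := fun p : ℂ × ℂ => lowDensity μ k n r p.1 * f6 (p.1 - p.2))
      ((h1.comp measurable_fst).mul m6)
  have m8 : Measurable fun x => ∫⁻ y, lowDensity μ k n r y * f6 (x - y) ∂μ :=
    Measurable.lintegral_prod_right' (f := fun p : ℂ × ℂ => lowDensity μ k n r p.2 * f6 (p.1 - p.2))
      ((h1.comp measurable_snd).mul m6)
  have m9 : Measurable fun x => ∫⁻ y, lowDensity μ k n r x * f6 (x - y) ∂μ +
      ∫⁻ y, lowDensity μ k n r y * f6 (x - y) ∂μ := m7.add m8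
  have m10 : Measurable fun x => ENNReal.ofReal 3 * (∫⁻ y, lowDensity μ k n r x * f6 (x - y) ∂μ +
      ∫⁻ y, lowDensity μ k n r y * f6 (x - y) ∂μ) + Ωᶜ.indicator 1 x :=
    (measurable_const.mul m9).add h3
  simp only [key]
  rw [lintegral_add_right _ m10,
    lintegral_add_right _ h3, hI3, add_zero, lintegral_const_mul _ m9,
    lintegral_add_right _ m8, ← hI4]
  refine add_le_add A1 ((mul_le_mul' le_rfl (add_le_add A2 A3)).trans (le_of_eq ?_))
  rw [hI6, show (6 : ℝ) * (poissonPlane k / (pairConst D * n * r) ^ 2) =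
    3 * (poissonPlane k / (pairConst D * n * r) ^ 2 + poissonPlane k / (pairConst D * n * r) ^ 2) by
      ring, ENNReal.ofReal_mul (by norm_num), ENNReal.ofReal_add]
  · ring
  all_goals exact div_nonneg (poissonPlane_nonneg k) (by positivity)

lemma UnitBody.pairBound_pairKernel (h : UnitBody Ω ρ R) (hr : 0 < r) (hr1 : r ≤ 2 * R)
    (hD : 2 ≤ D) (hη : η ≤ r / 4)
    (hZ : ∀ x ∈ Ω, x ∉ Z → ∃ ν τ, FlatAt Ω ((D + 2) * r) η x ν τ) :
    PairBound (volume.restrict Ω) k n r (pairKernel Ω Z R D k n r) := by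
  have := h.isProbabilityMeasure
  have h3 : (1 : ENNReal) ≤ ENNReal.ofReal 3 := by
    rw [ENNReal.one_le_ofReal]; norm_num
  have hc := pairConst_pos (D := D) (by linarith)
  intro x y hxy
  have one : ENNReal.ofReal (poissonLow k (n * (volume.restrict Ω).real (∅ : Set ℂ))) = 1 := by
    simp [poissonLow_zero]
  by_cases hx : x ∈ Ω
  swap
  · refine ⟨∅, ∅, .empty, .empty, by simp, by simp, by simp, ?_⟩
    rw [one, mul_one, pairKernel]
    refine le_trans (le_trans ?_ le_self_add) (le_add_self.trans le_add_self)
    rw [Set.indicator_of_mem (Set.mem_compl hx), Pi.one_apply]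
  by_cases hy : y ∈ Ω
  swap
  · refine ⟨∅, ∅, .empty, .empty, by simp, by simp, by simp, ?_⟩
    rw [one, mul_one, pairKernel]
    refine le_trans (le_trans ?_ le_add_self) (le_add_self.trans le_add_self)
    rw [Set.indicator_of_mem (Set.mem_compl hy), Pi.one_apply]
  by_cases hxZ : x ∈ Z
  · refine ⟨closedBall x r, ∅, measurableSet_closedBall, .empty, by simp, by simp, by simp, ?_⟩
    rw [one, mul_one, pairKernel]
    refine le_trans ?_ le_self_add
    rw [Set.indicator_of_mem hxZ, Set.indicator_of_mem, Pi.one_apply, one_mul]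
    · refine ENNReal.ofReal_le_ofReal (poissonLow_le (by positivity) ?_)
      refine mul_le_mul_of_nonneg_left (le_trans ?_ (h.le_ballArea hx hr.le hr1)) (by positivity)
      have := h.R_pos
      gcongr
      norm_num
    · rw [mem_closedBall_zero_iff, ← dist_eq_norm]; nlinarith
  obtain ⟨ν, τ, hf⟩ := hZ x hx hxZ
  have cone : ∀ {p q : ℂ}, q ∈ Ω → dist q x ≤ 2 * r → dist q p = dist x y →
      0 ≤ inner ℝ ν (q - p) →
      ENNReal.ofReal (poissonLow k (n * (volume.restrict Ω).real (closedBall q r \ closedBall p r)))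
        ≤ ENNReal.ofReal (poissonLow k (pairConst D * n * r * ‖x - y‖)) := by
    intro p q hq hqx hpq ho
    refine ENNReal.ofReal_le_ofReal (poissonLow_le (by positivity) ?_)
    by_cases hne : p = q
    · rw [← dist_eq_norm, ← hpq, hne, dist_self, mul_zero]; positivity
    · have := h.crescent_area hf hr (by nlinarith) hη hq hqx (by rw [hpq]; exact hxy) hne ho
      rw [hpq] at this
      have h5 : pairConst D ≤ coneConst / 4 := min_le_left _ _
      rw [← dist_eq_norm]
      calc pairConst D * n * r * dist x y = n * (pairConst D * (r * dist x y)) := by ring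
        _ ≤ n * (coneConst / 4 * (r * dist x y)) := by gcongr
        _ ≤ _ := by
          refine mul_le_mul_of_nonneg_left (le_trans (le_of_eq (by ring)) this) (by positivity)
  have fin : ∀ {A B : ENNReal}, (A ≤ lowDensity (volume.restrict Ω) k n r x +
      lowDensity (volume.restrict Ω) k n r y) →
      B ≤ ENNReal.ofReal (poissonLow k (pairConst D * n * r * ‖x - y‖)) →
      A * B ≤ pairKernel Ω Z R D k n r x y := by
    intro A B hA hB
    rw [pairKernel]
    refine le_trans ?_ (le_trans le_self_add le_add_self)
    refine mul_le_mul' ?_ hB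
    calc A = 1 * A := (one_mul A).symm
      _ ≤ _ := mul_le_mul' h3 hA
  rcases le_total 0 (inner ℝ ν (y - x)) with ho | ho
  · refine ⟨closedBall x r, closedBall y r \ closedBall x r, measurableSet_closedBall,
      measurableSet_closedBall.diff measurableSet_closedBall, Set.disjoint_sdiff_right,
      Or.inl le_rfl, Or.inr Set.sdiff_subset, fin le_self_add
        (cone hy (by rw [dist_comm]; exact hxy) (dist_comm _ _) ho)⟩
  · refine ⟨closedBall y r, closedBall x r \ closedBall y r, measurableSet_closedBall,
      measurableSet_closedBall.diff measurableSet_closedBall, Set.disjoint_sdiff_right,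
      Or.inr le_rfl, Or.inl Set.sdiff_subset, fin le_add_self
        (cone hx (by rw [dist_self]; positivity) rfl ?_)⟩
    rw [← neg_sub, inner_neg_right]; linarith

lemma UnitBody.pairRegion_le_pairKernel (h : UnitBody Ω ρ R) (hr : 0 < r) (hr1 : r ≤ 2 * R)
    (hD : 2 ≤ D) (hDR : 4 * R * (D * r) ≤ 1) (hη0 : 0 ≤ η) (hη : η ≤ r / 4)
    (hnη : 3 * n * r * η ≤ 1)
    (hZ : ∀ x ∈ Ω, x ∉ Z → ∃ ν τ, FlatAt Ω ((D + 2) * r) η x ν τ)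
    {x y : ℂ} (hx : x ∈ Ω) (hy : y ∈ Ω) (hxy : x ≠ y) (hd : dist x y ≤ D * r) :
    ENNReal.ofReal (poissonLow k (n * (volume.restrict Ω).real (pairRegion r x y))) ≤
      pairKernel Ω Z R D k n r x y := by
  have := h.isProbabilityMeasure
  have hR := h.R_pos
  have hc := pairConst_pos (D := D) (by linarith)
  by_cases hxZ : x ∈ Z
  · rw [pairKernel]
    refine le_trans ?_ le_self_add
    rw [Set.indicator_of_mem hxZ, Set.indicator_of_mem, Pi.one_apply, one_mul]
    · refine ENNReal.ofReal_le_ofReal (poissonLow_le (by positivity) ?_)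
      refine mul_le_mul_of_nonneg_left (h.crude_pair_area hx hy hxy hr hr1 ?_) (by positivity)
      refine le_trans ?_ hDR
      gcongr
    · rwa [mem_closedBall_zero_iff, ← dist_eq_norm]
  obtain ⟨ν, τ, hf⟩ := hZ x hx hxZ
  have h1 := h.flat_pair_area hf hr hη0 (by linarith) (by linarith) (by nlinarith) hx hy hxy hd
  rw [pairKernel]
  refine le_trans ?_ (le_trans le_self_add le_add_self)
  set m := min (ballArea Ω r x) (ballArea Ω r y) with hm
  have hm0 : 0 ≤ m := le_min (ballArea_nonneg _ _ _) (ballArea_nonneg _ _ _)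
  have h5 : pairConst D ≤ 1 / (40 * D ^ 2) := min_le_right _ _
  have h6 : n * m + pairConst D * n * r * ‖x - y‖ ≤
      n * (volume.restrict Ω).real (pairRegion r x y) + 1 := by
    rw [← dist_eq_norm]
    have : pairConst D * (r * dist x y) ≤ 1 / (40 * D ^ 2) * (r * dist x y) := by gcongr
    have h7 : m + pairConst D * (r * dist x y) - 3 * r * η ≤
        (volume.restrict Ω).real (pairRegion r x y) := by
      refine le_trans ?_ h1
      rw [show r * dist x y / (40 * D ^ 2) = 1 / (40 * D ^ 2) * (r * dist x y) by ring]
      linarith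
    have h8 := mul_le_mul_of_nonneg_left h7 (Nat.cast_nonneg (α := ℝ) n)
    linarith
  have h7 : poissonLow k (n * (volume.restrict Ω).real (pairRegion r x y)) ≤
      3 * (poissonLow k (n * m) * poissonLow k (pairConst D * n * r * ‖x - y‖)) := by
    calc _ ≤ exp 1 * poissonLow k (n * (volume.restrict Ω).real (pairRegion r x y) + 1) :=
          poissonLow_le_exp_mul k (by positivity) (by norm_num)
      _ ≤ 3 * poissonLow k (n * m + pairConst D * n * r * ‖x - y‖) := by
          refine mul_le_mul (exp_one_lt_d9.le.trans (by norm_num)) (poissonLow_le (by positivity) h6)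
            (poissonLow_pos k (by positivity)).le (by norm_num)
      _ ≤ _ := by
          refine mul_le_mul_of_nonneg_left (poissonLow_add_le k (by positivity) (by positivity))
            (by norm_num)
  refine (ENNReal.ofReal_le_ofReal h7).trans ?_
  have hq0 := (poissonLow_pos k (show (0 : ℝ) ≤ n * m by positivity)).le
  rw [ENNReal.ofReal_mul (by norm_num), ENNReal.ofReal_mul hq0,
    mul_assoc (ENNReal.ofReal 3)]
  refine mul_le_mul' le_rfl (mul_le_mul' ?_ le_rfl)
  rcases min_choice (ballArea Ω r x) (ballArea Ω r y) with h8 | h8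
  · rw [hm, h8]; exact le_self_add
  · rw [hm, h8]; exact le_add_self

lemma UnitBody.pi_pairRegion_le (h : UnitBody Ω ρ R) (hr : 0 < r) (hr1 : r ≤ 2 * R)
    (hD : 2 ≤ D) (hDR : 4 * R * (D * r) ≤ 1) (hη0 : 0 ≤ η) (hη : η ≤ r / 4)
    (hnη : 3 * n * r * η ≤ 1) (hZm : MeasurableSet Z)
    (hZ : ∀ x ∈ Ω, x ∉ Z → ∃ ν τ, FlatAt Ω ((D + 2) * r) η x ν τ) :
    (Measure.pi fun _ : Fin n => volume.restrict Ω) {X | ∃ i j, X i ≠ X j ∧ X i ∈ Ω ∧ X j ∈ Ω ∧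
      dist (X i) (X j) ≤ D * r ∧
      Nat.card {l // (l ≠ i ∧ l ≠ j) ∧ X l ∈ pairRegion r (X i) (X j)} ≤ k} ≤
    ENNReal.ofReal (n ^ 2 * exp (2 + 2 * k)) *
      ∫⁻ x, ∫⁻ y, pairKernel Ω Z R D k n r x y ∂volume.restrict Ω ∂volume.restrict Ω := by
  classical
  have := h.isProbabilityMeasure
  set μ := volume.restrict Ω with hμ
  set I := ∫⁻ x, ∫⁻ y, pairKernel Ω Z R D k n r x y ∂μ ∂μ with hI
  have hKm := h.measurable_pairKernel (R := R) (D := D) (k := k) (n := n) (r := r) hZm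
  have key : ∀ i j : Fin n, i ≠ j → (Measure.pi fun _ : Fin n => μ) {X | X i ≠ X j ∧ X i ∈ Ω ∧
      X j ∈ Ω ∧ dist (X i) (X j) ≤ D * r ∧
      Nat.card {l // (l ≠ i ∧ l ≠ j) ∧ X l ∈ pairRegion r (X i) (X j)} ≤ k} ≤
      ENNReal.ofReal (exp (2 + 2 * k)) * I := by
    intro i j hij
    let T : Finset (Fin n) := {i, j}
    let ii : T := ⟨i, by simp [T]⟩
    let jj : T := ⟨j, by simp [T]⟩
    have hiijj : ii ≠ jj := fun h => hij (congrArg Subtype.val h)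
    have hT : T.card = 2 := Finset.card_pair hij
    have hms : MeasurableSet {X : Fin n → ℂ | X i ≠ X j ∧ X i ∈ Ω ∧
        X j ∈ Ω ∧ dist (X i) (X j) ≤ D * r ∧
        Nat.card {l // (l ≠ i ∧ l ≠ j) ∧ X l ∈ pairRegion r (X i) (X j)} ≤ k} := by
      have m1 : MeasurableSet {X : Fin n → ℂ | X i ≠ X j} :=
        (measurableSet_eq_fun (measurable_pi_apply i) (measurable_pi_apply j)).compl
      have m2 : MeasurableSet {X : Fin n → ℂ | dist (X i) (X j) ≤ D * r} :=
        measurableSet_le (measurable_eval_dist i j) measurable_const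
      have m3 : MeasurableSet {X : Fin n → ℂ |
          Nat.card {l // (l ≠ i ∧ l ≠ j) ∧ X l ∈ pairRegion r (X i) (X j)} ≤ k} := by
        have : {X : Fin n → ℂ |
            Nat.card {l // (l ≠ i ∧ l ≠ j) ∧ X l ∈ pairRegion r (X i) (X j)} ≤ k} =
            {X | (Finset.univ.filter fun l => (l ≠ i ∧ l ≠ j) ∧
              X l ∈ pairRegion r (X i) (X j)).card ≤ k} := by
          ext X; simp only [Nat.card_eq_fintype_card, Fintype.card_subtype]
        rw [this]
        refine measurableSet_card_le (fun l (X : Fin n → ℂ) => (l ≠ i ∧ l ≠ j) ∧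
          X l ∈ pairRegion r (X i) (X j)) (fun l => ?_) k
        refine (MeasurableSet.const _).inter (MeasurableSet.diff ?_ ?_)
        · exact (measurableSet_le (measurable_eval_dist l i) measurable_const).union
            (measurableSet_le (measurable_eval_dist l j) measurable_const)
        · exact (measurableSet_le (measurable_eval_dist l i) (measurable_eval_dist i j)).inter
            (measurableSet_le (measurable_eval_dist l j) (measurable_eval_dist i j))
      exact m1.inter ((measurable_pi_apply i h.measurableSet).inter
        ((measurable_pi_apply j h.measurableSet).inter (m2.inter m3)))
    have k1 := pi_few_upper μ k n (Fintype.card_fin n) T _ hms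
      {x | x ii ≠ x jj ∧ x ii ∈ Ω ∧ x jj ∈ Ω ∧ dist (x ii) (x jj) ≤ D * r}
      (fun x l => if l = ii then pairRegion r (x ii) (x jj) else ∅) 1
      (fun x _ l => by
        split_ifs
        exacts [measurableSet_pairRegion _ _ _, .empty])
      (fun x _ l l' hl => by
        by_cases h1 : l = ii
        · have h2 : l' ≠ ii := fun h2 => hl (h1.trans h2.symm)
          simp [h2]
        · simp [h1])
      (fun x _ => by
        rw [Finset.sum_eq_single ii]
        · exact measureReal_le_one
        · intro l _ hl; simp [hl]
        · simp)
      (fun X hX => by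
        refine ⟨⟨hX.1, hX.2.1, hX.2.2.1, hX.2.2.2.1⟩, fun l => ?_⟩
        by_cases h1 : l = ii
        · refine (nat_card_le_of_imp fun m hm => ?_).trans hX.2.2.2.2
          rw [if_pos h1] at hm
          refine ⟨?_, hm.2⟩
          have := hm.1
          simpa [T] using this
        · rw [if_neg h1]; simp)
      (fun x => pairKernel Ω Z R D k n r (x ii) (x jj))
      (fun x hx => by
        rw [Finset.prod_eq_single ii]
        · rw [if_pos rfl]
          exact h.pairRegion_le_pairKernel hr hr1 hD hDR hη0 hη hnη hZ hx.2.1 hx.2.2.1 hx.1 hx.2.2.2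
        · intro l _ hl; rw [if_neg hl]; simp [poissonLow_zero]
        · simp)
    have k2 := lintegral_pi_kernel (ι := T) μ hiijj (pairKernel Ω Z R D k n r) hKm 1 measurable_one
    simp only [Pi.one_apply, Finset.prod_const_one, mul_one, lintegral_const, measure_univ,
      one_pow] at k2
    rw [k2, hT] at k1
    refine k1.trans (le_of_eq ?_)
    norm_num
    rfl
  calc _ ≤ (Measure.pi fun _ : Fin n => μ) (⋃ p ∈ (Finset.univ : Finset (Fin n × Fin n)),
        {X | p.1 ≠ p.2 ∧ X p.1 ≠ X p.2 ∧ X p.1 ∈ Ω ∧ X p.2 ∈ Ω ∧ dist (X p.1) (X p.2) ≤ D * r ∧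
        Nat.card {l // (l ≠ p.1 ∧ l ≠ p.2) ∧ X l ∈ pairRegion r (X p.1) (X p.2)} ≤ k}) := by
        refine measure_mono ?_
        rintro X ⟨i, j, hX⟩
        simp only [Set.mem_iUnion]
        exact ⟨(i, j), Finset.mem_univ _, fun hij => hX.1 (congrArg X hij), hX⟩
    _ ≤ ∑ p : Fin n × Fin n, ENNReal.ofReal (exp (2 + 2 * k)) * I := by
        refine (measure_biUnion_finset_le _ _).trans (Finset.sum_le_sum fun p _ => ?_)
        by_cases hp : p.1 = p.2
        · simp [hp]
        · exact (measure_mono fun X hX => hX.2).trans (key p.1 p.2 hp)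
    _ = _ := by
        rw [Finset.sum_const, Finset.card_univ, Fintype.card_prod, Fintype.card_fin, nsmul_eq_mul,
          ← mul_assoc, ENNReal.ofReal_mul (by positivity), ENNReal.ofReal_pow (by positivity),
          ENNReal.ofReal_natCast]
        push_cast
        ring
end

lemma exists_partition_curve (f : ℝ → ℂ) {s : Set ℝ} (hs : MeasurableSet s)
    (hd : ∀ x ∈ s, DifferentiableAt ℝ f x) {δ : ℝ} (hδ : 0 < δ) :
    ∃ (p : ℕ × ℕ → Set ℝ) (v : ℕ × ℕ → ℂ), Pairwise (Function.onFun Disjoint p) ∧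
      (∀ i, MeasurableSet (p i)) ∧ (⋃ i, p i) = s ∧
      (∀ i, ∀ x ∈ p i, ‖deriv f x - v i‖ ≤ δ) ∧
      ∀ i, ∀ x ∈ p i, ∀ y ∈ p i, ‖f x - f y - (x - y) • v i‖ ≤ δ * |x - y| := by
  let w := TopologicalSpace.denseSeq ℂ
  let B : ℕ → Set ℂ := disjointed fun m => ball (w m) (δ / 4)
  have hBm : ∀ m, MeasurableSet (B m) := MeasurableSet.disjointed fun m => measurableSet_ball
  have hBU : ⋃ m, B m = Set.univ := by
    rw [iUnion_disjointed]
    refine Set.eq_univ_of_forall fun z => ?_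
    obtain ⟨m, hm⟩ := (TopologicalSpace.denseRange_denseSeq ℂ).exists_dist_lt z
      (show 0 < δ / 4 by positivity)
    exact Set.mem_iUnion.2 ⟨m, hm⟩
  have hBs : ∀ m, ∀ z ∈ B m, ‖z - w m‖ < δ / 4 := fun m z hz => by
    have := disjointed_subset _ m hz
    rwa [mem_ball, dist_eq_norm] at this
  let S : ℕ → Set ℝ := fun m => s ∩ deriv f ⁻¹' B m
  have hSm : ∀ m, MeasurableSet (S m) := fun m => hs.inter (measurable_deriv f (hBm m))
  have key : ∀ m, ∃ (t : ℕ → Set ℝ) (A : ℕ → ℝ →L[ℝ] ℂ), Pairwise (Function.onFun Disjoint t) ∧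
      (∀ n, MeasurableSet (t n)) ∧ (S m ⊆ ⋃ n, t n) ∧
      (∀ n, ApproximatesLinearOn f (A n) (S m ∩ t n) (⟨δ / 4, by positivity⟩ : NNReal)) ∧
      ((S m).Nonempty → ∀ n, ∃ y ∈ S m, A n = ContinuousLinearMap.toSpanSingleton ℝ (deriv f y)) :=
    fun m => exists_partition_approximatesLinearOn_of_hasFDerivWithinAt f (S m)
      (fun y => ContinuousLinearMap.toSpanSingleton ℝ (deriv f y))
      (fun x hx => (hd x hx.1).hasDerivAt.hasFDerivAt.hasFDerivWithinAt)
      (fun _ => ⟨δ / 4, by positivity⟩) (fun _ h => by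
        have : δ / 4 = 0 := congrArg NNReal.toReal h
        linarith)
  choose t A ht1 ht2 ht3 ht4 ht5 using key
  refine ⟨fun i => S i.1 ∩ t i.1 i.2, fun i => w i.1, ?_, fun i => (hSm _).inter (ht2 _ _), ?_, ?_,
    ?_⟩
  · rintro ⟨m, n⟩ ⟨m', n'⟩ hne
    by_cases hm : m = m'
    · subst hm
      have : n ≠ n' := fun h => hne (by rw [h])
      exact (ht1 m this).mono Set.inter_subset_right Set.inter_subset_right
    · have h1 : Disjoint (B m) (B m') := disjoint_disjointed _ hm
      exact (Disjoint.preimage (deriv f) h1).mono (fun x hx => hx.1.2) (fun x hx => hx.1.2)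
  · ext x
    simp only [Set.mem_iUnion, Prod.exists]
    constructor
    · rintro ⟨m, n, hx⟩; exact hx.1.1
    · intro hx
      have : deriv f x ∈ ⋃ m, B m := hBU ▸ Set.mem_univ _
      obtain ⟨m, hm⟩ := Set.mem_iUnion.1 this
      have h1 : x ∈ S m := ⟨hx, hm⟩
      obtain ⟨n, hn⟩ := Set.mem_iUnion.1 (ht3 m h1)
      exact ⟨m, n, h1, hn⟩
  · intro i x hx
    exact (hBs _ _ hx.1.2).le.trans (by linarith)
  · intro i x hx y hy
    obtain ⟨z, hz, hA⟩ := ht5 i.1 ⟨x, hx.1⟩ i.2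
    have h1 := ht4 i.1 i.2 x hx y hy
    rw [hA, ContinuousLinearMap.toSpanSingleton_apply] at h1
    have h2 := hBs _ _ hz.2
    have h3 : f x - f y - (x - y) • w i.1 =
        (f x - f y - (x - y) • deriv f z) + (x - y) • (deriv f z - w i.1) := by
      rw [smul_sub]; ring
    rw [h3]
    refine (norm_add_le _ _).trans ?_
    rw [norm_smul, Real.norm_eq_abs]
    rw [Real.norm_eq_abs] at h1
    have h4 : ‖f x - f y - (x - y) • deriv f z‖ ≤ δ / 4 * |x - y| := h1
    have h5 := mul_le_mul_of_nonneg_left h2.le (abs_nonneg (x - y))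
    nlinarith [mul_nonneg hδ.le (abs_nonneg (x - y))]

lemma hausdorffMeasure_curve_piece (f : ℝ → ℂ) {p : Set ℝ} {v : ℂ} {δ : ℝ}
    (hδ : 0 < δ) (h1 : ∀ x ∈ p, ‖deriv f x - v‖ ≤ δ)
    (hp : MeasurableSet p)
    (h2 : ∀ x ∈ p, ∀ y ∈ p, ‖f x - f y - (x - y) • v‖ ≤ δ * |x - y|) :
    μH[1] (f '' p) ≤ (∫⁻ x in p, ‖deriv f x‖ₑ) + ENNReal.ofReal (2 * δ) * volume p ∧
    ∫⁻ x in p, ‖deriv f x‖ₑ ≤ μH[1] (f '' p) + ENNReal.ofReal (2 * δ) * volume p := by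
  have hf : Measurable fun x => ‖deriv f x‖ₑ := (measurable_deriv f).enorm
  have e1 : ∀ x ∈ p, ENNReal.ofReal (‖v‖ + δ) ≤ ‖deriv f x‖ₑ + ENNReal.ofReal (2 * δ) := by
    intro x hx
    rw [← ofReal_norm, ← ENNReal.ofReal_add (norm_nonneg _) (by positivity)]
    refine ENNReal.ofReal_le_ofReal ?_
    have := norm_sub_norm_le v (deriv f x)
    rw [norm_sub_rev] at this
    linarith [h1 x hx]
  have e2 : ∀ x ∈ p, ‖deriv f x‖ₑ ≤ ENNReal.ofReal (‖v‖ - δ) + ENNReal.ofReal (2 * δ) := by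
    intro x hx
    refine le_trans ?_ ENNReal.ofReal_add_le
    rw [← ofReal_norm]
    refine ENNReal.ofReal_le_ofReal ?_
    have := norm_sub_norm_le (deriv f x) v
    linarith [h1 x hx]
  have n1 : ∀ x ∈ p, ∀ y ∈ p, dist (f x) (f y) ≤ (‖v‖ + δ) * dist x y := by
    intro x hx y hy
    rw [dist_eq_norm, Real.dist_eq]
    have h3 := h2 x hx y hy
    have h4 := norm_sub_norm_le (f x - f y) ((x - y) • v)
    rw [norm_smul, Real.norm_eq_abs] at h4
    linarith
  have n2 : ∀ x ∈ p, ∀ y ∈ p, (‖v‖ - δ) * dist x y ≤ dist (f x) (f y) := by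
    intro x hx y hy
    rw [Real.dist_eq, dist_eq_norm]
    have h3 := h2 x hx y hy
    have h4 := norm_sub_norm_le ((x - y) • v) (f x - f y)
    rw [norm_smul, Real.norm_eq_abs, norm_sub_rev ((x - y) • v)] at h4
    linarith
  constructor
  · have h3 : LipschitzOnWith (‖v‖ + δ).toNNReal f p := by
      refine LipschitzOnWith.of_dist_le_mul fun x hx y hy => ?_
      rw [Real.coe_toNNReal _ (by positivity)]
      exact n1 x hx y hy
    have h4 := h3.hausdorffMeasure_image_le (d := 1) zero_le_one
    rw [ENNReal.rpow_one, hausdorffMeasure_real] at h4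
    refine h4.trans ?_
    have h5 : ((‖v‖ + δ).toNNReal : ENNReal) = ENNReal.ofReal (‖v‖ + δ) := rfl
    rw [h5, ← setLIntegral_const, ← setLIntegral_const, ← lintegral_add_left hf]
    exact setLIntegral_mono' hp e1
  · have h6 : ENNReal.ofReal (‖v‖ - δ) * volume p ≤ μH[1] (f '' p) := by
      rcases le_or_gt (‖v‖ - δ) 0 with h0 | h0
      · rw [ENNReal.ofReal_of_nonpos h0, zero_mul]; exact zero_le
      have hinj : Set.InjOn f p := by
        intro x hx y hy hxy
        have := n2 x hx y hy
        rw [hxy, dist_self] at this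
        by_contra hne
        have := mul_pos h0 (dist_pos.2 hne)
        linarith
      have h3 : LipschitzOnWith (‖v‖ - δ)⁻¹.toNNReal (Function.invFunOn f p)
          (f '' p) := by
        refine LipschitzOnWith.of_dist_le_mul ?_
        rintro _ ⟨x, hx, rfl⟩ _ ⟨y, hy, rfl⟩
        rw [hinj.leftInvOn_invFunOn hx, hinj.leftInvOn_invFunOn hy]
        rw [Real.coe_toNNReal _ (by positivity), inv_mul_eq_div, le_div_iff₀ h0, mul_comm]
        exact n2 x hx y hy
      have h4 := h3.hausdorffMeasure_image_le (d := 1) zero_le_one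
      rw [hinj.leftInvOn_invFunOn.image_image, ENNReal.rpow_one, hausdorffMeasure_real] at h4
      have h5 : ((‖v‖ - δ)⁻¹.toNNReal : ENNReal) = ENNReal.ofReal (‖v‖ - δ)⁻¹ := rfl
      rw [h5, ENNReal.ofReal_inv_of_pos h0] at h4
      calc _ ≤ ENNReal.ofReal (‖v‖ - δ) * ((ENNReal.ofReal (‖v‖ - δ))⁻¹ * μH[1] (f '' p)) :=
            mul_le_mul' le_rfl h4
        _ = _ := by
            rw [← mul_assoc, ENNReal.mul_inv_cancel (by simpa using h0) ENNReal.ofReal_ne_top,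
              one_mul]
    refine le_trans ?_ (add_le_add h6 le_rfl)
    rw [← add_mul, ← setLIntegral_const]
    exact setLIntegral_mono' hp e2

/-- Length of an injective Lipschitz curve. -/
lemma hausdorffMeasure_curve {f : ℝ → ℂ} {C : NNReal} (hf : LipschitzWith C f) {s : Set ℝ}
    (hs : MeasurableSet s) (hinj : Set.InjOn f s) (hfin : volume s ≠ ⊤) :
    μH[1] (f '' s) = ∫⁻ x in s, ‖deriv f x‖ₑ := by
  let D := {x | DifferentiableAt ℝ f x}
  have hD : MeasurableSet D := measurableSet_of_differentiableAt ℝ f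
  have hN : volume (s \ D) = 0 :=
    measure_mono_null (fun x hx => hx.2) (hf.ae_differentiableAt_real : volume Dᶜ = 0)
  have e1 : ∫⁻ x in s, ‖deriv f x‖ₑ = ∫⁻ x in s ∩ D, ‖deriv f x‖ₑ := by
    rw [← lintegral_inter_add_sdiff _ s hD, setLIntegral_measure_zero _ _ hN, add_zero]
  have e2 : μH[1] (f '' s) = μH[1] (f '' (s ∩ D)) := by
    refine le_antisymm ?_ (measure_mono (Set.image_mono Set.inter_subset_left))
    have h1 : f '' s ⊆ f '' (s ∩ D) ∪ f '' (s \ D) := by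
      rw [← Set.image_union, Set.inter_union_sdiff]
    refine (measure_mono h1).trans ((measure_union_le _ _).trans (le_of_eq ?_))
    have h2 := (hf.lipschitzOnWith (s := s \ D)).hausdorffMeasure_image_le (d := 1) zero_le_one
    rw [hausdorffMeasure_real, hN, mul_zero] at h2
    rw [le_antisymm h2 zero_le, add_zero]
  rw [e1, e2]
  have main : ∀ δ : ℝ, 0 < δ →
      μH[1] (f '' (s ∩ D)) ≤ (∫⁻ x in s ∩ D, ‖deriv f x‖ₑ) + ENNReal.ofReal (2 * δ) * volume s ∧
      ∫⁻ x in s ∩ D, ‖deriv f x‖ₑ ≤ μH[1] (f '' (s ∩ D)) + ENNReal.ofReal (2 * δ) * volume s := by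
    intro δ hδ
    obtain ⟨p, v, hp1, hp2, hp3, hp4, hp5⟩ :=
      exists_partition_curve f (hs.inter hD) (fun x hx => hx.2) hδ
    have hsub : ∀ i, p i ⊆ s := fun i =>
      (Set.subset_iUnion p i).trans (hp3.le.trans Set.inter_subset_left)
    have i1 : μH[1] (f '' (s ∩ D)) = ∑' i, μH[1] (f '' p i) := by
      rw [← hp3, Set.image_iUnion]
      refine measure_iUnion ?_ fun i => (hp2 i).image_of_continuousOn_injOn
        hf.continuous.continuousOn (hinj.mono (hsub i))
      intro i j hij
      rw [Function.onFun, Set.disjoint_left]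
      rintro _ ⟨x, hx, rfl⟩ ⟨y, hy, hxy⟩
      have := hinj (hsub j hy) (hsub i hx) hxy
      exact Set.disjoint_left.1 (hp1 hij) hx (this ▸ hy)
    have i2 : ∫⁻ x in s ∩ D, ‖deriv f x‖ₑ = ∑' i, ∫⁻ x in p i, ‖deriv f x‖ₑ := by
      rw [← hp3, lintegral_iUnion hp2 hp1]
    have i3 : ∑' i, volume (p i) ≤ volume s := by
      rw [← measure_iUnion hp1 hp2, hp3]
      exact measure_mono Set.inter_subset_left
    have hpc := fun i => hausdorffMeasure_curve_piece f hδ (hp4 i) (hp2 i) (hp5 i)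
    rw [i1, i2]
    constructor
    · calc _ ≤ ∑' i, ((∫⁻ x in p i, ‖deriv f x‖ₑ) + ENNReal.ofReal (2 * δ) * volume (p i)) :=
            ENNReal.tsum_le_tsum fun i => (hpc i).1
        _ ≤ _ := by
            rw [ENNReal.tsum_add, ENNReal.tsum_mul_left]
            gcongr
    · calc _ ≤ ∑' i, (μH[1] (f '' p i) + ENNReal.ofReal (2 * δ) * volume (p i)) :=
            ENNReal.tsum_le_tsum fun i => (hpc i).2
        _ ≤ _ := by
            rw [ENNReal.tsum_add, ENNReal.tsum_mul_left]
            gcongr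
  have lim : ∀ a b : ENNReal, (∀ δ : ℝ, 0 < δ → a ≤ b + ENNReal.ofReal (2 * δ) * volume s) →
      a ≤ b := by
    intro a b hab
    have h1 : Tendsto (fun δ : ℝ => b + ENNReal.ofReal (2 * δ) * volume s) (𝓝[>] 0)
        (𝓝 (b + ENNReal.ofReal (2 * 0) * volume s)) := by
      refine Tendsto.mono_left ?_ nhdsWithin_le_nhds
      refine tendsto_const_nhds.add (ENNReal.Tendsto.mul_const ?_ (Or.inr hfin))
      exact ENNReal.tendsto_ofReal (tendsto_id.const_mul 2)
    rw [mul_zero, ENNReal.ofReal_zero, zero_mul, add_zero] at h1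
    exact ge_of_tendsto h1 (eventually_nhdsWithin_of_forall fun δ hδ => hab δ hδ)
  exact le_antisymm (lim _ _ fun δ hδ => (main δ hδ).1) (lim _ _ fun δ hδ => (main δ hδ).2)

lemma lintegral_polar {f : ℂ → ENNReal} (hf : Measurable f) :
    ∫⁻ z, f z = ∫⁻ θ in Set.Ioo (-π) π, ∫⁻ s in Set.Ioi (0 : ℝ),
      ENNReal.ofReal s * f (s * Complex.exp (θ * Complex.I)) := by
  rw [← Complex.lintegral_comp_polarCoord_symm, polarCoord_target, Measure.volume_eq_prod,
    ← Measure.prod_restrict, lintegral_prod_symm]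
  · simp only [Complex.polarCoord_symm_apply, smul_eq_mul, Complex.exp_mul_I,
      Complex.ofReal_cos, Complex.ofReal_sin]
  · simp only [Complex.polarCoord_symm_apply, smul_eq_mul]
    refine Measurable.aemeasurable (Measurable.mul (by fun_prop) (hf.comp ?_))
    exact Continuous.measurable (by fun_prop)

section
variable {Ω : Set ℂ} {ρ R : ℝ}

/-- The gauge as a function of the angle. -/
noncomputable def angularGauge (Ω : Set ℂ) (θ : ℝ) : ℝ := gauge Ω (Complex.exp (θ * Complex.I))

/-- Norm of the derivative of the gauge as a function of the angle. -/
noncomputable def angularNorm (Ω : Set ℂ) (θ : ℝ) : ℝ :=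
  ‖fderiv ℝ (gauge Ω) (Complex.exp (θ * Complex.I))‖

/-- Polar parametrization of the boundary. -/
noncomputable def boundaryCurve (Ω : Set ℂ) (θ : ℝ) : ℂ :=
  (angularGauge Ω θ)⁻¹ • Complex.exp (θ * Complex.I)

lemma norm_exp_mul_I_sub_le (a b : ℝ) :
    ‖Complex.exp (a * Complex.I) - Complex.exp (b * Complex.I)‖ ≤ |a - b| := by
  have h1 : LipschitzWith 1 fun θ : ℝ => Complex.exp (θ * Complex.I) := by
    refine lipschitzWith_of_nnnorm_deriv_le (fun θ => ?_) fun θ => ?_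
    · fun_prop
    · have h2 : HasDerivAt (fun θ : ℝ => Complex.exp (θ * Complex.I))
          (Complex.exp (θ * Complex.I) * (1 * Complex.I)) θ :=
        ((Complex.ofRealCLM.hasDerivAt (x := θ)).mul_const Complex.I).cexp
      rw [h2.deriv, ← NNReal.coe_le_coe, coe_nnnorm]
      simp [Complex.norm_exp_ofReal_mul_I]
  have := h1.dist_le_mul a b
  rwa [dist_eq_norm, NNReal.coe_one, one_mul, Real.dist_eq] at this

namespace UnitBody
variable (h : UnitBody Ω ρ R)
include h

lemma angularGauge_pos (θ : ℝ) : 1 / R ≤ angularGauge Ω θ := by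
  have := h.le_gauge (Complex.exp (θ * Complex.I))
  rwa [Complex.norm_exp_ofReal_mul_I] at this

lemma angularGauge_le (θ : ℝ) : angularGauge Ω θ ≤ 1 / ρ := by
  have := h.gauge_le (Complex.exp (θ * Complex.I))
  rwa [Complex.norm_exp_ofReal_mul_I] at this

lemma angularGauge_pos' (θ : ℝ) : 0 < angularGauge Ω θ :=
  (by have := h.R_pos; positivity : 0 < 1 / R).trans_le (h.angularGauge_pos θ)

lemma abs_angularGauge_sub_le (a b : ℝ) :
    |angularGauge Ω a - angularGauge Ω b| ≤ |a - b| / ρ := by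
  refine (h.abs_gauge_sub_le _ _).trans ?_
  have := h.pos
  gcongr
  exact norm_exp_mul_I_sub_le a b

lemma lipschitz_boundaryCurve : ∃ C, LipschitzWith C (boundaryCurve Ω) := by
  have hR := h.R_pos
  have hρ := h.pos
  refine ⟨(R ^ 2 / ρ + R).toNNReal, LipschitzWith.of_dist_le_mul fun a b => ?_⟩
  rw [Real.coe_toNNReal _ (by positivity), dist_eq_norm, Real.dist_eq]
  have ua := h.angularGauge_pos' a
  have ub := h.angularGauge_pos' b
  have ia : (angularGauge Ω a)⁻¹ ≤ R := by
    rw [inv_le_comm₀ ua hR, ← one_div]; exact h.angularGauge_pos a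
  have ib : (angularGauge Ω b)⁻¹ ≤ R := by
    rw [inv_le_comm₀ ub hR, ← one_div]; exact h.angularGauge_pos b
  have e : boundaryCurve Ω a - boundaryCurve Ω b =
      ((angularGauge Ω a)⁻¹ - (angularGauge Ω b)⁻¹) • Complex.exp (a * Complex.I) +
      (angularGauge Ω b)⁻¹ • (Complex.exp (a * Complex.I) - Complex.exp (b * Complex.I)) := by
    rw [boundaryCurve, boundaryCurve, sub_smul, smul_sub]; ring
  rw [e]
  refine (norm_add_le _ _).trans ?_
  rw [norm_smul, norm_smul, Complex.norm_exp_ofReal_mul_I, mul_one, Real.norm_eq_abs,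
    Real.norm_of_nonneg (inv_pos.2 ub).le, add_mul]
  refine add_le_add ?_ (mul_le_mul ib (norm_exp_mul_I_sub_le a b) (norm_nonneg _) hR.le)
  rw [inv_sub_inv ua.ne' ub.ne', abs_div, abs_of_pos (mul_pos ua ub), div_eq_mul_inv, mul_inv]
  have h1 := h.abs_angularGauge_sub_le b a
  calc _ ≤ |b - a| / ρ * (R * R) := by
        gcongr
    _ = _ := by rw [abs_sub_comm]; ring

lemma arg_boundaryCurve {θ : ℝ} (hθ : θ ∈ Set.Ioc (-π) π) : (boundaryCurve Ω θ).arg = θ := by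
  have h1 := inv_pos.2 (h.angularGauge_pos' θ)
  rw [boundaryCurve, Complex.real_smul, Complex.arg_real_mul _ h1, Complex.exp_mul_I]
  exact Complex.arg_cos_add_sin_mul_I hθ

lemma injOn_boundaryCurve : Set.InjOn (boundaryCurve Ω) (Set.Ioc (-π) π) := by
  intro a ha b hb hab
  rw [← h.arg_boundaryCurve ha, hab, h.arg_boundaryCurve hb]

lemma image_boundaryCurve : boundaryCurve Ω '' Set.Ioc (-π) π = frontier Ω := by
  ext z
  rw [← gauge_eq_one_iff_mem_frontier h.convex h.mem_nhds]
  constructor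
  · rintro ⟨θ, hθ, rfl⟩
    have h1 := h.angularGauge_pos' θ
    rw [boundaryCurve, Complex.real_smul, h.gauge_smul (inv_pos.2 h1).le]
    exact inv_mul_cancel₀ h1.ne'
  · intro hz
    refine ⟨z.arg, ⟨Complex.neg_pi_lt_arg z, Complex.arg_le_pi z⟩, ?_⟩
    have h1 : gauge Ω (‖z‖ * Complex.exp (z.arg * Complex.I)) = 1 := by
      rw [Complex.norm_mul_exp_arg_mul_I, hz]
    rw [h.gauge_smul (norm_nonneg z)] at h1
    have h2 : (angularGauge Ω z.arg)⁻¹ = ‖z‖ := inv_eq_of_mul_eq_one_left h1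
    rw [boundaryCurve, h2, Complex.real_smul, Complex.norm_mul_exp_arg_mul_I]

lemma hasFDerivAt_gauge_smul {s : ℝ} (hs : 0 < s) {z : ℂ} {L : ℂ →L[ℝ] ℝ}
    (hL : HasFDerivAt (gauge Ω) L z) : HasFDerivAt (gauge Ω) L (s * z) := by
  have e : gauge Ω = fun w : ℂ => s • gauge Ω (s⁻¹ • w) := by
    ext w
    rw [Complex.real_smul, h.gauge_smul (inv_pos.2 hs).le, smul_eq_mul, mul_inv_cancel_left₀ hs.ne']
  have e2 : s⁻¹ • ((s : ℂ) * z) = z := by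
    rw [← Complex.real_smul, smul_smul, inv_mul_cancel₀ hs.ne', one_smul]
  rw [e]
  have h1 : HasFDerivAt (fun w : ℂ => s⁻¹ • w) (s⁻¹ • ContinuousLinearMap.id ℝ ℂ) ((s : ℂ) * z) :=
    (s⁻¹ • ContinuousLinearMap.id ℝ ℂ).hasFDerivAt
  rw [← e2] at hL
  refine ((hL.comp ((s : ℂ) * z) h1).const_smul s).congr_fderiv ?_
  ext v; simp [hs.ne']

lemma differentiableAt_gauge_smul_iff {s : ℝ} (hs : 0 < s) (z : ℂ) :
    DifferentiableAt ℝ (gauge Ω) (s * z) ↔ DifferentiableAt ℝ (gauge Ω) z := by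
  refine ⟨fun hd => ?_, fun hd => (h.hasFDerivAt_gauge_smul hs hd.hasFDerivAt).differentiableAt⟩
  have := h.hasFDerivAt_gauge_smul (inv_pos.2 hs) hd.hasFDerivAt
  rw [← mul_assoc, ← Complex.ofReal_mul, inv_mul_cancel₀ hs.ne', Complex.ofReal_one, one_mul] at this
  exact this.differentiableAt

lemma fderiv_gauge_smul {s : ℝ} (hs : 0 < s) (z : ℂ) :
    fderiv ℝ (gauge Ω) (s * z) = fderiv ℝ (gauge Ω) z := by
  by_cases hd : DifferentiableAt ℝ (gauge Ω) z
  · exact (h.hasFDerivAt_gauge_smul hs hd.hasFDerivAt).fderiv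
  · rw [fderiv_zero_of_not_differentiableAt hd, fderiv_zero_of_not_differentiableAt]
    rwa [h.differentiableAt_gauge_smul_iff hs]

lemma ae_differentiableAt_angular : ∀ᵐ θ : ℝ ∂volume.restrict (Set.Ioo (-π) π),
    DifferentiableAt ℝ (gauge Ω) (Complex.exp (θ * Complex.I)) := by
  let B : Set ℂ := {z | DifferentiableAt ℝ (gauge Ω) z}ᶜ
  have hB : MeasurableSet B := (measurableSet_of_differentiableAt ℝ (gauge Ω)).compl
  have hm : Measurable (B.indicator (1 : ℂ → ENNReal)) := measurable_one.indicator hB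
  have h0 : ∫⁻ z, B.indicator 1 z = 0 := by
    rw [lintegral_indicator_one hB]; exact h.ae_differentiableAt
  have hm2 : Measurable fun p : ℝ × ℝ => ENNReal.ofReal p.2 *
      B.indicator 1 (p.2 * Complex.exp (p.1 * Complex.I)) := by
    refine Measurable.mul (by fun_prop) (hm.comp ?_)
    exact Continuous.measurable (by fun_prop)
  rw [lintegral_polar hm, lintegral_eq_zero_iff (Measurable.lintegral_prod_right' hm2)] at h0
  filter_upwards [h0] with θ hθ
  by_contra hd
  have hm3 : Measurable fun s : ℝ => ENNReal.ofReal s *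
      B.indicator 1 (s * Complex.exp (θ * Complex.I)) := hm2.comp measurable_prodMk_left
  rw [Pi.zero_apply, lintegral_eq_zero_iff hm3] at hθ
  have h1 : ∀ᵐ s : ℝ ∂volume.restrict (Set.Ioi 0), False := by
    filter_upwards [hθ, ae_restrict_mem measurableSet_Ioi] with s hs hs0
    have hs0 : 0 < s := hs0
    have h2 : (s * Complex.exp (θ * Complex.I)) ∈ B := fun h3 =>
      hd ((h.differentiableAt_gauge_smul_iff hs0 _).1 h3)
    simp only [Pi.zero_apply, Set.indicator_of_mem h2, Pi.one_apply, mul_one,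
      ENNReal.ofReal_eq_zero] at hs
    linarith
  rw [ae_iff] at h1
  simp at h1

lemma norm_deriv_boundaryCurve {θ : ℝ}
    (hd : DifferentiableAt ℝ (gauge Ω) (Complex.exp (θ * Complex.I))) :
    ‖deriv (boundaryCurve Ω) θ‖ = angularNorm Ω θ / angularGauge Ω θ ^ 2 := by
  have hu := h.angularGauge_pos' θ
  set e := Complex.exp (θ * Complex.I) with he
  have he1 : e.re ^ 2 + e.im ^ 2 = 1 := by
    have : ‖e‖ = 1 := Complex.norm_exp_ofReal_mul_I θ
    have h0 := Complex.sq_norm e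
    rw [this, Complex.normSq_apply] at h0
    linarith
  set L := fderiv ℝ (gauge Ω) e with hL
  have h1 : HasDerivAt (fun θ : ℝ => Complex.exp (θ * Complex.I)) (e * Complex.I) θ := by
    have := ((Complex.ofRealCLM.hasDerivAt (x := θ)).mul_const Complex.I).cexp
    simpa using this
  have h2 : HasDerivAt (angularGauge Ω) (L (e * Complex.I)) θ := hd.hasFDerivAt.comp_hasDerivAt θ h1
  have h3 : HasDerivAt (boundaryCurve Ω) _ θ := (h2.inv hu.ne').smul h1
  have h4 : L e = angularGauge Ω θ := h.fderiv_self hd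
  set u := angularGauge Ω θ with hu'
  obtain ⟨w, hw⟩ : ∃ w : ℂ, w = (InnerProductSpace.toDual ℝ ℂ).symm L := ⟨_, rfl⟩
  have h5 : ∀ v, L v = w.re * v.re + w.im * v.im := fun v => by
    have : inner ℝ w v = L v := by rw [hw, InnerProductSpace.toDual_symm_apply]
    rw [← this, Complex.inner]; simp; ring
  have h6 : angularNorm Ω θ ^ 2 = w.re ^ 2 + w.im ^ 2 := by
    have : ‖w‖ = angularNorm Ω θ := by rw [hw, LinearIsometryEquiv.norm_map]; rfl
    rw [← this, Complex.sq_norm, Complex.normSq_apply]; ring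
  rw [h3.deriv]
  have hN : 0 ≤ angularNorm Ω θ := norm_nonneg _
  refine (sq_eq_sq₀ (norm_nonneg _) (by positivity)).1 ?_
  rw [Complex.sq_norm, Complex.normSq_apply, div_pow, h6]
  rw [h5] at h4
  rw [h5]
  change ((u⁻¹ • (e * Complex.I) + (-(w.re * (e * Complex.I).re + w.im * (e * Complex.I).im) / u ^ 2) • e).re
    * (u⁻¹ • (e * Complex.I) + (-(w.re * (e * Complex.I).re + w.im * (e * Complex.I).im) / u ^ 2) • e).re +
    (u⁻¹ • (e * Complex.I) + (-(w.re * (e * Complex.I).re + w.im * (e * Complex.I).im) / u ^ 2) • e).im *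
    (u⁻¹ • (e * Complex.I) + (-(w.re * (e * Complex.I).re + w.im * (e * Complex.I).im) / u ^ 2) • e).im) = _
  clear_value e u
  simp only [Complex.add_re, Complex.add_im, Complex.smul_re, Complex.smul_im, Complex.mul_re,
    Complex.mul_im, Complex.I_re, Complex.I_im, smul_eq_mul, mul_zero, mul_one, zero_sub, add_zero]
  generalize w.re = a at *
  generalize w.im = b at *
  generalize e.re = x at *
  generalize e.im = y at *
  clear h1 h2 h3 h5 h6
  have hx : u⁻¹ * -y + -(a * -y + b * x) / u ^ 2 * x = - b / u ^ 2 := by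
    field_simp
    linear_combination (-y) * h4 * (-1) - b * he1
  have hy : u⁻¹ * x + -(a * -y + b * x) / u ^ 2 * y = a / u ^ 2 := by
    field_simp
    linear_combination (x) * h4 * (-1) + a * he1
  rw [hx, hy]
  field_simp
  ring

end UnitBody
end

section
variable {Ω : Set ℂ} {ρ R : ℝ}

lemma lintegral_layer_substitution {u N δ : ℝ} (hu : 0 < u) (hN : 0 < N)
    (Ψ : ℝ → ENNReal) :
    ∫⁻ s in Set.Ioc ((1 - δ) / u) (1 / u), ENNReal.ofReal s * Ψ ((1 - s * u) / N) =
      ∫⁻ t in Set.Ico 0 (δ / N), ENNReal.ofReal (N / u) *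
        (ENNReal.ofReal ((1 - N * t) / u) * Ψ t) := by
  have himg : (fun t : ℝ => (1 - N * t) / u) '' Set.Ico 0 (δ / N) =
      Set.Ioc ((1 - δ) / u) (1 / u) := by
    ext s
    constructor
    · rintro ⟨t, ⟨h0, h1⟩, rfl⟩
      rw [lt_div_iff₀ hN] at h1
      constructor
      · change _ < (1 - N * t) / u
        gcongr
        linarith
      · change (1 - N * t) / u ≤ _
        gcongr
        nlinarith
    · rintro ⟨h1, h2⟩
      rw [div_lt_iff₀ hu] at h1
      rw [le_div_iff₀ hu] at h2
      refine ⟨(1 - s * u) / N, ⟨by apply div_nonneg <;> linarith, by gcongr; linarith⟩, ?_⟩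
      change (1 - N * ((1 - s * u) / N)) / u = s
      field_simp
      ring
  rw [← himg, lintegral_image_eq_lintegral_abs_deriv_mul measurableSet_Ico
    (f' := fun _ => -N / u)]
  · refine lintegral_congr fun t => ?_
    have e1 : |-N / u| = N / u := by rw [neg_div, abs_neg, abs_of_pos (by positivity)]
    have e2 : (1 - (1 - N * t) / u * u) / N = t := by field_simp; ring
    rw [e1, e2]
  · intro t _
    have := (((hasDerivAt_id t).const_mul N).const_sub 1).div_const u
    simpa using this.hasDerivWithinAt
  · intro a _ b _ hab
    have hab : (1 - N * a) / u = (1 - N * b) / u := hab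
    have h1 := hN.ne'
    have h2 := hu.ne'
    field_simp at hab
    nlinarith

lemma measurable_gaugeDepth (h : UnitBody Ω ρ R) : Measurable (gaugeDepth Ω) :=
  (measurable_const.sub h.measurable_gauge).div (measurable_fderiv ℝ _).norm

namespace UnitBody
variable (h : UnitBody Ω ρ R)
include h

lemma hausdorffMeasure_frontier : μH[1] (frontier Ω) =
    ∫⁻ θ in Set.Ioo (-π) π, ENNReal.ofReal (angularNorm Ω θ / angularGauge Ω θ ^ 2) := by
  obtain ⟨C, hC⟩ := h.lipschitz_boundaryCurve
  rw [← h.image_boundaryCurve, hausdorffMeasure_curve hC measurableSet_Ioc h.injOn_boundaryCurve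
    (by simp), ← restrict_Ioo_eq_restrict_Ioc]
  refine lintegral_congr_ae ?_
  filter_upwards [h.ae_differentiableAt_angular] with θ hθ
  rw [← h.norm_deriv_boundaryCurve hθ, ofReal_norm]

lemma angularNorm_le (θ : ℝ) : angularNorm Ω θ ≤ 1 / ρ := h.norm_fderiv_le _

lemma le_angularNorm {θ : ℝ}
    (hd : DifferentiableAt ℝ (gauge Ω) (Complex.exp (θ * Complex.I))) :
    1 / R ≤ angularNorm Ω θ := h.le_norm_fderiv hd (Complex.exp_ne_zero _)

lemma hausdorffMeasure_frontier_ne_top : μH[1] (frontier Ω) ≠ ⊤ := by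
  have hR := h.R_pos
  have hρ := h.pos
  rw [h.hausdorffMeasure_frontier]
  refine ne_top_of_le_ne_top (b := ∫⁻ θ in Set.Ioo (-π) π, ENNReal.ofReal (1 / ρ / (1 / R) ^ 2)) ?_ ?_
  · rw [setLIntegral_const]
    exact ENNReal.mul_ne_top ENNReal.ofReal_ne_top (by simp)
  · refine lintegral_mono fun θ => ENNReal.ofReal_le_ofReal ?_
    have h1 := h.angularNorm_le θ
    have h2 := h.angularGauge_pos θ
    gcongr

lemma hausdorffMeasure_frontier_pos : 0 < μH[1] (frontier Ω) := by
  have hR := h.R_pos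
  have hρ := h.pos
  rw [h.hausdorffMeasure_frontier]
  refine lt_of_lt_of_le (b := ∫⁻ θ in Set.Ioo (-π) π, ENNReal.ofReal (1 / R / (1 / ρ) ^ 2)) ?_ ?_
  · rw [setLIntegral_const]
    refine ENNReal.mul_pos (ENNReal.ofReal_pos.2 (by positivity)).ne' ?_
    rw [Real.volume_Ioo]
    exact (ENNReal.ofReal_pos.2 (by linarith [pi_pos])).ne'
  · refine lintegral_mono_ae ?_
    filter_upwards [h.ae_differentiableAt_angular] with θ hθ
    have h1 := h.le_angularNorm hθ
    have h2 := h.angularGauge_pos' θ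
    have h3 := h.angularGauge_le θ
    have : 0 ≤ angularNorm Ω θ := norm_nonneg _
    refine ENNReal.ofReal_le_ofReal ?_
    gcongr

lemma lintegral_collar {δ : ℝ} (hδ1 : δ ≤ 1) {Ψ : ℝ → ENNReal} (hΨ : Measurable Ψ) :
    ∫⁻ x in {x | 1 - δ < gauge Ω x ∧ gauge Ω x ≤ 1}, Ψ (gaugeDepth Ω x) =
      ∫⁻ θ in Set.Ioo (-π) π, ENNReal.ofReal (angularNorm Ω θ / angularGauge Ω θ ^ 2) *
        ∫⁻ t in Set.Ico 0 (δ / angularNorm Ω θ),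
          ENNReal.ofReal (1 - angularNorm Ω θ * t) * Ψ t := by
  have hR := h.R_pos
  have hS : MeasurableSet {x | 1 - δ < gauge Ω x ∧ gauge Ω x ≤ 1} :=
    (measurableSet_lt measurable_const h.measurable_gauge).inter
      (measurableSet_le h.measurable_gauge measurable_const)
  have hm : Measurable fun x => Ψ (gaugeDepth Ω x) := hΨ.comp (measurable_gaugeDepth h)
  rw [← lintegral_indicator hS, lintegral_polar (hm.indicator hS)]
  refine lintegral_congr_ae ?_
  filter_upwards [h.ae_differentiableAt_angular] with θ hθ
  have hu := h.angularGauge_pos' θ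
  have hN : 0 < angularNorm Ω θ := lt_of_lt_of_le (by positivity) (h.le_angularNorm hθ)
  have e1 : ∫⁻ s in Set.Ioi (0 : ℝ), ENNReal.ofReal s *
      {x | 1 - δ < gauge Ω x ∧ gauge Ω x ≤ 1}.indicator (fun x => Ψ (gaugeDepth Ω x))
        (s * Complex.exp (θ * Complex.I)) =
      ∫⁻ s in Set.Ioi (0 : ℝ), (Set.Ioc ((1 - δ) / angularGauge Ω θ)
        (1 / angularGauge Ω θ)).indicator (fun s => ENNReal.ofReal s *
          Ψ ((1 - s * angularGauge Ω θ) / angularNorm Ω θ)) s := by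
    refine setLIntegral_congr_fun measurableSet_Ioi fun s hs => ?_
    have hs : 0 < s := hs
    have hg : gauge Ω (s * Complex.exp (θ * Complex.I)) = s * angularGauge Ω θ :=
      h.gauge_smul hs.le _
    have hmem : (s * Complex.exp (θ * Complex.I) ∈ {x | 1 - δ < gauge Ω x ∧ gauge Ω x ≤ 1}) ↔
        s ∈ Set.Ioc ((1 - δ) / angularGauge Ω θ) (1 / angularGauge Ω θ) := by
      rw [Set.mem_Ioc, div_lt_iff₀ hu, le_div_iff₀ hu, ← hg]; rfl
    by_cases hc : s ∈ Set.Ioc ((1 - δ) / angularGauge Ω θ) (1 / angularGauge Ω θ)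
    · rw [Set.indicator_of_mem hc, Set.indicator_of_mem (hmem.2 hc), gaugeDepth, hg,
        h.fderiv_gauge_smul hs]
      rfl
    · rw [Set.indicator_of_notMem hc, Set.indicator_of_notMem (fun h' => hc (hmem.1 h')), mul_zero]
  have hsub : Set.Ioc ((1 - δ) / angularGauge Ω θ) (1 / angularGauge Ω θ) ⊆ Set.Ioi 0 :=
    fun s hs => lt_of_le_of_lt (div_nonneg (by linarith) hu.le) hs.1
  rw [e1, lintegral_indicator measurableSet_Ioc, Measure.restrict_restrict measurableSet_Ioc,
    Set.inter_eq_left.2 hsub, lintegral_layer_substitution hu hN,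
    ← lintegral_const_mul _ (by fun_prop)]
  refine lintegral_congr fun t => ?_
  rw [← mul_assoc, ← mul_assoc, ← ENNReal.ofReal_mul (by positivity),
    ← ENNReal.ofReal_mul (by positivity)]
  congr 2
  field_simp

lemma measurable_boundarySpeed : Measurable fun θ =>
    ENNReal.ofReal (angularNorm Ω θ / angularGauge Ω θ ^ 2) := by
  have he : Measurable fun θ : ℝ => Complex.exp (θ * Complex.I) :=
    Continuous.measurable (by fun_prop)
  have h1 : Measurable (angularNorm Ω) := ((measurable_fderiv ℝ (gauge Ω)).comp he).norm
  have h2 : Measurable (angularGauge Ω) := h.measurable_gauge.comp he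
  exact (h1.div (h2.pow_const 2)).ennreal_ofReal

lemma lintegral_collar_le {δ : ℝ} (hδ : 0 < δ) (hδ1 : δ ≤ 1) {Ψ : ℝ → ENNReal}
    (hΨ : Measurable Ψ) :
    ∫⁻ x in {x | 1 - δ < gauge Ω x ∧ gauge Ω x ≤ 1}, Ψ (gaugeDepth Ω x) ≤
      μH[1] (frontier Ω) * ∫⁻ t in Set.Ico 0 (δ * R), Ψ t := by
  have hR := h.R_pos
  rw [h.lintegral_collar hδ1 hΨ, h.hausdorffMeasure_frontier,
    ← lintegral_mul_const _ h.measurable_boundarySpeed]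
  refine lintegral_mono_ae ?_
  filter_upwards [h.ae_differentiableAt_angular] with θ hθ
  have hN := h.le_angularNorm hθ
  have hN0 : 0 < angularNorm Ω θ := lt_of_lt_of_le (by positivity) hN
  gcongr ENNReal.ofReal _ * ?_
  refine (setLIntegral_mono hΨ fun t ht => ?_).trans (lintegral_mono_set ?_)
  · refine mul_le_of_le_one_left' (ENNReal.ofReal_le_one.2 ?_)
    have := mul_nonneg hN0.le ht.1
    linarith
  · refine Set.Ico_subset_Ico_right ?_
    rw [div_le_iff₀ hN0, mul_assoc]
    refine le_mul_of_one_le_right hδ.le ?_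
    rwa [div_le_iff₀' hR] at hN

lemma le_lintegral_collar {δ : ℝ} (hδ : 0 < δ) (hδ1 : δ ≤ 1) {Ψ : ℝ → ENNReal}
    (hΨ : Measurable Ψ) :
    ENNReal.ofReal (1 - δ) * (μH[1] (frontier Ω) * ∫⁻ t in Set.Ico 0 (δ * ρ), Ψ t) ≤
    ∫⁻ x in {x | 1 - δ < gauge Ω x ∧ gauge Ω x ≤ 1}, Ψ (gaugeDepth Ω x) := by
  have hR := h.R_pos
  have hρ := h.pos
  rw [h.lintegral_collar hδ1 hΨ, h.hausdorffMeasure_frontier, mul_left_comm,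
    ← lintegral_mul_const _ h.measurable_boundarySpeed]
  refine lintegral_mono_ae ?_
  filter_upwards [h.ae_differentiableAt_angular] with θ hθ
  have hN := h.le_angularNorm hθ
  have hN0 : 0 < angularNorm Ω θ := lt_of_lt_of_le (by positivity) hN
  have hN1 := h.angularNorm_le θ
  gcongr ENNReal.ofReal _ * ?_
  rw [← lintegral_const_mul _ hΨ]
  have hsub : Set.Ico 0 (δ * ρ) ⊆ Set.Ico 0 (δ / angularNorm Ω θ) := by
    refine Set.Ico_subset_Ico_right ?_
    rw [le_div_iff₀ hN0, mul_assoc]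
    refine mul_le_of_le_one_right hδ.le ?_
    rwa [le_div_iff₀' hρ] at hN1
  refine le_trans ?_ (lintegral_mono_set hsub)
  refine setLIntegral_mono (by fun_prop) fun t ht => ?_
  have ht2 := (hsub ht).2
  rw [lt_div_iff₀ hN0] at ht2
  gcongr
  linarith

end UnitBody
end

section

lemma exp_mul_poissonLow (k : ℕ) (x : ℝ) :
    exp x * poissonLow k x = ∑ s ∈ Finset.range (k + 1), x ^ s / (s.factorial : ℝ) := by
  rw [poissonLow, ← mul_assoc, ← exp_add, add_neg_cancel, exp_zero, one_mul]

lemma tendsto_poissonLow_normalized (k : ℕ) :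
    Tendsto (fun x : ℝ => exp x * poissonLow k x / x ^ k) atTop (𝓝 (1 / (k.factorial : ℝ))) := by
  simp only [exp_mul_poissonLow, Finset.sum_div]
  have h1 : ∀ s ∈ Finset.range k,
      Tendsto (fun x : ℝ => x ^ s / (s.factorial : ℝ) / x ^ k) atTop (𝓝 0) := fun s hs => by
    have := (tendsto_pow_div_pow_atTop_zero (𝕜 := ℝ) (Finset.mem_range.1 hs)).div_const
      (s.factorial : ℝ)
    rw [zero_div] at this
    exact this.congr fun x => div_right_comm _ _ _
  have h2 : Tendsto (fun x : ℝ => x ^ k / (k.factorial : ℝ) / x ^ k) atTop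
      (𝓝 (1 / (k.factorial : ℝ))) := by
    refine tendsto_const_nhds.congr' ?_
    filter_upwards [eventually_gt_atTop 0] with x hx
    field_simp
  simp only [Finset.sum_range_succ]
  have := (tendsto_finsetSum _ h1).add h2
  simpa using this

lemma exp_mul_poissonLow_le (k : ℕ) {x : ℝ} (hx : 1 ≤ x) :
    exp x * poissonLow k x ≤ (k + 1) * x ^ k := by
  rw [exp_mul_poissonLow]
  calc _ ≤ ∑ s ∈ Finset.range (k + 1), x ^ k := by
        refine Finset.sum_le_sum fun s hs => ?_
        have h1 : (1 : ℝ) ≤ s.factorial := by exact_mod_cast Nat.one_le_iff_ne_zero.2 s.factorial_ne_zero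
        refine (div_le_self (by positivity) h1).trans ?_
        exact pow_le_pow_right₀ hx (by have := Finset.mem_range.1 hs; omega)
    _ = _ := by simp

lemma tendsto_poissonLow_half (k : ℕ) {y : ℝ → ℝ} {y₀ : ℝ} (hy : Tendsto y atTop (𝓝 y₀)) :
    Tendsto (fun L : ℝ => exp (L / 2) / (L / 2) ^ k * poissonLow k (L / 2 + y L)) atTop
      (𝓝 (1 / (k.factorial : ℝ) * exp (-y₀))) := by
  have hL : Tendsto (fun L : ℝ => L / 2) atTop atTop := tendsto_id.atTop_div_const (by norm_num)
  have hx : Tendsto (fun L : ℝ => L / 2 + y L) atTop atTop := hL.atTop_add hy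
  have h1 := (tendsto_poissonLow_normalized k).comp hx
  have h2 : Tendsto (fun L : ℝ => exp (-y L)) atTop (𝓝 (exp (-y₀))) :=
    (continuous_exp.tendsto _).comp hy.neg
  have h3 : Tendsto (fun L : ℝ => (1 + y L / (L / 2)) ^ k) atTop (𝓝 ((1 + 0) ^ k)) :=
    ((hy.div_atTop hL).const_add 1).pow k
  have := (h1.mul h2).mul h3
  rw [add_zero, one_pow, mul_one] at this
  refine this.congr' ?_
  filter_upwards [eventually_gt_atTop 0, hx.eventually_gt_atTop 0] with L h0 hx0
  have e1 : (1 + y L / (L / 2)) ^ k = (L / 2 + y L) ^ k / (L / 2) ^ k := by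
    rw [← div_pow]; congr 1; field_simp
  have e2 : exp (L / 2) = exp (L / 2 + y L) * exp (- y L) := by rw [← exp_add]; ring_nf
  simp only [Function.comp_apply]
  rw [e1, e2]
  generalize L / 2 + y L = x at hx0 ⊢
  have hx1 := hx0.ne'
  field_simp

/-- Centred argument of the Poisson function along the boundary. -/
noncomputable def capExcess (L v : ℝ) : ℝ := L / π * (capArea (v / L) - π / 2)

lemma capExcess_add (L v : ℝ) : L / 2 + capExcess L v = L / π * capArea (v / L) := by
  have := pi_pos
  rw [capExcess]; field_simp; ring

lemma tendsto_capExcess {v : ℝ} (hv : 0 ≤ v) :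
    Tendsto (fun L => capExcess L v) atTop (𝓝 (2 * v / π)) := by
  have hpi := pi_pos
  have hu : Tendsto (fun L : ℝ => v / L) atTop (𝓝 0) := tendsto_const_nhds.div_atTop tendsto_id
  have h1 : Tendsto (fun L : ℝ => 2 * v / π * √(1 - (v / L) ^ 2)) atTop (𝓝 (2 * v / π)) := by
    have : Tendsto (fun L : ℝ => √(1 - (v / L) ^ 2)) atTop (𝓝 (√(1 - 0 ^ 2))) :=
      ((hu.pow 2).const_sub 1).sqrt
    simpa using this.const_mul (2 * v / π)
  refine tendsto_of_tendsto_of_tendsto_of_le_of_le' h1 tendsto_const_nhds ?_ ?_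
  · filter_upwards [eventually_gt_atTop 0, eventually_ge_atTop v] with L h0 hLv
    have h2 := le_capArea (u := v / L) (by positivity) ((div_le_one h0).2 hLv)
    calc 2 * v / π * √(1 - (v / L) ^ 2) = L / π * (2 * (v / L) * √(1 - (v / L) ^ 2)) := by field_simp
      _ ≤ capExcess L v := by unfold capExcess; gcongr; linarith
  · filter_upwards [eventually_gt_atTop 0] with L h0
    have h2 := capArea_upper (u := v / L) (by positivity)
    calc capExcess L v ≤ L / π * (2 * (v / L)) := by unfold capExcess; gcongr; linarith
      _ = 2 * v / π := by field_simp

lemma le_capExcess {C L v : ℝ} (hC : 1 ≤ C) (hL : 0 < L) (hv : 0 ≤ v) (hvC : v ≤ C * L) :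
    v / (2 * C * π) ≤ capExcess L v := by
  have hpi := pi_pos
  have h2 := capArea_linear_le (u := v / L) (by positivity)
  have h3 : v / (2 * C * L) ≤ min (v / L) (1 / 2) := by
    refine le_min ?_ ?_
    · gcongr; nlinarith
    · rw [div_le_div_iff₀ (by positivity) (by norm_num)]; nlinarith
  calc v / (2 * C * π) = L / π * (v / (2 * C * L)) := by field_simp
    _ ≤ _ := by unfold capExcess; gcongr; linarith

lemma integrableOn_poissonLow_mul (k : ℕ) {c : ℝ} (hc : 0 < c) :
    IntegrableOn (fun v => poissonLow k (c * v)) (Set.Ioi 0) := by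
  obtain ⟨C, hC, h⟩ := poissonLow_le_pow k 2
  have h0 : IntegrableOn (fun v => C * (1 + ‖v‖) ^ (-(2 : ℝ))) (Set.Ioi (0 : ℝ)) :=
    ((integrable_one_add_norm (E := ℝ) (by simp)).const_mul C).integrableOn
  have h1 : IntegrableOn (fun v => poissonLow k v) (Set.Ioi 0) := by
    refine h0.mono' (continuous_poissonLow k).aestronglyMeasurable.restrict ?_
    filter_upwards [ae_restrict_mem measurableSet_Ioi] with v hv
    have hv : 0 < v := hv
    rw [Real.norm_of_nonneg (poissonLow_pos k hv.le).le, Real.norm_of_nonneg hv.le,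
      rpow_neg (by positivity), ← div_eq_mul_inv]
    have := h v hv.le
    exact_mod_cast this
  have := (integrableOn_Ioi_comp_mul_left_iff (fun v => poissonLow k v) 0 hc).2 (by simpa using h1)
  simpa using this

lemma tendsto_integral_capArea (k : ℕ) {C : ℝ} (hC : 1 ≤ C) :
    Tendsto (fun L => L * (exp (L / 2) / (L / 2) ^ k) *
      ∫ u in Set.Ioc 0 C, poissonLow k (L / π * capArea u)) atTop
      (𝓝 (π / (2 * (k.factorial : ℝ)))) := by
  have hpi := pi_pos
  let F : ℝ → ℝ → ℝ := fun L v => (Set.Ioc 0 (C * L)).indicator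
    (fun v => exp (L / 2) / (L / 2) ^ k * poissonLow k (L / 2 + capExcess L v)) v
  have hlim : Tendsto (fun L => ∫ v in Set.Ioi 0, F L v) atTop
      (𝓝 (∫ v in Set.Ioi 0, 1 / (k.factorial : ℝ) * exp (-(2 * v / π)))) := by
    refine tendsto_integral_filter_of_dominated_convergence
      (fun v => (k + 1) * poissonLow k ((2 * C * π)⁻¹ * v)) ?_ ?_ ?_ ?_
    · refine Eventually.of_forall fun L => ?_
      refine (Measurable.indicator ?_ measurableSet_Ioc).aestronglyMeasurable
      have h1 : Continuous fun v => capExcess L v :=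
        continuous_const.mul ((continuous_capArea.comp (continuous_id.div_const L)).sub
          continuous_const)
      exact (continuous_const.mul ((continuous_poissonLow k).comp
        (continuous_const.add h1))).measurable
    · filter_upwards [eventually_ge_atTop 2] with L hL
      filter_upwards [ae_restrict_mem measurableSet_Ioi] with v hv
      have hv : 0 < v := hv
      have hq : 0 ≤ poissonLow k ((2 * C * π)⁻¹ * v) := (poissonLow_pos k (by positivity)).le
      by_cases hvC : v ∈ Set.Ioc 0 (C * L)
      · have h1 := le_capExcess hC (by linarith : 0 < L) hv.le hvC.2
        have h0 : 0 ≤ v / (2 * C * π) := by positivity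
        have hq2 : 0 ≤ poissonLow k (L / 2 + capExcess L v) := (poissonLow_pos k (by linarith)).le
        have hq3 : 0 ≤ poissonLow k (L / 2) := (poissonLow_pos k (by linarith)).le
        simp only [F]
        rw [Set.indicator_of_mem hvC, Real.norm_of_nonneg (by positivity)]
        calc exp (L / 2) / (L / 2) ^ k * poissonLow k (L / 2 + capExcess L v)
            ≤ exp (L / 2) / (L / 2) ^ k * (poissonLow k (L / 2) * poissonLow k (v / (2 * C * π))) := by
              gcongr
              exact (poissonLow_add_le k (by linarith) (by linarith)).trans
                (mul_le_mul_of_nonneg_left (poissonLow_le h0 h1) hq3)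
          _ = (exp (L / 2) * poissonLow k (L / 2)) / (L / 2) ^ k * poissonLow k (v / (2 * C * π)) := by
              ring
          _ ≤ (k + 1) * poissonLow k (v / (2 * C * π)) := by
              gcongr
              · exact (poissonLow_pos k h0).le
              · rw [div_le_iff₀ (by positivity)]
                exact exp_mul_poissonLow_le k (by linarith)
          _ = _ := by rw [div_eq_inv_mul]
      · simp only [F]
        rw [Set.indicator_of_notMem hvC, norm_zero]
        positivity
    · exact (integrableOn_poissonLow_mul k (by positivity)).const_mul _
    · filter_upwards [ae_restrict_mem measurableSet_Ioi] with v hv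
      have hv : 0 < v := hv
      refine (tendsto_poissonLow_half k (tendsto_capExcess hv.le)).congr' ?_
      filter_upwards [eventually_ge_atTop v, eventually_gt_atTop 0] with L hL hL0
      simp only [F]
      rw [Set.indicator_of_mem (show v ∈ Set.Ioc 0 (C * L) from ⟨hv, by nlinarith⟩)]
  have hval : ∫ v in Set.Ioi 0, 1 / (k.factorial : ℝ) * exp (-(2 * v / π)) =
      π / (2 * (k.factorial : ℝ)) := by
    have : ∀ v : ℝ, exp (-(2 * v / π)) = exp (-(2 / π) * v) := fun v => by ring_nf
    simp only [this]
    rw [integral_const_mul, integral_exp_mul_Ioi (by simp; positivity)]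
    simp
    field_simp
  rw [hval] at hlim
  refine hlim.congr' ?_
  filter_upwards [eventually_gt_atTop 0] with L hL
  simp only [F]
  rw [integral_indicator measurableSet_Ioc, Measure.restrict_restrict measurableSet_Ioc,
    Set.inter_eq_left.2 (fun v hv => hv.1), integral_const_mul, mul_comm L, mul_assoc]
  congr 1
  rw [← intervalIntegral.integral_of_le (by positivity), ← intervalIntegral.integral_of_le (by positivity)]
  have := intervalIntegral.mul_integral_comp_mul_left (a := 0) (b := C)
    (f := fun v => poissonLow k (L / 2 + capExcess L v)) L
  rw [mul_zero, mul_comm L C] at this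
  rw [← this]
  congr 1
  refine intervalIntegral.integral_congr fun u _ => ?_
  simp only [capExcess_add]
  rw [mul_div_cancel_left₀ _ hL.ne']

end

section

/-- The normalized expected degree `n π r ^ 2` at the critical radius. -/
noncomputable def critLevel (k : ℕ) (ξ : ℝ) (n : ℕ) : ℝ :=
  Real.log n + (2 * (k : ℝ) - 1) * Real.log (Real.log n) + ξ

/-- The critical radius. -/
noncomputable def critRadius (k : ℕ) (ξ : ℝ) (n : ℕ) : ℝ := √(critLevel k ξ n / (π * n))

lemma tendsto_log_natCast : Tendsto (fun n : ℕ => Real.log n) atTop atTop :=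
  tendsto_log_atTop.comp tendsto_natCast_atTop_atTop

lemma tendsto_critLevel_div_log (k : ℕ) (ξ : ℝ) :
    Tendsto (fun n : ℕ => critLevel k ξ n / Real.log n) atTop (𝓝 1) := by
  have h1 : Tendsto (fun x : ℝ => Real.log x / x) atTop (𝓝 0) := by
    simpa using (Real.tendsto_pow_log_div_mul_add_atTop 1 0 1 one_ne_zero)
  have h2 : Tendsto (fun n : ℕ => 1 + (2 * (k : ℝ) - 1) * (Real.log (Real.log n) / Real.log n)
      + ξ / Real.log n) atTop (𝓝 (1 + (2 * (k : ℝ) - 1) * 0 + 0)) :=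
    (((h1.comp tendsto_log_natCast).const_mul _).const_add 1).add
      (tendsto_const_nhds.div_atTop tendsto_log_natCast)
  rw [mul_zero, add_zero, add_zero] at h2
  refine h2.congr' ?_
  filter_upwards [tendsto_log_natCast.eventually_gt_atTop 0] with n hn
  rw [critLevel]
  field_simp

lemma tendsto_critLevel (k : ℕ) (ξ : ℝ) : Tendsto (critLevel k ξ) atTop atTop := by
  have := (tendsto_critLevel_div_log k ξ).pos_mul_atTop one_pos tendsto_log_natCast
  refine this.congr' ?_
  filter_upwards [tendsto_log_natCast.eventually_gt_atTop 0] with n hn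
  rw [div_mul_cancel₀ _ hn.ne']

lemma exp_neg_critLevel {k : ℕ} (hk : 1 ≤ k) (ξ : ℝ) : ∀ᶠ n : ℕ in atTop,
    n * exp (-critLevel k ξ n) = exp (-ξ) / (Real.log n) ^ (2 * k - 1) := by
  filter_upwards [tendsto_log_natCast.eventually_gt_atTop 0, eventually_gt_atTop 0] with n hn hn0
  have hn0 : (0 : ℝ) < n := by exact_mod_cast hn0
  have e1 : (2 * (k : ℝ) - 1) = ((2 * k - 1 : ℕ) : ℝ) := by
    rw [Nat.cast_sub (by omega)]; push_cast; ring
  rw [critLevel, neg_add, neg_add, exp_add, exp_add, exp_neg (Real.log n), exp_log hn0, e1,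
    exp_neg (_ * _), exp_nat_mul, exp_log hn]
  field_simp

lemma tendsto_natCast_mul_poissonLow_critLevel {k : ℕ} (hk : 1 ≤ k) (ξ : ℝ) :
    Tendsto (fun n : ℕ => n * poissonLow k (critLevel k ξ n)) atTop
      (𝓝 (if k = 1 then exp (-ξ) else 0)) := by
  have h1 := (tendsto_poissonLow_normalized k).comp (tendsto_critLevel k ξ)
  have h2 := (tendsto_critLevel_div_log k ξ).pow k
  have h3 : Tendsto (fun n : ℕ => (1 : ℝ) / (Real.log n) ^ (k - 1)) atTop
      (𝓝 (if k = 1 then 1 else 0)) := by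
    split_ifs with hk1
    · subst hk1; simp
    · refine tendsto_const_nhds.div_atTop ((tendsto_pow_atTop (by omega)).comp tendsto_log_natCast)
  have h4 := ((h1.mul h2).mul h3).const_mul (exp (-ξ))
  have e : exp (-ξ) * (1 / (k.factorial : ℝ) * 1 ^ k * (if k = 1 then 1 else 0)) =
      if k = 1 then exp (-ξ) else 0 := by
    split_ifs with hk1
    · subst hk1; simp
    · simp
  rw [e] at h4
  refine h4.congr' ?_
  filter_upwards [exp_neg_critLevel hk ξ, tendsto_log_natCast.eventually_gt_atTop 0,
    (tendsto_critLevel k ξ).eventually_gt_atTop 0] with n h5 h6 h7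
  have e2 : (n : ℝ) * poissonLow k (critLevel k ξ n) =
      (n * exp (-critLevel k ξ n)) * (exp (critLevel k ξ n) * poissonLow k (critLevel k ξ n)) := by
    rw [mul_assoc, ← mul_assoc (exp _), ← exp_add, neg_add_cancel, exp_zero, one_mul]
  rw [e2, h5]
  simp only [Function.comp_apply]
  generalize exp (critLevel k ξ n) * poissonLow k (critLevel k ξ n) = A
  have e3 : 2 * k - 1 = k + (k - 1) := by omega
  rw [e3, pow_add, div_pow]
  field_simp

lemma tendsto_boundary_term {k : ℕ} (hk : 1 ≤ k) (ξ : ℝ) {C : ℝ} (hC : 1 ≤ C) :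
    Tendsto (fun n : ℕ => n * (critRadius k ξ n *
      ∫ u in Set.Ioc 0 C, poissonLow k (critLevel k ξ n / π * capArea u))) atTop
      (𝓝 (√π * exp (-ξ / 2) / (2 ^ (k + 1) * (k.factorial : ℝ)))) := by
  have hpi := pi_pos
  have h1 := (tendsto_integral_capArea k hC).comp (tendsto_critLevel k ξ)
  have h2 : Tendsto (fun n : ℕ => √(exp (-ξ) / (π * 4 ^ k) *
      (critLevel k ξ n / Real.log n) ^ (2 * k - 1))) atTop
      (𝓝 (√(exp (-ξ) / (π * 4 ^ k) * 1 ^ (2 * k - 1)))) :=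
    (((tendsto_critLevel_div_log k ξ).pow _).const_mul _).sqrt
  have e1 : √(exp (-ξ) / (π * 4 ^ k) * 1 ^ (2 * k - 1)) = exp (-ξ / 2) / (√π * 2 ^ k) := by
    rw [one_pow, mul_one]
    refine (Real.sqrt_eq_iff_mul_self_eq (by positivity) (by positivity)).2 ?_
    rw [div_mul_div_comm, ← exp_add, mul_mul_mul_comm, Real.mul_self_sqrt hpi.le, ← mul_pow]
    norm_num
  rw [e1] at h2
  have h3 := h2.mul h1
  have e2 : exp (-ξ / 2) / (√π * 2 ^ k) * (π / (2 * (k.factorial : ℝ))) =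
      √π * exp (-ξ / 2) / (2 ^ (k + 1) * (k.factorial : ℝ)) := by
    have : √π ≠ 0 := (Real.sqrt_pos.2 hpi).ne'
    rw [pow_succ]
    field_simp
    rw [Real.sq_sqrt hpi.le]
  rw [e2] at h3
  refine h3.congr' ?_
  filter_upwards [exp_neg_critLevel hk ξ, tendsto_log_natCast.eventually_gt_atTop 0,
    (tendsto_critLevel k ξ).eventually_gt_atTop 0, eventually_gt_atTop 0] with n h5 h6 h7 hn0
  have hn0 : (0 : ℝ) < n := by exact_mod_cast hn0
  simp only [Function.comp_apply]
  generalize ∫ u in Set.Ioc 0 C, poissonLow k (critLevel k ξ n / π * capArea u) = J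
  rw [critRadius]
  set L := critLevel k ξ n
  have e3 : √(exp (-ξ) / (π * 4 ^ k) * (L / Real.log n) ^ (2 * k - 1)) *
      (L * (exp (L / 2) / (L / 2) ^ k)) = n * √(L / (π * n)) := by
    have e4 : exp (-ξ) / (π * 4 ^ k) * (L / Real.log n) ^ (2 * k - 1) =
        (n * √(L / (π * n)) / (L * (exp (L / 2) / (L / 2) ^ k))) ^ 2 := by
      have e5 : exp (-ξ) = n * exp (-L) * (Real.log n) ^ (2 * k - 1) := by
        rw [h5]; field_simp
      have e6 : L ^ (2 * k) = L ^ (2 * k - 1) * L := by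
        rw [← pow_succ]; congr 1; omega
      have e7 : exp (-L) * (exp (L / 2)) ^ 2 = 1 := by
        rw [← exp_nat_mul, ← exp_add]; simp; ring
      have e8 : (4 : ℝ) ^ k = (2 ^ k) ^ 2 := by rw [← pow_mul, mul_comm, pow_mul]; norm_num
      rw [e5, div_pow L, div_pow (_ * _), mul_pow, Real.sq_sqrt (by positivity), div_pow L, e8]
      have e9 : (L ^ k) ^ 2 = L ^ (2 * k - 1) * L := by rw [← pow_mul, mul_comm k 2, e6]
      have e10 : exp (-L) = 1 / exp (L / 2) ^ 2 := by
        rw [eq_div_iff (by positivity), e7]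
      rw [e10]
      have e11 : (L * (exp (L / 2) / (L ^ k / 2 ^ k))) ^ 2 =
          L * exp (L / 2) ^ 2 * (2 ^ k) ^ 2 / (L ^ (2 * k - 1)) := by
        rw [mul_pow, div_pow, div_pow, e9]
        field_simp
      rw [e11]
      field_simp
    rw [e4, Real.sqrt_sq (by positivity)]
    field_simp
  rw [← mul_assoc, e3, mul_assoc]

lemma natCast_mul_critRadius_sq (k : ℕ) (ξ : ℝ) : ∀ᶠ n : ℕ in atTop,
    0 < critRadius k ξ n ∧ n * critRadius k ξ n ^ 2 = critLevel k ξ n / π := by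
  filter_upwards [(tendsto_critLevel k ξ).eventually_gt_atTop 0, eventually_gt_atTop 0] with n h hn0
  have hn0 : (0 : ℝ) < n := by exact_mod_cast hn0
  have hpi := pi_pos
  refine ⟨Real.sqrt_pos.2 (by positivity), ?_⟩
  rw [critRadius, Real.sq_sqrt (by positivity)]
  field_simp

lemma tendsto_critLevel_pow_div (k : ℕ) (ξ : ℝ) (m : ℕ) :
    Tendsto (fun n : ℕ => critLevel k ξ n ^ m / n) atTop (𝓝 0) := by
  have h1 : Tendsto (fun n : ℕ => Real.log n ^ m / n) atTop (𝓝 0) := by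
    have := (Real.tendsto_pow_log_div_mul_add_atTop 1 0 m one_ne_zero).comp
      (tendsto_natCast_atTop_atTop (R := ℝ))
    simpa [Function.comp_def] using this
  have h2 := ((tendsto_critLevel_div_log k ξ).pow m).mul h1
  rw [mul_zero] at h2
  refine h2.congr' ?_
  filter_upwards [tendsto_log_natCast.eventually_gt_atTop 0] with n hn
  rw [div_pow]
  field_simp

lemma tendsto_critRadius (k : ℕ) (ξ : ℝ) : Tendsto (critRadius k ξ) atTop (𝓝 0) := by
  have h := ((tendsto_critLevel_pow_div k ξ 1).div_const π).sqrt
  rw [zero_div, Real.sqrt_zero] at h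
  refine h.congr fun n => ?_
  rw [critRadius, pow_one, div_div, mul_comm π]

lemma tendsto_pow_mul_poissonLow (k m : ℕ) {c : ℝ} (hc : 0 < c) :
    Tendsto (fun L : ℝ => L ^ m * poissonLow k (c * L)) atTop (𝓝 0) := by
  obtain ⟨C, hC, h⟩ := poissonLow_le_pow k (m + 1)
  have h1 : Tendsto (fun L : ℝ => C / c ^ (m + 1) / L) atTop (𝓝 0) :=
    tendsto_const_nhds.div_atTop tendsto_id
  refine squeeze_zero' ?_ ?_ h1
  · filter_upwards [eventually_ge_atTop 0] with L hL
    exact mul_nonneg (by positivity) (poissonLow_pos k (by positivity)).le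
  · filter_upwards [eventually_gt_atTop 0] with L hL
    calc L ^ m * poissonLow k (c * L) ≤ L ^ m * (C / (1 + c * L) ^ (m + 1)) := by
          gcongr; exact h _ (by positivity)
      _ ≤ L ^ m * (C / (c * L) ^ (m + 1)) := by gcongr; linarith
      _ = _ := by rw [mul_pow, pow_succ L]; field_simp

end

section
variable {Ω : Set ℂ} {ρ R : ℝ}

/-- Low-degree density at depth `t` below a flat boundary. -/
noncomputable def layerDensity (k n : ℕ) (r t : ℝ) : ENNReal :=
  ENNReal.ofReal (poissonLow k (n * r ^ 2 * capArea (t / r)))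

lemma measurable_layerDensity (k n : ℕ) (r : ℝ) : Measurable (layerDensity k n r) :=
  (((continuous_poissonLow k).comp (continuous_const.mul (continuous_capArea.comp
    (continuous_id.div_const r)))).measurable).ennreal_ofReal

lemma capArea_nonneg (u : ℝ) : 0 ≤ capArea u := ENNReal.toReal_nonneg

lemma lintegral_layerDensity (k n : ℕ) {r C : ℝ} (hr : 0 < r) (hC : 0 ≤ C) :
    ∫⁻ t in Set.Ico 0 (C * r), layerDensity k n r t =
      ENNReal.ofReal (r * ∫ u in Set.Ioc 0 C, poissonLow k (n * r ^ 2 * capArea u)) := by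
  have hcont : Continuous fun u => poissonLow k (n * r ^ 2 * capArea u) :=
    (continuous_poissonLow k).comp (continuous_const.mul continuous_capArea)
  have hcont2 : Continuous fun t => poissonLow k (n * r ^ 2 * capArea (t / r)) :=
    hcont.comp (continuous_id.div_const r)
  rw [setLIntegral_congr Ico_ae_eq_Ioc]
  have e1 : r * ∫ u in Set.Ioc 0 C, poissonLow k (n * r ^ 2 * capArea u) =
      ∫ t in Set.Ioc 0 (C * r), poissonLow k (n * r ^ 2 * capArea (t / r)) := by
    rw [← intervalIntegral.integral_of_le hC, ← intervalIntegral.integral_of_le (by positivity)]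
    have := intervalIntegral.mul_integral_comp_mul_left (a := 0) (b := C)
      (f := fun t => poissonLow k (n * r ^ 2 * capArea (t / r))) r
    rw [mul_zero, mul_comm r C] at this
    rw [← this]
    congr 1
    refine intervalIntegral.integral_congr fun u _ => ?_
    rw [mul_div_cancel_left₀ _ hr.ne']
  rw [e1, ofReal_integral_eq_lintegral_ofReal]
  · rfl
  · exact (hcont2.integrableOn_Icc).mono_set Set.Ioc_subset_Icc_self
  · exact Eventually.of_forall fun t =>
      (poissonLow_pos k (mul_nonneg (by positivity) (capArea_nonneg _))).le

namespace UnitBody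
variable (h : UnitBody Ω ρ R)
include h

lemma gaugeDepth_nonneg {x : ℂ} (hx : x ∈ Ω) : 0 ≤ gaugeDepth Ω x :=
  div_nonneg (by linarith [h.gauge_le_one_iff.2 hx]) (norm_nonneg _)

lemma measurableSet_collar (δ : ℝ) : MeasurableSet {x | 1 - δ < gauge Ω x ∧ gauge Ω x ≤ 1} :=
  (measurableSet_lt measurable_const h.measurable_gauge).inter
    (measurableSet_le h.measurable_gauge measurable_const)

lemma lintegral_lowDensity_le (k n : ℕ) {r δ σ η : ℝ} (hr : 0 < r) (hr1 : r ≤ 2 * R)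
    (hσ : r ≤ σ) (hδ : σ = δ * ρ) (hδ1 : δ < 1) (hη : 0 ≤ η) (hη1 : η ≤ r / 2) :
    ∫⁻ x, lowDensity (volume.restrict Ω) k n r x ∂volume.restrict Ω ≤
      ENNReal.ofReal (poissonLow k (n * (π * r ^ 2))) +
      ENNReal.ofReal (poissonLow k (n * (r ^ 2 / (4 * R ^ 2)))) * volume (roughSet Ω R δ σ η) +
      ENNReal.ofReal (exp (2 * (n * r * η))) *
        (μH[1] (frontier Ω) * ∫⁻ t in Set.Ico 0 (δ * R), layerDensity k n r t) := by
  have hR := h.R_pos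
  have hρ := h.pos
  have hpi := pi_pos
  have hδ0 : 0 < δ := by
    have : 0 < δ * ρ := by linarith
    exact (pos_iff_pos_of_mul_pos this).2 hρ
  have hZ := h.measurableSet_roughSet δ σ η
  have hS := h.measurableSet_collar δ
  have hΨ : Measurable fun x => layerDensity k n r (gaugeDepth Ω x) :=
    (measurable_layerDensity k n r).comp (measurable_gaugeDepth h)
  set c1 := ENNReal.ofReal (poissonLow k (n * (π * r ^ 2))) with hc1
  set c2 := ENNReal.ofReal (poissonLow k (n * (r ^ 2 / (4 * R ^ 2)))) with hc2
  set c3 := ENNReal.ofReal (exp (2 * (n * r * η))) with hc3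
  have key : ∀ x ∈ Ω, lowDensity (volume.restrict Ω) k n r x ≤
      (c1 + (roughSet Ω R δ σ η).indicator (fun _ => c2) x) +
        {x | 1 - δ < gauge Ω x ∧ gauge Ω x ≤ 1}.indicator
          (fun x => c3 * layerDensity k n r (gaugeDepth Ω x)) x := by
    intro x hx
    have hg := h.gauge_le_one_iff.2 hx
    by_cases hxc : 1 - δ < gauge Ω x
    · by_cases hxZ : x ∈ roughSet Ω R δ σ η
      · refine le_trans ?_ (le_add_right (le_add_left le_rfl))
        rw [Set.indicator_of_mem hxZ]
        refine ENNReal.ofReal_le_ofReal (poissonLow_le (by positivity) ?_)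
        gcongr
        exact h.le_ballArea hx hr.le hr1
      · refine le_trans ?_ (le_add_left le_rfl)
        have h2 : ¬ (¬ DifferentiableAt ℝ (gauge Ω) x ∨ η ≤ R * secondDiff (gauge Ω) (2 * σ) x) :=
          fun hc => hxZ ⟨hx, hxc, hc⟩
        push Not at h2
        have hx0 : x ≠ 0 := by
          rintro rfl
          rw [gauge_zero] at hxc; linarith
        obtain ⟨ν, hf⟩ := h.flatAt h2.1 hx0 (by linarith : 0 < σ)
        have h3 := h.le_ballArea_of_flat (hf.mono h2.2.le) hr hη hσ
        rw [Set.indicator_of_mem (show x ∈ {x | 1 - δ < gauge Ω x ∧ gauge Ω x ≤ 1} from ⟨hxc, hg⟩),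
          hc3, layerDensity, ← ENNReal.ofReal_mul (exp_pos _).le]
        refine ENNReal.ofReal_le_ofReal ?_
        have h4 : π / 2 ≤ capArea (gaugeDepth Ω x / r) := by
          rw [← capArea_zero]
          exact capArea_mono (div_nonneg (h.gaugeDepth_nonneg hx) hr.le)
        have h5 : 0 ≤ r ^ 2 * capArea (gaugeDepth Ω x / r) - 2 * r * η := by
          have : r ^ 2 * 1 ≤ r ^ 2 * capArea (gaugeDepth Ω x / r) := by
            gcongr; linarith [Real.pi_gt_three]
          nlinarith
        calc poissonLow k (n * (volume.restrict Ω).real (closedBall x r))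
            ≤ poissonLow k (n * (r ^ 2 * capArea (gaugeDepth Ω x / r) - 2 * r * η)) := by
              refine poissonLow_le (by positivity) ?_
              gcongr
              exact h3
          _ ≤ exp (2 * (n * r * η)) * poissonLow k (n * (r ^ 2 * capArea (gaugeDepth Ω x / r)
              - 2 * r * η) + 2 * (n * r * η)) :=
              poissonLow_le_exp_mul k (by positivity) (by positivity)
          _ = _ := by ring_nf
    · refine le_trans ?_ (le_add_right (le_add_right le_rfl))
      have h1 : closedBall x r ⊆ Ω := by
        refine (closedBall_subset_closedBall hσ).trans (h.closedBall_subset ?_)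
        rw [hδ, mul_div_cancel_right₀ _ hρ.ne']
        linarith
      rw [lowDensity, hc1]
      refine (congrArg (fun t => ENNReal.ofReal (poissonLow k (n * t))) ?_).le
      rw [measureReal_restrict_apply measurableSet_closedBall, Set.inter_eq_left.2 h1,
        Measure.real, Complex.volume_closedBall]
      simp [hr.le]
      ring
  calc _ ≤ ∫⁻ x in Ω, ((c1 + (roughSet Ω R δ σ η).indicator (fun _ => c2) x) +
        {x | 1 - δ < gauge Ω x ∧ gauge Ω x ≤ 1}.indicator
          (fun x => c3 * layerDensity k n r (gaugeDepth Ω x)) x) :=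
        setLIntegral_mono' h.measurableSet key
    _ = c1 + c2 * volume (roughSet Ω R δ σ η) + c3 *
        ∫⁻ x in {x | 1 - δ < gauge Ω x ∧ gauge Ω x ≤ 1}, layerDensity k n r (gaugeDepth Ω x) := by
        have m1 : Measurable fun x => (roughSet Ω R δ σ η).indicator (fun _ => c2) x :=
          measurable_const.indicator hZ
        have m2 : Measurable fun x => c1 + (roughSet Ω R δ σ η).indicator (fun _ => c2) x :=
          measurable_const.add m1
        rw [lintegral_add_left m2, lintegral_add_left measurable_const, setLIntegral_const,
          h.volume_eq, mul_one, setLIntegral_indicator hZ, setLIntegral_const,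
          setLIntegral_indicator hS, lintegral_const_mul _ hΨ]
        have e1 : roughSet Ω R δ σ η ∩ Ω = roughSet Ω R δ σ η :=
          Set.inter_eq_left.2 fun x hx => hx.1
        have e2 : {x | 1 - δ < gauge Ω x ∧ gauge Ω x ≤ 1} ∩ Ω =
            {x | 1 - δ < gauge Ω x ∧ gauge Ω x ≤ 1} :=
          Set.inter_eq_left.2 fun x hx => h.gauge_le_one_iff.1 hx.2
        rw [e1, e2]
    _ ≤ _ := by
        gcongr
        exact h.lintegral_collar_le hδ0 hδ1.le (measurable_layerDensity k n r)

lemma le_lintegral_lowDensity (k n : ℕ) {r δ : ℝ} (hr : 0 < r)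
    (hδ : 0 < δ) (hδ1 : δ < 1) :
    ENNReal.ofReal ((1 - δ) ^ 2) * ENNReal.ofReal (poissonLow k (n * (π * r ^ 2))) +
      ENNReal.ofReal (1 - δ) *
        (μH[1] (frontier Ω) * ∫⁻ t in Set.Ico 0 (δ * ρ), layerDensity k n r t) ≤
    ∫⁻ x, lowDensity (volume.restrict Ω) k n r x ∂volume.restrict Ω := by
  have hpi := pi_pos
  have hS := h.measurableSet_collar δ
  have hdeep : MeasurableSet {x | gauge Ω x ≤ 1 - δ} :=
    measurableSet_le h.measurable_gauge measurable_const
  have hunion : Ω = {x | gauge Ω x ≤ 1 - δ} ∪ {x | 1 - δ < gauge Ω x ∧ gauge Ω x ≤ 1} := by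
    ext x
    rw [← h.gauge_le_one_iff]
    change _ ↔ (gauge Ω x ≤ 1 - δ) ∨ (1 - δ < gauge Ω x ∧ gauge Ω x ≤ 1)
    constructor
    · intro h1
      rcases le_or_gt (gauge Ω x) (1 - δ) with h2 | h2
      · exact Or.inl h2
      · exact Or.inr ⟨h2, h1⟩
    · rintro (h1 | h1)
      · linarith
      · exact h1.2
  have hdisj : Disjoint {x | gauge Ω x ≤ 1 - δ} {x | 1 - δ < gauge Ω x ∧ gauge Ω x ≤ 1} := by
    refine Set.disjoint_left.2 fun x h1 h2 => ?_
    have h1 : gauge Ω x ≤ 1 - δ := h1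
    linarith [h2.1]
  have hsplit : ∫⁻ x, lowDensity (volume.restrict Ω) k n r x ∂volume.restrict Ω =
      (∫⁻ x in {x | gauge Ω x ≤ 1 - δ}, lowDensity (volume.restrict Ω) k n r x) +
      ∫⁻ x in {x | 1 - δ < gauge Ω x ∧ gauge Ω x ≤ 1}, lowDensity (volume.restrict Ω) k n r x := by
    rw [← lintegral_union hS hdisj]
    exact congrArg (fun S => ∫⁻ x in S, lowDensity (volume.restrict Ω) k n r x) hunion
  rw [hsplit]
  refine add_le_add ?_ ((h.le_lintegral_collar hδ hδ1.le (measurable_layerDensity k n r)).trans ?_)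
  · rw [← h.volume_gauge_le (by linarith : 0 < 1 - δ), mul_comm, ← setLIntegral_const]
    refine lintegral_mono fun x => ENNReal.ofReal_le_ofReal (poissonLow_le
      (mul_nonneg (Nat.cast_nonneg _) measureReal_nonneg) ?_)
    gcongr
    exact h.ballArea_le x hr.le
  · refine lintegral_mono_ae ?_
    filter_upwards [ae_restrict_of_ae h.ae_differentiableAt, ae_restrict_mem hS] with x hx hxS
    have hx0 : x ≠ 0 := by
      rintro rfl
      have := hxS.1
      rw [gauge_zero] at this; linarith
    refine ENNReal.ofReal_le_ofReal (poissonLow_le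
      (mul_nonneg (Nat.cast_nonneg _) measureReal_nonneg) ?_)
    rw [mul_assoc]
    gcongr
    exact h.ballArea_le_capArea hx hx0 hr

end UnitBody
end

section
variable {Ω : Set ℂ} {ρ R : ℝ}

/-- Exceptional set near the boundary at the critical scale. -/
noncomputable def critRough (Ω : Set ℂ) (ρ R D : ℝ) (k : ℕ) (ξ : ℝ) (n : ℕ) : Set ℂ :=
  roughSet Ω R ((D + 2) * critRadius k ξ n / ρ) ((D + 2) * critRadius k ξ n)
    (critRadius k ξ n / critLevel k ξ n ^ 2)

lemma eventually_crit (k : ℕ) (ξ : ℝ) {ε : ℝ} (hε : 0 < ε) (M : ℝ) : ∀ᶠ n : ℕ in atTop,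
    0 < (n : ℝ) ∧ 0 < critRadius k ξ n ∧ critRadius k ξ n < ε ∧ M < critLevel k ξ n ∧
      n * critRadius k ξ n ^ 2 = critLevel k ξ n / π := by
  filter_upwards [eventually_gt_atTop 0, natCast_mul_critRadius_sq k ξ,
    (tendsto_critRadius k ξ).eventually_lt_const hε,
    (tendsto_critLevel k ξ).eventually_gt_atTop M] with n h0 h1 h2 h3
  exact ⟨by exact_mod_cast h0, h1.1, h2, h3, h1.2⟩

namespace UnitBody
variable (h : UnitBody Ω ρ R)
include h

lemma volume_critRough_le (k : ℕ) (ξ : ℝ) {D : ℝ} (hD : 2 ≤ D) : ∀ᶠ n : ℕ in atTop,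
    (volume (critRough Ω ρ R D k ξ n)).toReal ≤
      1024 * R * (D + 2) ^ 3 / ρ ^ 3 * (critRadius k ξ n ^ 2 * critLevel k ξ n ^ 2) := by
  have hρ := h.pos
  have hR := h.R_pos
  filter_upwards [eventually_crit k ξ (ε := ρ / (4 * (D + 2))) (by positivity) 0]
    with n ⟨_, hr, hr1, hL, _⟩
  rw [lt_div_iff₀ (by positivity)] at hr1
  refine (h.volume_roughSet_le (δ := (D + 2) * critRadius k ξ n / ρ) (by positivity) ?_
    (by positivity) (by linarith) (by positivity)).trans (le_of_eq ?_)
  · rw [div_le_iff₀ hρ]; linarith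
  · field_simp

lemma tendsto_firstMoment {k : ℕ} (hk : 1 ≤ k) (ξ : ℝ) :
    Tendsto (fun n : ℕ => n * (∫⁻ x, lowDensity (volume.restrict Ω) k n (critRadius k ξ n) x
      ∂volume.restrict Ω).toReal) atTop
      (𝓝 ((if k = 1 then exp (-ξ) else 0) + (μH[1] (frontier Ω)).toReal *
        (√π * exp (-ξ / 2) / (2 ^ (k + 1) * (k.factorial : ℝ))))) := by
  have hρ := h.pos
  have hR := h.R_pos
  have hρR := h.le
  have hpi := pi_pos
  set ℓ := (μH[1] (frontier Ω)).toReal with hℓ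
  have hℓ0 : 0 ≤ ℓ := ENNReal.toReal_nonneg
  have hℓe : μH[1] (frontier Ω) = ENNReal.ofReal ℓ :=
    (ENNReal.ofReal_toReal h.hausdorffMeasure_frontier_ne_top).symm
  set K := 1024 * R * (2 + 2) ^ 3 / ρ ^ 3 with hK
  set κ := 1 / (4 * π * R ^ 2) with hκ
  have hK0 : 0 ≤ K := by positivity
  let J : ℝ → ℕ → ℝ := fun C n => critRadius k ξ n *
    ∫ u in Set.Ioc 0 C, poissonLow k (critLevel k ξ n / π * capArea u)
  let V : ℕ → ℝ := fun n => K * (critRadius k ξ n ^ 2 * critLevel k ξ n ^ 2)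
  have hq := tendsto_natCast_mul_poissonLow_critLevel hk ξ
  have hJ1 : Tendsto (fun n => n * J 4 n) atTop _ := tendsto_boundary_term hk ξ (by norm_num : (1 : ℝ) ≤ 4)
  have hJ2 : Tendsto (fun n => n * J (4 * R / ρ) n) atTop _ := tendsto_boundary_term hk ξ
    (by rw [le_div_iff₀ hρ]; linarith : (1 : ℝ) ≤ 4 * R / ρ)
  have hinv : Tendsto (fun n => (critLevel k ξ n)⁻¹) atTop (𝓝 0) :=
    tendsto_inv_atTop_zero.comp (tendsto_critLevel k ξ)
  have hV : Tendsto (fun n : ℕ => n * (poissonLow k (κ * critLevel k ξ n) * V n)) atTop (𝓝 0) := by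
    have := ((tendsto_pow_mul_poissonLow k 3 (by positivity : 0 < κ)).comp
      (tendsto_critLevel k ξ)).const_mul (K / π)
    rw [mul_zero] at this
    refine this.congr' ?_
    filter_upwards [eventually_crit k ξ one_pos 0] with n ⟨_, _, _, _, hn⟩
    have : n * (poissonLow k (κ * critLevel k ξ n) * V n) = K * (n * critRadius k ξ n ^ 2) *
        critLevel k ξ n ^ 2 * poissonLow k (κ * critLevel k ξ n) := by simp only [V]; ring
    rw [this, hn]
    simp only [Function.comp_apply]
    field_simp
  have hexp : Tendsto (fun n => exp (2 * ((critLevel k ξ n)⁻¹ / π))) atTop (𝓝 1) := by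
    have := (continuous_exp.tendsto _).comp ((hinv.div_const π).const_mul 2)
    simpa [Function.comp_def] using this
  have hδ : Tendsto (fun n => 1 - 4 * critRadius k ξ n / ρ) atTop (𝓝 1) := by
    have := (((tendsto_critRadius k ξ).const_mul 4).div_const ρ).const_sub 1
    simpa using this
  have hup : Tendsto (fun n : ℕ => n * poissonLow k (critLevel k ξ n) +
      n * (poissonLow k (κ * critLevel k ξ n) * V n) +
      exp (2 * ((critLevel k ξ n)⁻¹ / π)) * (ℓ * (n * J (4 * R / ρ) n))) atTop _ :=
    (hq.add hV).add (hexp.mul (hJ2.const_mul ℓ))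
  have hlow : Tendsto (fun n : ℕ => (1 - 4 * critRadius k ξ n / ρ) ^ 2 *
      (n * poissonLow k (critLevel k ξ n)) + (1 - 4 * critRadius k ξ n / ρ) * (ℓ * (n * J 4 n)))
      atTop _ := ((hδ.pow 2).mul hq).add (hδ.mul (hJ1.const_mul ℓ))
  rw [add_zero, one_mul] at hup
  rw [one_pow, one_mul, one_mul] at hlow
  have hJ0 : ∀ C, ∀ᶠ n in atTop, 0 ≤ J C n := fun C => by
    filter_upwards [eventually_crit k ξ one_pos 0] with n ⟨_, h1, _, h2, _⟩
    refine mul_nonneg h1.le (setIntegral_nonneg measurableSet_Ioc fun u _ => (poissonLow_pos k ?_).le)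
    exact mul_nonneg (by positivity) (capArea_nonneg u)
  refine tendsto_of_tendsto_of_tendsto_of_le_of_le' hlow hup ?_ ?_
  · filter_upwards [eventually_crit k ξ (ε := ρ / 4) (by positivity) 0, hJ0 4]
      with n ⟨hn0, hr, hr1, hL, hn⟩ hJn
    have hδ0 : 0 < 4 * critRadius k ξ n / ρ := by positivity
    have hδ1 : 4 * critRadius k ξ n / ρ < 1 := by rw [div_lt_one hρ]; linarith
    have h1 := h.le_lintegral_lowDensity k n hr hδ0 hδ1
    rw [div_mul_cancel₀ _ hρ.ne', lintegral_layerDensity k n hr (by norm_num), hn, mul_left_comm,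
      hn, mul_div_cancel₀ _ hpi.ne', hℓe, ← ENNReal.ofReal_mul hℓ0,
      ← ENNReal.ofReal_mul (sq_nonneg _), ← ENNReal.ofReal_mul (sub_nonneg.2 hδ1.le),
      ← ENNReal.ofReal_add (mul_nonneg (by positivity) (poissonLow_pos k hL.le).le)
        (mul_nonneg (by linarith) (mul_nonneg hℓ0 hJn))] at h1
    have hfin : ∫⁻ x, lowDensity (volume.restrict Ω) k n (critRadius k ξ n) x
        ∂volume.restrict Ω ≠ ⊤ := by
      have := h.isProbabilityMeasure
      exact ne_top_of_le_ne_top ENNReal.one_ne_top (lintegral_lowDensity_le_one _ k n _)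
    have h2 := (ENNReal.ofReal_le_iff_le_toReal hfin).1 h1
    calc _ = n * ((1 - 4 * critRadius k ξ n / ρ) ^ 2 * poissonLow k (critLevel k ξ n) +
          (1 - 4 * critRadius k ξ n / ρ) * (ℓ * J 4 n)) := by ring
      _ ≤ _ := by gcongr
  · filter_upwards [eventually_crit k ξ (ε := ρ / 4) (by positivity) 2, hJ0 (4 * R / ρ),
      h.volume_critRough_le k ξ le_rfl]
      with n ⟨hn0, hr, hr1, hL, hn⟩ hJn hZ
    have hL0 : 0 < critLevel k ξ n := by linarith
    have h1 := h.lintegral_lowDensity_le k n (σ := (2 + 2) * critRadius k ξ n)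
      (δ := (2 + 2) * critRadius k ξ n / ρ) (η := critRadius k ξ n / critLevel k ξ n ^ 2) hr
      (by linarith) (by linarith) (by field_simp)
      (by rw [div_lt_one hρ]; linarith) (by positivity) (by
        refine div_le_div_of_nonneg_left hr.le (by norm_num) ?_
        nlinarith)
    have hZfin : volume (critRough Ω ρ R 2 k ξ n) ≠ ⊤ :=
      ne_top_of_le_ne_top (h.volume_ne_top Set.univ) (measure_mono fun x hx => ⟨hx.1, trivial⟩)
    have hZ' : volume (roughSet Ω R ((2 + 2) * critRadius k ξ n / ρ) ((2 + 2) * critRadius k ξ n)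
        (critRadius k ξ n / critLevel k ξ n ^ 2)) ≤ ENNReal.ofReal (V n) := by
      refine (ENNReal.ofReal_toReal hZfin).symm.le.trans ?_
      exact ENNReal.ofReal_le_ofReal hZ
    have e1 : n * (critRadius k ξ n ^ 2 / (4 * R ^ 2)) = κ * critLevel k ξ n := by
      rw [← mul_div_assoc, hn, hκ]; field_simp
    have e2 : n * critRadius k ξ n * (critRadius k ξ n / critLevel k ξ n ^ 2) =
        (critLevel k ξ n)⁻¹ / π := by
      rw [mul_assoc, ← mul_div_assoc, ← sq, ← mul_div_assoc, hn]; field_simp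
    have e3 : (2 + 2) * critRadius k ξ n / ρ * R = 4 * R / ρ * critRadius k ξ n := by ring
    have hVn : 0 ≤ V n := by positivity
    have h2 := h1.trans (add_le_add_left (add_le_add_right (mul_le_mul_right hZ' _) _) _)
    rw [e1, e2, e3, lintegral_layerDensity k n hr (by positivity), hn, mul_left_comm (n : ℝ) π,
      hn, mul_div_cancel₀ _ hpi.ne', hℓe, ← ENNReal.ofReal_mul hℓ0,
      ← ENNReal.ofReal_mul (exp_pos _).le,
      ← ENNReal.ofReal_mul (poissonLow_pos k (by positivity)).le,
      ← ENNReal.ofReal_add (poissonLow_pos k hL0.le).le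
        (mul_nonneg (poissonLow_pos k (by positivity)).le hVn),
      ← ENNReal.ofReal_add (add_nonneg (poissonLow_pos k hL0.le).le
        (mul_nonneg (poissonLow_pos k (by positivity)).le hVn))
        (mul_nonneg (exp_pos _).le (mul_nonneg hℓ0 hJn))] at h2
    have h3 := ENNReal.toReal_le_of_le_ofReal (add_nonneg (add_nonneg (poissonLow_pos k hL0.le).le
        (mul_nonneg (poissonLow_pos k (by positivity)).le hVn))
        (mul_nonneg (exp_pos _).le (mul_nonneg hℓ0 hJn))) h2
    calc _ ≤ n * (poissonLow k (critLevel k ξ n) + poissonLow k (κ * critLevel k ξ n) * V n +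
          exp (2 * ((critLevel k ξ n)⁻¹ / π)) * (ℓ * J (4 * R / ρ) n)) := by gcongr
      _ = _ := by ring

end UnitBody

lemma critical_constant {k : ℕ} (hk : 1 ≤ k) {ℓ c ξ : ℝ} (hℓ : 0 < ℓ)
    (hξ1 : k = 1 → ξ = -2 * Real.log (√(exp (-c) + π * ℓ ^ 2 / 64) - ℓ * √π / 8))
    (hξ2 : 1 < k → ξ = 2 * Real.log (ℓ * √π / (2 ^ (k + 1) * (k.factorial : ℝ))) + 2 * c) :
    (if k = 1 then exp (-ξ) else 0) + ℓ * (√π * exp (-ξ / 2) / (2 ^ (k + 1) * (k.factorial : ℝ))) =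
      exp (-c) := by
  have hpi := pi_pos
  have hs := Real.sqrt_pos.2 hpi
  rcases hk.eq_or_lt with hk1 | hk1
  · have hξ := hξ1 hk1.symm
    subst hk1
    set s := √(exp (-c) + π * ℓ ^ 2 / 64) - ℓ * √π / 8 with hsd
    have hsq : (ℓ * √π / 8) ^ 2 = π * ℓ ^ 2 / 64 := by
      rw [div_pow, mul_pow, Real.sq_sqrt hpi.le]; ring
    have h0 : 0 < s := by
      rw [hsd, sub_pos]
      refine Real.lt_sqrt_of_sq_lt ?_
      rw [hsq]; linarith [exp_pos (-c)]
    have h1 : (s + ℓ * √π / 8) ^ 2 = exp (-c) + π * ℓ ^ 2 / 64 := by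
      rw [hsd, sub_add_cancel, Real.sq_sqrt (by positivity)]
    have h2 : exp (-ξ / 2) = s := by
      rw [hξ, show -(-2 * Real.log s) / 2 = Real.log s by ring, exp_log h0]
    have h3 : exp (-ξ) = s ^ 2 := by rw [← h2, ← exp_nat_mul]; congr 1; push_cast; ring
    rw [if_pos rfl, h2, h3]
    norm_num
    nlinarith
  · rw [if_neg (by omega), zero_add, hξ2 hk1]
    set A := ℓ * √π / (2 ^ (k + 1) * (k.factorial : ℝ)) with hA
    have hA0 : 0 < A := by positivity
    have h1 : exp (-(2 * Real.log A + 2 * c) / 2) = A⁻¹ * exp (-c) := by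
      rw [show -(2 * Real.log A + 2 * c) / 2 = -Real.log A + -c by ring, exp_add, exp_neg (Real.log A),
        exp_log hA0]
    rw [h1]
    calc _ = A * (A⁻¹ * exp (-c)) := by rw [hA]; ring
      _ = _ := by rw [mul_inv_cancel_left₀ hA0.ne']

end

section
variable {Ω : Set ℂ} {ρ R : ℝ}

/-- Bound for the mass of the pair kernel at the critical scale. -/
noncomputable def pairMass (Ω : Set ℂ) (ρ R D : ℝ) (k : ℕ) (ξ : ℝ) (n : ℕ) : ℝ :=
  (volume (critRough Ω ρ R D k ξ n)).toReal *
      (poissonLow k (n * (critRadius k ξ n ^ 2 / (16 * R ^ 2))) * (π * (D * critRadius k ξ n) ^ 2)) +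
    6 * (poissonPlane k / (pairConst D * n * critRadius k ξ n) ^ 2) *
      (∫⁻ x, lowDensity (volume.restrict Ω) k n (critRadius k ξ n) x ∂volume.restrict Ω).toReal

namespace UnitBody
variable (h : UnitBody Ω ρ R)
include h

lemma pairMass_nonneg (D : ℝ) (k : ℕ) (ξ : ℝ) (n : ℕ) : 0 ≤ pairMass Ω ρ R D k ξ n := by
  have := h.R_pos
  have h1 := poissonLow_pos k (x := n * (critRadius k ξ n ^ 2 / (16 * R ^ 2))) (by positivity)
  have h2 := poissonPlane_nonneg k
  unfold pairMass
  positivity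

lemma lintegral_lowDensity_ne_top (k n : ℕ) (r : ℝ) :
    ∫⁻ x, lowDensity (volume.restrict Ω) k n r x ∂volume.restrict Ω ≠ ⊤ := by
  have := h.isProbabilityMeasure
  exact ne_top_of_le_ne_top ENNReal.one_ne_top (lintegral_lowDensity_le_one _ k n _)

lemma volume_critRough_ne_top (D : ℝ) (k : ℕ) (ξ : ℝ) (n : ℕ) :
    volume (critRough Ω ρ R D k ξ n) ≠ ⊤ :=
  ne_top_of_le_ne_top (h.volume_ne_top Set.univ) (measure_mono fun _ hx => ⟨hx.1, trivial⟩)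

lemma lintegral_critPair_le {D : ℝ} (hD : 2 ≤ D) (k : ℕ) (ξ : ℝ) : ∀ᶠ n : ℕ in atTop,
    ∫⁻ x, ∫⁻ y, pairKernel Ω (critRough Ω ρ R D k ξ n) R D k n (critRadius k ξ n) x y
      ∂volume.restrict Ω ∂volume.restrict Ω ≤ ENNReal.ofReal (pairMass Ω ρ R D k ξ n) := by
  have := h.R_pos
  have h2 := poissonPlane_nonneg k
  filter_upwards [eventually_crit k ξ one_pos 0] with n ⟨hn, hr, _, _, _⟩
  refine (h.lintegral_pairKernel_le (h.measurableSet_roughSet _ _ _) (by linarith) hr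
    (by exact_mod_cast hn)).trans (le_of_eq ?_)
  have h1 := poissonLow_pos k (x := n * (critRadius k ξ n ^ 2 / (16 * R ^ 2))) (by positivity)
  rw [pairMass, ENNReal.ofReal_add (by positivity) (by positivity),
    ENNReal.ofReal_mul ENNReal.toReal_nonneg,
    ENNReal.ofReal_toReal (h.volume_critRough_ne_top _ _ _ _),
    ENNReal.ofReal_mul (q := (∫⁻ x, lowDensity (volume.restrict Ω) k n (critRadius k ξ n) x
      ∂volume.restrict Ω).toReal) (by positivity),
    ENNReal.ofReal_toReal (h.lintegral_lowDensity_ne_top _ _ _)]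
  rfl

lemma tendsto_pairMass {D : ℝ} (hD : 2 ≤ D) {k : ℕ} (hk : 1 ≤ k) (ξ : ℝ) :
    Tendsto (fun n : ℕ => n ^ 2 * pairMass Ω ρ R D k ξ n) atTop (𝓝 0) := by
  have hR := h.R_pos
  have hρ := h.pos
  have hpi := pi_pos
  have hD0 : 0 < D := by linarith
  have hc := pairConst_pos hD0
  have hpp := poissonPlane_nonneg k
  have hinv : Tendsto (fun n => (critLevel k ξ n)⁻¹) atTop (𝓝 0) :=
    tendsto_inv_atTop_zero.comp (tendsto_critLevel k ξ)
  set κ := 1 / (16 * π * R ^ 2) with hκ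
  set A := 1024 * R * (D + 2) ^ 3 / ρ ^ 3 with hA
  have t1 := ((tendsto_pow_mul_poissonLow k 4 (by positivity : 0 < κ)).comp
    (tendsto_critLevel k ξ)).const_mul (A * D ^ 2 / π)
  have t2 := ((h.tendsto_firstMoment hk ξ).mul hinv).const_mul
    (6 * poissonPlane k * π / pairConst D ^ 2)
  have t := t1.add t2
  simp only [mul_zero, add_zero] at t
  refine squeeze_zero' (.of_forall fun n => mul_nonneg (by positivity) (h.pairMass_nonneg D k ξ n))
    ?_ t
  filter_upwards [eventually_crit k ξ one_pos 0, h.volume_critRough_le k ξ hD]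
    with n ⟨hn0, hr, _, hL, hn⟩ hZ
  have e1 : n * (critRadius k ξ n ^ 2 / (16 * R ^ 2)) = κ * critLevel k ξ n := by
    rw [← mul_div_assoc, hn, hκ]; field_simp
  have hq := poissonLow_pos k (x := κ * critLevel k ξ n) (by positivity)
  simp only [Function.comp_apply]
  rw [pairMass, e1, mul_add]
  set r := critRadius k ξ n with hr'
  set L := critLevel k ξ n with hL'
  have hL2 : L = n * r ^ 2 * π := by rw [hn]; field_simp
  refine add_le_add ?_ (le_of_eq ?_)
  · calc _ ≤ (n : ℝ) ^ 2 * (A * (r ^ 2 * L ^ 2) * (poissonLow k (κ * L) * (π * (D * r) ^ 2))) := by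
          gcongr
      _ = A * D ^ 2 * π * (n * r ^ 2) ^ 2 * L ^ 2 * poissonLow k (κ * L) := by ring
      _ = _ := by rw [hn]; field_simp
  · rw [hL2]; field_simp

lemma closePairs_le {k n : ℕ} {r : ℝ} (hr : 0 ≤ r) (hr1 : r ≤ 2 * R) :
    closePairs (volume.restrict Ω) k n r ≤
      ENNReal.ofReal ((∫⁻ x, lowDensity (volume.restrict Ω) k n r x ∂volume.restrict Ω).toReal *
        (poissonLow k (n * (r ^ 2 / (4 * R ^ 2))) * (π * (4 * r) ^ 2))) := by
  have := h.isProbabilityMeasure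
  have hR := h.R_pos
  set μ := volume.restrict Ω with hμ
  have hq := poissonLow_pos k (x := n * (r ^ 2 / (4 * R ^ 2))) (by positivity)
  set q := poissonLow k (n * (r ^ 2 / (4 * R ^ 2)))
  rw [closePairs, ENNReal.ofReal_mul ENNReal.toReal_nonneg,
    ENNReal.ofReal_toReal (h.lintegral_lowDensity_ne_top _ _ _),
    ← lintegral_mul_const _ (measurable_lowDensity μ k n r)]
  refine lintegral_mono fun x => ?_
  have hmem : ∀ᵐ y ∂μ, y ∈ Ω := ae_restrict_mem h.measurableSet
  calc _ ≤ ∫⁻ y, (closedBall x (4 * r)).indicator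
        (fun _ => lowDensity μ k n r x * ENNReal.ofReal q) y ∂μ := by
        refine lintegral_mono_ae (hmem.mono fun y hy => ?_)
        by_cases hd : dist x y ≤ 4 * r
        · have hyb : y ∈ closedBall x (4 * r) := by rwa [mem_closedBall, dist_comm]
          rw [if_pos hd, Set.indicator_of_mem hyb]
          refine mul_le_mul_right (ENNReal.ofReal_le_ofReal (poissonLow_le (by positivity) ?_)) _
          have := h.le_ballArea hy hr hr1
          rw [ballArea] at this
          gcongr
        · rw [if_neg hd]; exact zero_le
    _ = lowDensity μ k n r x * ENNReal.ofReal q * μ (closedBall x (4 * r)) := by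
        rw [lintegral_indicator measurableSet_closedBall, setLIntegral_const]
    _ ≤ _ := by
        rw [ENNReal.ofReal_mul hq.le, ← mul_assoc]
        refine mul_le_mul_right ?_ _
        rw [← ENNReal.ofReal_toReal (measure_ne_top μ (closedBall x (4 * r)))]
        exact ENNReal.ofReal_le_ofReal (h.ballArea_le x (by positivity))

/-- The number of vertices of degree at most `k` is asymptotically Poisson. -/
theorem tendsto_no_lowDeg {k : ℕ} (hk : 1 ≤ k) (ξ : ℝ) :
    Tendsto (fun n : ℕ => (Measure.pi fun _ : Fin n => volume.restrict Ω).real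
      {X | ∀ i, ¬ LowDeg k (critRadius k ξ n) X i}) atTop
      (𝓝 (exp (-((if k = 1 then exp (-ξ) else 0) + (μH[1] (frontier Ω)).toReal *
        (√π * exp (-ξ / 2) / (2 ^ (k + 1) * (k.factorial : ℝ))))))) := by
  have := h.isProbabilityMeasure
  have hR := h.R_pos
  have hρ := h.pos
  have hpi := pi_pos
  have hr0 : ∀ n, 0 ≤ critRadius k ξ n := fun n => Real.sqrt_nonneg _
  set κ := 1 / (4 * π * R ^ 2) with hκ
  refine tendsto_pi_no_lowDeg (volume.restrict Ω) k
    (pm := fun n => π * critRadius k ξ n ^ 2) (H := pairMass Ω ρ R 2 k ξ)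
    (K := fun n => (∫⁻ x, lowDensity (volume.restrict Ω) k n (critRadius k ξ n) x
      ∂volume.restrict Ω).toReal * (poissonLow k (n * (critRadius k ξ n ^ 2 / (4 * R ^ 2))) *
        (π * (4 * critRadius k ξ n) ^ 2)))
    (h := fun n => pairKernel Ω (critRough Ω ρ R 2 k ξ n) R 2 k n (critRadius k ξ n))
    hr0 (fun n x => h.ballArea_le x (hr0 n)) ?_ ?_ (h.tendsto_firstMoment hk ξ)
    (h.pairMass_nonneg 2 k ξ) (fun n => ?_)
    (fun n => h.measurable_pairKernel (h.measurableSet_roughSet _ _ _)) ?_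
    (h.lintegral_critPair_le le_rfl k ξ) ?_ (h.tendsto_pairMass le_rfl hk ξ) ?_
  · simpa using ((tendsto_critRadius k ξ).pow 2).const_mul π
  · refine (tendsto_critLevel_pow_div k ξ 2).congr' ?_
    filter_upwards [eventually_crit k ξ one_pos 0] with n ⟨hn0, hr, _, hL, hn⟩
    have : critLevel k ξ n = n * critRadius k ξ n ^ 2 * π := by rw [hn]; field_simp
    rw [this]; field_simp
  · have h1 := poissonLow_pos k (x := n * (critRadius k ξ n ^ 2 / (4 * R ^ 2))) (by positivity)
    positivity
  · filter_upwards [eventually_crit k ξ (ε := ρ / 4) (by positivity) 2] with n ⟨hn0, hr, hr1, hL, hn⟩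
    have hρR := h.le
    refine h.pairBound_pairKernel hr (by linarith) le_rfl
      (η := critRadius k ξ n / critLevel k ξ n ^ 2) ?_ fun x hx hxZ => ?_
    · exact div_le_div_of_nonneg_left hr.le (by norm_num) (by nlinarith)
    · refine h.exists_flatAt ?_ (by positivity) le_rfl hx hxZ
      rw [div_lt_one hρ]; linarith
  · filter_upwards [eventually_crit k ξ hR 0] with n ⟨hn0, hr, hr1, hL, hn⟩
    exact h.closePairs_le hr.le (by linarith)
  · have t := ((h.tendsto_firstMoment hk ξ).mul
      (((tendsto_pow_mul_poissonLow k 1 (by positivity : 0 < κ)).comp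
        (tendsto_critLevel k ξ)))).const_mul 16
    simp only [mul_zero] at t
    refine t.congr' ?_
    filter_upwards [eventually_crit k ξ one_pos 0] with n ⟨hn0, hr, _, hL, hn⟩
    have e1 : n * (critRadius k ξ n ^ 2 / (4 * R ^ 2)) = κ * critLevel k ξ n := by
      rw [← mul_div_assoc, hn, hκ]; field_simp
    have e2 : critLevel k ξ n = n * critRadius k ξ n ^ 2 * π := by rw [hn]; field_simp
    simp only [Function.comp_apply]
    rw [e1, pow_one]
    nth_rw 1 [e2]
    ring

/-- Close pairs of points whose joint private neighbourhood is sparse are asymptotically absent. -/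
theorem tendsto_pairRegion {D : ℝ} (hD : 2 ≤ D) {k : ℕ} (hk : 1 ≤ k) (ξ : ℝ) :
    Tendsto (fun n : ℕ => (Measure.pi fun _ : Fin n => volume.restrict Ω) {X | ∃ i j, X i ≠ X j ∧
      X i ∈ Ω ∧ X j ∈ Ω ∧ dist (X i) (X j) ≤ D * critRadius k ξ n ∧
      Nat.card {l // (l ≠ i ∧ l ≠ j) ∧ X l ∈ pairRegion (critRadius k ξ n) (X i) (X j)} ≤ k})
      atTop (𝓝 0) := by
  have hR := h.R_pos
  have hρ := h.pos
  have hpi := pi_gt_three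
  have hD0 : 0 < D := by linarith
  have t := (h.tendsto_pairMass hD hk ξ).mul_const (exp (2 + 2 * k))
  rw [zero_mul] at t
  have t2 := (ENNReal.continuous_ofReal.tendsto _).comp t
  rw [ENNReal.ofReal_zero] at t2
  refine tendsto_of_tendsto_of_tendsto_of_le_of_le' tendsto_const_nhds t2
    (.of_forall fun n => zero_le) ?_
  filter_upwards [eventually_crit k ξ (ε := min (ρ / (D + 2)) (1 / (4 * R * D))) (by positivity) 2,
    h.lintegral_critPair_le hD k ξ] with n ⟨hn0, hr, hr1, hL, hn⟩ hI
  have hρR := h.le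
  rw [lt_min_iff, lt_div_iff₀ (by positivity), lt_div_iff₀ (by positivity)] at hr1
  refine (h.pi_pairRegion_le (η := critRadius k ξ n / critLevel k ξ n ^ 2) hr (by nlinarith) hD
    (by nlinarith) (by positivity) ?_ ?_ (h.measurableSet_roughSet _ _ _)
    (fun x hx hxZ => ?_)).trans ((mul_le_mul_right hI _).trans (le_of_eq ?_))
  · exact div_le_div_of_nonneg_left hr.le (by norm_num) (by nlinarith)
  · have e : 3 * n * critRadius k ξ n * (critRadius k ξ n / critLevel k ξ n ^ 2) =
        3 * (n * critRadius k ξ n ^ 2) / critLevel k ξ n ^ 2 := by ring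
    rw [e, hn, div_le_one (by positivity)]
    calc 3 * (critLevel k ξ n / π) ≤ 3 * (critLevel k ξ n / 3) := by gcongr
      _ ≤ _ := by nlinarith
  · refine h.exists_flatAt ?_ (by positivity) le_rfl hx hxZ
    rw [div_lt_one hρ]; linarith
  · rw [← ENNReal.ofReal_mul (by positivity)]
    simp only [Function.comp_apply]
    congr 1; ring

end UnitBody
end

lemma poissonLow_le_exp_half (k : ℕ) {x : ℝ} (hx : 0 ≤ x) :
    poissonLow k x ≤ 2 ^ k * exp (-(x / 2)) := by
  have h1 : ∑ s ∈ Finset.range (k + 1), x ^ s / (s.factorial : ℝ) ≤ 2 ^ k * exp (x / 2) := by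
    refine le_trans ?_ (mul_le_mul_of_nonneg_left
      (Real.sum_le_exp_of_nonneg (by positivity : 0 ≤ x / 2) (k + 1)) (by positivity))
    rw [Finset.mul_sum]
    refine Finset.sum_le_sum fun s hs => ?_
    have hs : s ≤ k := Nat.lt_succ_iff.1 (Finset.mem_range.1 hs)
    have : (2 : ℝ) ^ s ≤ 2 ^ k := pow_le_pow_right₀ one_le_two hs
    rw [div_pow, div_div, mul_comm, div_mul_eq_mul_div]
    rw [div_le_div_iff₀ (by positivity) (by positivity)]
    have h0 : 0 ≤ x ^ s * (s.factorial : ℝ) := by positivity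
    nlinarith
  calc poissonLow k x ≤ exp (-x) * (2 ^ k * exp (x / 2)) :=
        mul_le_mul_of_nonneg_left h1 (exp_pos _).le
    _ = 2 ^ k * (exp (-x) * exp (x / 2)) := by ring
    _ = _ := by rw [← exp_add]; congr 2; ring

/-- Locally, only few well separated small discs contain at most `k` of the points. -/
def SparseVoids {ι : Type*} (Ω : Set ℂ) (J k : ℕ) (M r : ℝ) (X : ι → ℂ) : Prop :=
  ∀ p ∈ Ω, ∀ g : Fin (J + 1) → ℂ, (∀ j, g j ∈ Ω ∧ dist (g j) p ≤ M * r) →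
    (∀ i j, i ≠ j → r ≤ dist (g i) (g j)) →
    ∃ j, k < Nat.card {i // X i ∈ closedBall (g j) (r / 8)}

noncomputable def cellOf (s : ℝ) (z : ℂ) : ℤ × ℤ := (⌊z.re / s⌋, ⌊z.im / s⌋)

open Classical in
/-- A point of `Ω` in the given cell of the grid of mesh `s` if there is one. -/
noncomputable def cellRep (Ω : Set ℂ) (s : ℝ) (a : ℤ × ℤ) : ℂ :=
  if h : ∃ z ∈ Ω, cellOf s z = a then h.choose else 0

lemma cellRep_spec {Ω : Set ℂ} {s : ℝ} {z : ℂ} (hz : z ∈ Ω) :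
    cellRep Ω s (cellOf s z) ∈ Ω ∧ cellOf s (cellRep Ω s (cellOf s z)) = cellOf s z := by
  have h : ∃ w ∈ Ω, cellOf s w = cellOf s z := ⟨z, hz, rfl⟩
  rw [cellRep, dif_pos h]
  exact h.choose_spec

lemma abs_sub_le_of_floor_eq {s x y : ℝ} (hs : 0 < s) (h : ⌊x / s⌋ = ⌊y / s⌋) : |x - y| ≤ s := by
  have h1 := Int.floor_le (x / s)
  have h2 := Int.lt_floor_add_one (x / s)
  have h3 := Int.floor_le (y / s)
  have h4 := Int.lt_floor_add_one (y / s)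
  rw [h] at h1 h2
  have h5 : |x / s - y / s| ≤ 1 := by rw [abs_le]; constructor <;> linarith
  rwa [← sub_div, abs_div, abs_of_pos hs, div_le_one hs] at h5

lemma dist_le_of_cellOf_eq {s : ℝ} {z w : ℂ} (hs : 0 < s) (h : cellOf s z = cellOf s w) :
    dist z w ≤ 2 * s := by
  rw [cellOf, cellOf, Prod.mk.injEq] at h
  have h1 := abs_sub_le_of_floor_eq hs h.1
  have h2 := abs_sub_le_of_floor_eq hs h.2
  rw [dist_eq_norm]
  refine (Complex.norm_le_abs_re_add_abs_im _).trans ?_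
  rw [Complex.sub_re, Complex.sub_im]
  linarith

lemma floor_sub_mem {s x y t : ℝ} {Q : ℤ} (hs : 0 < s) (h : |x - y| ≤ t) (hQ : t / s + 1 ≤ Q) :
    ⌊x / s⌋ - ⌊y / s⌋ ∈ Finset.Icc (-Q) Q := by
  have h1 := Int.floor_le (x / s)
  have h2 := Int.lt_floor_add_one (x / s)
  have h3 := Int.floor_le (y / s)
  have h4 := Int.lt_floor_add_one (y / s)
  have h5 : |x / s - y / s| ≤ t / s := by
    rw [← sub_div, abs_div, abs_of_pos hs]; gcongr
  rw [abs_le] at h5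
  rw [Finset.mem_Icc]
  constructor
  · have : (-Q : ℝ) ≤ ⌊x / s⌋ - ⌊y / s⌋ := by linarith
    exact_mod_cast this
  · have : (⌊x / s⌋ : ℝ) - ⌊y / s⌋ ≤ Q := by linarith
    exact_mod_cast this

section
variable {Ω : Set ℂ} {ρ R : ℝ}
namespace UnitBody
variable (h : UnitBody Ω ρ R)
include h

lemma cellRep_mem (s : ℝ) (a : ℤ × ℤ) : cellRep Ω s a ∈ Ω := by
  classical
  rw [cellRep]
  split_ifs with h1
  · exact h1.choose_spec.1
  · exact h.zero_mem

lemma pi_cells_le {J k n : ℕ} {r : ℝ} (hr : 0 < r) (hr1 : r ≤ 2 * R) (z : Fin (J + 1) → ℂ)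
    (hz : ∀ j, z j ∈ Ω)
    (hd : Pairwise fun i j => Disjoint (closedBall (z i) (r / 16)) (closedBall (z j) (r / 16))) :
    (Measure.pi fun _ : Fin n => volume.restrict Ω)
      {X | ∀ j, Nat.card {i // X i ∈ closedBall (z j) (r / 16)} ≤ k} ≤
      ENNReal.ofReal (exp ((J + 1) * k) * poissonLow k (n * (r ^ 2 / (1024 * R ^ 2))) ^ (J + 1)) := by
  have := h.isProbabilityMeasure
  have hR := h.R_pos
  rw [← ENNReal.ofReal_toReal (measure_ne_top _ _)]
  refine ENNReal.ofReal_le_ofReal ?_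
  refine (pi_real_few_le (volume.restrict Ω) k (fun j => closedBall (z j) (r / 16))
    (fun _ => measurableSet_closedBall) hd n (by simp)).trans ?_
  have hP1 := sum_real_le_one (volume.restrict Ω) (fun j => closedBall (z j) (r / 16))
    (fun _ => measurableSet_closedBall) hd
  have hb : ∀ j, r ^ 2 / (1024 * R ^ 2) ≤ (volume.restrict Ω).real (closedBall (z j) (r / 16)) := by
    intro j
    have := h.le_ballArea (hz j) (r := r / 16) (by positivity) (by linarith)
    refine le_trans (le_of_eq ?_) this
    rw [div_pow]; field_simp; norm_num
  have hq := poissonLow_pos k (x := n * (r ^ 2 / (1024 * R ^ 2))) (by positivity)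
  refine mul_le_mul (exp_le_exp.2 ?_) ?_
    (Finset.prod_nonneg fun j _ => (poissonLow_pos k (by positivity)).le) (exp_pos _).le
  · rw [Fintype.card_fin, Fintype.card_fin, sub_self, zero_add]
    push_cast
    exact mul_le_of_le_one_left (by positivity) hP1
  · refine (Finset.prod_le_prod (fun j _ => (poissonLow_pos k (by positivity)).le) fun j _ =>
      poissonLow_le (by positivity) (mul_le_mul_of_nonneg_left (hb j) (by positivity))).trans ?_
    simp

lemma pi_not_sparseVoids_le {J k n : ℕ} {M r : ℝ} {N Q : ℕ} (hr : 0 < r) (hr1 : r ≤ 2 * R)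
    (hN : 32 * R / r + 1 ≤ N) (hQ : 64 * M + 1 ≤ Q) :
    (Measure.pi fun _ : Fin n => volume.restrict Ω) {X | ¬ SparseVoids Ω J k M r X} ≤
      ENNReal.ofReal ((2 * N + 1) ^ 2 * (((2 * Q + 1) ^ 2) ^ (J + 1) *
        (exp ((J + 1) * k) * poissonLow k (n * (r ^ 2 / (1024 * R ^ 2))) ^ (J + 1)))) := by
  classical
  have := h.isProbabilityMeasure
  set P := Measure.pi fun _ : Fin n => volume.restrict Ω with hP
  set s := r / 32 with hs
  have hs0 : 0 < s := by positivity
  set B := ENNReal.ofReal (exp ((J + 1) * k) *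
    poissonLow k (n * (r ^ 2 / (1024 * R ^ 2))) ^ (J + 1)) with hB
  let box (Q : ℕ) : Finset (ℤ × ℤ) := Finset.Icc (-(Q : ℤ)) Q ×ˢ Finset.Icc (-(Q : ℤ)) Q
  have hcard : ∀ Q : ℕ, (box Q).card = (2 * Q + 1) ^ 2 := fun Q => by
    simp only [box, Finset.card_product, Int.card_Icc]
    rw [sq]; congr 1 <;> omega
  let z (a : ℤ × ℤ) (d : Fin (J + 1) → box Q) (j : Fin (J + 1)) : ℂ := cellRep Ω s (a + (d j).1)
  let E (a : ℤ × ℤ) (d : Fin (J + 1) → box Q) : Set (Fin n → ℂ) :=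
    {X | (Pairwise fun i j => Disjoint (closedBall (z a d i) (r / 16)) (closedBall (z a d j) (r / 16)))
      ∧ ∀ j, Nat.card {i // X i ∈ closedBall (z a d j) (r / 16)} ≤ k}
  have hE : ∀ a d, P (E a d) ≤ B := by
    intro a d
    by_cases hd : Pairwise fun i j =>
        Disjoint (closedBall (z a d i) (r / 16)) (closedBall (z a d j) (r / 16))
    · exact (measure_mono fun X hX => hX.2).trans
        (h.pi_cells_le hr hr1 (z a d) (fun j => h.cellRep_mem s _) hd)
    · have : E a d = ∅ := Set.eq_empty_of_forall_notMem fun X hX => hd hX.1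
      rw [this, measure_empty]; exact zero_le
  have hsub : {X | ¬ SparseVoids Ω J k M r X} ⊆ ⋃ a ∈ box N, ⋃ d, E a d := by
    intro X hX
    replace hX : ¬ SparseVoids Ω J k M r X := hX
    unfold SparseVoids at hX
    push Not at hX
    obtain ⟨p, hp, g, hg, hgd, hgk⟩ := hX
    have hNr : R / s + 1 ≤ ((N : ℤ) : ℝ) := by
      refine le_trans (le_of_eq ?_) hN
      rw [hs]; field_simp
    have hQr : 2 * M * r / s + 1 ≤ ((Q : ℤ) : ℝ) := by
      refine le_trans (le_of_eq ?_) hQ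
      rw [hs]; field_simp; ring
    have hbase : cellOf s (g 0) ∈ box N := by
      have hn := h.norm_le (hg 0).1
      have h1 := floor_sub_mem (y := 0) hs0
        (by simpa using (Complex.abs_re_le_norm (g 0)).trans hn) hNr
      have h2 := floor_sub_mem (y := 0) hs0
        (by simpa using (Complex.abs_im_le_norm (g 0)).trans hn) hNr
      simp only [zero_div, Int.floor_zero, sub_zero] at h1 h2
      exact Finset.mem_product.2 ⟨h1, h2⟩
    have hoff : ∀ j, cellOf s (g j) - cellOf s (g 0) ∈ box Q := by
      intro j
      have hd : ‖g j - g 0‖ ≤ 2 * M * r := by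
        rw [← dist_eq_norm]
        have := dist_triangle_right (g j) (g 0) p
        linarith [(hg j).2, (hg 0).2]
      refine Finset.mem_product.2 ⟨floor_sub_mem hs0 ?_ hQr, floor_sub_mem hs0 ?_ hQr⟩
      · rw [← Complex.sub_re]; exact (Complex.abs_re_le_norm _).trans hd
      · rw [← Complex.sub_im]; exact (Complex.abs_im_le_norm _).trans hd
    simp only [Set.mem_iUnion]
    refine ⟨_, hbase, fun j => ⟨_, hoff j⟩, ?_⟩
    have hzj : ∀ j, dist (z (cellOf s (g 0)) (fun j => ⟨_, hoff j⟩) j) (g j) ≤ r / 16 := by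
      intro j
      simp only [z, add_sub_cancel]
      refine (dist_le_of_cellOf_eq hs0 (cellRep_spec (hg j).1).2).trans (le_of_eq ?_)
      rw [hs]; ring
    refine ⟨fun i j hij => closedBall_disjoint_closedBall ?_, fun j => ?_⟩
    · have h1 := hzj i
      have h2 := hzj j
      have h3 := hgd i j hij
      have h4 := dist_triangle4 (g i) (z (cellOf s (g 0)) (fun j => ⟨_, hoff j⟩) i)
        (z (cellOf s (g 0)) (fun j => ⟨_, hoff j⟩) j) (g j)
      rw [dist_comm] at h1
      linarith
    · refine (nat_card_le_of_imp fun i hi => ?_).trans (hgk j)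
      rw [mem_closedBall] at hi ⊢
      have := dist_triangle (X i) _ (g j) |>.trans (add_le_add hi (hzj j))
      linarith
  have hB0 := poissonLow_pos k (x := n * (r ^ 2 / (1024 * R ^ 2)))
    (by have := h.R_pos; positivity)
  calc P _ ≤ P (⋃ a ∈ box N, ⋃ d, E a d) := measure_mono hsub
    _ ≤ ∑ a ∈ box N, P (⋃ d, E a d) := measure_biUnion_finset_le _ _
    _ ≤ ∑ a ∈ box N, ∑ d, P (E a d) := Finset.sum_le_sum fun a _ => measure_iUnion_fintype_le _ _
    _ ≤ ∑ a ∈ box N, ∑ d : Fin (J + 1) → box Q, B :=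
        Finset.sum_le_sum fun a _ => Finset.sum_le_sum fun d _ => hE a d
    _ = _ := by
        rw [Finset.sum_const, Finset.sum_const, Finset.card_univ, Fintype.card_fun,
          Fintype.card_coe, hcard, hcard, Fintype.card_fin, nsmul_eq_mul, nsmul_eq_mul,
          ENNReal.ofReal_mul (by positivity), ENNReal.ofReal_mul (by positivity)]
        have e : ∀ m : ℕ, ((m : ℕ) : ENNReal) = ENNReal.ofReal m := fun m => by simp
        rw [e, e]
        push_cast
        rfl

lemma tendsto_not_sparseVoids {k : ℕ} (hk : 1 ≤ k) (ξ : ℝ) : ∃ J : ℕ, ∀ M,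
    Tendsto (fun n : ℕ => (Measure.pi fun _ : Fin n => volume.restrict Ω)
      {X | ¬ SparseVoids Ω J k M (critRadius k ξ n) X}) atTop (𝓝 0) := by
  have hR := h.R_pos
  have hpi := pi_pos
  set κ := 1 / (1024 * π * R ^ 2) with hκ
  have hκ0 : 0 < κ := by positivity
  obtain ⟨J, hJ⟩ := exists_nat_gt (2 / κ)
  rw [div_lt_iff₀ hκ0] at hJ
  refine ⟨J, fun M => ?_⟩
  obtain ⟨Q, hQ⟩ := exists_nat_ge (64 * M + 1)
  set A := (70 * R) ^ 2 * π * (((2 * Q + 1) ^ 2) ^ (J + 1) * (exp ((J + 1) * k) * (2 ^ k) ^ (J + 1)))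
    with hA
  have t : Tendsto (fun n : ℕ => A * (exp (-ξ) / Real.log n ^ (2 * k - 1))) atTop (𝓝 0) := by
    have h1 := (tendsto_pow_atTop (α := ℝ) (n := 2 * k - 1) (by omega)).comp tendsto_log_natCast
    have := (tendsto_const_nhds (x := exp (-ξ))).div_atTop h1
    simpa using this.const_mul A
  have t2 := (ENNReal.continuous_ofReal.tendsto _).comp t
  rw [ENNReal.ofReal_zero] at t2
  refine tendsto_of_tendsto_of_tendsto_of_le_of_le' tendsto_const_nhds t2
    (.of_forall fun n => zero_le) ?_
  filter_upwards [eventually_crit k ξ (ε := R) hR π, exp_neg_critLevel hk ξ]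
    with n ⟨hn0, hr, hr1, hL, hn⟩ he
  have hL0 : 0 < critLevel k ξ n := by linarith
  obtain ⟨N, hN1, hN2⟩ : ∃ N : ℕ, 32 * R / critRadius k ξ n + 1 ≤ N ∧
      (N : ℝ) ≤ 32 * R / critRadius k ξ n + 2 := by
    refine ⟨⌈32 * R / critRadius k ξ n + 1⌉₊, Nat.le_ceil _, ?_⟩
    have := (Nat.ceil_lt_add_one (a := 32 * R / critRadius k ξ n + 1) (by positivity)).le
    linarith
  refine (h.pi_not_sparseVoids_le hr (by linarith) hN1 hQ).trans (ENNReal.ofReal_le_ofReal ?_)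
  have e1 : n * (critRadius k ξ n ^ 2 / (1024 * R ^ 2)) = κ * critLevel k ξ n := by
    rw [← mul_div_assoc, hn, hκ]; field_simp
  rw [e1]
  have hq := poissonLow_pos k (x := κ * critLevel k ξ n) (by positivity)
  have h1 : (2 * (N : ℝ) + 1) ^ 2 ≤ (70 * R) ^ 2 * π * n := by
    have hR1 : 1 ≤ R / critRadius k ξ n := by rw [one_le_div hr]; exact hr1.le
    have h2 : 2 * (N : ℝ) + 1 ≤ 70 * (R / critRadius k ξ n) := by
      have : 32 * R / critRadius k ξ n = 32 * (R / critRadius k ξ n) := by ring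
      linarith
    calc (2 * (N : ℝ) + 1) ^ 2 ≤ (70 * (R / critRadius k ξ n)) ^ 2 := by gcongr
      _ = (70 * R) ^ 2 * (1 / critRadius k ξ n ^ 2) := by ring
      _ ≤ (70 * R) ^ 2 * (π * n) := by
          gcongr
          rw [div_le_iff₀ (by positivity), mul_assoc, hn, mul_div_cancel₀ _ hpi.ne']
          linarith [pi_gt_three]
      _ = _ := by ring
  have h3 : poissonLow k (κ * critLevel k ξ n) ^ (J + 1) ≤
      (2 ^ k) ^ (J + 1) * exp (-critLevel k ξ n) := by
    calc _ ≤ (2 ^ k * exp (-(κ * critLevel k ξ n / 2))) ^ (J + 1) := by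
          gcongr; exact poissonLow_le_exp_half k (by positivity)
      _ = (2 ^ k) ^ (J + 1) * exp ((J + 1 : ℕ) * (-(κ * critLevel k ξ n / 2))) := by
          rw [mul_pow, ← exp_nat_mul]
      _ ≤ _ := by
          gcongr
          push_cast
          nlinarith
  beta_reduce
  rw [← he]
  calc _ ≤ (70 * R) ^ 2 * π * n * (((2 * Q + 1) ^ 2) ^ (J + 1) * (exp ((J + 1) * k) *
        ((2 ^ k) ^ (J + 1) * exp (-critLevel k ξ n)))) := by gcongr
    _ = _ := by rw [hA]; ring

end UnitBody
end

lemma of_segment_of_close {E : Type*} [NormedAddCommGroup E] [NormedSpace ℝ E] {P : E → Prop}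
    {x y : E} {ε : ℝ} (hε : 0 < ε)
    (h : ∀ p ∈ segment ℝ x y, ∀ q ∈ segment ℝ x y, dist p q ≤ ε → P p → P q) (hx : P x) : P y := by
  obtain ⟨N, hN⟩ := exists_nat_gt (dist x y / ε)
  have hN0 : (0 : ℝ) < N := lt_of_le_of_lt (by positivity) hN
  have hmem : ∀ j : ℕ, j ≤ N → AffineMap.lineMap x y ((j : ℝ) / N) ∈ segment ℝ x y := by
    intro j hj
    rw [segment_eq_image_lineMap]
    refine ⟨_, ⟨by positivity, ?_⟩, rfl⟩
    rw [div_le_one hN0]; exact_mod_cast hj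
  have key : ∀ j : ℕ, j ≤ N → P (AffineMap.lineMap x y ((j : ℝ) / N)) := by
    intro j
    induction j with
    | zero => intro _; simpa using hx
    | succ j ih =>
      intro hj
      refine h _ (hmem j (by omega)) _ (hmem _ hj) ?_ (ih (by omega))
      rw [dist_lineMap_lineMap, Real.dist_eq, ← sub_div, Nat.cast_succ]
      rw [show (j : ℝ) - (j + 1) = -1 by ring, abs_div, abs_neg, abs_one, abs_of_pos hN0]
      rw [div_lt_iff₀ hε] at hN
      rw [one_div_mul_eq_div, div_le_iff₀ hN0]
      linarith
  have := key N le_rfl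
  rwa [div_self hN0.ne', AffineMap.lineMap_apply_one] at this

lemma exists_exit {α : Type*} {rel : α → α → Prop} {d : α → ℝ} {r D : ℝ} {a w : α} (hr : 0 ≤ r)
    (hstep : ∀ u v, rel u v → d v ≤ d u + r) (h : Relation.ReflTransGen rel a w)
    (hw : D < d w) :
    ∃ w', Relation.ReflTransGen (fun u v => rel u v ∧ d u ≤ D + r ∧ d v ≤ D + r) a w' ∧ D < d w' := by
  suffices H : Relation.ReflTransGen (fun u v => rel u v ∧ d u ≤ D + r ∧ d v ≤ D + r) a w ∨
      ∃ w', Relation.ReflTransGen (fun u v => rel u v ∧ d u ≤ D + r ∧ d v ≤ D + r) a w' ∧ D < d w' from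
    H.elim (fun h => ⟨w, h, hw⟩) id
  clear hw
  induction h with
  | refl => exact .inl .refl
  | @tail u v _ huv ih =>
    rcases ih with ih | ih
    · by_cases hu : D < d u
      · exact .inr ⟨u, ih, hu⟩
      · push Not at hu
        exact .inl (ih.tail ⟨huv, by linarith, by linarith [hstep u v huv]⟩)
    · exact .inr ih

lemma exists_crossing {α : Type*} {rel : α → α → Prop} {φ : α → ℝ} {c : ℝ} {a w : α}
    (ha : φ a ≤ c) (h : Relation.ReflTransGen rel a w) (hw : c < φ w) :
    ∃ u v, Relation.ReflTransGen rel a u ∧ rel u v ∧ φ u ≤ c ∧ c < φ v := by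
  induction h with
  | refl => linarith
  | @tail u v hu huv ih =>
    by_cases h1 : c < φ u
    · exact ih h1
    · exact ⟨u, v, hu, huv, not_lt.1 h1, hw⟩

lemma exists_transversal (V₀ : ℂ) {δ : ℂ} (hδ : δ ≠ 0) {m : ℝ} (hm : 0 < m) :
    ∃ V e : ℂ, ‖V - V₀‖ ≤ m ∧ m ≤ ‖V‖ ∧ ‖e‖ = 1 ∧ inner ℝ e V = 0 ∧
      ‖δ‖ * m ≤ inner ℝ e δ * ‖V‖ := by
  have hδ0 : 0 < ‖δ‖ := norm_pos_iff.2 hδ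
  obtain ⟨σ, hσ1, hσ⟩ : ∃ σ : ℝ, σ * σ = 1 ∧ 0 ≤ σ * inner ℝ (Complex.I * δ) V₀ := by
    rcases le_total 0 (inner ℝ (Complex.I * δ) V₀) with h | h
    · exact ⟨1, by norm_num, by linarith⟩
    · exact ⟨-1, by norm_num, by linarith⟩
  have hσa : |σ| = 1 := by
    have := abs_mul_abs_self σ
    rw [hσ1] at this
    nlinarith [abs_nonneg σ]
  set u : ℂ := (‖δ‖⁻¹ : ℝ) • (Complex.I * δ) with hu
  have hun : ‖u‖ = 1 := by
    rw [hu, norm_smul, norm_mul, Complex.norm_I, one_mul, norm_inv, norm_norm,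
      inv_mul_cancel₀ hδ0.ne']
  set V := V₀ + (σ * m) • u with hV
  have huV : m ≤ σ * inner ℝ u V := by
    rw [hV, inner_add_right, inner_smul_right, real_inner_self_eq_norm_sq, hun, hu,
      real_inner_smul_left]
    have : 0 ≤ ‖δ‖⁻¹ * (σ * inner ℝ (Complex.I * δ) V₀) := by positivity
    linear_combination this - m * hσ1
  have hVm : m ≤ ‖V‖ := by
    refine huV.trans ((le_abs_self _).trans ?_)
    rw [abs_mul, hσa, one_mul]
    exact (abs_real_inner_le_norm u V).trans (by rw [hun, one_mul])
  have hV0 : 0 < ‖V‖ := hm.trans_le hVm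
  refine ⟨V, (-σ * ‖V‖⁻¹) • (Complex.I * V), ?_, hVm, ?_, ?_, ?_⟩
  · rw [hV, add_sub_cancel_left, norm_smul, hun, mul_one, norm_mul, Real.norm_eq_abs, hσa, one_mul,
      Real.norm_of_nonneg hm.le]
  · rw [norm_smul, norm_mul, norm_mul, norm_neg, Real.norm_eq_abs, hσa, Complex.norm_I, norm_inv,
      norm_norm, one_mul, one_mul, inv_mul_cancel₀ hV0.ne']
  · rw [real_inner_smul_left]
    have : inner ℝ (Complex.I * V) V = 0 := by
      rw [Complex.inner]
      simp
      ring
    rw [this, mul_zero]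
  · rw [real_inner_smul_left]
    have h1 : inner ℝ (Complex.I * V) δ = - inner ℝ (Complex.I * δ) V := by
      rw [Complex.inner, Complex.inner]
      simp
      ring
    have h2 : inner ℝ (Complex.I * δ) V = ‖δ‖ * inner ℝ u V := by
      rw [hu, real_inner_smul_left, mul_inv_cancel_left₀ hδ0.ne']
    rw [h1, h2, mul_right_comm, mul_assoc (-σ), inv_mul_cancel₀ hV0.ne']
    nlinarith

/-- Adjacency in the geometric graph after removal of `S`. -/
def GeomStep {ι : Type*} (r : ℝ) (X : ι → ℂ) (S : Finset ι) (u v : ι) : Prop :=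
  u ∉ S ∧ v ∉ S ∧ dist (X u) (X v) ≤ r

abbrev GeomReach {ι : Type*} (r : ℝ) (X : ι → ℂ) (S : Finset ι) : ι → ι → Prop :=
  Relation.ReflTransGen (GeomStep r X S)

/-- The point `p` is very close to a vertex in the component of `a`. -/
def Touches {ι : Type*} (r : ℝ) (X : ι → ℂ) (S : Finset ι) (a : ι) (p : ℂ) : Prop :=
  ∃ u ∉ S, GeomReach r X S a u ∧ dist (X u) p ≤ r / 8

section
variable {ι : Type*} {k : ℕ} {r : ℝ} {X : ι → ℂ} {S : Finset ι} {a b : ι} {p q : ℂ}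

lemma GeomReach.symm (h : GeomReach r X S a b) : GeomReach r X S b a :=
  have : Std.Symm (GeomStep r X S) :=
    ⟨fun _ _ huv => ⟨huv.2.1, huv.1, by rw [dist_comm]; exact huv.2.2⟩⟩
  Relation.ReflTransGen.stdSymm.symm _ _ h

lemma GeomReach.notMem (h : GeomReach r X S a b) (ha : a ∉ S) : b ∉ S := by
  induction h with
  | refl => exact ha
  | tail _ h _ => exact h.2.1

lemma SparseVoids.exists_line {Ω : Set ℂ} {J : ℕ} {M : ℝ} (h : SparseVoids Ω J k M r X)
    (hr : 0 ≤ r) (hp : p ∈ Ω) {e : ℂ} (he : ‖e‖ = 1) : ∃ c, 0 ≤ c ∧ c ≤ J * r ∧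
      ∀ q ∈ Ω, dist q p ≤ M * r → inner ℝ e (q - p) = c →
        k < Nat.card {i // X i ∈ closedBall q (r / 8)} := by
  by_contra! hc
  have hj : ∀ j : Fin (J + 1), ∃ q ∈ Ω, dist q p ≤ M * r ∧ inner ℝ e (q - p) = j * r ∧
      Nat.card {i // X i ∈ closedBall q (r / 8)} ≤ k := fun j =>
    hc (j * r) (by positivity) (by
      have : ((j : ℕ) : ℝ) ≤ J := by exact_mod_cast Nat.lt_succ_iff.1 j.2
      gcongr)
  choose g hg1 hg2 hg3 hg4 using hj
  obtain ⟨j, hj⟩ := h p hp g (fun j => ⟨hg1 j, hg2 j⟩) fun i j hij => by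
    have h1 : inner ℝ e (g i - g j) = ((i : ℕ) - (j : ℕ) : ℝ) * r := by
      rw [← sub_sub_sub_cancel_right (g i) (g j) p, inner_sub_right, hg3, hg3]; ring
    have h2 := abs_real_inner_le_norm e (g i - g j)
    rw [h1, he, one_mul, abs_mul, abs_of_nonneg hr, ← dist_eq_norm] at h2
    refine le_trans ?_ h2
    have h3 : (1 : ℝ) ≤ |((i : ℕ) - (j : ℕ) : ℝ)| := by
      have h4 : ((i : ℕ) : ℤ) - (j : ℕ) ≠ 0 := fun h0 => hij (Fin.ext (by omega))
      exact_mod_cast Int.one_le_abs h4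
    exact le_mul_of_one_le_left hr h3
  exact absurd hj (not_lt.2 (hg4 j))

lemma Touches.reach (hr : 0 ≤ r) (h1 : Touches r X S a p) (h2 : Touches r X S b p) :
    GeomReach r X S a b := by
  obtain ⟨u, hu, hau, hup⟩ := h1
  obtain ⟨v, hv, hbv, hvp⟩ := h2
  refine (hau.tail ⟨hu, hv, ?_⟩).trans hbv.symm
  have := dist_triangle_right (X u) (X v) p
  linarith

variable [Finite ι]

lemma exists_notMem_of_card (hS : S.card ≤ k) {P : ι → Prop} (h : k < Nat.card {i // P i}) :
    ∃ i ∉ S, P i := by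
  by_contra! hc
  have h1 : Nat.card {i // P i} ≤ Nat.card {i // i ∈ S} :=
    nat_card_le_of_imp fun i hi => by_contra fun hiS => hc i hiS hi
  have h2 : Nat.card {i // i ∈ S} = S.card := by simp
  omega

lemma touches_of_dist_le (hS : S.card ≤ k)
    (hp : k < Nat.card {i // X i ∈ closedBall p (r / 8)}) (ha : a ∉ S) (hab : GeomReach r X S a b)
    (hb : dist (X b) p ≤ 7 * r / 8) : Touches r X S a p := by
  obtain ⟨i, hi, hip⟩ := exists_notMem_of_card hS hp
  rw [mem_closedBall] at hip
  refine ⟨i, hi, hab.tail ⟨hab.notMem ha, hi, ?_⟩, hip⟩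
  have := dist_triangle_right (X b) (X i) p
  linarith

lemma Touches.segment (hS : S.card ≤ k) (hr : 0 < r) (ha : a ∉ S)
    (h : ∀ x ∈ segment ℝ p q, k < Nat.card {i // X i ∈ closedBall x (r / 8)})
    (hp : Touches r X S a p) : Touches r X S a q := by
  refine of_segment_of_close (ε := r / 4) (by positivity) (fun x _ y hy hxy hx => ?_) hp
  obtain ⟨u, hu, hau, hux⟩ := hx
  refine touches_of_dist_le hS (h y hy) ha hau ?_
  have := dist_triangle (X u) x y
  linarith

end

section
variable {Ω : Set ℂ} {ρ R : ℝ}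
variable {ι : Type*} {J k : ℕ} {M D B r : ℝ} {X : ι → ℂ} {S : Finset ι} {a b w v : ι}

lemma exists_level_touch {e : ℂ} {c : ℝ} {x₀ : ℂ} {u : ι}
    (hau : GeomReach r X S a u) (huv : GeomStep r X S u v)
    (hu : inner ℝ e (X u - x₀) ≤ c) (hv : c < inner ℝ e (X v - x₀)) :
    ∃ q ∈ segment ℝ (X u) (X v), inner ℝ e (q - x₀) = c ∧
      ∃ y, GeomReach r X S a y ∧ dist (X y) q ≤ 7 * r / 8 := by
  set s := (c - inner ℝ e (X u - x₀)) / (inner ℝ e (X v - x₀) - inner ℝ e (X u - x₀)) with hs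
  have hpos : 0 < inner ℝ e (X v - x₀) - inner ℝ e (X u - x₀) := by linarith
  have hs0 : 0 ≤ s := div_nonneg (by linarith) hpos.le
  have hs1 : s ≤ 1 := by rw [hs, div_le_one hpos]; linarith
  have hq : X u + s • (X v - X u) ∈ segment ℝ (X u) (X v) := by
    rw [segment_eq_image']; exact ⟨s, ⟨hs0, hs1⟩, rfl⟩
  refine ⟨_, hq, ?_, ?_⟩
  · have e1 : X u + s • (X v - X u) - x₀ = (X u - x₀) + s • ((X v - x₀) - (X u - x₀)) := by
      rw [sub_sub_sub_cancel_right]; ring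
    rw [e1, inner_add_right, real_inner_smul_right,
      inner_sub_right e (X v - x₀) (X u - x₀), hs, div_mul_cancel₀ _ hpos.ne']
    ring
  · have h1 := dist_add_dist_of_mem_segment hq
    have h2 := huv.2.2
    rcases le_total (dist (X u) (X u + s • (X v - X u))) (r / 2) with h3 | h3
    · have := dist_nonneg (x := X u) (y := X u + s • (X v - X u))
      have := dist_nonneg (x := X u) (y := X v)
      exact ⟨u, hau, by linarith⟩
    · refine ⟨v, hau.tail huv, ?_⟩
      have := dist_nonneg (x := X u) (y := X v)
      rw [dist_comm]; linarith

variable [Finite ι]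

lemma UnitBody.exists_contact (h : UnitBody Ω ρ R) (hX : ∀ i, X i ∈ Ω)
    (hsp : SparseVoids Ω J k M r X) (hS : S.card ≤ k) (hr : 0 < r) (hD0 : 0 ≤ D)
    (hD : 3 * R * J ≤ ρ * D) (hB : 4 * (D + 1 + J) ≤ B) (hBr : 2 * B * r ≤ ρ)
    (hM : D + 1 + 6 * B * R / ρ ≤ M) (ha : a ∉ S) (hw : GeomReach r X S a w)
    (hfar : D * r < dist (X a) (X w)) :
    ∃ z, closedBall z (B * r) ⊆ Ω ∧ ∀ cx cy, 0 ≤ cx - z.re → cx - z.re ≤ J * r →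
      0 ≤ cy - z.im → cy - z.im ≤ J * r →
      ∃ t ∈ closedBall z (B * r), (t.re = cx ∨ t.im = cy) ∧ Touches r X S a t := by
  have hρ := h.pos
  have hR := h.R_pos
  have hB0 : 0 < B := by have : (0 : ℝ) ≤ J := by positivity
                         linarith
  set m := B * r with hm
  have hm0 : 0 < m := by positivity
  obtain ⟨w', hw', hfar'⟩ := exists_exit (d := fun i => dist (X a) (X i)) (D := D * r) hr.le
    (fun u v huv => (dist_triangle (X a) (X u) (X v)).trans (add_le_add_right huv.2.2 _)) hw hfar
  have hδ : X w' - X a ≠ 0 := by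
    intro h0
    rw [sub_eq_zero] at h0
    simp only [h0, dist_self] at hfar'
    have : 0 ≤ D * r := by positivity
    linarith
  set V₀ : ℂ := -((2 * m / ρ : ℝ) • X a) with hV₀
  obtain ⟨V, e, hVV, hmV, he, heV, hδV⟩ := exists_transversal V₀ hδ hm0
  have hV0 : 0 < ‖V‖ := hm0.trans_le hmV
  have hVle : ‖V‖ ≤ 3 * m * R / ρ := by
    have h1 : ‖V₀‖ ≤ 2 * m / ρ * R := by
      rw [hV₀, norm_neg, norm_smul, Real.norm_of_nonneg (by positivity)]
      gcongr
      exact h.norm_le (hX a)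
    have h2 : ‖V‖ ≤ ‖V - V₀‖ + ‖V₀‖ := by simpa using norm_add_le (V - V₀) V₀
    have h3 : m ≤ m * R / ρ := by
      rw [le_div_iff₀ hρ]; exact mul_le_mul_of_nonneg_left h.le hm0.le
    calc ‖V‖ ≤ m * R / ρ + 2 * m / ρ * R := by linarith
      _ = _ := by ring
  have hδe : J * r < inner ℝ e (X w' - X a) := by
    have h1 : D * r < ‖X w' - X a‖ := by rw [← dist_eq_norm, dist_comm]; exact hfar'
    have hE : 0 ≤ inner ℝ e (X w' - X a) := by
      by_contra! hc
      have : 0 ≤ ‖X w' - X a‖ * m := by positivity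
      nlinarith
    have h2 : ‖X w' - X a‖ * m ≤ inner ℝ e (X w' - X a) * (3 * m * R / ρ) :=
      hδV.trans (mul_le_mul_of_nonneg_left hVle hE)
    have h3 : ‖X w' - X a‖ ≤ inner ℝ e (X w' - X a) * (3 * R / ρ) := by
      refine le_of_mul_le_mul_right (h2.trans (le_of_eq ?_)) hm0
      ring
    have h4 : D * r < inner ℝ e (X w' - X a) * (3 * R / ρ) := h1.trans_le h3
    rw [← mul_div_assoc, lt_div_iff₀ hρ] at h4
    have h5 : 3 * R * (J * r) < 3 * R * inner ℝ e (X w' - X a) := by nlinarith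
    exact lt_of_mul_lt_mul_left h5 (by positivity)
  obtain ⟨c, hc0, hcJ, hgood⟩ := hsp.exists_line hr.le (hX a) he
  obtain ⟨u, v, hau, ⟨huv, hu, hv⟩, hcu, hcv⟩ := exists_crossing
    (φ := fun i => inner ℝ e (X i - X a)) (c := c) (by simpa using hc0) hw' (hcJ.trans_lt hδe)
  have hau' : GeomReach r X S a u := Relation.ReflTransGen.mono (fun _ _ hxy => hxy.1) _ _ hau
  obtain ⟨q, hq, hqc, y, hay, hyq⟩ := exists_level_touch hau' huv hcu hcv
  have hqΩ : q ∈ Ω := h.convex.segment_subset (hX u) (hX v) hq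
  have hqa : dist q (X a) ≤ (D + 1) * r := by
    have hu' : X u ∈ closedBall (X a) ((D + 1) * r) := by
      rw [mem_closedBall, dist_comm]; linarith
    have hv' : X v ∈ closedBall (X a) ((D + 1) * r) := by
      rw [mem_closedBall, dist_comm]; linarith
    exact (convex_closedBall _ _).segment_subset hu' hv' hq
  have hz : closedBall (X a + V) m ⊆ Ω := by
    have h1 : closedBall (X a + V₀) (2 * m) ⊆ Ω := by
      refine h.closedBall_subset ?_
      have e1 : X a + V₀ = ((1 - 2 * m / ρ : ℝ) : ℂ) * X a := by
        rw [hV₀, Complex.real_smul]; push_cast; ring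
      have h2 : 0 ≤ 1 - 2 * m / ρ := by
        rw [sub_nonneg, div_le_one hρ]; linarith
      rw [e1, h.gauge_smul h2]
      exact mul_le_of_le_one_right h2 (h.gauge_le_one_iff.2 (hX a))
    refine (closedBall_subset_closedBall' ?_).trans h1
    rw [dist_add_left, dist_eq_norm]; linarith
  set τ := m / (2 * ‖V‖) with hτ
  have hτ0 : 0 < τ := by positivity
  have hτ1 : τ ≤ 1 / 2 := by
    rw [hτ, div_le_iff₀ (by positivity)]; linarith
  have hτV : τ * ‖V‖ = m / 2 := by rw [hτ]; field_simp
  have hJ0 : (0 : ℝ) ≤ J := by positivity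
  have hBr' : 4 * ((D + 1) * r + J * r) ≤ m := by
    have := mul_le_mul_of_nonneg_right hB hr.le
    linarith
  have hJr : 0 ≤ J * r := by positivity
  have hnear : ∀ t : ℝ, |t - 1| ≤ τ → q + t • V ∈ closedBall (X a + V) m := by
    intro t ht
    have e1 : q + t • V - (X a + V) = (q - X a) + (t - 1) • V := by rw [sub_smul, one_smul]; ring
    rw [mem_closedBall, dist_eq_norm, e1]
    refine (norm_add_le _ _).trans ?_
    rw [norm_smul, Real.norm_eq_abs, ← dist_eq_norm]
    have := mul_le_mul_of_nonneg_right ht hV0.le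
    linarith
  have hend : q + (1 + τ) • V ∈ Ω := hz (hnear _ (by rw [add_sub_cancel_left, abs_of_pos hτ0]))
  have hcrowd : ∀ t : ℝ, 0 ≤ t → t ≤ 1 + τ →
      k < Nat.card {i // X i ∈ closedBall (q + t • V) (r / 8)} := by
    intro t ht0 ht1
    refine hgood _ ?_ ?_ ?_
    · refine h.convex.segment_subset hqΩ hend ?_
      rw [segment_eq_image']
      refine ⟨t / (1 + τ), ⟨by positivity, (div_le_one (by positivity)).2 ht1⟩, ?_⟩
      beta_reduce
      rw [add_sub_cancel_left, smul_smul, div_mul_cancel₀ _ (by positivity)]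
    · rw [dist_eq_norm, add_sub_right_comm]
      refine (norm_add_le _ _).trans ?_
      rw [norm_smul, Real.norm_of_nonneg ht0, ← dist_eq_norm]
      have h1 : t * ‖V‖ ≤ 2 * (3 * m * R / ρ) := by gcongr; linarith
      have h2 := mul_le_mul_of_nonneg_right hM hr.le
      have h3 : 2 * (3 * m * R / ρ) = 6 * B * R / ρ * r := by rw [hm]; ring
      linarith
    · rw [add_sub_right_comm, inner_add_right, real_inner_smul_right, heV, hqc]; ring
  have htouch : ∀ t : ℝ, |t - 1| ≤ τ → Touches r X S a (q + t • V) := by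
    intro t ht
    rw [abs_le] at ht
    have hq0 : Touches r X S a q := touches_of_dist_le hS
      (by simpa using hcrowd 0 le_rfl (by linarith)) ha hay hyq
    refine hq0.segment hS hr ha fun x hx => ?_
    rw [segment_eq_image'] at hx
    obtain ⟨s, hs, rfl⟩ := hx
    beta_reduce
    rw [add_sub_cancel_left, smul_smul]
    refine hcrowd _ (mul_nonneg hs.1 (by linarith)) ?_
    exact (mul_le_of_le_one_left (by linarith) hs.2).trans (by linarith)
  refine ⟨X a + V, hz, fun cx cy hx0 hx1 hy0 hy1 => ?_⟩
  have solve : ∀ x z y v c : ℝ, |y| ≤ (D + 1) * r → ‖V‖ / 2 ≤ |v| → z = x - y + v →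
      0 ≤ c - z → c - z ≤ J * r → ∃ t : ℝ, |t - 1| ≤ τ ∧ x + t * v = c := by
    intro x z y v c hy hv hz hc0 hc1
    have hv0 : v ≠ 0 := abs_pos.1 (by linarith)
    refine ⟨(c - x) / v, ?_, by field_simp; ring⟩
    have e1 : (c - x) / v - 1 = (c - z - y) / v := by rw [hz]; field_simp; ring
    rw [e1, abs_div, div_le_iff₀ (abs_pos.2 hv0)]
    have h1 : |c - z - y| ≤ J * r + (D + 1) * r := by
      refine (abs_sub _ _).trans (add_le_add ?_ hy)
      rwa [abs_of_nonneg hc0]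
    have h2 : τ * (‖V‖ / 2) ≤ τ * |v| := mul_le_mul_of_nonneg_left hv hτ0.le
    linarith
  rcases le_total (‖V‖ / 2) |V.re| with hre | hre
  · obtain ⟨t, ht, htc⟩ := solve q.re (X a + V).re (q - X a).re V.re cx
      ((Complex.abs_re_le_norm _).trans (by rwa [← dist_eq_norm])) hre
      (by simp only [Complex.add_re, Complex.sub_re]; ring) hx0 hx1
    exact ⟨_, hnear t ht, .inl (by simpa using htc), htouch t ht⟩
  · have him : ‖V‖ / 2 ≤ |V.im| := by
      have := Complex.norm_le_abs_re_add_abs_im V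
      linarith
    obtain ⟨t, ht, htc⟩ := solve q.im (X a + V).im (q - X a).im V.im cy
      ((Complex.abs_im_le_norm _).trans (by rwa [← dist_eq_norm])) him
      (by simp only [Complex.add_im, Complex.sub_im]; ring) hy0 hy1
    exact ⟨_, hnear t ht, .inr (by simpa using htc), htouch t ht⟩

end

section
variable {Ω : Set ℂ} {ρ R : ℝ} {ι : Type*} {J k : ℕ} {M D B r : ℝ} {X : ι → ℂ} {S : Finset ι}
  {a b : ι}

lemma SparseVoids.exists_cross (h : SparseVoids Ω J k M r X) (hr : 0 ≤ r) :
    ∃ o : ℂ → ℂ, ∀ z ∈ Ω, (0 ≤ (o z).re - z.re ∧ (o z).re - z.re ≤ J * r) ∧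
      (0 ≤ (o z).im - z.im ∧ (o z).im - z.im ≤ J * r) ∧
      ∀ q ∈ Ω, dist q z ≤ M * r → q.re = (o z).re ∨ q.im = (o z).im →
        k < Nat.card {i // X i ∈ closedBall q (r / 8)} := by
  have key : ∀ z, ∃ o : ℂ, z ∈ Ω → (0 ≤ o.re - z.re ∧ o.re - z.re ≤ J * r) ∧
      (0 ≤ o.im - z.im ∧ o.im - z.im ≤ J * r) ∧
      ∀ q ∈ Ω, dist q z ≤ M * r → q.re = o.re ∨ q.im = o.im →
        k < Nat.card {i // X i ∈ closedBall q (r / 8)} := by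
    intro z
    by_cases hz : z ∈ Ω
    · obtain ⟨c, hc0, hc1, hc⟩ := h.exists_line hr hz (e := 1) (by simp)
      obtain ⟨d, hd0, hd1, hd⟩ := h.exists_line hr hz (e := Complex.I) (by simp)
      refine ⟨⟨z.re + c, z.im + d⟩, fun _ => ⟨by simpa using ⟨hc0, hc1⟩, by simpa using ⟨hd0, hd1⟩,
        fun q hq hqz hqo => ?_⟩⟩
      rcases hqo with hqo | hqo
      · exact hc q hq hqz (by rw [Complex.inner]; simp [hqo])
      · exact hd q hq hqz (by rw [Complex.inner]; simp [hqo])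
    · exact ⟨0, fun h => absurd h hz⟩
  choose o ho using key
  exact ⟨o, ho⟩

variable [Finite ι]

lemma UnitBody.reach_of_far (h : UnitBody Ω ρ R) (hX : ∀ i, X i ∈ Ω)
    (hsp : SparseVoids Ω J k M r X) (hS : S.card ≤ k) (hr : 0 < r) (hD0 : 0 ≤ D)
    (hD : 3 * R * J ≤ ρ * D) (hB : 4 * (D + 1 + J) ≤ B) (hBr : 2 * B * r ≤ ρ)
    (hM : D + 1 + 6 * B * R / ρ ≤ M) (ha : a ∉ S) (hb : b ∉ S)
    (hfa : ∃ w, GeomReach r X S a w ∧ D * r < dist (X a) (X w))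
    (hfb : ∃ w, GeomReach r X S b w ∧ D * r < dist (X b) (X w)) : GeomReach r X S a b := by
  have hρ := h.pos
  have hJ0 : (0 : ℝ) ≤ J := by positivity
  have hJr : 0 ≤ J * r := by positivity
  have hB0 : 0 < B := by linarith
  have hBr0 : (2 * J + 1) * r ≤ B * r := by gcongr; linarith
  have hMB : B * r ≤ M * r := by
    gcongr
    have : B ≤ 6 * B * R / ρ := by
      rw [le_div_iff₀ hρ]
      have := mul_le_mul_of_nonneg_left h.le hB0.le
      have : 0 ≤ B * ρ := by positivity
      linarith
    linarith
  obtain ⟨w, hw, hfa⟩ := hfa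
  obtain ⟨w', hw', hfb⟩ := hfb
  obtain ⟨za, hza, hca⟩ := h.exists_contact hX hsp hS hr hD0 hD hB hBr hM ha hw hfa
  obtain ⟨zb, hzb, hcb⟩ := h.exists_contact hX hsp hS hr hD0 hD hB hBr hM hb hw' hfb
  obtain ⟨o, ho⟩ := hsp.exists_cross hr.le
  have hΩ : ∀ z, closedBall z (B * r) ⊆ Ω → z ∈ Ω := fun z hz =>
    hz (mem_closedBall_self (by positivity))
  have move : ∀ c, c ∉ S → ∀ z, closedBall z (B * r) ⊆ Ω → ∀ t ∈ closedBall z (B * r),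
      ∀ t' ∈ closedBall z (B * r), (t.re = (o z).re ∧ t'.re = (o z).re) ∨
        (t.im = (o z).im ∧ t'.im = (o z).im) → Touches r X S c t → Touches r X S c t' := by
    intro c hc z hz t ht t' ht' hor htt
    refine htt.segment hS hr hc fun x hx => ?_
    have hxb := (convex_closedBall z (B * r)).segment_subset ht ht' hx
    refine (ho z (hΩ z hz)).2.2 x (hz hxb) ((mem_closedBall.1 hxb).trans hMB) ?_
    obtain ⟨α, β, -, -, hαβ, rfl⟩ := hx
    rcases hor with ⟨h1, h2⟩ | ⟨h1, h2⟩
    · left; simp [h1, h2, ← add_mul, hαβ]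
    · right; simp [h1, h2, ← add_mul, hαβ]
  have near : ∀ z t : ℂ, |t.re - z.re| ≤ J * r → |t.im - z.im| ≤ J * r + r →
      t ∈ closedBall z (B * r) := by
    intro z t h1 h2
    rw [mem_closedBall, dist_eq_norm]
    have := Complex.norm_le_abs_re_add_abs_im (t - z)
    rw [Complex.sub_re, Complex.sub_im] at this
    linarith
  have near' : ∀ z t : ℂ, |t.re - z.re| ≤ J * r + r → |t.im - z.im| ≤ J * r →
      t ∈ closedBall z (B * r) := by
    intro z t h1 h2
    rw [mem_closedBall, dist_eq_norm]
    have := Complex.norm_le_abs_re_add_abs_im (t - z)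
    rw [Complex.sub_re, Complex.sub_im] at this
    linarith
  have hcross : ∀ z, closedBall z (B * r) ⊆ Ω → o z ∈ closedBall z (B * r) := by
    intro z hz
    obtain ⟨⟨h1, h2⟩, ⟨h3, h4⟩, -⟩ := ho z (hΩ z hz)
    exact near _ _ (by rwa [abs_of_nonneg h1]) (by rw [abs_of_nonneg h3]; linarith)
  have contact : ∀ c, c ∉ S → ∀ z, closedBall z (B * r) ⊆ Ω →
      (∀ cx cy, 0 ≤ cx - z.re → cx - z.re ≤ J * r → 0 ≤ cy - z.im → cy - z.im ≤ J * r →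
        ∃ t ∈ closedBall z (B * r), (t.re = cx ∨ t.im = cy) ∧ Touches r X S c t) →
      Touches r X S c (o z) := by
    intro c hc z hz hcon
    obtain ⟨⟨h1, h2⟩, ⟨h3, h4⟩, -⟩ := ho z (hΩ z hz)
    obtain ⟨t, ht, hor, htt⟩ := hcon _ _ h1 h2 h3 h4
    exact move c hc z hz t ht _ (hcross z hz) (hor.imp (fun h => ⟨h, rfl⟩) fun h => ⟨h, rfl⟩) htt
  have hdeep : ∀ z ∈ segment ℝ za zb, closedBall z (B * r) ⊆ Ω := by
    rintro z ⟨α, β, hα, hβ, hαβ, rfl⟩ x hx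
    have hx' : x - (α • za + β • zb) ∈ closedBall (0 : ℂ) (B * r) := by
      rwa [mem_closedBall_zero_iff, ← dist_eq_norm]
    rw [mem_closedBall_zero_iff] at hx'
    have e : x = α • (za + (x - (α • za + β • zb))) + β • (zb + (x - (α • za + β • zb))) := by
      rw [smul_add, smul_add, add_add_add_comm, ← add_smul, hαβ, one_smul]; ring
    rw [e]
    refine h.convex (hza ?_) (hzb ?_) hα hβ hαβ
    · rwa [mem_closedBall, dist_eq_norm, add_sub_cancel_left]
    · rwa [mem_closedBall, dist_eq_norm, add_sub_cancel_left]
  have hab : Touches r X S a (o zb) := by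
    refine of_segment_of_close (P := fun z => Touches r X S a (o z)) hr (fun z hz z' hz' hzz ht => ?_)
      (contact a ha za hza hca)
    have hzd := hdeep z hz
    have hzd' := hdeep z' hz'
    obtain ⟨⟨h1, h2⟩, ⟨h3, h4⟩, -⟩ := ho z (hΩ z hzd)
    obtain ⟨⟨h1', h2'⟩, ⟨h3', h4'⟩, -⟩ := ho z' (hΩ z' hzd')
    rw [dist_eq_norm] at hzz
    have hre := abs_le.1 ((Complex.abs_re_le_norm (z - z')).trans hzz)
    have him := abs_le.1 ((Complex.abs_im_le_norm (z - z')).trans hzz)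
    rw [Complex.sub_re] at hre
    rw [Complex.sub_im] at him
    set y : ℂ := ⟨(o z).re, (o z').im⟩ with hy
    have hyz : y ∈ closedBall z (B * r) := near _ _ (by rwa [abs_of_nonneg h1]) (by
      rw [abs_le]; constructor <;> simp only [hy] <;> linarith)
    have hyz' : y ∈ closedBall z' (B * r) := near' _ _ (by
      rw [abs_le]; constructor <;> simp only [hy] <;> linarith) (by rwa [abs_of_nonneg h3'])
    exact move a ha z' hzd' y hyz' _ (hcross z' hzd') (.inr ⟨rfl, rfl⟩)
      (move a ha z hzd _ (hcross z hzd) y hyz (.inl ⟨rfl, rfl⟩) ht)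
  exact hab.reach hr.le (contact b hb zb hzb hcb)

end

section
variable {Ω : Set ℂ} {ρ R : ℝ} {ι : Type} [Finite ι] {J k : ℕ} {M D B r : ℝ} {X : ι → ℂ}
  {S : Finset ι} {a b : ι}

lemma exists_geomReach_far (hX : ∀ i, X i ∈ Ω) (hinj : ∀ i j, i ≠ j → X i ≠ X j)
    (hlow : ∀ i, ¬ LowDeg k r X i)
    (hpair : ¬ ∃ i j, X i ≠ X j ∧ X i ∈ Ω ∧ X j ∈ Ω ∧ dist (X i) (X j) ≤ 2 * D * r ∧
      Nat.card {l // (l ≠ i ∧ l ≠ j) ∧ X l ∈ pairRegion r (X i) (X j)} ≤ k)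
    (hS : S.card ≤ k) (ha : a ∉ S) : ∃ w, GeomReach r X S a w ∧ D * r < dist (X a) (X w) := by
  by_contra! hc
  have step : ∀ i, GeomReach r X S a i → ∀ l, l ∉ S → X l ∈ closedBall (X i) r →
      GeomReach r X S a l := fun i hi l hl hli =>
    hi.tail ⟨hi.notMem ha, hl, by rw [dist_comm]; exact hli⟩
  obtain ⟨b, hb, hba, hbr⟩ := exists_notMem_of_card hS (not_le.1 (hlow a))
  set U : Set (ι × ι) := {p | GeomReach r X S a p.1 ∧ GeomReach r X S a p.2} with hU
  obtain ⟨⟨i, j⟩, ⟨hi, hj⟩, hmax⟩ := Set.exists_max_image U (fun p => dist (X p.1) (X p.2))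
    U.toFinite ⟨(a, b), ⟨.refl, step a .refl b hb hbr⟩⟩
  replace hmax : ∀ l m, GeomReach r X S a l → GeomReach r X S a m →
    dist (X l) (X m) ≤ dist (X i) (X j) := fun l m hl hm => hmax (l, m) ⟨hl, hm⟩
  replace hi : GeomReach r X S a i := hi
  replace hj : GeomReach r X S a j := hj
  refine hpair ⟨i, j, ?_, hX i, hX j, ?_, ?_⟩
  · have h1 : 0 < dist (X a) (X b) := dist_pos.2 (hinj a b hba.symm)
    exact dist_pos.1 (h1.trans_le (hmax a b .refl (step a .refl b hb hbr)))
  · have := dist_triangle_left (X i) (X j) (X a)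
    linarith [hc i hi, hc j hj]
  · refine le_trans (nat_card_le_of_imp (Q := fun l => l ∈ S) ?_) (by simpa using hS)
    rintro l ⟨-, hl, hln⟩
    by_contra hlS
    have hal : GeomReach r X S a l := hl.elim (step i hi l hlS) (step j hj l hlS)
    exact hln ⟨hmax l i hal hi, (hmax l j hal hj).trans le_rfl⟩

lemma UnitBody.geomReach_of_generic (h : UnitBody Ω ρ R) (hX : ∀ i, X i ∈ Ω)
    (hinj : ∀ i j, i ≠ j → X i ≠ X j)
    (hsp : SparseVoids Ω J k M r X) (hlow : ∀ i, ¬ LowDeg k r X i)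
    (hpair : ¬ ∃ i j, X i ≠ X j ∧ X i ∈ Ω ∧ X j ∈ Ω ∧ dist (X i) (X j) ≤ 2 * D * r ∧
      Nat.card {l // (l ≠ i ∧ l ≠ j) ∧ X l ∈ pairRegion r (X i) (X j)} ≤ k)
    (hr : 0 < r) (hD0 : 0 ≤ D) (hD : 3 * R * J ≤ ρ * D) (hB : 4 * (D + 1 + J) ≤ B)
    (hBr : 2 * B * r ≤ ρ) (hM : D + 1 + 6 * B * R / ρ ≤ M) (hS : S.card ≤ k)
    (ha : a ∉ S) (hb : b ∉ S) : GeomReach r X S a b :=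
  h.reach_of_far hX hsp hS hr hD0 hD hB hBr hM ha hb
    (exists_geomReach_far hX hinj hlow hpair hS ha) (exists_geomReach_far hX hinj hlow hpair hS hb)

end

/-- The geometric graph on `X` with radius `r` is `(k + 1)`-connected. -/
def HighlyConnected {E : Type*} [PseudoMetricSpace E] {n : ℕ} (k : ℕ) (r : ℝ) (X : Fin n → E) :
    Prop :=
  k + 2 ≤ n ∧ ∀ S : Finset (Fin n), S.card ≤ k →
    ((SimpleGraph.fromRel fun i j : Fin n => dist (X i) (X j) ≤ r).induce
      ((↑S : Set (Fin n))ᶜ)).Connected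

section
variable {k n : ℕ} {r : ℝ}

lemma GeomReach.reachable {X : Fin n → ℂ} {S : Finset (Fin n)} {a b : Fin n} (ha : a ∉ S)
    (hb : b ∉ S) (h : GeomReach r X S a b) :
    ((SimpleGraph.fromRel fun i j : Fin n => dist (X i) (X j) ≤ r).induce
      ((↑S : Set (Fin n))ᶜ)).Reachable ⟨a, ha⟩ ⟨b, hb⟩ := by
  induction h with
  | refl => exact .refl _
  | @tail u v _ huv ih =>
    rcases eq_or_ne u v with rfl | hne
    · exact ih hb
    · refine (ih huv.1).trans (SimpleGraph.Adj.reachable ?_)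
      rw [SimpleGraph.induce_adj, SimpleGraph.fromRel_adj]
      exact ⟨hne, .inl huv.2.2⟩

lemma highlyConnected_of_geomReach {X : Fin n → ℂ} (hn : k + 2 ≤ n)
    (h : ∀ S : Finset (Fin n), S.card ≤ k → ∀ a ∉ S, ∀ b ∉ S, GeomReach r X S a b) :
    HighlyConnected k r X := by
  refine ⟨hn, fun S hS => ?_⟩
  obtain ⟨a, -, ha⟩ : ∃ a ∈ Finset.univ, a ∉ S :=
    Finset.exists_mem_notMem_of_card_lt_card (by simp; omega)
  have : Nonempty ((↑S : Set (Fin n))ᶜ : Set (Fin n)) := ⟨⟨a, ha⟩⟩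
  exact ⟨fun ⟨u, hu⟩ ⟨v, hv⟩ => (h S hS u hu v hv).reachable hu hv⟩

lemma HighlyConnected.not_lowDeg {E : Type*} [PseudoMetricSpace E] {X : Fin n → E}
    (h : HighlyConnected k r X) (i : Fin n) : ¬ LowDeg k r X i := by
  classical
  intro hc
  set S : Finset (Fin n) := {j | j ≠ i ∧ X j ∈ closedBall (X i) r} with hSdef
  have hS : S.card ≤ k := by
    rwa [LowDeg, Nat.card_eq_fintype_card, Fintype.card_subtype] at hc
  have hi : i ∉ S := by simp [hSdef]
  obtain ⟨m, -, hm⟩ : ∃ a ∈ Finset.univ, a ∉ insert i S := by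
    refine Finset.exists_mem_notMem_of_card_lt_card ?_
    have := Finset.card_insert_le i S
    have := h.1
    simp; omega
  rw [Finset.mem_insert, not_or] at hm
  obtain ⟨p⟩ := (h.2 S hS).preconnected ⟨i, hi⟩ ⟨m, hm.2⟩
  cases p with
  | nil => exact hm.1 rfl
  | @cons _ v _ hadj _ =>
    rw [SimpleGraph.induce_adj, SimpleGraph.fromRel_adj] at hadj
    refine v.2 ?_
    have : dist (X v) (X i) ≤ r := hadj.2.elim (fun h => by rwa [dist_comm]) id
    simpa [hSdef] using ⟨hadj.1.symm, this⟩

end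

namespace UnitBody
variable {Ω : Set ℂ} {ρ R : ℝ} (h : UnitBody Ω ρ R)
include h

lemma ae_pi_generic (n : ℕ) : ∀ᵐ X ∂(Measure.pi fun _ : Fin n => volume.restrict Ω),
    (∀ i, X i ∈ Ω) ∧ ∀ i j, i ≠ j → X i ≠ X j := by
  have := h.isProbabilityMeasure
  refine Filter.Eventually.and ?_ ?_
  · exact Filter.eventually_all.2 fun i =>
      Measure.tendsto_eval_ae_ae.eventually (ae_restrict_mem h.measurableSet)
  · refine Filter.eventually_all.2 fun i => Filter.eventually_all.2 fun j => ?_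
    by_cases hij : i = j
    · exact .of_forall fun _ h => absurd hij h
    have hm : MeasurableSet {p : ℂ × ℂ | p.1 = p.2} := measurableSet_eq_fun measurable_fst measurable_snd
    have hK := lintegral_pi_kernel (volume.restrict Ω) hij
      (fun x y => Set.indicator {p : ℂ × ℂ | p.1 = p.2} 1 (x, y)) (measurable_one.indicator hm)
      1 measurable_one
    have h0 : ∀ u : ℂ, ∫⁻ v, Set.indicator {p : ℂ × ℂ | p.1 = p.2} 1 (u, v) ∂(volume.restrict Ω) =
        0 := by
      intro u
      have e : (fun v => Set.indicator {p : ℂ × ℂ | p.1 = p.2} 1 (u, v)) =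
          Set.indicator {u} (1 : ℂ → ENNReal) := by
        ext v
        simp [Set.indicator_apply, eq_comm]
      rw [e, lintegral_indicator_one (measurableSet_singleton u)]
      exact measure_singleton _
    simp only [h0, lintegral_zero, zero_mul, Pi.one_apply, Finset.prod_const_one, mul_one] at hK
    have hmX : Measurable fun X : Fin n → ℂ => (X i, X j) :=
      (measurable_pi_apply i).prodMk (measurable_pi_apply j)
    replace hK := (lintegral_eq_zero_iff ((measurable_one.indicator hm).comp hmX)).1 hK
    filter_upwards [hK] with X hX _ hXX
    have : Set.indicator {p : ℂ × ℂ | p.1 = p.2} (1 : ℂ × ℂ → ENNReal) (X i, X j) = 0 := hX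
    rw [Set.indicator_of_mem (show (X i, X j) ∈ {p : ℂ × ℂ | p.1 = p.2} from hXX)] at this
    exact one_ne_zero this

theorem tendsto_highlyConnected {k : ℕ} (hk : 1 ≤ k) (ξ : ℝ) :
    Tendsto (fun n : ℕ => (Measure.pi fun _ : Fin n => volume.restrict Ω).real
      {X | HighlyConnected k (critRadius k ξ n) X}) atTop
      (𝓝 (exp (-((if k = 1 then exp (-ξ) else 0) + (μH[1] (frontier Ω)).toReal *
        (√π * exp (-ξ / 2) / (2 ^ (k + 1) * (k.factorial : ℝ))))))) := by
  have := h.isProbabilityMeasure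
  have hR := h.R_pos
  have hρ := h.pos
  obtain ⟨J, hJ⟩ := h.tendsto_not_sparseVoids hk ξ
  set D := 3 * R * J / ρ + 1 with hD
  have hD0 : 0 ≤ 3 * R * J / ρ := by positivity
  set B := 4 * (D + 1 + J) with hB
  have hB0 : 0 < B := by positivity
  set M := D + 1 + 6 * B * R / ρ with hM
  have hA := h.tendsto_no_lowDeg hk ξ
  set A : ∀ n : ℕ, Set (Fin n → ℂ) := fun n => {X | ∀ i, ¬ LowDeg k (critRadius k ξ n) X i}
  set E : ∀ n : ℕ, Set (Fin n → ℂ) := fun n => {X | HighlyConnected k (critRadius k ξ n) X}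
  have hbad := (hJ M).add (h.tendsto_pairRegion (D := 2 * D) (by linarith) hk ξ)
  rw [add_zero] at hbad
  have hbad' := (ENNReal.tendsto_toReal ENNReal.zero_ne_top).comp hbad
  rw [ENNReal.toReal_zero] at hbad'
  have hlow := hA.sub hbad'
  rw [sub_zero] at hlow
  refine tendsto_of_tendsto_of_tendsto_of_le_of_le' hlow hA ?_ ?_
  · filter_upwards [eventually_ge_atTop (k + 2),
      eventually_crit k ξ (ε := ρ / (2 * B)) (by positivity) 0] with n hn hcrit
    obtain ⟨-, hr, hrB, -, -⟩ := hcrit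
    rw [lt_div_iff₀ (by positivity)] at hrB
    rw [sub_le_iff_le_add]
    set μ := Measure.pi fun _ : Fin n => volume.restrict Ω
    set s₁ : Set (Fin n → ℂ) := {X | ¬ SparseVoids Ω J k M (critRadius k ξ n) X}
    set s₂ : Set (Fin n → ℂ) := {X | ∃ i j, X i ≠ X j ∧
      X i ∈ Ω ∧ X j ∈ Ω ∧ dist (X i) (X j) ≤ 2 * D * critRadius k ξ n ∧
      Nat.card {l // (l ≠ i ∧ l ≠ j) ∧ X l ∈ pairRegion (critRadius k ξ n) (X i) (X j)} ≤ k}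
    have hle : μ (A n) ≤ μ (E n ∪ (s₁ ∪ s₂)) := by
      refine measure_mono_ae ?_
      filter_upwards [h.ae_pi_generic n] with X hX hXA
      by_cases h1 : X ∈ s₁
      · exact .inr (.inl h1)
      by_cases h2 : X ∈ s₂
      · exact .inr (.inr h2)
      refine .inl (highlyConnected_of_geomReach hn fun S hS a ha b hb => ?_)
      exact h.geomReach_of_generic hX.1 hX.2 (not_not.1 h1) hXA h2 hr (by positivity)
        (by rw [hD]; field_simp; linarith) hB.ge (by linarith) hM.ge hS ha hb
    have hle2 : μ (A n) ≤ μ (E n) + (μ s₁ + μ s₂) :=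
      hle.trans ((measure_union_le _ _).trans (add_le_add le_rfl (measure_union_le _ _)))
    have hfin : μ s₁ + μ s₂ ≠ ⊤ := ENNReal.add_ne_top.2 ⟨measure_ne_top _ _, measure_ne_top _ _⟩
    have := ENNReal.toReal_mono (ENNReal.add_ne_top.2 ⟨measure_ne_top _ _, hfin⟩) hle2
    rwa [ENNReal.toReal_add (measure_ne_top _ _) hfin] at this
  · exact .of_forall fun n => measureReal_mono fun X hX i => HighlyConnected.not_lowDeg hX i

end UnitBody

lemma highlyConnected_congr {E F : Type*} [PseudoMetricSpace E] [PseudoMetricSpace F] {n k : ℕ}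
    {r : ℝ} {X : Fin n → E} {Y : Fin n → F} (h : ∀ i j, dist (X i) (X j) = dist (Y i) (Y j)) :
    HighlyConnected k r X ↔ HighlyConnected k r Y := by
  simp only [HighlyConnected, h]

/-- The isometry from the Euclidean plane to `ℂ` sending `x₀` to `0`. -/
noncomputable def planeIsometry (x₀ : EuclideanSpace ℝ (Fin 2)) : EuclideanSpace ℝ (Fin 2) ≃ᵢ ℂ :=
  (IsometryEquiv.subRight x₀).trans Complex.orthonormalBasisOneI.repr.symm.toIsometryEquiv

lemma planeIsometry_apply (x₀ x : EuclideanSpace ℝ (Fin 2)) :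
    planeIsometry x₀ x = Complex.orthonormalBasisOneI.repr.symm (x - x₀) := rfl

lemma measurePreserving_planeIsometry (x₀ : EuclideanSpace ℝ (Fin 2)) :
    MeasurePreserving (planeIsometry x₀) :=
  (Complex.orthonormalBasisOneI.measurePreserving_repr_symm).comp
    (measurePreserving_sub_right volume x₀)

lemma exists_unitBody_image {Ω : Set (EuclideanSpace ℝ (Fin 2))} (hconv : Convex ℝ Ω)
    (hcomp : IsCompact Ω) (hvol : volume Ω = 1) {x₀ : EuclideanSpace ℝ (Fin 2)}
    (hx₀ : x₀ ∈ interior Ω) : ∃ ρ R, UnitBody (planeIsometry x₀ '' Ω) ρ R := by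
  have hc : IsCompact (planeIsometry x₀ '' Ω) := hcomp.image (planeIsometry x₀).continuous
  have h0 : planeIsometry x₀ '' Ω ∈ 𝓝 (0 : ℂ) := by
    have h1 : planeIsometry x₀ x₀ = 0 := by rw [planeIsometry_apply, sub_self, map_zero]
    rw [← h1]
    exact (planeIsometry x₀).toHomeomorph.isOpenMap.image_mem_nhds (mem_interior_iff_mem_nhds.1 hx₀)
  obtain ⟨ρ, hρ, hρs⟩ := nhds_basis_closedBall.mem_iff.1 h0
  obtain ⟨R, hR⟩ := hc.isBounded.subset_closedBall 0
  refine ⟨ρ, R, ?_, hc, ?_, hρ, hρs, hR⟩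
  · rintro _ ⟨x, hx, rfl⟩ _ ⟨y, hy, rfl⟩ a b ha hb hab
    refine ⟨a • x + b • y, hconv hx hy ha hb hab, ?_⟩
    simp only [planeIsometry_apply, ← map_smul, ← map_add]
    congr 1
    rw [smul_sub, smul_sub, sub_add_sub_comm, ← add_smul, hab, one_smul]
  · rw [← (measurePreserving_planeIsometry x₀).measure_preimage_emb
      (planeIsometry x₀).toHomeomorph.measurableEmbedding,
      Set.preimage_image_eq _ (planeIsometry x₀).injective, hvol]

lemma pi_highlyConnected_planeIsometry (Ω : Set (EuclideanSpace ℝ (Fin 2)))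
    [IsFiniteMeasure (volume.restrict Ω)] (x₀ : EuclideanSpace ℝ (Fin 2)) (k n : ℕ) (r : ℝ) :
    (Measure.pi fun _ : Fin n => volume.restrict Ω) {X | HighlyConnected k r X} =
      (Measure.pi fun _ : Fin n => volume.restrict (planeIsometry x₀ '' Ω))
        {X | HighlyConnected k r X} := by
  have hmp := (measurePreserving_planeIsometry x₀).restrict_image_emb
    (planeIsometry x₀).toHomeomorph.measurableEmbedding Ω
  have : IsFiniteMeasure (volume.restrict (planeIsometry x₀ '' Ω)) := by
    rw [← hmp.map_eq]; infer_instance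
  have hpi := measurePreserving_pi (ι := Fin n) (fun _ => volume.restrict Ω)
    (fun _ => volume.restrict (planeIsometry x₀ '' Ω)) fun _ => hmp
  have := MeasurePreserving.measure_preimage_equiv (f := MeasurableEquiv.piCongrRight fun _ : Fin n =>
    (planeIsometry x₀).toHomeomorph.toMeasurableEquiv) hpi {X | HighlyConnected k r X}
  rw [← this]
  congr 1
  ext X
  exact highlyConnected_congr fun i j => ((planeIsometry x₀).dist_eq (X i) (X j)).symm

theorem k_connectivity_critical_radius_2d
    (Ω : Set (EuclideanSpace ℝ (Fin 2)))
    (hconv : Convex ℝ Ω) (hcomp : IsCompact Ω) (hint : (interior Ω).Nonempty)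
    (hvol : volume Ω = 1)
    (ℓ : ℝ) (hℓ : ℓ = (μH[1] (frontier Ω)).toReal)
    (k : ℕ) (hk : 1 ≤ k) (c : ℝ) (hc : 0 < c) (ξ : ℝ)
    (hξ1 : k = 1 → ξ = -2 * Real.log
        (Real.sqrt (Real.exp (-c) + π * ℓ ^ 2 / 64) - ℓ * Real.sqrt π / 8))
    (hξ2 : 1 < k → ξ = 2 * Real.log
        (ℓ * Real.sqrt π / (2 ^ (k + 1) * (k.factorial : ℝ))) + 2 * c)
    (r : ℕ → ℝ)
    (hr : ∀ n : ℕ, r n = Real.sqrt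
        ((Real.log n + (2 * (k : ℝ) - 1) * Real.log (Real.log n) + ξ) / (π * n))) :
    Tendsto (fun n : ℕ =>
        ((Measure.pi fun _ : Fin n => volume.restrict Ω)
          {X : Fin n → EuclideanSpace ℝ (Fin 2) |
            k + 2 ≤ n ∧
            ∀ S : Finset (Fin n), S.card ≤ k →
              ((SimpleGraph.fromRel fun i j : Fin n => dist (X i) (X j) ≤ r n).induce
                ((↑S : Set (Fin n))ᶜ)).Connected}).toReal)
      atTop (𝓝 (Real.exp (-Real.exp (-c)))) := by
  obtain ⟨x₀, hx₀⟩ := hint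
  obtain ⟨ρ, R, h⟩ := exists_unitBody_image hconv hcomp hvol hx₀
  have hℓ' : ℓ = (μH[1] (frontier (planeIsometry x₀ '' Ω))).toReal := by
    have e : frontier (planeIsometry x₀ '' Ω) = planeIsometry x₀ '' frontier Ω :=
      ((planeIsometry x₀).toHomeomorph.image_frontier Ω).symm
    rw [hℓ, e, IsometryEquiv.hausdorffMeasure_image]
  have hpos : 0 < ℓ := by
    rw [hℓ']
    exact ENNReal.toReal_pos h.hausdorffMeasure_frontier_pos.ne' h.hausdorffMeasure_frontier_ne_top
  have hlim := h.tendsto_highlyConnected hk ξ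
  rw [← hℓ', critical_constant hk hpos hξ1 hξ2] at hlim
  have : IsFiniteMeasure (volume.restrict Ω) := ⟨by simp [hvol]⟩
  refine hlim.congr fun n => ?_
  rw [measureReal_def, ← pi_highlyConnected_planeIsometry, show critRadius k ξ n = r n from (hr n).symm]
  rfl
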